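/- Let α be an irrational real number, λ = e^{2πiα}, and let f(z) = λ∫₀^z (1+t)e^t dt = λ z e^z. If f is linearizable at the fixed point 0, then α satisfies the Brjuno condition. -/

import Mathlib

open Metric Set

/-- The denominators `q n` of the continued fraction expansion of `α`. -/
noncomputable def contFracDen (α : ℝ) (n : ℕ) : ℝ :=
  (GenContFract.of α).dens n

/-- The Brjuno condition: `∑ (log q_{n+1}) / q_n < ∞`. -/
def BrjunoCondition (α : ℝ) : Prop :=
  Summable (fun n : ℕ => Real.log (contFracDen α (n + 1)) / contFracDen α n)

/-- `f` is linearizable at the fixed point `z₀` with multiplier `lam`. -/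
def LinearizableAt (f : ℂ → ℂ) (z₀ lam : ℂ) : Prop :=
  ∃ r > (0 : ℝ), ∃ h : ℂ → ℂ,
    DifferentiableOn ℂ h (ball (0 : ℂ) r) ∧ InjOn h (ball (0 : ℂ) r) ∧ h 0 = z₀ ∧
    ∀ z ∈ ball (0 : ℂ) r, f (h z) = h (lam * z)

namespace GB
open PowerSeries Asymptotics Filter Topology

local notation "eC" => Complex.exp
local notation "eR" => Real.exp

/-- `f` agrees with the power series `A` up to order `M` at `0`. -/
def HasJet (M : ℕ) (f : ℂ → ℂ) (A : PowerSeries ℂ) : Prop :=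
  (fun x => f x - (trunc M A).eval x) =O[𝓝 0] (fun x : ℂ => x^M)

lemma eval_trunc (M : ℕ) (A : PowerSeries ℂ) (x:ℂ) :
    (trunc M A).eval x = ∑ k ∈ Finset.range M, coeff k A*x^k := by
  have := eval₂_trunc_eq_sum_range (s := x) (G := RingHom.id ℂ) M A
  simpa [Polynomial.eval₂_eq_eval_map] using this

lemma isBigO_of_X_pow_dvd {M : ℕ} {p : Polynomial ℂ} (h : Polynomial.X^M ∣ p) :
    (fun x => p.eval x) =O[𝓝 0] (fun x : ℂ => x^M) := by
  obtain ⟨q, rfl⟩ := h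
  simp only [Polynomial.eval_mul, Polynomial.eval_pow, Polynomial.eval_X]
  have : (fun x => q.eval x) =O[𝓝 (0:ℂ)] (fun _ => (1:ℂ)) :=
    (q.continuous.tendsto 0).isBigO_one ℂ
  simpa using (isBigO_refl (fun x : ℂ => x^M) (𝓝 0)).mul this

lemma X_pow_dvd_of_isBigO {M : ℕ} {p : Polynomial ℂ}
    (h : (fun x => p.eval x) =O[𝓝 0] (fun x : ℂ => x^M)) : Polynomial.X^M ∣ p := by
  by_contra hn
  rcases eq_or_ne p 0 with rfl | hp
  · exact hn (dvd_zero _)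
  obtain ⟨q, hq, hq0⟩ := Polynomial.exists_eq_pow_rootMultiplicity_mul_and_not_dvd p hp 0
  set m := p.rootMultiplicity 0
  simp only [Polynomial.C_0, sub_zero] at hq hq0
  have hm : m < M := by
    by_contra hlt
    exact hn (hq ▸ Dvd.dvd.mul_right (pow_dvd_pow _ (not_lt.mp hlt)) _)
  have hq1 : q.eval 0 ≠ 0 := by
    intro h0; apply hq0
    rw [Polynomial.X_dvd_iff, Polynomial.coeff_zero_eq_eval_zero]; exact h0
  have h1 : (fun x : ℂ => x^m*q.eval x) =O[𝓝[≠] 0] (fun x : ℂ => x^M) := by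
    refine (h.mono nhdsWithin_le_nhds).congr_left ?_
    intro x; rw [hq]; simp
  have h2 : (fun x : ℂ => q.eval x) =O[𝓝[≠] 0] (fun x : ℂ => x^(M - m)) := by
    rw [isBigO_iff] at h1 ⊢
    obtain ⟨c, hc⟩ := h1
    refine ⟨c, ?_⟩
    filter_upwards [hc, self_mem_nhdsWithin] with x hx hx0
    have hx0 : x ≠ 0 := hx0
    have hp : 0 < ‖x‖^m := by positivity
    rw [norm_mul, norm_pow, norm_pow, show M = m + (M - m) by omega, pow_add] at hx
    rw [norm_pow]
    have : ‖x‖^m*‖q.eval x‖≤‖x‖^m*(c*‖x‖^(M - m)) := by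
      calc _≤_ := hx
        _ = _ := by ring
    exact le_of_mul_le_mul_left this hp
  have h3 : Tendsto (fun x : ℂ => q.eval x) (𝓝[≠] 0) (𝓝 0) := by
    apply h2.trans_tendsto
    have : Tendsto (fun x : ℂ => x^(M - m)) (𝓝 0) (𝓝 0) := by
      have := (continuous_pow (M := ℂ) (M - m)).tendsto 0
      rwa [zero_pow (by omega)] at this
    exact this.mono_left nhdsWithin_le_nhds
  have h4 : Tendsto (fun x : ℂ => q.eval x) (𝓝[≠] 0) (𝓝 (q.eval 0)) :=
    (q.continuous.tendsto 0).mono_left nhdsWithin_le_nhds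
  exact hq1 (tendsto_nhds_unique h4 h3)

lemma X_pow_dvd_trunc {M : ℕ} {A : PowerSeries ℂ} :
    Polynomial.X^M ∣ trunc M A ↔ ∀ k < M, coeff k A = 0 := by
  rw [Polynomial.X_pow_dvd_iff]
  refine forall_congr' fun k => imp_congr_right fun hk => ?_
  rw [coeff_trunc, if_pos hk]

lemma HasJet.unique {M : ℕ} {f : ℂ → ℂ} {A B : PowerSeries ℂ} (hA : HasJet M f A)
    (hB : HasJet M f B) : ∀ k < M, coeff k A = coeff k B := by
  have h := hB.sub hA
  have h2 : (fun x => (trunc M (A - B)).eval x) =O[𝓝 0] (fun x : ℂ => x^M) := by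
    refine h.congr_left ?_
    intro x; simp
  intro k hk
  have := X_pow_dvd_trunc.1 (X_pow_dvd_of_isBigO h2) k hk
  simpa [sub_eq_zero] using this

lemma HasJet.congr {M : ℕ} {f g : ℂ → ℂ} {A : PowerSeries ℂ} (hA : HasJet M f A)
    (h : (fun x => f x - g x) =O[𝓝 0] (fun x : ℂ => x^M)) : HasJet M g A := by
  have := IsBigO.sub hA h
  refine this.congr_left ?_
  intro x; ring

lemma HasJet.congr_coeff {M : ℕ} {f : ℂ → ℂ} {A B : PowerSeries ℂ} (hA : HasJet M f A)
    (h : ∀ k < M, coeff k A = coeff k B) : HasJet M f B := by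
  have : trunc M A = trunc M B := by
    ext k; simp only [coeff_trunc]; split_ifs with hk
    · exact h k hk
    · rfl
  unfold HasJet; rw [← this]; exact hA

lemma HasJet.diff {M : ℕ} {f g : ℂ → ℂ} {A : PowerSeries ℂ} (hA : HasJet M f A)
    (hB : HasJet M g A) : (fun x => f x - g x) =O[𝓝 0] (fun x : ℂ => x^M) := by
  have := IsBigO.sub hA hB
  refine this.congr_left ?_
  intro x; ring

lemma HasJet.add {M : ℕ} {f g : ℂ → ℂ} {A B : PowerSeries ℂ} (hA : HasJet M f A)
    (hB : HasJet M g B) : HasJet M (fun x => f x + g x) (A + B) := by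
  refine (IsBigO.add hA hB).congr_left ?_
  intro x; simp; ring

lemma HasJet.isBigO_one {M : ℕ} {f : ℂ → ℂ} {A : PowerSeries ℂ} (hA : HasJet M f A) :
    f =O[𝓝 0] (fun _ => (1:ℂ)) := by
  have h1 : (fun x : ℂ => x^M) =O[𝓝 0] (fun _ => (1:ℂ)) :=
    ((continuous_pow (M := ℂ) M).tendsto 0).isBigO_one ℂ
  have h2 : (fun x => (trunc M A).eval x) =O[𝓝 (0:ℂ)] (fun _ => (1:ℂ)) :=
    ((trunc M A).continuous.tendsto 0).isBigO_one ℂ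
  refine ((IsBigO.trans hA h1).add h2).congr_left ?_
  intro x; ring

lemma X_pow_dvd_trunc_mul (M : ℕ) (A B : PowerSeries ℂ) :
    Polynomial.X^M ∣ trunc M A*trunc M B - trunc M (A*B) := by
  rw [Polynomial.X_pow_dvd_iff]
  intro k hk
  rw [Polynomial.coeff_sub, coeff_trunc, if_pos hk, Polynomial.coeff_mul, coeff_mul, sub_eq_zero]
  refine Finset.sum_congr rfl fun p hp => ?_
  have := Finset.HasAntidiagonal.mem_antidiagonal.1 hp
  rw [coeff_trunc, coeff_trunc, if_pos (by omega), if_pos (by omega)]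

lemma HasJet.mul {M : ℕ} {f g : ℂ → ℂ} {A B : PowerSeries ℂ} (hA : HasJet M f A)
    (hB : HasJet M g B) : HasJet M (fun x => f x*g x) (A*B) := by
  have h2 : (fun x => (trunc M A).eval x) =O[𝓝 (0:ℂ)] (fun _ => (1:ℂ)) :=
    ((trunc M A).continuous.tendsto 0).isBigO_one ℂ
  have e1 := IsBigO.mul hA hB.isBigO_one
  have e2 := h2.mul hB
  have e3 := isBigO_of_X_pow_dvd (X_pow_dvd_trunc_mul M A B)
  simp only [one_mul, mul_one] at e1 e2
  refine ((e1.add e2).add e3).congr_left ?_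
  intro x; simp; ring

lemma HasJet.const (M : ℕ) (c:ℂ) : HasJet M (fun _ => c) (C c) := by
  rcases Nat.eq_zero_or_pos M with rfl | h
  · unfold HasJet; simp only [pow_zero]
    exact (isBigO_refl _ _).congr (fun x => by simp) (fun _ => rfl) |>.trans
      (isBigO_const_const c one_ne_zero _)
  · obtain ⟨m, rfl⟩ := Nat.exists_eq_succ_of_ne_zero h.ne'
    unfold HasJet; rw [trunc_C]; simp [isBigO_zero]

lemma HasJet.pow {M : ℕ} {f : ℂ → ℂ} {A : PowerSeries ℂ} (hA : HasJet M f A) (j : ℕ) :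
    HasJet M (fun x => f x^j) (A^j) := by
  induction j with
  | zero => simpa using HasJet.const M 1
  | succ j ih => simpa only [pow_succ] using ih.mul hA

lemma HasJet.smul {M : ℕ} {f : ℂ → ℂ} {A : PowerSeries ℂ} (hA : HasJet M f A) (c:ℂ) :
    HasJet M (fun x => c*f x) (C c*A) := (HasJet.const M c).mul hA

lemma HasJet.sum {ι : Type*} {M : ℕ} (s : Finset ι) {f : ι → ℂ → ℂ} {A : ι → PowerSeries ℂ}
    (hA : ∀ i ∈ s, HasJet M (f i) (A i)) : HasJet M (fun x => ∑ i ∈ s, f i x) (∑ i ∈ s, A i) := by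
  classical
  induction s using Finset.induction_on with
  | empty => simpa using HasJet.const M 0
  | insert a s ha ih =>
    simp only [Finset.sum_insert ha]
    exact (hA a (by simp)).add (ih fun i hi => hA i (by simp [hi]))

lemma HasJet.id (M : ℕ) : HasJet M (fun x => x) X := by
  unfold HasJet
  rcases M with _ | _ | M
  · simp only [pow_zero]
    have : Tendsto (fun x : ℂ => x) (𝓝 0) (𝓝 0) := tendsto_id
    simpa using this.isBigO_one ℂ
  · have : trunc 1 (X : PowerSeries ℂ) = 0 := by
      ext k; simp [coeff_X]
    simp only [zero_add, this]; simpa using isBigO_refl _ _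
  · have : trunc (M+2) (X : PowerSeries ℂ) = Polynomial.X := by
      ext k; simp only [coeff_trunc, coeff_X, Polynomial.coeff_X]
      by_cases hk : k = 1
      · subst hk; simp
      · simp [hk, Ne.symm hk]
    simp [this, isBigO_zero]

lemma AnalyticAt.hasJet {f : ℂ → ℂ} (hf : AnalyticAt ℂ f 0) :
    ∃ A : PowerSeries ℂ, ∀ M, HasJet M f A := by
  obtain ⟨p, hp⟩ := hf
  refine ⟨PowerSeries.mk fun n => p.coeff n, fun M => ?_⟩
  have := hp.isBigO_sub_partialSum_pow M
  simp only [zero_add] at this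
  unfold HasJet
  have h2 : (fun x : ℂ => ‖x‖^M) =O[𝓝 0] fun x : ℂ => x^M := by
    refine IsBigO.of_bound 1 ?_
    filter_upwards with x; simp
  refine (this.trans h2).congr_left ?_
  intro x
  congr 1
  rw [FormalMultilinearSeries.partialSum, eval_trunc]
  refine Finset.sum_congr rfl fun k hk => ?_
  rw [FormalMultilinearSeries.apply_eq_pow_smul_coeff]
  simp [mul_comm]

/-- composition with an inner function of the form `x*e x`. -/
lemma HasJet.comp {M : ℕ} {W g : ℂ → ℂ} {w A : PowerSeries ℂ} (hW : HasJet M W w)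
    (hg : HasJet M g A) (hA : coeff 0 A = 0) (hM : 0 < M) :
    HasJet M (fun x => W (g x)) (∑ j ∈ Finset.range M, C (coeff j w)*A^j) := by
  -- g = O(x)
  have hgx : g =O[𝓝 0] (fun x : ℂ => x) := by
    have h1 : (fun x : ℂ => x^M) =O[𝓝 0] (fun x : ℂ => x) := by
      obtain ⟨m, rfl⟩ := Nat.exists_eq_succ_of_ne_zero hM.ne'
      have : (fun x : ℂ => x^m) =O[𝓝 0] (fun _ => (1:ℂ)) :=
        ((continuous_pow (M := ℂ) m).tendsto 0).isBigO_one ℂ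
      simpa [pow_succ] using this.mul (isBigO_refl (fun x : ℂ => x) (𝓝 0))
    have h2 : (fun x => (trunc M A).eval x) =O[𝓝 0] (fun x : ℂ => x^1) := by
      apply isBigO_of_X_pow_dvd
      rw [Polynomial.X_pow_dvd_iff]
      intro k hk
      have : k = 0 := by omega
      subst this
      rw [coeff_trunc, if_pos hM, hA]
    simp only [pow_one] at h2
    refine ((IsBigO.trans hg h1).add h2).congr_left ?_
    intro x; ring
  have hg0 : Tendsto g (𝓝 0) (𝓝 0) := hgx.trans_tendsto tendsto_id
  have e1 : (fun x => W (g x) - (trunc M w).eval (g x)) =O[𝓝 0] (fun x : ℂ => x^M) :=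
    (hW.comp_tendsto hg0).trans (hgx.pow M)
  have e2 : HasJet M (fun x => (trunc M w).eval (g x))
      (∑ j ∈ Finset.range M, C (coeff j w)*A^j) := by
    have := HasJet.sum (M := M) (Finset.range M) (f := fun j x => coeff j w*g x^j)
      (A := fun j => C (coeff j w)*A^j) (fun j _ => (hg.pow j).smul _)
    have h3 : (fun x => (trunc M w).eval (g x)) = fun x => ∑ j ∈ Finset.range M, coeff j w*g x^j := by
      funext x
      rw [eval_trunc]
    rw [h3]; exact this
  refine e2.congr ?_
  refine e1.neg_left.congr_left ?_
  intro x; ring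

lemma HasJet.rescale {M : ℕ} {f : ℂ → ℂ} {A : PowerSeries ℂ} (hA : HasJet M f A) (c:ℂ) :
    HasJet M (fun x => f (c*x)) (rescale c A) := by
  have ht : Tendsto (fun x : ℂ => c*x) (𝓝 0) (𝓝 0) := by
    have : Continuous (fun x : ℂ => c*x) := by fun_prop
    simpa using this.tendsto 0
  have h1 := IsBigO.comp_tendsto hA ht
  have h2 : (fun x : ℂ => (c*x)^M) =O[𝓝 0] (fun x : ℂ => x^M) := by
    simp only [mul_pow]; exact isBigO_const_mul_self _ _ _
  refine (h1.trans h2).congr_left ?_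
  intro x
  simp only [Function.comp]
  congr 1
  rw [eval_trunc, eval_trunc]
  refine Finset.sum_congr rfl fun k hk => ?_
  simp [coeff_rescale, mul_pow]; ring

/-- `E` solves the formal linearization equation `E(λx) = W(xE) E` up to order `M`. -/
def Lin (lam:ℂ) (w E : PowerSeries ℂ) (M : ℕ) : Prop :=
  coeff 0 E = 1 ∧ ∀ k < M, lam^k*coeff k E =
    ∑ j ∈ Finset.range (k + 1), coeff j w*coeff (k - j) (E^(j + 1))

lemma coeff_pow_congr {A B : PowerSeries ℂ} {M : ℕ} (h : ∀ k < M, coeff k A = coeff k B) (j : ℕ) :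
    ∀ k < M, coeff k (A^j) = coeff k (B^j) := by
  have h1 : X^M ∣ A - B := X_pow_dvd_iff.2 fun k hk => by simp [h k hk]
  have h2 : X^M ∣ A^j - B^j := h1.trans (sub_dvd_pow_sub_pow A B j)
  intro k hk
  have := X_pow_dvd_iff.1 h2 k hk
  simpa [sub_eq_zero] using this

lemma sum_range_split (w E : PowerSeries ℂ) (hw : coeff 0 w = 1) (k : ℕ) :
    ∑ j ∈ Finset.range (k + 1), coeff j w*coeff (k - j) (E^(j + 1)) =
      (∑ j ∈ Finset.range k, coeff (j+1) w*coeff (k - (j+1)) (E^(j + 2))) + coeff k E := by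
  rw [Finset.sum_range_succ']; simp [hw]

lemma Lin.unique {lam : ℂ} {w w' E E' : PowerSeries ℂ} {M : ℕ}
    (hlam : ∀ k, 0 < k → lam^k ≠ 1)
    (hw : coeff 0 w = 1) (hww : ∀ k < M, coeff k w = coeff k w')
    (h : Lin lam w E M) (h' : Lin lam w' E' M) : ∀ k < M, coeff k E = coeff k E' := by
  intro k
  induction k using Nat.strong_induction_on with
  | _ k ih =>
    intro hk
    rcases Nat.eq_zero_or_pos k with rfl | hk0
    · rw [h.1, h'.1]
    have hw' : coeff 0 w' = 1 := by rw [← hww 0 (by omega), hw]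
    have e1 := h.2 k hk
    have e2 := h'.2 k hk
    rw [sum_range_split w E hw] at e1
    rw [sum_range_split w' E' hw'] at e2
    have e3 : ∑ j ∈ Finset.range k, coeff (j+1) w*coeff (k - (j+1)) (E^(j + 2)) =
       ∑ j ∈ Finset.range k, coeff (j+1) w'*coeff (k - (j+1)) (E'^(j + 2)) := by
      refine Finset.sum_congr rfl fun j hj => ?_
      have hj := Finset.mem_range.1 hj
      rw [hww (j+1) (by omega), coeff_pow_congr (M := k) (fun i hi => ih i hi (by omega)) (j+2) (k - (j+1)) (by omega)]
    have : (lam^k - 1)*(coeff k E - coeff k E') = 0 := by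
      linear_combination e1 - e2 + e3
    rcases mul_eq_zero.1 this with h0 | h0
    · exact absurd (sub_eq_zero.1 h0) (hlam k hk0)
    · exact sub_eq_zero.1 h0

/-- coefficients of the formal linearizer -/
noncomputable def linCoef (lam:ℂ) (w : PowerSeries ℂ) : ℕ → ℂ
  | k => if k = 0 then 1 else
    (∑ j ∈ Finset.range k, coeff (j+1) w *
      coeff (k - (j+1)) ((PowerSeries.mk fun i => if _h : i < k then linCoef lam w i else 0)^(j + 2)))
      / (lam^k - 1)

noncomputable def linSer (lam:ℂ) (w : PowerSeries ℂ) : PowerSeries ℂ := PowerSeries.mk (linCoef lam w)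

lemma linSer_rec (lam:ℂ) (w : PowerSeries ℂ) {k : ℕ} (hk : 0 < k) :
    coeff k (linSer lam w) = (∑ j ∈ Finset.range k, coeff (j+1) w *
      coeff (k - (j+1)) ((linSer lam w)^(j + 2)))/(lam^k - 1) := by
  have h0 : coeff k (linSer lam w) = linCoef lam w k := by simp [linSer]
  rw [h0, linCoef, if_neg hk.ne']
  congr 1
  refine Finset.sum_congr rfl fun j hj => ?_
  congr 1
  refine coeff_pow_congr (M := k) (fun i hi => ?_) _ _ (by omega)
  simp [linSer, hi]

lemma linSer_lin (lam:ℂ) (w : PowerSeries ℂ) (hlam : ∀ k, 0 < k → lam^k ≠ 1)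
    (hw : coeff 0 w = 1) (M : ℕ) : Lin lam w (linSer lam w) M := by
  have h0 : coeff 0 (linSer lam w) = 1 := by simp [linSer]; rw [linCoef]; simp
  refine ⟨h0, fun k hk => ?_⟩
  rw [sum_range_split _ _ hw]
  rcases Nat.eq_zero_or_pos k with rfl | hk0
  · simp
  · have := linSer_rec lam w hk0
    have hne : lam^k - 1 ≠ 0 := sub_ne_zero.2 (hlam k hk0)
    rw [eq_div_iff hne] at this
    linear_combination this

lemma coeff_bridge (w E : PowerSeries ℂ) {M k : ℕ} (hk : k < M) :
    coeff k ((∑ j ∈ Finset.range M, C (coeff j w)*(X*E)^j)*E) =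
    ∑ j ∈ Finset.range (k + 1), coeff j w*coeff (k - j) (E^(j + 1)) := by
  rw [Finset.sum_mul, map_sum]
  have h1 : ∀ j, coeff k (C (coeff j w)*(X*E)^j*E) =
      if j ≤ k then coeff j w*coeff (k - j) (E^(j + 1)) else 0 := by
    intro j
    have : C (coeff j w)*(X*E)^j*E = C (coeff j w)*(E^(j+1)*X^j) := by ring
    rw [this, coeff_C_mul, coeff_mul_X_pow']
    split_ifs <;> simp
  simp only [h1]
  symm
  rw [← Finset.sum_filter]
  refine Finset.sum_congr ?_ fun _ _ => rfl
  ext j; simp; omega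

/-- analytic meaning of `Lin` -/
lemma lin_bridge {lam : ℂ} {w E : PowerSeries ℂ} {M : ℕ} {W e : ℂ → ℂ} (hM : 0 < M)
    (hW : HasJet M W w) (he : HasJet M e E) (h0 : coeff 0 E = 1) :
    Lin lam w E M ↔
    (fun x => W (x*e x)*e x - e (lam*x)) =O[𝓝 0] (fun x : ℂ => x^M) := by
  have hg : HasJet M (fun x => x*e x) (X*E) := (HasJet.id M).mul he
  have h1 : HasJet M (fun x => W (x*e x)*e x)
      ((∑ j ∈ Finset.range M, C (coeff j w)*(X*E)^j)*E) :=
    (hW.comp hg (by simp) hM).mul he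
  have h2 : HasJet M (fun x => e (lam*x)) (rescale lam E) := he.rescale lam
  constructor
  · intro h
    refine h1.diff (h2.congr_coeff ?_)
    intro k hk
    rw [coeff_bridge w E hk, coeff_rescale, h.2 k hk]
  · intro h
    refine ⟨h0, fun k hk => ?_⟩
    have := (h1.congr h).unique h2 k hk
    rw [coeff_bridge w E hk, coeff_rescale] at this
    rw [this]

/-- weighted l1 norm of a truncation -/
noncomputable def wn (M : ℕ) (ρ:ℝ) (A : PowerSeries ℂ) : ℝ :=
  ∑ k ∈ Finset.range M, ‖coeff k A‖*ρ^k

lemma wn_nonneg (M : ℕ) {ρ : ℝ} (hρ : 0 ≤ ρ) (A : PowerSeries ℂ) : 0 ≤ wn M ρ A :=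
  Finset.sum_nonneg fun k _ => by positivity

lemma wn_mul (M : ℕ) {ρ : ℝ} (hρ : 0 ≤ ρ) (A B : PowerSeries ℂ) :
    wn M ρ (A*B) ≤ wn M ρ A*wn M ρ B := by
  unfold wn
  rw [Finset.sum_mul_sum, ← Finset.sum_product']
  have h1 : ∀ k ∈ Finset.range M, ‖coeff k (A*B)‖*ρ^k ≤
      ∑ p ∈ Finset.HasAntidiagonal.antidiagonal k, (‖coeff p.1 A‖*ρ^p.1)*(‖coeff p.2 B‖*ρ^p.2) := by
    intro k _
    rw [coeff_mul]
    calc _≤(∑ p ∈ Finset.HasAntidiagonal.antidiagonal k, ‖coeff p.1 A*coeff p.2 B‖)*ρ^k := by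
            gcongr; exact norm_sum_le _ _
      _ = _ := by
          rw [Finset.sum_mul]
          refine Finset.sum_congr rfl fun p hp => ?_
          have := Finset.HasAntidiagonal.mem_antidiagonal.1 hp
          rw [← this, pow_add, norm_mul]; ring
  refine (Finset.sum_le_sum h1).trans ?_
  have h2 := Finset.sum_fiberwise_of_maps_to (g := fun p : ℕ × ℕ => p.1 + p.2)
    (s := (Finset.range M ×ˢ Finset.range M).filter (fun p => p.1 + p.2 < M)) (t := Finset.range M)
    (fun p hp => by simp at hp ⊢; omega)
    (fun p : ℕ × ℕ => (‖coeff p.1 A‖*ρ^p.1)*(‖coeff p.2 B‖*ρ^p.2))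
  refine le_trans (le_of_eq ?_) (h2.le.trans ?_)
  · refine Finset.sum_congr rfl fun k hk => ?_
    refine Finset.sum_congr ?_ fun _ _ => rfl
    ext p; simp at hk ⊢; omega
  · refine Finset.sum_le_sum_of_subset_of_nonneg (Finset.filter_subset _ _) fun p _ _ => by positivity

lemma wn_pow (M : ℕ) {ρ : ℝ} (hρ : 0 ≤ ρ) (A : PowerSeries ℂ) (j : ℕ) :
    wn M ρ (A^(j+1)) ≤ wn M ρ A^(j+1) := by
  induction j with
  | zero => simp
  | succ j ih =>
    rw [pow_succ, pow_succ (wn M ρ A)]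
    exact (wn_mul M hρ _ _).trans (by gcongr; exact wn_nonneg M hρ A)

/-- Majorant lemma (PL). -/
lemma majorant {lam : ℂ} {w E : PowerSeries ℂ} {M : ℕ} (hw : coeff 0 w = 1) (h : Lin lam w E M)
    {ρ a : ℝ} (hρ : 0 ≤ ρ) (ha : 0 ≤ a) (D : ℕ → ℝ) (hD0 : ∀ j, 0 ≤ D j)
    (hD : ∀ j k, 1 ≤ j → j ≤ k → k < M → 1 ≤ D j*‖lam^k - 1‖)
    (hs : ∑ j ∈ Finset.Ico 1 M, D j*‖coeff j w‖*ρ^j*(1 + a)^(j + 1) ≤ a) :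
    ∑ k ∈ Finset.Ico 1 M, ‖coeff k E‖*ρ^k ≤ a := by
  have key : ∀ m, m ≤ M → ∑ k ∈ Finset.Ico 1 m, ‖coeff k E‖*ρ^k ≤ a := by
    intro m
    induction m with
    | zero => intro _; simpa using ha
    | succ m ih =>
      intro hm
      rcases Nat.eq_zero_or_pos m with rfl | hm0
      · simpa using ha
      have ih := ih (by omega)
      have hN : wn m ρ E≤1 + a := by
        unfold wn
        rw [Finset.range_eq_Ico, Finset.sum_eq_sum_Ico_succ_bot hm0, h.1]
        simpa using ih
      have h1 : ∀ k ∈ Finset.Ico 1 (m+1), ‖coeff k E‖*ρ^k ≤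
          ∑ j ∈ Finset.Ico 1 (k+1), (D j*‖coeff j w‖*ρ^j)*(‖coeff (k - j) (E^(j+1))‖*ρ^(k-j)) := by
        intro k hk
        have hk := Finset.mem_Ico.1 hk
        have e := h.2 k (by omega)
        rw [Finset.range_eq_Ico, Finset.sum_eq_sum_Ico_succ_bot (by omega)] at e
        simp only [hw, one_mul, Nat.sub_zero, zero_add, pow_one] at e
        have e' : (lam^k - 1)*coeff k E = ∑ j ∈ Finset.Ico 1 (k+1), coeff j w*coeff (k - j) (E^(j + 1)) := by
          linear_combination e
        have e2 : ‖lam^k - 1‖*‖coeff k E‖ ≤ ∑ j ∈ Finset.Ico 1 (k+1), ‖coeff j w‖*‖coeff (k - j) (E^(j + 1))‖ := by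
          rw [← norm_mul, e']
          refine (norm_sum_le _ _).trans (le_of_eq ?_)
          simp
        have hpos : 0 < ‖lam^k - 1‖ := by
          have := hD k k (by omega) le_rfl (by omega)
          by_contra hc
          have h0 : ‖lam^k - 1‖ = 0 := le_antisymm (not_lt.1 hc) (norm_nonneg _)
          rw [h0] at this; linarith
        have e3 : ‖lam^k - 1‖*(‖coeff k E‖*ρ^k)≤‖lam^k - 1‖*∑ j ∈ Finset.Ico 1 (k+1), (D j*‖coeff j w‖*ρ^j)*(‖coeff (k - j) (E^(j+1))‖*ρ^(k-j)) := by
          calc _ = (‖lam^k - 1‖*‖coeff k E‖)*ρ^k := by ring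
            _≤(∑ j ∈ Finset.Ico 1 (k+1), ‖coeff j w‖*‖coeff (k - j) (E^(j + 1))‖)*ρ^k := by gcongr
            _≤_ := by
              rw [Finset.sum_mul, Finset.mul_sum]
              refine Finset.sum_le_sum fun j hj => ?_
              have hj := Finset.mem_Ico.1 hj
              have hd := hD j k hj.1 (by omega) (by omega)
              have hx : 0≤‖coeff j w‖*‖coeff (k - j) (E^(j + 1))‖*ρ^k := by positivity
              have hρk : ρ^k = ρ^j*ρ^(k - j) := by rw [← pow_add]; congr 1; omega
              calc _≤(D j*‖lam^k - 1‖)*(‖coeff j w‖*‖coeff (k - j) (E^(j + 1))‖*ρ^k) := by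
                    nlinarith
                _ = _ := by rw [hρk]; ring
        exact le_of_mul_le_mul_left e3 hpos
      refine (Finset.sum_le_sum h1).trans ?_
      have h2 : ∑ k ∈ Finset.Ico 1 (m+1), ∑ j ∈ Finset.Ico 1 (k+1), (D j*‖coeff j w‖*ρ^j)*(‖coeff (k - j) (E^(j+1))‖*ρ^(k-j))
        = ∑ j ∈ Finset.Ico 1 (m+1), ∑ k ∈ Finset.Ico j (m+1), (D j*‖coeff j w‖*ρ^j)*(‖coeff (k - j) (E^(j+1))‖*ρ^(k-j)) := by
        refine Finset.sum_comm' ?_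
        intro x y; simp only [Finset.mem_Ico]; omega
      rw [h2]
      refine le_trans ?_ hs
      have h3 : ∀ j ∈ Finset.Ico 1 (m+1), ∑ k ∈ Finset.Ico j (m+1), (D j*‖coeff j w‖*ρ^j)*(‖coeff (k - j) (E^(j+1))‖*ρ^(k-j)) ≤ D j*‖coeff j w‖*ρ^j*(1 + a)^(j + 1) := by
        intro j hj
        have hj := Finset.mem_Ico.1 hj
        have hd := hD0 j
        rw [← Finset.mul_sum]
        refine mul_le_mul_of_nonneg_left ?_ (by positivity)
        rw [Finset.sum_Ico_eq_sum_range]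
        simp only [Nat.add_sub_cancel_left]
        calc _ ≤ wn m ρ (E^(j+1)) := by
              unfold wn
              refine Finset.sum_le_sum_of_subset_of_nonneg ?_ fun _ _ _ => by positivity
              intro x; simp; omega
          _ ≤ wn m ρ E^(j+1) := wn_pow m hρ E j
          _≤_ := by
              have := wn_nonneg m hρ E
              gcongr
      refine (Finset.sum_le_sum h3).trans ?_
      refine Finset.sum_le_sum_of_subset_of_nonneg ?_ fun j _ _ => ?_
      · intro x; simp; omega
      · have := hD0 j; positivity
  exact key M le_rfl

section
open Asymptotics Filter Topology

/-- holomorphic contraction principle -/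
lemma holfix {U : Set ℂ} (hU : IsOpen U) (Φ : ℂ → ℂ → ℂ) {b : ℝ} (_hb : 0 ≤ b)
    (H1 : ∀ w : ℂ → ℂ, DifferentiableOn ℂ w U → (∀ x ∈ U, ‖w x‖ ≤ b) →
      DifferentiableOn ℂ (fun x => Φ x (w x)) U)
    (H2 : ∀ x ∈ U, ‖Φ x 0‖ ≤ b/2)
    (H3 : ∀ x ∈ U, ∀ w w' : ℂ, ‖w‖ ≤ b → ‖w'‖ ≤ b → ‖Φ x w - Φ x w'‖≤(1/2)*‖w - w'‖) :
    ∃ w : ℂ → ℂ, DifferentiableOn ℂ w U ∧ (∀ x ∈ U, ‖w x‖ ≤ b ∧ Φ x (w x) = w x ∧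
      ‖w x‖≤2*‖Φ x 0‖) := by
  let W : ℕ → ℂ → ℂ := fun k => Nat.rec (fun _ => 0) (fun _ w x => Φ x (w x)) k
  have W0 : ∀ x, W 0 x = 0 := fun x => rfl
  have WS : ∀ k x, W (k+1) x = Φ x (W k x) := fun k x => rfl
  have hWb : ∀ k, ∀ x ∈ U, ‖W k x‖ ≤ b := by
    intro k x hx
    induction k with
    | zero => simpa [W0] using _hb
    | succ k ih =>
      rw [WS]
      have h1 := H3 x hx (W k x) 0 ih (by simpa using _hb)
      have h2 := H2 x hx
      have : ‖Φ x (W k x)‖≤‖Φ x (W k x) - Φ x 0‖ + ‖Φ x 0‖ := by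
        simpa using norm_add_le (Φ x (W k x) - Φ x 0) (Φ x 0)
      simp only [sub_zero] at h1
      linarith
  have hWd : ∀ k, DifferentiableOn ℂ (W k) U := by
    intro k
    induction k with
    | zero => exact differentiableOn_const 0
    | succ k ih => exact H1 _ ih (hWb k)
  have hstep : ∀ k, ∀ x ∈ U, dist (W k x) (W (k+1) x) ≤ b/2/2^k := by
    intro k x hx
    induction k with
    | zero => simpa [W0, WS] using H2 x hx
    | succ k ih =>
      rw [dist_eq_norm, WS k, WS (k+1)]
      have := H3 x hx (W k x) (W (k+1) x) (hWb k x hx) (hWb (k+1) x hx)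
      rw [dist_eq_norm] at ih
      calc _≤_ := this
        _≤1/2*(b/2/2^k) := by gcongr
        _ = _ := by rw [pow_succ]; field_simp
  have hlim : ∀ x, ∃ l, x ∈ U → Tendsto (fun k => W k x) atTop (𝓝 l) := by
    intro x
    by_cases hx : x ∈ U
    · obtain ⟨l, hl⟩ := cauchySeq_tendsto_of_complete
        (cauchySeq_of_le_geometric_two (fun k => hstep k x hx))
      exact ⟨l, fun _ => hl⟩
    · exact ⟨0, fun h => absurd h hx⟩
  choose w hw using hlim
  have hwb : ∀ x ∈ U, ‖w x‖ ≤ b := fun x hx =>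
    le_of_tendsto (hw x hx).norm (Eventually.of_forall fun k => hWb k x hx)
  have hfix : ∀ x ∈ U, Φ x (w x) = w x := by
    intro x hx
    have h1 : Tendsto (fun k => W (k+1) x) atTop (𝓝 (Φ x (w x))) := by
      rw [tendsto_iff_norm_sub_tendsto_zero]
      have h2 : Tendsto (fun k => (1/2)*‖W k x - w x‖) atTop (𝓝 0) := by
        simpa using (tendsto_iff_norm_sub_tendsto_zero.1 (hw x hx)).const_mul (1/2 : ℝ)
      refine squeeze_zero (fun _ => norm_nonneg _) (fun k => ?_) h2
      rw [WS]; exact H3 x hx _ _ (hWb k x hx) (hwb x hx)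
    exact tendsto_nhds_unique h1 ((tendsto_add_atTop_iff_nat 1).2 (hw x hx))
  refine ⟨w, ?_, fun x hx => ⟨hwb x hx, hfix x hx, ?_⟩⟩
  · have hunif : TendstoUniformlyOn W w atTop U := by
      rw [Metric.tendstoUniformlyOn_iff]
      intro ε hε
      have h0 : Tendsto (fun k : ℕ => b/2^k) atTop (𝓝 0) := by
        have := (tendsto_pow_atTop_nhds_zero_of_lt_one (r := (1/2:ℝ)) (by norm_num) (by norm_num)).const_mul b
        simpa [div_eq_mul_inv] using this
      filter_upwards [h0.eventually (gt_mem_nhds hε)] with k hk x hx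
      have := dist_le_of_le_geometric_two_of_tendsto (fun k => hstep k x hx) (hw x hx) k
      rw [dist_comm]; exact this.trans_lt hk
    exact hunif.tendstoLocallyUniformlyOn.differentiableOn (Eventually.of_forall hWd) hU
  · have h1 := H3 x hx (w x) 0 (hwb x hx) (by simpa using _hb)
    rw [hfix x hx, sub_zero] at h1
    have : ‖w x‖≤‖w x - Φ x 0‖ + ‖Φ x 0‖ := by
      simpa using norm_add_le (w x - Φ x 0) (Φ x 0)
    linarith

/-- Cauchy estimate -/
lemma norm_deriv_le {f : ℂ → ℂ} {c : ℂ} {R B : ℝ} (hR : 0 < R) (hf : DifferentiableOn ℂ f (ball c R))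
    (hB : ∀ z ∈ ball c R, ‖f z‖ ≤ B) : ‖deriv f c‖ ≤ B/R := by
  have h : ∀ s, 0 < s → s < R → ‖deriv f c‖*s ≤ B := by
    intro s hs hsR
    have h1 : DiffContOnCl ℂ f (ball c s) :=
      (hf.mono (closedBall_subset_ball hsR)).diffContOnCl_ball (subset_refl _)
    have := Complex.norm_deriv_le_of_forall_mem_sphere_norm_le hs h1
      (fun z hz => hB z (sphere_subset_closedBall.trans (closedBall_subset_ball hsR) hz))
    rwa [le_div_iff₀ hs] at this
  rw [le_div_iff₀ hR]
  have hc : ContinuousWithinAt (fun s : ℝ => ‖deriv f c‖*s) (Iio R) R := by fun_prop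
  refine le_of_tendsto hc.tendsto ?_
  filter_upwards [Ioo_mem_nhdsLT hR] with s hs using h s hs.1 hs.2

lemma norm_deriv_le' {f : ℂ → ℂ} {c x : ℂ} {R B : ℝ} (hx : x ∈ ball c R)
    (hf : DifferentiableOn ℂ f (ball c R))
    (hB : ∀ z ∈ ball c R, ‖f z‖ ≤ B) : ‖deriv f x‖ ≤ B/(R - ‖x - c‖) := by
  have hx' : ‖x - c‖ < R := by rwa [mem_ball, dist_eq_norm] at hx
  have hs : ball x (R - ‖x - c‖) ⊆ ball c R := by
    apply ball_subset_ball'; rw [dist_eq_norm]; linarith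
  exact norm_deriv_le (by linarith) (hf.mono hs) (fun z hz => hB z (hs hz))

/-- Lipschitz estimate from a derivative bound on a ball -/
lemma lip_of_deriv {f : ℂ → ℂ} {s : Set ℂ} (ho : IsOpen s) (hs : Convex ℝ s) {C : ℝ} (hf : DifferentiableOn ℂ f s)
    (hB : ∀ x ∈ s, ‖deriv f x‖ ≤ C) {x y : ℂ} (hx : x ∈ s) (hy : y ∈ s) :
    ‖f x - f y‖ ≤ C*‖x - y‖ :=
  hs.norm_image_sub_le_of_norm_deriv_le (fun _ hz => hf.differentiableAt (ho.mem_nhds hz)) hB hy hx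

lemma quad_lip {k : ℂ → ℂ} {s B b : ℝ} (hs : 0 < s) (hk : DifferentiableOn ℂ k (ball 0 s))
    (hB : ∀ z ∈ ball (0:ℂ) s, ‖k z‖ ≤ B) (hbs : b < s/4) {w w' : ℂ} (hw : ‖w‖ ≤ b) (hw' : ‖w'‖ ≤ b) :
    ‖k w - k w' - deriv k 0*(w - w')‖≤8*B/s^2*b*‖w - w'‖ := by
  have hb0 : 0 ≤ b := (norm_nonneg _).trans hw
  have hB0 : 0 ≤ B := (norm_nonneg _).trans (hB 0 (by simpa using hs))
  have hd1 : DifferentiableOn ℂ (deriv k) (ball 0 s) := hk.deriv isOpen_ball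
  have hb1 : ∀ z ∈ ball (0:ℂ) (s/2), ‖deriv k z‖≤2*B/s := by
    intro z hz
    have hz' : ‖z‖ < s/2 := by simpa using hz
    have := norm_deriv_le' (ball_subset_ball (by linarith) hz) hk hB
    refine this.trans ?_
    rw [sub_zero, div_le_div_iff₀ (by linarith) hs]
    nlinarith
  have hb2 : ∀ z ∈ ball (0:ℂ) (s/4), ‖deriv (deriv k) z‖≤8*B/s^2 := by
    intro z hz
    have hz' : ‖z‖ < s/4 := by simpa using hz
    have := norm_deriv_le' (ball_subset_ball (by linarith) hz) (hd1.mono (ball_subset_ball (by linarith))) hb1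
    refine this.trans ?_
    rw [sub_zero, div_div, div_le_div_iff₀ (mul_pos hs (by linarith)) (by positivity)]
    have : s*s/4 ≤ s*(s/2 - ‖z‖) := by nlinarith
    nlinarith [mul_nonneg hB0 (sub_nonneg.2 this)]
  have hb3 : ∀ z ∈ closedBall (0:ℂ) b, ‖deriv k z - deriv k 0‖≤8*B/s^2*b := by
    intro z hz
    have hz' : ‖z‖ ≤ b := by simpa using hz
    have := lip_of_deriv isOpen_ball (convex_ball (0:ℂ) (s/4)) (hd1.mono (ball_subset_ball (by linarith))) hb2
      (x := z) (y := 0) (by simp; linarith) (by simp; linarith)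
    refine this.trans ?_
    rw [sub_zero]; gcongr
  have hd : ∀ z ∈ closedBall (0:ℂ) b, HasDerivWithinAt (fun z => k z - deriv k 0*z) (deriv k z - deriv k 0) (closedBall (0:ℂ) b) z := by
    intro z hz
    have hz' : ‖z‖ ≤ b := by simpa using hz
    have h1 : HasDerivAt k (deriv k z) z := (hk.differentiableAt (isOpen_ball.mem_nhds (by simp; linarith))).hasDerivAt
    have h2 : HasDerivAt (fun z => k z - deriv k 0*z) (deriv k z - deriv k 0*1) z :=
      h1.sub ((hasDerivAt_id z).const_mul (deriv k 0))
    rw [mul_one] at h2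
    exact h2.hasDerivWithinAt
  have := (convex_closedBall (0:ℂ) b).norm_image_sub_le_of_norm_hasDerivWithin_le hd hb3
    (x := w') (y := w) (by simpa using hw') (by simpa using hw)
  refine le_trans (le_of_eq ?_) this
  congr 1; ring

lemma norm_mul_exp_le {x w : ℂ} {b : ℝ} (hw : ‖w‖ ≤ b) : ‖x*eC w‖≤‖x‖*eR b := by
  rw [norm_mul, Complex.norm_exp]
  gcongr
  exact (Complex.re_le_norm w).trans hw

/-- conjugation lemma: `T = x e^φ` conjugates the two maps. -/
lemma conj_lemma {lam : ℂ} (hl : ‖lam‖ = 1) {φ ω : ℂ → ℂ} {r a b R1 R2 : ℝ} (hb : 0 ≤ b)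
    (hR1 : r*eR b ≤ R1) (hR2 : r*eR a ≤ R2) (hr1 : r ≤ R1)
    (hφ : DifferentiableOn ℂ φ (ball 0 R1)) (hω : DifferentiableOn ℂ ω (ball 0 R2))
    (hφa : ∀ x ∈ ball (0:ℂ) r, ‖φ x‖ ≤ a)
    (hφ' : ∀ x ∈ ball (0:ℂ) R1, ‖x*deriv φ x‖≤1/2)
    (hsm : ∀ x ∈ ball (0:ℂ) r, ‖φ x + ω (x*eC (φ x)) - φ (lam*x)‖ ≤ b/2) :
    ∃ ω' : ℂ → ℂ, DifferentiableOn ℂ ω' (ball 0 r) ∧ ∀ x ∈ ball (0:ℂ) r, ‖ω' x‖ ≤ b ∧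
      ω' x + φ (lam*x*eC (ω' x)) = φ x + ω (x*eC (φ x)) ∧
      ‖ω' x‖≤2*‖φ x + ω (x*eC (φ x)) - φ (lam*x)‖ := by
  have hin : ∀ x ∈ ball (0:ℂ) r, ∀ w : ℂ, ‖w‖ ≤ b → lam*x*eC w ∈ ball (0:ℂ) R1 := by
    intro x hx w hw
    rw [mem_ball_zero_iff] at hx ⊢
    have := norm_mul_exp_le (x := lam*x) hw
    rw [norm_mul lam, hl, one_mul] at this
    calc _≤_ := this
      _ < r*eR b := by gcongr
      _ ≤ R1 := hR1
  have hin2 : ∀ x ∈ ball (0:ℂ) r, x*eC (φ x) ∈ ball (0:ℂ) R2 := by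
    intro x hx
    have h1 := norm_mul_exp_le (x := x) (hφa x hx)
    rw [mem_ball_zero_iff] at hx ⊢
    calc _≤_ := h1
      _ < r*eR a := by gcongr
      _ ≤ R2 := hR2
  have hsub : ball (0:ℂ) r ⊆ ball 0 R1 := ball_subset_ball hr1
  have key := holfix (U := ball (0:ℂ) r) isOpen_ball
    (fun x w => φ x + ω (x*eC (φ x)) - φ (lam*x*eC w)) hb ?_ ?_ ?_
  · obtain ⟨w, hw1, hw2⟩ := key
    refine ⟨w, hw1, fun x hx => ?_⟩
    obtain ⟨h1, h2, h3⟩ := hw2 x hx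
    refine ⟨h1, ?_, by simpa using h3⟩
    linear_combination -h2
  · intro w hw hwb
    have e1 : DifferentiableOn ℂ φ (ball 0 r) := hφ.mono hsub
    have e2 : DifferentiableOn ℂ (fun x => ω (x*eC (φ x))) (ball 0 r) :=
      hω.comp (by fun_prop) hin2
    have e3 : DifferentiableOn ℂ (fun x => φ (lam*x*eC (w x))) (ball 0 r) :=
      hφ.comp (by fun_prop) (fun x hx => hin x hx _ (hwb x hx))
    exact (e1.add e2).sub e3
  · intro x hx; simpa using hsm x hx
  · intro x hx v v' hv hv'
    have hd : ∀ z ∈ closedBall (0:ℂ) b, HasDerivWithinAt (fun z => φ (lam*x*eC z))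
        ((lam*x*eC z)*deriv φ (lam*x*eC z)) (closedBall (0:ℂ) b) z := by
      intro z hz
      have hz' : ‖z‖ ≤ b := by simpa using hz
      have h1 : HasDerivAt φ (deriv φ (lam*x*eC z)) (lam*x*eC z) :=
        (hφ.differentiableAt (isOpen_ball.mem_nhds (hin x hx z hz'))).hasDerivAt
      have h2 : HasDerivAt (fun z => lam*x*eC z) (lam*x*eC z) z :=
        (Complex.hasDerivAt_exp z).const_mul _
      have := h1.comp z h2
      rw [mul_comm (deriv φ _)] at this
      exact this.hasDerivWithinAt
    have := (convex_closedBall (0:ℂ) b).norm_image_sub_le_of_norm_hasDerivWithin_le hd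
      (fun z hz => hφ' _ (hin x hx z (by simpa using hz))) (x := v) (y := v') (by simpa using hv) (by simpa using hv')
    rw [norm_sub_rev v v']
    refine le_trans (le_of_eq ?_) this
    congr 1; ring
end

section
open Asymptotics Filter Topology PowerSeries

lemma isBigO_zero_val {f : ℂ → ℂ} {N : ℕ} (hN : 0 < N) (hO : f =O[𝓝 0] (fun x : ℂ => x^N)) : f 0 = 0 := by
  have h := hO.norm_right
  have h2 : f =O[𝓝 0] (fun x : ℂ => ‖x - 0‖^N) := by simpa using h
  exact h2.eq_zero_of_norm_pow (by omega)

/-- Schwarz lemma with order of vanishing -/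
lemma vanish {f : ℂ → ℂ} {r B : ℝ} {N : ℕ} (hN : 0 < N) (hf : DifferentiableOn ℂ f (ball 0 r))
    (hB : ∀ x ∈ ball (0:ℂ) r, ‖f x‖ ≤ B) (hO : f =O[𝓝 0] (fun x : ℂ => x^N)) :
    ∀ x ∈ ball (0:ℂ) r, ‖f x‖ ≤ B*(‖x‖/r)^N := by
  intro x hx
  have f0 := isBigO_zero_val hN hO
  obtain ⟨m, rfl⟩ := Nat.exists_eq_succ_of_ne_zero hN.ne'
  have h1 : (fun x => f x - f 0) =o[𝓝 0] (fun w : ℂ => ‖w - 0‖^m) := by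
    simp only [f0, sub_zero]
    refine hO.trans_isLittleO ?_
    have h2 : (fun x : ℂ => x) =o[𝓝 0] (fun _ => (1:ℂ)) := by
      rw [isLittleO_one_iff]; exact tendsto_id
    have h3 := ((isBigO_refl (fun x : ℂ => x^m) (𝓝 0)).norm_right).mul_isLittleO h2.norm_right
    refine h3.congr (fun x => by rw [pow_succ]) (fun x => by simp)
  have := Complex.dist_le_mul_div_pow_of_mapsTo_ball_of_isLittleO (R₂ := B) hf
    (fun y hy => by rw [f0]; simpa using hB y hy) h1 hx
  simpa [f0] using this

lemma norm_le_two_mul_exp_sub_one {z : ℂ} (hz : ‖z‖≤1/2) : ‖z‖≤2*‖eC z - 1‖ := by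
  have h := Complex.norm_exp_sub_one_sub_id_le (x := z) (by linarith)
  have h2 : ‖z‖≤‖eC z - 1‖ + ‖eC z - 1 - z‖ := by
    have := norm_sub_le (eC z - 1) (eC z - 1 - z)
    simpa using this
  nlinarith [norm_nonneg z]

/-- Taylor coefficient at `0`. -/
noncomputable def tc (n : ℕ) (f : ℂ → ℂ) : ℂ := iteratedDeriv n f 0/(n.factorial : ℂ)

lemma hasJet_tc {f : ℂ → ℂ} {R : ℝ} (hR : 0 < R) (hf : DifferentiableOn ℂ f (ball 0 R)) (M : ℕ) :
    HasJet M f (PowerSeries.mk fun n => tc n f) := by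
  have ha : AnalyticAt ℂ f 0 := hf.analyticAt (ball_mem_nhds _ hR)
  have hp := ha.hasFPowerSeriesAt
  have := hp.isBigO_sub_partialSum_pow M
  simp only [zero_add] at this
  unfold HasJet
  have h2 : (fun x : ℂ => ‖x‖^M) =O[𝓝 0] fun x : ℂ => x^M := by
    refine IsBigO.of_bound 1 ?_
    filter_upwards with x; simp
  refine (this.trans h2).congr_left ?_
  intro x
  congr 1
  rw [FormalMultilinearSeries.partialSum, eval_trunc]
  refine Finset.sum_congr rfl fun k hk => ?_
  rw [FormalMultilinearSeries.apply_eq_pow_smul_coeff]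
  simp [mul_comm, tc, div_eq_mul_inv]

lemma tc_eq_of_hasJet {f : ℂ → ℂ} {R : ℝ} (hR : 0 < R) (hf : DifferentiableOn ℂ f (ball 0 R)) {M : ℕ}
    {A : PowerSeries ℂ} (hA : HasJet M f A) {k : ℕ} (hk : k < M) : tc k f = coeff k A := by
  have := (hasJet_tc hR hf M).unique hA k hk
  simpa using this

lemma norm_tc_le {f : ℂ → ℂ} {R B : ℝ} (hR : 0 < R) (hf : DifferentiableOn ℂ f (ball 0 R))
    (hB : ∀ x ∈ ball (0:ℂ) R, ‖f x‖ ≤ B) (n : ℕ) : ‖tc n f‖ ≤ B/R^n := by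
  have h : ∀ s, 0 < s → s < R → ‖tc n f‖*s^n ≤ B := by
    intro s hs hsR
    have h1 : DiffContOnCl ℂ f (ball 0 s) :=
      (hf.mono (closedBall_subset_ball hsR)).diffContOnCl_ball (subset_refl _)
    have := Complex.norm_iteratedDeriv_le_of_forall_mem_sphere_norm_le n hs h1
      (fun z hz => hB z (sphere_subset_closedBall.trans (closedBall_subset_ball hsR) hz))
    rw [tc, norm_div, Complex.norm_natCast, ← le_div_iff₀ (by positivity), div_le_iff₀ (by positivity)]
    calc _≤_ := this
      _ = _ := by ring
  rw [le_div_iff₀ (by positivity)]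
  have hc : ContinuousWithinAt (fun s : ℝ => ‖tc n f‖*s^n) (Iio R) R := by fun_prop
  refine le_of_tendsto hc.tendsto ?_
  filter_upwards [Ioo_mem_nhdsLT hR] with s hs using h s hs.1 hs.2

lemma tc_zero (f : ℂ → ℂ) : tc 0 f = f 0 := by simp [tc]

/-- `(e^t - 1)` style radius bound: Cauchy for the derivative -/
lemma norm_mul_deriv_le {φ : ℂ → ℂ} {ρ a t : ℝ} (ht : 0 < t) (ha : 0 ≤ a)
    (hφ : DifferentiableOn ℂ φ (ball 0 ρ)) (hφa : ∀ x ∈ ball (0:ℂ) ρ, ‖φ x‖ ≤ a) :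
    ∀ x ∈ ball (0:ℂ) (ρ*eR (-t)), ‖x*deriv φ x‖ ≤ a/t := by
  intro x hx
  rw [mem_ball_zero_iff] at hx
  have hρ : 0 < ρ := by
    by_contra hc
    have : ρ*eR (-t)≤0 := mul_nonpos_of_nonpos_of_nonneg (not_lt.1 hc) (Real.exp_pos _).le
    linarith [norm_nonneg x]
  have he : eR (-t) < 1 := by rw [Real.exp_lt_one_iff]; linarith
  have hx1 : ‖x‖ < ρ := by nlinarith
  have h1 := norm_deriv_le' (c := 0) (x := x) (R := ρ) (by simpa using hx1) hφ hφa
  rw [sub_zero] at h1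
  rw [norm_mul]
  have h2 : ‖x‖*t ≤ ρ - ‖x‖ := by
    have h3 : 1 + t ≤ eR t := by linarith [Real.add_one_le_exp t]
    have h4 : ‖x‖*eR t ≤ ρ := by
      have : ρ*eR (-t)*eR t = ρ := by rw [mul_assoc, ← Real.exp_add]; simp
      rw [← this]; gcongr
    nlinarith [norm_nonneg x]
  rw [le_div_iff₀ ht]
  rw [le_div_iff₀ (by linarith)] at h1
  calc ‖x‖*‖deriv φ x‖*t = ‖deriv φ x‖*(‖x‖*t) := by ring
    _≤‖deriv φ x‖*(ρ - ‖x‖) := by gcongr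
    _ ≤ a := h1

lemma exp_lt_self_mul {ρ t : ℝ} (hρ : 0 < ρ) (ht : 0 < t) : ρ*eR (-t) < ρ := by
  have he : eR (-t) < 1 := by rw [Real.exp_lt_one_iff]; linarith
  nlinarith

/-- normalization: from a formal partial linearization to an actual conjugacy -/
lemma normalize {lam : ℂ} (hl : ‖lam‖ = 1) {ω : ℂ → ℂ} {ρ μ a t : ℝ} {M : ℕ} {w E : PowerSeries ℂ}
    (hM : 0 < M) (hρ : 0 < ρ) (ht : 0 < t)
    (hω : DifferentiableOn ℂ ω (ball 0 ρ)) (hμ : ∀ x ∈ ball (0:ℂ) ρ, ‖ω x‖ ≤ μ)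
    (hw : HasJet M (fun x => eC (ω x)) w) (hE : Lin lam w E M) (ha : 0 ≤ a)
    (hEa : ∑ k ∈ Finset.Ico 1 M, ‖coeff k E‖*ρ^k ≤ a)
    (hat : 16*a + 4*μ ≤ t) (ht1 : t≤1/2) :
    ∃ φ ω' : ℂ → ℂ, DifferentiableOn ℂ φ (ball 0 ρ) ∧ φ 0 = 0 ∧ (∀ x ∈ ball (0:ℂ) ρ, ‖φ x‖≤2*a) ∧
      DifferentiableOn ℂ ω' (ball 0 (ρ*eR (-t))) ∧
      (∀ x ∈ ball (0:ℂ) (ρ*eR (-t)), ‖ω' x‖≤8*a + 2*μ ∧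
        ω' x + φ (lam*x*eC (ω' x)) = φ x + ω (x*eC (φ x))) ∧
      ω' =O[𝓝 0] (fun x : ℂ => x^M) := by
  have hμ0 : 0 ≤ μ := (norm_nonneg _).trans (hμ 0 (by simpa using hρ))
  set P := trunc M E with hP
  have hP0 : P.eval 0 = 1 := by
    rw [hP, eval_trunc, Finset.range_eq_Ico, Finset.sum_eq_sum_Ico_succ_bot hM]
    have : ∑ k ∈ Finset.Ico (0+1) M, coeff k E*(0:ℂ)^k = 0 := by
      refine Finset.sum_eq_zero fun k hk => ?_
      have := (Finset.mem_Ico.1 hk).1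
      rw [zero_pow (by omega), mul_zero]
    rw [this, hE.1]; simp
  have hPa : ∀ x ∈ ball (0:ℂ) ρ, ‖P.eval x - 1‖ ≤ a := by
    intro x hx
    have hx : ‖x‖ < ρ := by simpa using hx
    rw [hP, eval_trunc, Finset.range_eq_Ico, Finset.sum_eq_sum_Ico_succ_bot hM, hE.1]
    simp only [pow_zero, mul_one, add_sub_cancel_left, zero_add]
    refine (norm_sum_le _ _).trans (le_trans ?_ hEa)
    refine Finset.sum_le_sum fun k _ => ?_
    rw [norm_mul, norm_pow]; gcongr
  have ha2 : a≤1/2 := by linarith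
  have hslit : ∀ x ∈ ball (0:ℂ) ρ, P.eval x ∈ Complex.slitPlane := by
    intro x hx
    have h1 := hPa x hx
    left
    have h2 : |(P.eval x - 1).re| ≤ a := (Complex.abs_re_le_norm _).trans h1
    rw [Complex.sub_re, Complex.one_re, abs_le] at h2
    linarith
  set φ : ℂ → ℂ := fun x => Complex.log (P.eval x) with hφdef
  have hexpφ : ∀ x ∈ ball (0:ℂ) ρ, eC (φ x) = P.eval x := by
    intro x hx
    exact Complex.exp_log (Complex.slitPlane_ne_zero (hslit x hx))
  have hφd : DifferentiableOn ℂ φ (ball 0 ρ) := by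
    intro x hx
    exact (P.differentiable.differentiableAt.clog (hslit x hx)).differentiableWithinAt
  have hφ0 : φ 0 = 0 := by simp [hφdef, hP0]
  have hφa : ∀ x ∈ ball (0:ℂ) ρ, ‖φ x‖≤2*a := by
    intro x hx
    have h1 := hPa x hx
    have h2 := Complex.norm_log_one_add_half_le_self (z := P.eval x - 1) (h1.trans ha2)
    rw [add_sub_cancel] at h2
    linarith
  have hin : ρ*eR (-t) < ρ := exp_lt_self_mul hρ ht
  have hin2 : ρ*eR (-(t/2)) < ρ := exp_lt_self_mul hρ (by linarith)
  have hsub : ball (0:ℂ) (ρ*eR (-t)) ⊆ ball 0 ρ := ball_subset_ball hin.le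
  have hlx : ∀ x ∈ ball (0:ℂ) ρ, lam*x ∈ ball (0:ℂ) ρ := by
    intro x hx; simpa [hl] using hx
  have hTin : ∀ x ∈ ball (0:ℂ) (ρ*eR (-t)), x*eC (φ x) ∈ ball (0:ℂ) ρ := by
    intro x hx
    have h1 := norm_mul_exp_le (x := x) (hφa x (hsub hx))
    rw [mem_ball_zero_iff] at hx ⊢
    calc _≤_ := h1
      _ < ρ*eR (-t)*eR (2*a) := by gcongr
      _ = ρ*eR (-t + 2*a) := by rw [Real.exp_add]; ring
      _ ≤ ρ*1 := by
        gcongr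
        rw [Real.exp_le_one_iff]; linarith
      _ = ρ := mul_one _
  have hres : ∀ x ∈ ball (0:ℂ) (ρ*eR (-t)),
      ‖φ x + ω (x*eC (φ x)) - φ (lam*x)‖≤4*a + μ := by
    intro x hx
    have h1 := hφa x (hsub hx)
    have h2 := hφa _ (hlx x (hsub hx))
    have h3 := hμ _ (hTin x hx)
    calc _≤‖φ x‖ + ‖ω (x*eC (φ x))‖ + ‖φ (lam*x)‖ :=
          (norm_sub_le _ _).trans (by gcongr; exact norm_add_le _ _)
      _≤_ := by linarith
  have hderiv : ∀ x ∈ ball (0:ℂ) (ρ*eR (-(t/2))), ‖x*deriv φ x‖≤1/2 := by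
    intro x hx
    refine (norm_mul_deriv_le (by linarith) (by linarith) hφd hφa x hx).trans ?_
    rw [div_le_div_iff₀ (by linarith) (by norm_num)]; linarith
  obtain ⟨ω', hω'd, hω'⟩ := conj_lemma hl (φ := φ) (ω := ω) (r := ρ*eR (-t)) (a := 2*a)
    (b := 8*a + 2*μ) (R1 := ρ*eR (-(t/2))) (R2 := ρ) (by linarith)
    (by rw [mul_assoc, ← Real.exp_add]; gcongr; linarith)
    (by
      rw [mul_assoc, ← Real.exp_add]
      have : eR (-t + 2*a)≤1 := by rw [Real.exp_le_one_iff]; linarith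
      nlinarith)
    (by gcongr; linarith) (hφd.mono (ball_subset_ball hin2.le)) hω (fun x hx => hφa x (hsub hx)) hderiv
    (fun x hx => (hres x hx).trans (by linarith))
  refine ⟨φ, ω', hφd, hφ0, hφa, hω'd, fun x hx => ⟨(hω' x hx).1, (hω' x hx).2.1⟩, ?_⟩
  -- order of vanishing
  have hjE : HasJet M (fun x => P.eval x) E := by
    unfold HasJet; simp [← hP, isBigO_zero]
  have hb := (lin_bridge (lam := lam) hM hw hjE hE.1).1 hE
  have hnh : ball (0:ℂ) (ρ*eR (-t)) ∈ 𝓝 (0:ℂ) := ball_mem_nhds _ (by positivity)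
  refine IsBigO.trans (IsBigO.of_bound 8 ?_) hb
  filter_upwards [hnh] with x hx
  have h1 := (hω' x hx).2.2
  have h2 := hres x hx
  set z := φ x + ω (x*eC (φ x)) - φ (lam*x) with hz
  have h3 := norm_le_two_mul_exp_sub_one (z := z) (h2.trans (by linarith))
  have e1 : eC z = eC (ω (x*P.eval x))*P.eval x/P.eval (lam*x) := by
    rw [hz, Complex.exp_sub, Complex.exp_add, hexpφ x (hsub hx), hexpφ _ (hlx x (hsub hx))]
    ring
  have hne : P.eval (lam*x) ≠ 0 := Complex.slitPlane_ne_zero (hslit _ (hlx x (hsub hx)))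
  have e2 : eC z - 1 = (eC (ω (x*P.eval x))*P.eval x - P.eval (lam*x))/P.eval (lam*x) := by
    rw [e1, sub_div, div_self hne]
  have e3 : 1/2≤‖P.eval (lam*x)‖ := by
    have h4 := hPa _ (hlx x (hsub hx))
    have h5 : ‖(1:ℂ)‖≤‖P.eval (lam*x)‖ + ‖P.eval (lam*x) - 1‖ := by
      have := norm_sub_le (P.eval (lam*x)) (P.eval (lam*x) - 1)
      simpa using this
    rw [norm_one] at h5; linarith
  rw [e2, norm_div] at h3
  have h6 : ‖eC (ω (x*P.eval x))*P.eval x - P.eval (lam*x)‖/‖P.eval (lam*x)‖ ≤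
      ‖eC (ω (x*P.eval x))*P.eval x - P.eval (lam*x)‖*2 := by
    rw [div_le_iff₀ (by linarith)]
    nlinarith [norm_nonneg (eC (ω (x*P.eval x))*P.eval x - P.eval (lam*x))]
  linarith
end

lemma phi_exp_lip {φ : ℂ → ℂ} {x : ℂ} {b R1 : ℝ} (hx : ‖x‖*eR b < R1)
    (hφ : DifferentiableOn ℂ φ (ball 0 R1))
    (hφ' : ∀ x ∈ ball (0:ℂ) R1, ‖x*deriv φ x‖≤1/2) {v v' : ℂ} (hv : ‖v‖ ≤ b) (hv' : ‖v'‖ ≤ b) :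
    ‖φ (x*eC v) - φ (x*eC v')‖≤(1/2)*‖v - v'‖ := by
  have hin : ∀ w : ℂ, ‖w‖ ≤ b → x*eC w ∈ ball (0:ℂ) R1 := by
    intro w hw
    rw [mem_ball_zero_iff]
    exact (norm_mul_exp_le hw).trans_lt hx
  have hd : ∀ z ∈ closedBall (0:ℂ) b, HasDerivWithinAt (fun z => φ (x*eC z))
      ((x*eC z)*deriv φ (x*eC z)) (closedBall (0:ℂ) b) z := by
    intro z hz
    have hz' : ‖z‖ ≤ b := by simpa using hz
    have h1 : HasDerivAt φ (deriv φ (x*eC z)) (x*eC z) :=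
      (hφ.differentiableAt (isOpen_ball.mem_nhds (hin z hz'))).hasDerivAt
    have h2 : HasDerivAt (fun z => x*eC z) (x*eC z) z :=
      (Complex.hasDerivAt_exp z).const_mul _
    have := h1.comp z h2
    rw [mul_comm (deriv φ _)] at this
    exact this.hasDerivWithinAt
  exact (convex_closedBall (0:ℂ) b).norm_image_sub_le_of_norm_hasDerivWithin_le hd
    (fun z hz => hφ' _ (hin z (by simpa using hz))) (x := v') (y := v) (by simpa using hv') (by simpa using hv)

/-- inversion of `x e^{φ x}` -/
lemma inv_lemma {φ : ℂ → ℂ} {a ρ : ℝ} (ha : 0 ≤ a) (hφ : DifferentiableOn ℂ φ (ball 0 ρ))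
    (hφa : ∀ x ∈ ball (0:ℂ) ρ, ‖φ x‖ ≤ a)
    (hφ' : ∀ x ∈ ball (0:ℂ) ρ, ‖x*deriv φ x‖≤1/2) {y : ℂ} (hy : ‖y‖*eR (2*a) < ρ) :
    ∃ x, ‖x‖≤‖y‖*eR (2*a) ∧ x*eC (φ x) = y := by
  have key := holfix (U := univ) isOpen_univ (fun _ w => - φ (y*eC w)) (b := 2*a)
    (by linarith) ?_ ?_ ?_
  · obtain ⟨w, -, hw⟩ := key
    obtain ⟨h1, h2, -⟩ := hw 0 (mem_univ _)
    refine ⟨y*eC (w 0), norm_mul_exp_le h1, ?_⟩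
    have : φ (y*eC (w 0)) = - w 0 := by linear_combination -h2
    rw [this, mul_assoc, ← Complex.exp_add]; simp
  · intro w hw hwb
    refine (hφ.comp (t := ball 0 ρ) (by fun_prop) ?_).neg
    intro x hx
    rw [mem_ball_zero_iff]
    exact (norm_mul_exp_le (hwb x hx)).trans_lt hy
  · intro x _
    have h1 : y ∈ ball (0:ℂ) ρ := by
      rw [mem_ball_zero_iff]
      have : 1 ≤ eR (2*a) := Real.one_le_exp (by linarith)
      nlinarith [norm_nonneg y]
    simpa using hφa y h1
  · intro x _ w w' hw hw'
    have := phi_exp_lip hy hφ hφ' hw hw'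
    rw [show -φ (y*eC w) - -φ (y*eC w') =
      -(φ (y*eC w) - φ (y*eC w')) by ring, norm_neg]
    exact this

lemma inj_lemma {φ : ℂ → ℂ} {a ρ r : ℝ} (hr : r*eR (2*a) ≤ ρ) (hrρ : r ≤ ρ)
    (hφ : DifferentiableOn ℂ φ (ball 0 ρ))
    (hφa : ∀ x ∈ ball (0:ℂ) ρ, ‖φ x‖ ≤ a)
    (hφ' : ∀ x ∈ ball (0:ℂ) ρ, ‖x*deriv φ x‖≤1/2) :
    InjOn (fun x => x*eC (φ x)) (ball 0 r) := by
  intro x hx x' hx' h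
  simp only at h
  set w := φ x - φ x' with hw
  have h1 : x' = x*eC w := by
    rw [hw, Complex.exp_sub, ← mul_div_assoc, h]
    field_simp
  have hwa : ‖w‖≤2*a := by
    have := norm_sub_le (φ x) (φ x')
    have := hφa x (ball_subset_ball hrρ hx)
    have := hφa x' (ball_subset_ball hrρ hx')
    linarith
  have h3 : ‖x‖*eR (2*a) < ρ := by
    rw [mem_ball_zero_iff] at hx
    exact lt_of_lt_of_le (by gcongr) hr
  have h2 := phi_exp_lip h3 hφ hφ' (v := 0) (v' := w) (by simpa using (norm_nonneg _).trans hwa) hwa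
  rw [← h1] at h2
  simp only [Complex.exp_zero, mul_one, zero_sub, norm_neg] at h2
  rw [← hw] at h2
  have : w = 0 := by
    rw [← norm_eq_zero]; linarith [norm_nonneg w]
  rw [h1, this]; simp

/-- a chart `Ξ = x e^χ` semiconjugating `λ x e^ω` to `λ z e^u` -/
structure Sys (lam:ℂ) (u : ℂ → ℂ) (r κ : ℝ) (χ ω : ℂ → ℂ) : Prop where
  dχ : DifferentiableOn ℂ χ (ball 0 r)
  dω : DifferentiableOn ℂ ω (ball 0 r)
  χ0 : χ 0 = 0
  inj : InjOn (fun x => x*eC (χ x)) (ball 0 r)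
  bd : ∀ x ∈ ball (0:ℂ) r, ‖x*eC (χ x)‖ < 2
  κ_le : ∀ x ∈ ball (0:ℂ) r, κ≤‖1 + x*deriv χ x‖
  eq : ∀ x ∈ ball (0:ℂ) r, lam*x*eC (ω x) ∈ ball (0:ℂ) r →
    χ x + u (x*eC (χ x)) = ω x + χ (lam*x*eC (ω x))

lemma Sys.trans {lam : ℂ} {u : ℂ → ℂ} {r κ : ℝ} {χ ω : ℂ → ℂ} (S : Sys lam u r κ χ ω)
    {r' κ' : ℝ} {φ ω' : ℂ → ℂ} (hκ : 0 ≤ κ) (hφ : DifferentiableOn ℂ φ (ball 0 r'))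
    (hω' : DifferentiableOn ℂ ω' (ball 0 r')) (hφ0 : φ 0 = 0)
    (hmap : ∀ x ∈ ball (0:ℂ) r', x*eC (φ x) ∈ ball (0:ℂ) r)
    (hinj : InjOn (fun x => x*eC (φ x)) (ball 0 r'))
    (hκ' : ∀ x ∈ ball (0:ℂ) r', κ'≤‖1 + x*deriv φ x‖)
    (heq : ∀ x ∈ ball (0:ℂ) r', lam*x*eC (ω' x) ∈ ball (0:ℂ) r' →
      ω' x + φ (lam*x*eC (ω' x)) = φ x + ω (x*eC (φ x))) :
    Sys lam u r' (κ*κ') (fun x => φ x + χ (x*eC (φ x))) ω' := by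
  have hc : ∀ x, x*eC (φ x + χ (x*eC (φ x))) =
      (x*eC (φ x))*eC (χ (x*eC (φ x))) := by
    intro x; rw [Complex.exp_add]; ring
  refine ⟨?_, hω', by simp [hφ0, S.χ0], ?_, ?_, ?_, ?_⟩
  · exact hφ.add (S.dχ.comp (by fun_prop) hmap)
  · intro x hx x' hx' h
    simp only [hc] at h
    exact hinj hx hx' (S.inj (hmap x hx) (hmap x' hx') h)
  · intro x hx
    rw [hc]; exact S.bd _ (hmap x hx)
  · intro x hx
    have h1 : HasDerivAt φ (deriv φ x) x := (hφ.differentiableAt (isOpen_ball.mem_nhds hx)).hasDerivAt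
    have h2 : HasDerivAt χ (deriv χ (x*eC (φ x))) (x*eC (φ x)) :=
      (S.dχ.differentiableAt (isOpen_ball.mem_nhds (hmap x hx))).hasDerivAt
    have h3 : HasDerivAt (fun x => x*eC (φ x))
        (1*eC (φ x) + x*(eC (φ x)*deriv φ x)) x :=
      (hasDerivAt_id x).mul h1.cexp
    have h4 := h1.add (h2.comp x h3)
    have h5 : deriv (fun x => φ x + χ (x*eC (φ x))) x = _ := h4.deriv
    rw [h5]
    have h6 : 1 + x*(deriv φ x + deriv χ (x*eC (φ x)) *
        (1*eC (φ x) + x*(eC (φ x)*deriv φ x))) =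
        (1 + (x*eC (φ x))*deriv χ (x*eC (φ x)))*(1 + x*deriv φ x) := by ring
    rw [h6, norm_mul]
    have := S.κ_le _ (hmap x hx)
    have h7 := hκ' x hx
    calc κ*κ' ≤ κ*‖1 + x*deriv φ x‖ := by gcongr
      _≤_ := by gcongr
  · intro x hx hy
    have e1 := heq x hx hy
    set y := lam*x*eC (ω' x) with hyd
    have e2 : y*eC (φ y) = lam*(x*eC (φ x))*eC (ω (x*eC (φ x))) := by
      rw [hyd, mul_assoc _ (eC _), ← Complex.exp_add, e1, Complex.exp_add]; ring
    have e3 := S.eq _ (hmap x hx) (by rw [← e2]; exact hmap y hy)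
    rw [← e2] at e3
    simp only [hc]
    linear_combination e3 - e1

/-- uniform linearizability of polynomial perturbations -/
def BoundP (lam:ℂ) (K C η : ℝ) : Prop :=
  ∀ (c : ℕ → ℂ) (d : ℕ), (∀ i, ‖c i‖ ≤ η) → ∀ w E : PowerSeries ℂ,
    HasJet (d+1) (fun z => eC (∑ i ∈ Finset.Icc 1 d, c i*z^i)) w → Lin lam w E (d+1) →
    ∀ k ≤ d, ‖coeff k E‖ ≤ K*C^k

lemma comp_sub_isBigO {F a b : ℂ → ℂ} {p : ℂ} (hF : AnalyticAt ℂ F p) (ha : Tendsto a (𝓝 0) (𝓝 p))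
    (hb : Tendsto b (𝓝 0) (𝓝 p)) : (fun x => F (a x) - F (b x)) =O[𝓝 0] (fun x => a x - b x) := by
  have h1 := hF.hasStrictFDerivAt.isBigO_sub
  exact h1.comp_tendsto (ha.prodMk_nhds hb)

lemma sys_lin {lam : ℂ} {u χ ω : ℂ → ℂ} {r κ : ℝ} {N : ℕ} (hN : 0 < N) (hr : 0 < r)
    (S : Sys lam u r κ χ ω) (hω : ω =O[𝓝 0] (fun x : ℂ => x^N)) {w E : PowerSeries ℂ}
    (hw : HasJet N (fun z => eC (u z)) w) (hE : HasJet N (fun x => eC (χ x)) E) :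
    Lin lam w E N := by
  have hE0 : coeff 0 E = 1 := by
    have h1 := tc_eq_of_hasJet (f := fun x => eC (χ x)) hr (by have := S.dχ; fun_prop) hE hN
    rw [← h1, tc_zero]; simp [S.χ0]
  rw [lin_bridge hN hw hE hE0]
  have hω0 := isBigO_zero_val hN hω
  have hcω : ContinuousAt ω 0 := S.dω.continuousOn.continuousAt (ball_mem_nhds _ hr)
  have hcχ : ContinuousAt χ 0 := S.dχ.continuousOn.continuousAt (ball_mem_nhds _ hr)
  have haχ : AnalyticAt ℂ χ 0 := S.dχ.analyticAt (ball_mem_nhds _ hr)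
  have tω : Tendsto ω (𝓝 0) (𝓝 0) := by simpa [hω0] using hcω.tendsto
  have t2 : Tendsto (fun x => lam*x*eC (ω x)) (𝓝 0) (𝓝 0) := by
    have : ContinuousAt (fun x => lam*x*eC (ω x)) 0 := by fun_prop
    simpa using this.tendsto
  have t1 : Tendsto (fun x : ℂ => lam*x) (𝓝 0) (𝓝 0) := by
    have : ContinuousAt (fun x : ℂ => lam*x) 0 := by fun_prop
    simpa using this.tendsto
  have tχ : Tendsto χ (𝓝 0) (𝓝 0) := by simpa [S.χ0] using hcχ.tendsto
  have b1 : (fun x => eC (ω x) - eC 0) =O[𝓝 0] (fun x => ω x - 0) :=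
    comp_sub_isBigO (F := eC) (b := fun _ => 0) (p := 0) (by fun_prop) tω tendsto_const_nhds
  have b2 : (fun x => lam*x*eC (ω x) - lam*x) =O[𝓝 0] ω := by
    have h3 : (fun x : ℂ => lam*x) =O[𝓝 0] (fun _ => (1:ℂ)) := by
      have : ContinuousAt (fun x : ℂ => lam*x) 0 := by fun_prop
      exact this.norm.isBoundedUnder_le.isBigO_one ℂ
    refine (h3.mul b1).congr (fun x => ?_) (fun x => ?_)
    · simp; ring
    · simp
  have b3 := (comp_sub_isBigO haχ t2 t1).trans b2
  have b4 : (fun x => ω x + χ (lam*x*eC (ω x)) - χ (lam*x)) =O[𝓝 0] ω := by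
    refine ((isBigO_refl ω _).add b3).congr_left fun x => by ring
  have b5 : (fun x => eC (ω x + χ (lam*x*eC (ω x))) - eC (χ (lam*x))) =O[𝓝 0]
      (fun x => ω x + χ (lam*x*eC (ω x)) - χ (lam*x)) := by
    refine comp_sub_isBigO (F := eC) (p := 0) (by fun_prop) ?_ (tχ.comp t1)
    simpa using tω.add (tχ.comp t2)
  refine ((b5.trans b4).trans hω).congr' ?_ (EventuallyEq.refl _ _)
  filter_upwards [ball_mem_nhds (0:ℂ) hr, t2 (ball_mem_nhds (0:ℂ) hr)] with x hx hy
  rw [← S.eq x hx hy, Complex.exp_add]; ring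

lemma jet_exp_trunc {u : ℂ → ℂ} {R : ℝ} (hR : 0 < R) (hu : DifferentiableOn ℂ u (ball 0 R)) (hu0 : u 0 = 0)
    (d : ℕ) {w : PowerSeries ℂ} (hw : HasJet (d+1) (fun z => eC (u z)) w) :
    HasJet (d+1) (fun z => eC (∑ i ∈ Finset.Icc 1 d, tc i u*z^i)) w := by
  have h1 := hasJet_tc hR hu (d+1)
  refine hw.congr ?_
  unfold HasJet at h1
  have e : ∀ x, (trunc (d+1) (PowerSeries.mk fun n => tc n u)).eval x = ∑ i ∈ Finset.Icc 1 d, tc i u*x^i := by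
    intro x
    rw [eval_trunc, Finset.range_eq_Ico, Finset.sum_eq_sum_Ico_succ_bot (by omega)]
    simp only [coeff_mk, tc_zero, hu0, zero_mul, zero_add]
    rfl
  simp only [e] at h1
  have hcu : ContinuousAt u 0 := hu.continuousOn.continuousAt (ball_mem_nhds _ hR)
  have tu : Tendsto u (𝓝 0) (𝓝 0) := by simpa [hu0] using hcu.tendsto
  have ts : Tendsto (fun z : ℂ => ∑ i ∈ Finset.Icc 1 d, tc i u*z^i) (𝓝 0) (𝓝 0) := by
    have hc : Continuous (fun z : ℂ => ∑ i ∈ Finset.Icc 1 d, tc i u*z^i) := by fun_prop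
    have h := hc.tendsto 0
    have h0 : ∑ i ∈ Finset.Icc 1 d, tc i u*(0:ℂ)^i = 0 := by
      refine Finset.sum_eq_zero fun i hi => ?_
      have := (Finset.mem_Icc.1 hi).1
      rw [zero_pow (by omega), mul_zero]
    rwa [h0] at h
  exact (comp_sub_isBigO (F := eC) (p := 0) (by fun_prop) tu ts).trans h1

/-- lower bound for the radius -/
lemma final {lam : ℂ} {K C η : ℝ} (hP : BoundP lam K C η) (hK : 0 < K) (hC : 0 < C)
    {u χ ω : ℂ → ℂ} {r κ d : ℝ} {N : ℕ} (hN : 0 < N) (hr : 0 < r)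
    (hu : DifferentiableOn ℂ u (ball 0 1.05)) (hu0 : u 0 = 0) (huη : ∀ z ∈ ball (0:ℂ) 1.05, ‖u z‖ ≤ η)
    (S : Sys lam u r κ χ ω) (hω : ∀ x ∈ ball (0:ℂ) r, ‖ω x‖≤(‖x‖/r)^N)
    {xa : ℂ} (hd : 0 < d) (hdN : 1 ≤ d*N) (hxa : ‖xa‖ ≤ r*eR (-d))
    (hΞ : 3/2≤‖xa*eC (χ xa)‖) : 1/2 < C*r ∨ 1/2 < 2*K*r := by
  by_contra hcon
  push Not at hcon
  obtain ⟨hc1, hc2⟩ := hcon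
  have hωO : ω =O[𝓝 0] (fun x : ℂ => x^N) := by
    refine IsBigO.of_bound (1/r^N) ?_
    filter_upwards [ball_mem_nhds (0:ℂ) hr] with x hx
    refine (hω x hx).trans (le_of_eq ?_)
    rw [div_pow, norm_pow]; ring
  have hR : (0:ℝ) < 1.05 := by norm_num
  have hue : DifferentiableOn ℂ (fun z => eC (u z)) (ball 0 1.05) := by fun_prop
  have hχe : DifferentiableOn ℂ (fun z => eC (χ z)) (ball 0 r) := by have := S.dχ; fun_prop
  have hw := hasJet_tc hR hue N
  have hE := hasJet_tc hr hχe N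
  have hL := sys_lin hN hr S hωO hw hE
  obtain ⟨d', rfl⟩ : ∃ d', N = d' + 1 := ⟨N - 1, by omega⟩
  have hEk := hP (fun i => tc i u) d' (fun i => by
    refine (norm_tc_le hR hu huη i).trans ?_
    refine div_le_self ((norm_nonneg _).trans (huη 0 (by simp only [mem_ball_zero_iff, norm_zero]; norm_num))) (one_le_pow₀ (by norm_num))) _ _
    (jet_exp_trunc hR hu hu0 d' hw) hL
  set E := PowerSeries.mk fun n => tc n (fun z => eC (χ z)) with hEdef
  have hhead : ∀ x ∈ ball (0:ℂ) r, ‖x*(trunc (d'+1) E).eval x‖≤1/2 := by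
    intro x hx
    rw [mem_ball_zero_iff] at hx
    rw [eval_trunc, norm_mul]
    have h1 : ‖∑ k ∈ Finset.range (d'+1), coeff k E*x^k‖ ≤ ∑ k ∈ Finset.range (d'+1), K*(1/2)^k := by
      refine norm_sum_le_of_le _ fun k hk => ?_
      have h2 := hEk k (by simp at hk; omega)
      rw [norm_mul, norm_pow]
      calc ‖coeff k E‖*‖x‖^k≤(K*C^k)*r^k := by gcongr
        _ = K*(C*r)^k := by rw [mul_pow]; ring
        _ ≤ K*(1/2)^k := by gcongr
    have h3 : ∑ k ∈ Finset.range (d'+1), K*(1/2 : ℝ)^k ≤ K*2 := by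
      rw [← Finset.mul_sum]
      gcongr
      rw [geom_sum_eq (by norm_num)]
      have : (0:ℝ)≤(1/2)^(d'+1) := by positivity
      rw [div_le_iff_of_neg (by norm_num)]
      linarith
    calc _ ≤ r*(K*2) := by gcongr; exact h1.trans h3
      _≤_ := by linarith
  have htail : ∀ x ∈ ball (0:ℂ) r, ‖x*eC (χ x) - x*(trunc (d'+1) E).eval x‖ ≤
      5/2*(‖x‖/r)^(d' + 1) := by
    refine vanish (by omega) ?_ ?_ ?_
    · exact (differentiableOn_id.mul hχe).sub (by fun_prop)
    · intro x hx
      have := norm_sub_le (x*eC (χ x)) (x*(trunc (d'+1) E).eval x)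
      linarith [S.bd x hx, hhead x hx]
    · have h3 : (fun x : ℂ => x) =O[𝓝 0] (fun _ => (1:ℂ)) := by
        have : ContinuousAt (fun x : ℂ => x) 0 := by fun_prop
        exact this.norm.isBoundedUnder_le.isBigO_one ℂ
      unfold HasJet at hE
      refine (h3.mul hE).congr (fun x => by ring) (fun x => by ring)
  have hexp : eR (-d) < 1 := by rw [Real.exp_lt_one_iff]; linarith
  have hxr : xa ∈ ball (0:ℂ) r := by
    rw [mem_ball_zero_iff]; nlinarith
  have h1 := hhead xa hxr
  have h2 := htail xa hxr
  have h3 : (‖xa‖/r)^(d'+1) ≤ eR (-1) := by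
    calc (‖xa‖/r)^(d'+1) ≤ eR (-d)^(d'+1) := by
          gcongr
          rw [div_le_iff₀ hr]; linarith
      _ = eR (-(d*((d'+1 : ℕ) : ℝ))) := by rw [← Real.exp_nat_mul]; congr 1; ring
      _≤_ := by rw [Real.exp_le_exp]; linarith
  have h4 := Real.exp_neg_one_lt_d9
  have h5 := norm_le_norm_add_norm_sub' (xa*eC (χ xa)) (xa*(trunc (d'+1) E).eval xa)
  norm_num at h4
  linarith

lemma norm_exp_sub_one_le_two {z : ℂ} (hz : ‖z‖≤1) : ‖eC z - 1‖≤2*‖z‖ :=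
  Complex.norm_exp_sub_one_le hz

/-- coefficients of `exp ω` -/
noncomputable def expS (ω : ℂ → ℂ) : PowerSeries ℂ := PowerSeries.mk fun n => tc n (fun x => eC (ω x))

lemma expS_jet {ω : ℂ → ℂ} {ρ : ℝ} (hρ : 0 < ρ) (hω : DifferentiableOn ℂ ω (ball 0 ρ)) (M : ℕ) :
    HasJet M (fun x => eC (ω x)) (expS ω) :=
  hasJet_tc hρ (by fun_prop) M

lemma expS_zero {ω : ℂ → ℂ} (h0 : ω 0 = 0) : coeff 0 (expS ω) = 1 := by
  simp [expS, tc_zero, h0]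

lemma tc_sub_const {f : ℂ → ℂ} {ρ : ℝ} (hρ : 0 < ρ) (hf : DifferentiableOn ℂ f (ball 0 ρ)) (c:ℂ) {j : ℕ}
    (hj : 1 ≤ j) : tc j (fun x => f x - c) = tc j f := by
  have h1 := (hasJet_tc hρ hf (j+1)).add (HasJet.const (j+1) (-c))
  have h2 : DifferentiableOn ℂ (fun x => f x + -c) (ball 0 ρ) := by fun_prop
  have := tc_eq_of_hasJet hρ h2 h1 (k := j) (by omega)
  simp only [sub_eq_add_neg, this]
  simp [PowerSeries.coeff_C, show j ≠ 0 by omega]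

lemma expS_coeff_le {ω : ℂ → ℂ} {ρ μ : ℝ} (hρ : 0 < ρ) (hω : DifferentiableOn ℂ ω (ball 0 ρ))
    (hμ : ∀ x ∈ ball (0:ℂ) ρ, ‖ω x‖ ≤ μ) (hμ1 : μ≤1) {j : ℕ} (hj : 1 ≤ j) :
    ‖coeff j (expS ω)‖*ρ^j≤2*μ := by
  have h0 : DifferentiableOn ℂ (fun x => eC (ω x)) (ball 0 ρ) := by fun_prop
  have h1 := norm_tc_le (f := fun x => eC (ω x) - 1) (B := 2*μ) hρ (by fun_prop) (fun x hx => by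
    have := hμ x hx
    exact (norm_exp_sub_one_le_two (by linarith)).trans (by linarith)) j
  rw [tc_sub_const hρ h0 1 hj, le_div_iff₀ (by positivity)] at h1
  simpa [expS] using h1

lemma pow_le_three {a : ℝ} {M j : ℕ} (ha : 0 ≤ a) (haM : a*M≤1) (hj : j ≤ M) : (1 + a)^j≤3 := by
  calc (1 + a)^j≤(1 + a)^M := pow_le_pow_right₀ (by linarith) hj
    _ ≤ eR a^M := by gcongr; rw [add_comm]; exact Real.add_one_le_exp a
    _ = eR (a*M) := by rw [← Real.exp_nat_mul]; ring_nf
    _ ≤ eR 1 := by gcongr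
    _≤3 := by have := Real.exp_one_lt_d9; norm_num at this; linarith

lemma lin_simple {lam : ℂ} (hlam : ∀ k, 0 < k → lam^k ≠ 1) {ω : ℂ → ℂ} {ρ μ D a : ℝ} {M : ℕ} (hρ : 0 < ρ)
    (hω : DifferentiableOn ℂ ω (ball 0 ρ)) (hω0 : ω 0 = 0)
    (hμ : ∀ x ∈ ball (0:ℂ) ρ, ‖ω x‖ ≤ μ) (hμ1 : μ≤1) (hD0 : 0 ≤ D)
    (hD : ∀ k, 1 ≤ k → k < M → 1 ≤ D*‖lam^k - 1‖) (ha : 6*D*M*μ ≤ a) (haM : a*M≤1) :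
    ∃ E, Lin lam (expS ω) E M ∧ ∑ k ∈ Finset.Ico 1 M, ‖coeff k E‖*ρ^k ≤ a := by
  have hμ0 : 0 ≤ μ := (norm_nonneg _).trans (hμ 0 (by simpa using hρ))
  have ha0 : 0 ≤ a := le_trans (by positivity) ha
  have hw0 := expS_zero hω0
  refine ⟨linSer lam (expS ω), linSer_lin lam _ hlam hw0 M, ?_⟩
  refine majorant hw0 (linSer_lin lam _ hlam hw0 M) hρ.le ha0 (fun _ => D) (fun _ => hD0)
    (fun j k hj hjk hk => hD k (by omega) hk) ?_
  refine le_trans ?_ ha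
  calc _ ≤ ∑ j ∈ Finset.Ico 1 M, D*(2*μ)*3 := by
        refine Finset.sum_le_sum fun j hj => ?_
        rw [Finset.mem_Ico] at hj
        have h1 := expS_coeff_le hρ hω hμ hμ1 hj.1
        have h2 := pow_le_three (j := j+1) ha0 haM (by omega)
        calc D*‖coeff j (expS ω)‖*ρ^j*(1 + a)^(j + 1)
            = D*(‖coeff j (expS ω)‖*ρ^j)*(1 + a)^(j + 1) := by ring
          _ ≤ D*(2*μ)*3 := by gcongr
    _≤_ := by
        rw [Finset.sum_const, nsmul_eq_mul, Nat.card_Ico]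
        have : ((M - 1 : ℕ) : ℝ) ≤ M := by exact_mod_cast Nat.sub_le M 1
        calc ((M - 1 : ℕ) : ℝ)*(D*(2*μ)*3) ≤ M*(D*(2*μ)*3) := by gcongr
          _ = _ := by ring

/-- one conjugation step -/
lemma lin_step {lam : ℂ} (hl : ‖lam‖ = 1) {u χ ω : ℂ → ℂ} {r κ ρ μ a t : ℝ} {M : ℕ} {w E : PowerSeries ℂ}
    (S : Sys lam u r κ χ ω) (hκ : 0 ≤ κ) (hρ : 0 < ρ) (hρr : ρ ≤ r) (hM : 0 < M) (ht : 0 < t)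
    (hμ : ∀ x ∈ ball (0:ℂ) ρ, ‖ω x‖ ≤ μ)
    (hw : HasJet M (fun x => eC (ω x)) w) (hE : Lin lam w E M) (ha : 0 ≤ a)
    (hEa : ∑ k ∈ Finset.Ico 1 M, ‖coeff k E‖*ρ^k ≤ a)
    (hat : 16*a + 4*μ ≤ t) (ht1 : t≤1/2) :
    ∃ φ ω' : ℂ → ℂ, Sys lam u (ρ*eR (-(2*t))) (κ*(1 - 2*a/t))
        (fun x => φ x + χ (x*eC (φ x))) ω' ∧
      DifferentiableOn ℂ φ (ball 0 ρ) ∧ φ 0 = 0 ∧ (∀ x ∈ ball (0:ℂ) ρ, ‖φ x‖≤2*a) ∧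
      DifferentiableOn ℂ ω' (ball 0 (ρ*eR (-t))) ∧
      (∀ x ∈ ball (0:ℂ) (ρ*eR (-t)), ‖ω' x‖≤8*a + 2*μ ∧
        ω' x + φ (lam*x*eC (ω' x)) = φ x + ω (x*eC (φ x))) ∧
      ω' =O[𝓝 0] (fun x : ℂ => x^M) ∧
      (∀ y, ‖y‖*eR (4*a) < ρ*eR (-t) → ∃ x, ‖x‖≤‖y‖*eR (4*a) ∧
        x*eC (φ x) = y) := by
  have hμ0 : 0 ≤ μ := (norm_nonneg _).trans (hμ 0 (by simpa using hρ))
  obtain ⟨φ, ω', hφ, hφ0, hφa, hω', hb, hO⟩ := normalize hl hM hρ ht (S.dω.mono (ball_subset_ball hρr))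
    hμ hw hE ha hEa hat ht1
  have hs1 : ρ*eR (-t) < ρ := exp_lt_self_mul hρ ht
  have hs2 : ρ*eR (-(2*t)) ≤ ρ*eR (-t) := by gcongr; linarith
  have hφ2 : DifferentiableOn ℂ φ (ball 0 (ρ*eR (-t))) := hφ.mono (ball_subset_ball hs1.le)
  have hφa2 : ∀ x ∈ ball (0:ℂ) (ρ*eR (-t)), ‖φ x‖≤2*a :=
    fun x hx => hφa x (ball_subset_ball hs1.le hx)
  have hd : ∀ x ∈ ball (0:ℂ) (ρ*eR (-t)), ‖x*deriv φ x‖≤2*a/t :=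
    norm_mul_deriv_le ht (by linarith) hφ hφa
  have hd2 : ∀ x ∈ ball (0:ℂ) (ρ*eR (-t)), ‖x*deriv φ x‖≤1/2 := by
    intro x hx
    refine (hd x hx).trans ?_
    rw [div_le_iff₀ ht]; linarith
  refine ⟨φ, ω', ?_, hφ, hφ0, hφa, hω', hb, hO, ?_⟩
  · refine S.trans hκ (hφ2.mono (ball_subset_ball hs2)) (hω'.mono (ball_subset_ball hs2)) hφ0 ?_ ?_ ?_ ?_
    · intro x hx
      have h1 := norm_mul_exp_le (x := x) (hφa2 x (ball_subset_ball hs2 hx))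
      rw [mem_ball_zero_iff] at hx ⊢
      calc _≤_ := h1
        _ < ρ*eR (-(2*t))*eR (2*a) := by gcongr
        _ = ρ*eR (-(2*t) + 2*a) := by rw [mul_assoc, ← Real.exp_add]
        _ ≤ ρ*eR 0 := by gcongr; linarith
        _ ≤ r := by simpa using hρr
    · refine inj_lemma (a := 2*a) (ρ := ρ*eR (-t)) ?_ hs2 hφ2 hφa2 hd2
      rw [mul_assoc, ← Real.exp_add]; gcongr; linarith
    · intro x hx
      have h1 := hd x (ball_subset_ball hs2 hx)
      have h2 := norm_sub_le (1 + x*deriv φ x) (x*deriv φ x)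
      rw [add_sub_cancel_right, norm_one] at h2
      linarith
    · intro x hx _
      exact (hb x (ball_subset_ball hs2 hx)).2
  · intro y hy
    have := inv_lemma (a := 2*a) (by linarith) hφ2 hφa2 hd2 (y := y) (by rwa [show 2*(2*a) = 4*a by ring])
    rwa [show 2*(2*a) = 4*a by ring] at this

/-- arithmetic data at a pair of consecutive denominators -/
structure Level (lam:ℂ) (n n' : ℕ) : Prop where
  pos : 0 < n
  lt : n < n'
  small : ∀ k, ¬ n ∣ k → 2*k ≤ n' → 1≤(n:ℝ)*‖lam^k - 1‖
  res : ∀ i, 1 ≤ i → 2*(i*n) ≤ n' → (i:ℝ)≤(n' : ℝ)*‖lam^(i*n) - 1‖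
  up : ‖lam^n - 1‖≤7/n'

structure St (lam:ℂ) (ηP:ℝ) (n : ℕ) (σ G : ℝ) where
  (u χ ω : ℂ → ℂ)
  (r:ℝ)
  (N : ℕ)
  (xa:ℂ)
  (S : Sys lam u r (1/n) χ ω)
  (r0 : 0 < r)
  (r2 : r≤2)
  (hu : DifferentiableOn ℂ u (ball 0 1.05))
  (hu0 : u 0 = 0)
  (hub : ∀ z ∈ ball (0:ℂ) 1.05, ‖u z‖ ≤ ηP*(1 - 1/n))
  (hω : ∀ x ∈ ball (0:ℂ) r, ‖ω x‖≤(‖x‖/r)^N)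
  (hN : n≤2*N)
  (hxa : ‖xa‖ ≤ r*eR (-σ))
  (arm : 3/2 + 600/Real.log n≤‖xa*eC (χ xa)‖)
  (gain : G ≤ Real.log (2/r))

lemma Level.all {lam : ℂ} {n n' : ℕ} (h : Level lam n n') {k : ℕ} (hk : 1 ≤ k) (hk' : 2*k ≤ n') :
    1≤(n' : ℝ)*‖lam^k - 1‖ := by
  by_cases hd : n ∣ k
  · obtain ⟨i, rfl⟩ := hd
    rw [mul_comm n i] at hk hk' ⊢
    have hi : 1 ≤ i := by
      rcases Nat.eq_zero_or_pos i with rfl | h1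
      · simp at hk
      · exact h1
    have h0 := h.res i hi hk'
    have h1 : (1:ℝ) ≤ i := by exact_mod_cast hi
    linarith
  · have h1 := h.small k hd hk'
    have h2 : (n:ℝ) ≤ n' := by exact_mod_cast h.lt.le
    nlinarith [norm_nonneg (lam^k - 1)]

set_option maxHeartbeats 1000000 in
lemma ng_step {lam : ℂ} (hl : ‖lam‖ = 1) (hlam : ∀ k, 0 < k → lam^k ≠ 1) {ηP : ℝ} (hη : 0 ≤ ηP) {n n' : ℕ} {σ σ' G : ℝ}
    (hL : Level lam n n') (hn : 1000 ≤ Real.log n) (hnn : (n' : ℝ)≤(n:ℝ)^116)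
    (hσ' : 0 < σ') (hσ : σ' + Real.log n^2/n ≤ σ) (T : St lam ηP n σ G) : Nonempty (St lam ηP n' σ' G) := by
  obtain ⟨u, χ, ω, r, N, xa, S, r0, r2, hu, hu0, hub, hω, hN, hxa, arm, gain⟩ := T
  set L := Real.log n with hLdef
  have hn0 : (0:ℝ) < n := by exact_mod_cast hL.pos
  have hnn' : (n:ℝ) + 1 ≤ n' := by exact_mod_cast hL.lt
  set ν : ℝ := (n:ℝ) with hν
  set ν' : ℝ := (n' : ℝ) with hν'
  have hbig : 1000 ≤ ν := by
    have := Real.log_le_sub_one_of_pos hn0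
    linarith
  set μ : ℝ := (ν^400)⁻¹ with hμ
  have hμ0 : 0 < μ := by positivity
  have hH : 1000*ν'^3*ν*μ≤1 := by
    rw [hμ, ← div_eq_mul_inv, div_le_one (by positivity)]
    calc 1000*ν'^3*ν ≤ ν*(ν^116)^3*ν := by gcongr
      _ = ν^350 := by ring
      _ ≤ ν^400 := pow_le_pow_right₀ (by linarith) (by norm_num)
  have hν1 : 1 ≤ ν' := by linarith
  set s := 800*L/ν with hs
  have hs0 : 0 < s := by positivity
  set ρ := r*eR (-s) with hρ
  have hρ0 : 0 < ρ := by positivity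
  have hρr : ρ ≤ r := (exp_lt_self_mul r0 hs0).le
  have hN0 : 0 < N := by have := hL.pos; omega
  have hN1 : ν≤2*N := by rw [hν]; exact_mod_cast hN
  have hωμ : ∀ x ∈ ball (0:ℂ) ρ, ‖ω x‖ ≤ μ := by
    intro x hx
    refine (hω x (ball_subset_ball hρr hx)).trans ?_
    rw [mem_ball_zero_iff] at hx
    calc (‖x‖/r)^N ≤ eR (-s)^N := by
          gcongr; rw [div_le_iff₀ r0]; linarith
      _ = eR (-(N*s)) := by rw [← Real.exp_nat_mul]; congr 1; ring
      _ ≤ eR (-(400*L)) := by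
          rw [Real.exp_le_exp]
          have : N*s = (2*N/ν)*(400*L) := by rw [hs]; field_simp; ring
          have h2 : 1≤2*N/ν := by rw [one_le_div hn0]; exact hN1
          rw [this]
          nlinarith
      _ = μ := by
          rw [Real.exp_neg, hμ, hLdef, show (400:ℝ) = ((400:ℕ):ℝ) by norm_num, Real.exp_nat_mul, Real.exp_log hn0]
  clear_value μ
  have hω0 : ω 0 = 0 := by
    have := hω 0 (by simpa using r0)
    simpa [hN0.ne'] using this
  set M := (n' + 1)/2 with hM
  have hM0 : 0 < M := by have := hL.lt; have := hL.pos; omega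
  have hMν : (M:ℝ) ≤ ν' := by
    have : M ≤ n' := by have := hL.lt; have := hL.pos; omega
    rw [hν']; exact_mod_cast this
  set a := 6*ν'*M*μ with ha
  have ha0 : 0 ≤ a := by positivity
  have haν : a≤6*ν'^2*μ := by
    rw [ha]
    calc 6*ν'*M*μ≤6*ν'*ν'*μ := by gcongr
      _ = _ := by ring
  have hp2 : 1000*ν'^2*ν*μ≤1 := by
    refine le_trans ?_ hH
    gcongr 1000*?_*_*_
    exact pow_le_pow_right₀ hν1 (by norm_num)
  have hp3 : 1000*ν'^3*μ≤1 := by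
    refine le_trans ?_ hH
    rw [mul_right_comm _ ν μ]
    exact le_mul_of_one_le_right (by positivity) (by linarith)
  have hp20 : 1000*ν'^2*μ≤1/ν := by
    rw [le_div_iff₀ hn0]; linarith
  have hμ2 : 1000*μ≤1000*ν'^2*μ := by
    gcongr
    exact le_mul_of_one_le_right (by norm_num) (one_le_pow₀ hν1)
  have h1ν : 1/ν≤1/2 := by
    apply one_div_le_one_div_of_le <;> linarith
  obtain ⟨E, hE, hEa⟩ := lin_simple (D := ν') (a := a) (M := M) hlam hρ0 (S.dω.mono (ball_subset_ball hρr)) hω0 hωμ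
    (by linarith) (by linarith)
    (fun k hk hk' => hL.all hk (by omega)) le_rfl (by
      calc a*M≤(6*ν'^2*μ)*ν' := by gcongr
        _ = 6*ν'^3*μ := by ring
        _≤1 := by linarith)
  obtain ⟨φ, ω', S', hφ, hφ0, hφa, hω', hb, hO, hinv⟩ := lin_step hl (t := 1/ν) S (by positivity) hρ0 hρr hM0
    (by positivity) hωμ (expS_jet hρ0 (S.dω.mono (ball_subset_ball hρr)) M) hE ha0 hEa (by linarith) h1ν
  set r' := ρ*eR (-(2*(1/ν))) with hr'
  have hr'0 : 0 < r' := by positivity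
  have hr'ρ : r' ≤ ρ*eR (-(1/ν)) := by
    rw [hr']; gcongr; have : 0 < 1/ν := by positivity
    linarith
  have hr'r : r' ≤ r := by
    refine hr'ρ.trans (le_trans ?_ hρr)
    exact (exp_lt_self_mul hρ0 (by positivity)).le
  have hLpos : 0 < L := by linarith
  have hloss : s + 2*(1/ν) + 4*a ≤ L^2/ν := by
    have h1 : 4*a≤1/ν := by linarith
    have h2 : s + 2*(1/ν) + 1/ν = (800*L + 3)/ν := by rw [hs]; ring
    have h3 : (800*L + 3)/ν ≤ L^2/ν := by gcongr; nlinarith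
    linarith
  clear_value a s L
  obtain ⟨xb, hxb, hxbe⟩ := hinv xa (by
    calc ‖xa‖*eR (4*a) ≤ r*eR (-σ)*eR (4*a) := by gcongr
      _ = r*eR (-σ + 4*a) := by rw [mul_assoc, ← Real.exp_add]
      _ < r*eR (-s + -(1/ν)) := by
        refine mul_lt_mul_of_pos_left (Real.exp_lt_exp.2 ?_) r0
        have : 0 < 1/ν := by positivity
        linarith
      _ = _ := by rw [hρ, mul_assoc, ← Real.exp_add])
  have hcc : ∀ x, x*eC (φ x + χ (x*eC (φ x))) =
      (x*eC (φ x))*eC (χ (x*eC (φ x))) := by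
    intro x; rw [Complex.exp_add]; ring
  have hlog : L ≤ Real.log ν' := by rw [hLdef]; exact Real.log_le_log hn0 (by linarith)
  refine ⟨⟨u, fun x => φ x + χ (x*eC (φ x)), ω', r', M, xb, ?_, hr'0, hr'r.trans r2, hu, hu0, ?_, ?_, by omega, ?_, ?_, ?_⟩⟩
  · refine ⟨S'.dχ, S'.dω, S'.χ0, S'.inj, S'.bd, fun x hx => le_trans ?_ (S'.κ_le x hx), S'.eq⟩
    have h1 : 2*a/(1/ν)≤1/ν' := by
      rw [div_div_eq_mul_div, div_one, le_div_iff₀ (by linarith)]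
      calc 2*a*ν*ν'≤2*(6*ν'^2*μ)*ν*ν' := by gcongr
        _ = 12*ν'^3*ν*μ := by ring
        _≤1 := by nlinarith [show 0 ≤ ν'^3*ν*μ by positivity]
    have h2 : 1/ν'≤1/ν*(1 - 1/ν') := by
      rw [div_mul_eq_mul_div, one_mul, le_div_iff₀ hn0, div_mul_eq_mul_div, one_mul, div_le_iff₀ (by linarith)]
      rw [sub_mul, div_mul_cancel₀ _ (by linarith)]; linarith
    refine h2.trans ?_
    gcongr
  · intro z hz
    refine (hub z hz).trans ?_
    gcongr
    linarith
  · intro x hx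
    have := vanish (B := 1) hM0 S'.dω (fun x hx => (hb x (ball_subset_ball hr'ρ hx)).1.trans (by linarith)) hO x hx
    simpa using this
  · calc ‖xb‖ ≤ r*eR (-σ)*eR (4*a) := hxb.trans (by gcongr)
      _ = r*eR (-σ + 4*a) := by rw [mul_assoc, ← Real.exp_add]
      _ ≤ r*eR (-s + -(2*(1/ν)) + -σ') := by
        refine mul_le_mul_of_nonneg_left (Real.exp_le_exp.2 ?_) r0.le
        linarith
      _ = _ := by rw [hr', hρ, Real.exp_add, Real.exp_add]; ring
  · rw [hcc, hxbe]
    refine le_trans ?_ arm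
    gcongr
  · refine gain.trans ?_
    gcongr

lemma tc_add {f g : ℂ → ℂ} {R : ℝ} (hR : 0 < R) (hf : DifferentiableOn ℂ f (ball 0 R))
    (hg : DifferentiableOn ℂ g (ball 0 R)) (n : ℕ) : tc n (fun x => f x + g x) = tc n f + tc n g := by
  rw [tc_eq_of_hasJet (f := fun x => f x + g x) hR (hf.add hg) ((hasJet_tc hR hf (n+1)).add (hasJet_tc hR hg (n+1))) (Nat.lt_succ_self n)]
  simp

lemma tc_smul {f : ℂ → ℂ} {R : ℝ} (hR : 0 < R) (hf : DifferentiableOn ℂ f (ball 0 R)) (c:ℂ)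
    (n : ℕ) : tc n (fun x => c*f x) = c*tc n f := by
  rw [tc_eq_of_hasJet hR (hf.const_mul c) ((hasJet_tc hR hf (n+1)).smul c) (Nat.lt_succ_self n)]
  simp

lemma tc_congr {f g : ℂ → ℂ} {R : ℝ} (hR : 0 < R)
    (h : ∀ x ∈ ball (0:ℂ) R, f x = g x) (n : ℕ) : tc n f = tc n g := by
  unfold tc
  congr 1
  apply Filter.EventuallyEq.iteratedDeriv_eq
  filter_upwards [ball_mem_nhds (0:ℂ) hR] with x hx using h x hx

lemma expchi_bound {lam : ℂ} {u χ ω : ℂ → ℂ} {r κ : ℝ} (S : Sys lam u r κ χ ω) (hr : 0 < r) :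
    ∀ x ∈ ball (0:ℂ) r, ‖eC (χ x)‖≤2/r := by
  intro x hx
  rcases eq_or_ne x 0 with rfl | hx0
  · rw [S.χ0]; simp
    rw [le_div_iff₀ hr]
    by_contra! hlt
    have hd : DifferentiableOn ℂ (fun x => x*eC (χ x)) (ball 0 r) := by
      have := S.dχ; fun_prop
    have h2 := norm_deriv_le hr hd (fun z hz => (S.bd z hz).le)
    have h3 : HasDerivAt (fun x => x*eC (χ x)) (1*eC (χ 0) + 0*(eC (χ 0)*deriv χ 0)) 0 :=
      (hasDerivAt_id (0:ℂ)).mul (S.dχ.differentiableAt (isOpen_ball.mem_nhds hx)).hasDerivAt.cexp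
    rw [h3.deriv, S.χ0] at h2
    simp at h2
    rw [le_div_iff₀ hr] at h2
    linarith
  · have hd : DifferentiableOn ℂ (fun x => x*eC (χ x)) (ball 0 r) := by
      have := S.dχ; fun_prop
    have := vanish (N := 1) one_pos hd (fun z hz => (S.bd z hz).le) (by
      have hc : ContinuousAt χ 0 := (S.dχ.differentiableAt (ball_mem_nhds 0 hr)).continuousAt
      have h2 : (fun x => eC (χ x)) =O[𝓝 0] (fun _ => (1:ℂ)) := (hc.cexp).isBigO_one ℂ
      simpa using (isBigO_refl (fun x : ℂ => x) (𝓝 0)).mul h2) x hx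
    rw [norm_mul, pow_one] at this
    have hx1 : 0 < ‖x‖ := norm_pos_iff.2 hx0
    rw [le_div_iff₀ hr]
    rw [mul_div_assoc', le_div_iff₀ hr] at this
    nlinarith

lemma chi_bound {lam : ℂ} {u χ ω : ℂ → ℂ} {r κ V : ℝ} (S : Sys lam u r κ χ ω) (hr : 0 < r) (hV : 10 ≤ V)
    (hrV : 1/V ≤ r) : ∀ x ∈ ball (0:ℂ) (r*eR (-(1/V))), ‖χ x‖≤8*V^2 := by
  have h1 := expchi_bound S hr
  have hV0 : 0 < V := by linarith
  have hlog : Real.log (2/r)≤2*V := by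
    have h2 : 2/r≤2*V := by
      rw [div_le_iff₀ hr]; rw [div_le_iff₀ hV0] at hrV; nlinarith
    have := Real.log_le_sub_one_of_pos (show 0 < 2/r by positivity)
    linarith
  intro x hx
  have hre : MapsTo χ (ball 0 r) {z | z.re≤2*V} := by
    intro z hz
    have := h1 z hz
    rw [Complex.norm_exp] at this
    have := Real.log_le_log (Real.exp_pos _) this
    rw [Real.log_exp] at this
    exact this.trans hlog
  have hxr : ‖x‖ < r*eR (-(1/V)) := by simpa using hx
  have hexp : eR (-(1/V))*(1 + 1/V)≤1 := by
    have := Real.add_one_le_exp (1/V)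
    have h3 : eR (-(1/V))*eR (1/V) = 1 := by rw [← Real.exp_add]; simp
    nlinarith [Real.exp_pos (-(1/V))]
  have hxV : ‖x‖*(1 + 1/V) < r := by
    have : 0 < 1/V := by positivity
    nlinarith
  have hxr' : ‖x‖ < r := by
    have : 0 < 1/V := by positivity
    nlinarith [norm_nonneg x]
  refine (Complex.borelCaratheodory_zero (by linarith : 0 < 2*V) S.dχ hre hr (by simpa using hxr') S.χ0).trans ?_
  rw [div_le_iff₀ (by linarith)]
  have : ‖x‖ ≤ V*(r - ‖x‖) := by
    have h4 : V*(‖x‖*(1 + 1/V)) = V*‖x‖ + ‖x‖ := by field_simp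
    nlinarith
  nlinarith

/-- quantitative separation of values of an injective map -/
lemma sep {f : ℂ → ℂ} {U : Set ℂ} {p : ℂ} {s B κ b : ℝ} (hs : 0 < s) (hsU : ball p s ⊆ U)
    (hf : DifferentiableOn ℂ f U) (hinj : InjOn f U) (hB : ∀ z ∈ U, ‖f z‖ ≤ B) (hκ : 0 < κ)
    (hd : κ≤‖deriv f p‖) (hb : 0 < b) (hbs : b < s/4) (hbB : 16*B*b ≤ κ*s^2) :
    (∀ x, ‖x - p‖ ≤ b → κ/2*‖x - p‖≤‖f x - f p‖) ∧
    (∀ x ∈ U, b < ‖x - p‖ → κ*b/4≤‖f x - f p‖) := by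
  have h1 : ∀ x, ‖x - p‖ ≤ b → κ/2*‖x - p‖≤‖f x - f p‖ := by
    intro x hx
    have hm : ∀ w ∈ ball (0:ℂ) s, p + w ∈ ball p s := by
      intro w hw; simpa using hw
    have hp : DifferentiableAt ℂ f (p + 0) := by
      simpa using (hf.mono hsU).differentiableAt (ball_mem_nhds p hs)
    have := quad_lip (k := fun w => f (p + w)) (w := x - p) (w' := 0) hs
      ((hf.mono hsU).comp (by fun_prop) hm) (fun z hz => hB _ (hsU (hm z hz))) hbs hx (by simpa using hb.le)
    have hdd : deriv (fun w => f (p + w)) 0 = deriv f p := by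
      rw [deriv_comp_const_add, add_zero]
    simp only [add_sub_cancel, add_zero, sub_zero, hdd] at this
    have h2 : 8*B/s^2*b ≤ κ/2 := by
      rw [div_mul_eq_mul_div, div_le_iff₀ (by positivity)]; linarith
    have h3 : ‖deriv f p*(x - p)‖≤‖f x - f p‖ + ‖f x - f p - deriv f p*(x - p)‖ := by
      have h4 : deriv f p*(x - p) = (f x - f p) - (f x - f p - deriv f p*(x - p)) := by ring
      calc _ = ‖(f x - f p) - (f x - f p - deriv f p*(x - p))‖ := by rw [← h4]
        _≤_ := norm_sub_le _ _
    rw [norm_mul] at h3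
    have h5 : 8*B/s^2*b*‖x - p‖ ≤ κ/2*‖x - p‖ := by gcongr
    have h6 : κ*‖x - p‖≤‖deriv f p‖*‖x - p‖ := by gcongr
    linarith
  refine ⟨h1, fun x hx hxb => ?_⟩
  by_contra! hlt
  have hcb : closedBall p b ⊆ U := (closedBall_subset_ball (by linarith)).trans hsU
  have hdc : DiffContOnCl ℂ f (ball p b) := by
    refine ⟨hf.mono (ball_subset_closedBall.trans hcb), ?_⟩
    rw [closure_ball p hb.ne']
    exact hf.continuousOn.mono hcb
  have hsph : ∀ z ∈ sphere p b, κ*b/2≤‖f z - f p‖ := by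
    intro z hz
    rw [mem_sphere, dist_eq_norm] at hz
    have := h1 z hz.le
    rw [hz] at this; linarith
  have hfr : ∃ᶠ z in 𝓝 p, f z ≠ f p := by
    have : ∀ᶠ z in 𝓝[≠] p, f z ≠ f p := by
      filter_upwards [self_mem_nhdsWithin, mem_nhdsWithin_of_mem_nhds (ball_mem_nhds p hs)] with z hz hzb h
      exact hz (hinj (hsU hzb) (hsU (mem_ball_self hs)) h)
    exact this.frequently.filter_mono nhdsWithin_le_nhds
  have := hdc.ball_subset_image_closedBall hb hsph hfr (show f x ∈ ball (f p) (κ*b/2/2) by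
    rw [mem_ball, dist_eq_norm]; linarith)
  obtain ⟨z, hz, hzx⟩ := this
  have := hinj (hcb hz) hx hzx
  rw [this, mem_closedBall, dist_eq_norm] at hz
  linarith

lemma dslope_lower {f : ℂ → ℂ} {U : Set ℂ} {p : ℂ} {s B κ b : ℝ} (hs : 0 < s) (hsU : ball p s ⊆ U)
    (hf : DifferentiableOn ℂ f U) (hinj : InjOn f U) (hB : ∀ z ∈ U, ‖f z‖ ≤ B) (hκ : 0 < κ)
    (hd : κ≤‖deriv f p‖) (hb : 0 < b) (hbs : b < s/4) (hbB : 16*B*b ≤ κ*s^2)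
    (hU : ∀ x ∈ U, ‖x - p‖≤4) (hb1 : b≤1) :
    ∀ x ∈ U, κ*b/16≤‖dslope f p x‖ := by
  obtain ⟨h1, h2⟩ := sep hs hsU hf hinj hB hκ hd hb hbs hbB
  intro x hx
  have hkb : κ*b/16 ≤ κ/2 := by nlinarith
  rcases eq_or_ne x p with rfl | hne
  · rw [dslope_same]; linarith
  · rw [dslope_of_ne _ hne, slope_def_field, norm_div]
    have h0 : 0 < ‖x - p‖ := norm_pos_iff.2 (sub_ne_zero.2 hne)
    rw [le_div_iff₀ h0]
    by_cases hxb : ‖x - p‖ ≤ b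
    · have := h1 x hxb
      nlinarith
    · push Not at hxb
      have := h2 x hx hxb
      have := hU x hx
      nlinarith [mul_pos hκ hb]

/-- perturbing `u` by `g`, keeping the chart -/
lemma pert {lam : ℂ} {u g χ ω : ℂ → ℂ} {r κ : ℝ} (S : Sys lam u r κ χ ω) (hκ : 0 < κ)
    {r₁ R2 B s γ : ℝ} (hr1 : 0 < r₁) (hr₁ : r₁ ≤ r) (hR2 : R2 ≤ r) (hs : 0 < s)
    (hB : ∀ z ∈ ball (0:ℂ) R2, ‖χ z‖ ≤ B) (hy : ∀ x ∈ ball (0:ℂ) r₁, ‖lam*x*eC (ω x)‖*eR s ≤ R2)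
    (hg : DifferentiableOn ℂ (fun x => g (x*eC (χ x))) (ball 0 r₁))
    (hγ : ∀ x ∈ ball (0:ℂ) r₁, ‖g (x*eC (χ x))‖ ≤ γ) (hγ0 : 0 ≤ γ) (hg0 : g 0 = 0) (hω0 : ω 0 = 0)
    (hbs : 2*γ/κ < s/4) (hct : 8*B/s^2*(2*γ/κ)/κ≤1/2) (hR20 : 0 < R2) :
    ∃ ω₁, Sys lam (fun z => u z + g z) r₁ κ χ ω₁ ∧ ω₁ 0 = 0 ∧ ∀ x ∈ ball (0:ℂ) r₁, ‖ω₁ x - ω x‖≤2*γ/κ ∧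
      ‖ω₁ x - ω x - g (x*eC (χ x))/(1 + (lam*x*eC (ω x))*deriv χ (lam*x*eC (ω x)))‖
       ≤8*B/s^2*(2*γ/κ)/κ*(2*γ/κ) := by
  set b := 2*γ/κ with hb
  have hb0 : 0 ≤ b := by positivity
  set y : ℂ → ℂ := fun x => lam*x*eC (ω x) with hydef
  have hωd := S.dω.mono (ball_subset_ball hr₁)
  have hyd : DifferentiableOn ℂ y (ball 0 r₁) := by
    rw [hydef]; fun_prop
  have hyR : ∀ x ∈ ball (0:ℂ) r₁, ∀ w : ℂ, ‖w‖ < s → y x*eC w ∈ ball (0:ℂ) R2 := by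
    intro x hx w hw
    rw [mem_ball_zero_iff, norm_mul]
    have h1 := hy x hx
    rcases eq_or_ne (y x) 0 with h0 | h0
    · rw [h0]; simpa using hR20
    · have h2 : 0 < ‖y x‖ := norm_pos_iff.2 h0
      have h3 : ‖eC w‖ < eR s := by
        rw [Complex.norm_exp, Real.exp_lt_exp]
        exact (Complex.re_le_norm w).trans_lt hw
      calc _ < ‖y x‖*eR s := by gcongr
        _≤_ := h1
  have hyr : ∀ x ∈ ball (0:ℂ) r₁, y x ∈ ball (0:ℂ) r := by
    intro x hx
    have := hyR x hx 0 (by simpa using hs)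
    simp only [Complex.exp_zero, mul_one] at this
    exact ball_subset_ball hR2 this
  have hSy : ∀ x ∈ ball (0:ℂ) r₁, κ≤‖1 + y x*deriv χ (y x)‖ := fun x hx => S.κ_le _ (hyr x hx)
  have hS0 : ∀ x ∈ ball (0:ℂ) r₁, 1 + y x*deriv χ (y x) ≠ 0 := by
    intro x hx h
    have := hSy x hx
    rw [h, norm_zero] at this; linarith
  set Φ : ℂ → ℂ → ℂ := fun x w => (g (x*eC (χ x)) -
    (χ (y x*eC w) - χ (y x) - y x*deriv χ (y x)*w))/(1 + y x*deriv χ (y x)) with hΦ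
  have hΦ0 : ∀ x, Φ x 0 = g (x*eC (χ x))/(1 + y x*deriv χ (y x)) := by
    intro x; simp [hΦ]
  have hdχ' : DifferentiableOn ℂ (deriv χ) (ball 0 r) := S.dχ.deriv isOpen_ball
  have hlip : ∀ x ∈ ball (0:ℂ) r₁, ∀ w w' : ℂ, ‖w‖ ≤ b → ‖w'‖ ≤ b →
      ‖Φ x w - Φ x w'‖≤8*B/s^2*b/κ*‖w - w'‖ := by
    intro x hx w w' hw hw'
    have hk : DifferentiableOn ℂ (fun w => χ (y x*eC w)) (ball 0 s) := by
      refine (S.dχ.mono (ball_subset_ball hR2)).comp (by fun_prop) ?_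
      intro w hw
      exact hyR x hx w (by simpa using hw)
    have h1 := quad_lip (k := fun w => χ (y x*eC w)) hs hk
      (fun z hz => hB _ (hyR x hx z (by simpa using hz))) hbs hw hw'
    have hd : deriv (fun w => χ (y x*eC w)) 0 = y x*deriv χ (y x) := by
      have h2 : HasDerivAt χ (deriv χ (y x)) (y x*eC 0) := by
        rw [Complex.exp_zero, mul_one]
        exact (S.dχ.differentiableAt (isOpen_ball.mem_nhds (hyr x hx))).hasDerivAt
      have h3 : HasDerivAt (fun w => y x*eC w) (y x*(eC 0*1)) 0 :=
        ((hasDerivAt_id (0:ℂ)).cexp).const_mul _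
      have := (h2.comp 0 h3).deriv
      simp only [Function.comp_def] at this
      rw [this]; simp; ring
    rw [hd] at h1
    have h4 : Φ x w - Φ x w' = -((χ (y x*eC w) - χ (y x*eC w') -
        y x*deriv χ (y x)*(w - w')))/(1 + y x*deriv χ (y x)) := by
      simp only [hΦ]; rw [← sub_div]; congr 1; ring
    rw [h4, norm_div, norm_neg, div_le_iff₀ (norm_pos_iff.2 (hS0 x hx))]
    refine h1.trans ?_
    have h5 := hSy x hx
    have h6 : 0≤8*B/s^2*b*‖w - w'‖ := (norm_nonneg _).trans h1
    calc _ = 8*B/s^2*b*‖w - w'‖/κ*κ := by field_simp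
      _≤8*B/s^2*b*‖w - w'‖/κ*‖1 + y x*deriv χ (y x)‖ := by gcongr
      _ = _ := by ring
  have hc0 : ∀ x ∈ ball (0:ℂ) r₁, ‖Φ x 0‖ ≤ b/2 := by
    intro x hx
    rw [hΦ0, norm_div, div_le_iff₀ (norm_pos_iff.2 (hS0 x hx))]
    refine (hγ x hx).trans ?_
    calc γ = b/2*κ := by rw [hb]; field_simp
      _≤_ := by gcongr; exact hSy x hx
  obtain ⟨w, hw, hwb⟩ := holfix isOpen_ball Φ hb0 (U := ball 0 r₁) (by
    intro w hw hwb
    simp only [hΦ]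
    have m1 : MapsTo y (ball 0 r₁) (ball 0 r) := hyr
    have d1 := S.dχ.comp hyd m1
    have d2 := hdχ'.comp hyd m1
    have d3 : DifferentiableOn ℂ (fun x => χ (y x*eC (w x))) (ball 0 r₁) := by
      refine S.dχ.comp (hyd.mul hw.cexp) ?_
      intro x hx
      exact ball_subset_ball hR2 (hyR x hx _ (by have := hwb x hx; linarith))
    simp only [Function.comp_def] at d1 d2
    exact (hg.sub ((d3.sub d1).sub ((hyd.mul d2).mul hw))).div ((differentiableOn_const 1).add (hyd.mul d2)) hS0) hc0
    (fun x hx w w' h1 h2 => (hlip x hx w w' h1 h2).trans (by gcongr))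
  have heqw : ∀ x ∈ ball (0:ℂ) r₁, g (x*eC (χ x)) = w x + (χ (y x*eC (w x)) - χ (y x)) := by
    intro x hx
    have h1 := (hwb x hx).2.1
    simp only [hΦ] at h1
    rw [div_eq_iff (hS0 x hx)] at h1
    linear_combination h1
  refine ⟨fun x => ω x + w x, ⟨S.dχ.mono (ball_subset_ball hr₁), hωd.add hw, S.χ0, S.inj.mono (ball_subset_ball hr₁),
    fun x hx => S.bd x (ball_subset_ball hr₁ hx), fun x hx => S.κ_le x (ball_subset_ball hr₁ hx), ?_⟩, ?_, ?_⟩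
  · intro x hx _
    have e1 := S.eq x (ball_subset_ball hr₁ hx) (hyr x hx)
    have e2 := heqw x hx
    have e3 : lam*x*eC (ω x + w x) = y x*eC (w x) := by
      rw [Complex.exp_add]; simp only [hydef]; ring
    simp only [e3]
    rw [e2]
    change χ x + u _ = ω x + χ (y x) at e1
    linear_combination e1
  · have := (hwb 0 (mem_ball_self hr1)).2.2
    rw [hΦ0] at this
    simp [hg0] at this
    simp [hω0, this]
  · intro x hx
    obtain ⟨h1, h2, h3⟩ := hwb x hx
    simp only [add_sub_cancel_left]
    refine ⟨h1, ?_⟩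
    change ‖w x - g (x*eC (χ x))/(1 + y x*deriv χ (y x))‖≤_
    rw [← hΦ0, ← h2]
    have := hlip x hx (w x) 0 h1 (by simpa using hb0)
    rw [h2] at this ⊢
    refine this.trans ?_
    rw [sub_zero]
    have hnn : 0≤8*B/s^2*b/κ := by
      have : 0 ≤ B := (norm_nonneg _).trans (hB 0 (by simpa using hR20))
      positivity
    gcongr

lemma tc_pole {p : ℂ} (hp : p ≠ 0) (n : ℕ) : tc n (fun x => 1/(p - x)) = 1/p^(n + 1) := by
  have hp0 : 0 < ‖p‖ := norm_pos_iff.2 hp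
  have hne : ∀ x ∈ ball (0:ℂ) ‖p‖, p - x ≠ 0 := by
    intro x hx h
    rw [mem_ball_zero_iff] at hx
    rw [sub_eq_zero] at h; rw [h] at hx; exact lt_irrefl _ hx
  have hd : DifferentiableOn ℂ (fun x => 1/(p - x)) (ball 0 ‖p‖) :=
    (differentiableOn_const 1).div (by fun_prop) hne
  rw [tc_eq_of_hasJet (A := PowerSeries.mk fun k => 1/p^(k+1)) hp0 hd (M := n + 1) ?_ (Nat.lt_succ_self n)]
  · simp
  unfold HasJet
  have : ∀ᶠ x in 𝓝 (0:ℂ), 1/p^(n+1)*(1/(p - x))*x^(n+1) = 1/(p - x) - (trunc (n+1) (PowerSeries.mk fun k => 1/p^(k+1))).eval x := by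
    filter_upwards [ball_mem_nhds (0:ℂ) hp0] with x hx
    rw [eval_trunc]
    simp only [coeff_mk]
    have h1 := hne x hx
    have h2 : ∑ k ∈ Finset.range (n+1), 1/p^(k+1)*x^k = (1/p)*∑ k ∈ Finset.range (n+1), (x/p)^k := by
      rw [Finset.mul_sum]; refine Finset.sum_congr rfl fun k _ => ?_
      rw [div_pow, pow_succ]; field_simp
    have h3 : x/p ≠ 1 := by
      intro h; rw [div_eq_one_iff_eq hp] at h; exact h1 (by rw [h, sub_self])
    rw [h2, geom_sum_eq h3]
    have h4 : x/p - 1 = -(p - x)/p := by field_simp; ring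
    rw [h4, div_pow]
    have : p^(n+1) ≠ 0 := pow_ne_zero _ hp
    field_simp
    ring
  refine (IsBigO.congr' ?_ this EventuallyEq.rfl)
  have hc : ContinuousAt (fun x : ℂ => 1/p^(n+1)*(1/(p - x))) 0 := by
    apply ContinuousAt.mul continuousAt_const
    apply ContinuousAt.div continuousAt_const (by fun_prop)
    simpa using hp
  simpa using (hc.isBigO_one ℂ).mul (isBigO_refl (fun x : ℂ => x^(n+1)) (𝓝 0))

lemma pole_coeff {m h : ℂ → ℂ} {p : ℂ} {R R1 Mm H : ℝ} (hp : p ≠ 0) (hpR : ‖p‖ < R1) (hR : R1 < R)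
    (hm : DifferentiableOn ℂ m (ball 0 R)) (hmM : ∀ x ∈ ball (0:ℂ) R, ‖m x‖ ≤ Mm)
    (hh : DifferentiableOn ℂ h (ball 0 R1)) (hH : ∀ x ∈ ball (0:ℂ) R1, ‖h x‖ ≤ H) (n : ℕ) :
    ‖m p‖/‖p‖^(n+1) - (Mm/(R - R1) + H)/R1^n≤‖tc n (fun x => m x*(1/(p - x)) + h x)‖ := by
  have hp0 : 0 < ‖p‖ := norm_pos_iff.2 hp
  have hR1 : 0 < R1 := by linarith
  have hne : ∀ x ∈ ball (0:ℂ) ‖p‖, p - x ≠ 0 := by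
    intro x hx h
    rw [mem_ball_zero_iff] at hx
    rw [sub_eq_zero] at h; rw [h] at hx; exact lt_irrefl _ hx
  have hd : DifferentiableOn ℂ (fun x => 1/(p - x)) (ball 0 ‖p‖) :=
    (differentiableOn_const 1).div (by fun_prop) hne
  have hpm : p ∈ ball (0:ℂ) R := by rw [mem_ball_zero_iff]; linarith
  have hds : DifferentiableOn ℂ (dslope m p) (ball 0 R) :=
    (Complex.differentiableOn_dslope (isOpen_ball.mem_nhds hpm)).2 hm
  have hsub := ball_subset_ball (x := (0:ℂ)) hR.le
  have hder : ∀ x ∈ ball (0:ℂ) R1, ‖deriv m x‖ ≤ Mm/(R - R1) := by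
    intro x hx
    refine (norm_deriv_le' (hsub hx) hm hmM).trans ?_
    have hM0 : 0 ≤ Mm := (norm_nonneg _).trans (hmM x (hsub hx))
    rw [mem_ball_zero_iff] at hx
    rw [sub_zero]
    gcongr
  have hdsb : ∀ x ∈ ball (0:ℂ) R1, ‖dslope m p x‖ ≤ Mm/(R - R1) := by
    intro x hx
    rcases eq_or_ne x p with rfl | hxp
    · rw [dslope_same]; exact hder _ hx
    · rw [dslope_of_ne _ hxp, slope_def_field, norm_div, div_le_iff₀ (norm_pos_iff.2 (sub_ne_zero.2 hxp))]
      exact lip_of_deriv isOpen_ball (convex_ball 0 R1) (hm.mono hsub) hder hx (by simpa using hpR)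
  have hkey : tc n (fun x => m x*(1/(p - x)) + h x) = m p*(1/p^(n+1)) + tc n (fun x => - dslope m p x + h x) := by
    have hs2 := ball_subset_ball (x := (0:ℂ)) hpR.le
    rw [← tc_pole hp, ← tc_smul hp0 hd, ← tc_add (g := fun x => - dslope m p x + h x) hp0 (hd.const_mul _) (((hds.mono hsub).neg.add hh).mono hs2)]
    apply tc_congr hp0
    intro x hx
    have hxp : x ≠ p := by rintro rfl; simp at hx
    rw [dslope_of_ne _ hxp, slope_def_field]
    have h1 := hne x hx
    have h2 : x - p ≠ 0 := sub_ne_zero.2 hxp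
    have h3 : x - p = -(p - x) := by ring
    rw [h3] at h2 ⊢
    field_simp
    ring
  rw [hkey]
  have h1 := norm_tc_le hR1 ((hds.mono hsub).neg.add hh) (B := Mm/(R - R1) + H) (fun x hx => by
    refine (norm_add_le _ _).trans ?_
    have := hdsb x hx
    have := hH x hx
    simp only [Pi.neg_apply, norm_neg]
    linarith) n
  have h2 : ‖m p*(1/p^(n+1))‖ = ‖m p‖/‖p‖^(n+1) := by
    rw [norm_mul, norm_div, norm_pow, norm_one]; ring
  rw [← h2]
  have h3 := norm_sub_norm_le (m p*(1/p^(n+1))) (-tc n (fun x => - dslope m p x + h x))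
  rw [sub_neg_eq_add, norm_neg] at h3
  have h4 : ‖tc n (fun x => - dslope m p x + h x)‖≤(Mm/(R - R1) + H)/R1^n := h1
  linarith

lemma deriv_Xi {χ : ℂ → ℂ} {x : ℂ} (h : DifferentiableAt ℂ χ x) :
    deriv (fun x => x*eC (χ x)) x = eC (χ x)*(1 + x*deriv χ x) := by
  have h3 : HasDerivAt (fun x => x*eC (χ x)) (1*eC (χ x) + x*(eC (χ x)*deriv χ x)) x :=
    (hasDerivAt_id x).mul h.hasDerivAt.cexp
  rw [h3.deriv]; ring

set_option maxHeartbeats 1600000 in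
/-- lower bound for the `n`-th coefficient of the pole perturbation -/
lemma pole_pert {lam : ℂ} (hl : ‖lam‖ = 1) {u χ ω : ℂ → ℂ} {r V δ ε : ℝ} {xa : ℂ} (S : Sys lam u r (1/V) χ ω)
    (hV : 10000 ≤ V) (hr0 : 0 < r) (hrV : 1/V ≤ r) (hr2 : r≤2) (hω0 : ω 0 = 0)
    (hδ : 6/V ≤ δ) (hδ1 : δ≤1/2)
    (hxa : ‖xa‖*eR (8*δ) ≤ r) (hε0 : 0 ≤ ε) (hε : ε≤1/V)
    (hωε : ∀ x ∈ ball (0:ℂ) (‖xa‖*eR (5*δ)), ‖ω x‖ ≤ ε)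
    (harm : 3/2≤‖xa*eC (χ xa)‖) {τ : ℝ} (hτ : 0 < τ) (hτV : 1024*τ*V^14≤1) :
    ∃ g ω₁ : ℂ → ℂ, DifferentiableOn ℂ g (ball 0 1.05) ∧ g 0 = 0 ∧ (∀ z ∈ ball (0:ℂ) 1.05, ‖g z‖≤3*τ) ∧
      Sys lam (fun z => u z + g z) (‖xa‖*eR (-δ)) (1/V) χ ω₁ ∧ ω₁ 0 = 0 ∧
      (∀ x ∈ ball (0:ℂ) (‖xa‖*eR (-δ)), ‖ω₁ x‖ ≤ ε + 4*τ*V^9) ∧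
      ∀ n : ℕ, τ*((V^8)⁻¹/‖xa‖^n - 2*V^11/(‖xa‖*eR (4*δ))^n)
        - ε/‖xa‖^n - τ^2*V^24/(‖xa‖*eR (-δ))^n≤‖tc n ω₁‖ := by
  have hV0 : 0 < V := by linarith
  set Ξ : ℂ → ℂ := fun x => x*eC (χ x) with hΞ
  set w := Ξ xa with hw
  have hδ0 : 0 < δ := lt_of_lt_of_le (by positivity) hδ
  have hw32 : 3/2≤‖w‖ := harm
  have hw0 : w ≠ 0 := by intro h; rw [h, norm_zero] at hw32; norm_num at hw32
  have hxa0 : xa ≠ 0 := by rintro rfl; simp [hw, hΞ] at hw0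
  set Ra := ‖xa‖ with hRa
  have hRa0 : 0 < Ra := norm_pos_iff.2 hxa0
  have hxr : Ra < r := lt_of_lt_of_le (by nlinarith [Real.add_one_le_exp (8*δ)]) hxa
  have hxm : xa ∈ ball (0:ℂ) r := by rw [mem_ball_zero_iff]; exact hxr
  have hexpχ := expchi_bound S hr0
  have hRar : 3/4*r ≤ Ra := by
    have h1 := hexpχ xa hxm
    rw [hw, hΞ] at hw32
    simp only [norm_mul] at hw32
    have h2 : Ra*‖eC (χ xa)‖ ≤ Ra*(2/r) := by gcongr
    have h3 : 3/2 ≤ Ra*(2/r) := by linarith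
    rw [mul_div_assoc', le_div_iff₀ hr0] at h3
    linarith
  have hexp : ∀ z ∈ ball (0:ℂ) (r*eR (-(1/V))), ‖χ z‖≤8*V^2 := chi_bound S hr0 (by linarith) hrV
  have hxder : ∀ x ∈ ball (0:ℂ) (r*eR (-(2/V))), ‖x*deriv χ x‖≤8*V^3 := by
    intro x hx
    have := norm_mul_deriv_le (t := 1/V) (by positivity) (by positivity)
      (S.dχ.mono (ball_subset_ball (exp_lt_self_mul hr0 (by positivity)).le)) hexp x (by
        rw [mul_assoc, ← Real.exp_add]; convert hx using 3; ring)
    refine this.trans (le_of_eq ?_)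
    field_simp
  have hVinv : 1/V ≤ δ/6 := by
    have : 6/V = 6*(1/V) := by ring
    linarith
  have hSup : ∀ x ∈ ball (0:ℂ) (r*eR (-(2/V))), ‖1 + x*deriv χ x‖≤9*V^3 := by
    intro x hx
    refine (norm_add_le _ _).trans ?_
    have := hxder x hx
    rw [norm_one]
    have : 1 ≤ V^3 := one_le_pow₀ (by linarith)
    linarith
  have hdΞ : DifferentiableOn ℂ Ξ (ball 0 r) := by have := S.dχ; rw [hΞ]; fun_prop
  have hΞder : ∀ x ∈ ball (0:ℂ) r, deriv Ξ x = eC (χ x)*(1 + x*deriv χ x) := fun x hx =>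
    deriv_Xi (S.dχ.differentiableAt (isOpen_ball.mem_nhds hx))
  -- exponentials
  have hE : ∀ c : ℝ, c≤8*δ → Ra*eR c ≤ r := fun c hc => le_trans (by gcongr) hxa
  have hE2 : ∀ c d : ℝ, c + d≤8*δ → Ra*eR c ≤ r*eR (-d) := by
    intro c d h
    have h1 := hE (c + d) h
    rw [Real.exp_add] at h1
    rw [Real.exp_neg, ← div_eq_mul_inv, le_div_iff₀ (Real.exp_pos _)]; linarith
  -- derivative at xa
  have hκd : 3/4/V≤‖deriv Ξ xa‖ := by
    rw [hΞder xa hxm, norm_mul]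
    have h1 := S.κ_le xa hxm
    have h2 : 3/4≤‖eC (χ xa)‖ := by
      rw [hw, hΞ] at hw32
      simp only [norm_mul] at hw32
      have : Ra*‖eC (χ xa)‖≤2*‖eC (χ xa)‖ := by gcongr; linarith
      linarith
    calc 3/4/V = 3/4*(1/V) := by ring
      _≤_ := by gcongr
  have hgap : ∀ c : ℝ, 0 < c → c≤1 → 4/V ≤ c → (V^2)⁻¹ ≤ Ra*(1 - eR (-c)) := by
    intro c hc hc1 hcV
    have h1 : c/2≤1 - eR (-c) := by
      have h2 := Real.exp_bound' (n := 2) hc.le hc1 (by norm_num)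
      have h2 : 1 + c ≤ eR c := by linarith [Real.add_one_le_exp c]
      rw [Real.exp_neg]
      have : (eR c)⁻¹≤(1 + c)⁻¹ := inv_anti₀ (by linarith) h2
      have h3 : (1 + c)⁻¹≤1 - c/2 := by
        rw [inv_eq_one_div, div_le_iff₀ (by linarith)]; nlinarith
      linarith
    have h3 : 3/4/V ≤ Ra := by
      refine le_trans ?_ hRar
      calc 3/4/V = 3/4*(1/V) := by ring
        _≤_ := by gcongr
    calc (V^2)⁻¹≤3/4/V*((4/V)/2) := by
          rw [show 3/4/V*((4/V)/2) = (3/2)*(V^2)⁻¹ by field_simp]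
          have : 0≤(V^2)⁻¹ := by positivity
          linarith
      _ ≤ Ra*(c/2) := by gcongr
      _≤_ := by gcongr
  have h4V : 4/V ≤ δ := by
    refine le_trans ?_ hδ; gcongr; norm_num
  have hs2 : ball xa ((V^2)⁻¹) ⊆ ball (0:ℂ) r := by
    intro z hz
    rw [mem_ball, dist_eq_norm] at hz
    rw [mem_ball_zero_iff]
    have h1 : ‖z‖≤‖z - xa‖ + ‖xa‖ := by simpa using norm_add_le (z - xa) xa
    have h2 := hgap δ hδ0 (by linarith) h4V
    have h3 := hE δ (by linarith)
    have h4 : Ra*(1 - eR (-δ)) ≤ Ra*(eR δ - 1) := by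
      refine mul_le_mul_of_nonneg_left ?_ hRa0.le
      linarith [Real.add_one_le_exp δ, Real.add_one_le_exp (-δ)]
    linarith
  have hV2 : 0 < (V^2)⁻¹ := by positivity
  have hb6 : (V^6)⁻¹ < (V^2)⁻¹/4 := by
    rw [lt_div_iff₀ (by norm_num), inv_mul_eq_div, inv_eq_one_div, div_lt_div_iff₀ (by positivity) (by positivity)]
    have : V^6 = V^2*V^4 := by ring
    have h2 : V ≤ V^4 := le_self_pow₀ (by linarith) (by norm_num)
    nlinarith [show 0 < V^2 by positivity]
  have hbB : 16*2*(V^6)⁻¹≤3/4/V*((V^2)⁻¹)^2 := by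
    rw [show 3/4/V*((V^2)⁻¹)^2 = 3/4*V*(V^6)⁻¹ by field_simp]
    exact mul_le_mul_of_nonneg_right (by linarith) (by positivity)
  have hκ34 : 0 < 3/4/V := by positivity
  obtain ⟨-, hsep⟩ := sep hV2 hs2 hdΞ S.inj (fun z hz => (S.bd z hz).le) hκ34 hκd (by positivity) hb6 hbB
  have hDl := dslope_lower hV2 hs2 hdΞ S.inj (fun z hz => (S.bd z hz).le) hκ34 hκd (by positivity) hb6 hbB
    (fun x hx => by
      rw [mem_ball_zero_iff] at hx
      have := norm_sub_le x xa
      linarith) (inv_le_one_of_one_le₀ (one_le_pow₀ (by linarith)))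
  have hc8 : (V^8)⁻¹≤3/4/V*(V^6)⁻¹/16 := by
    rw [show 3/4/V*(V^6)⁻¹/16 = 3/64*V*(V^8)⁻¹ by field_simp; norm_num]
    have : 0≤(V^8)⁻¹ := by positivity
    nlinarith
  have hDl' : ∀ x ∈ ball (0:ℂ) r, (V^8)⁻¹≤‖dslope Ξ xa x‖ := fun x hx => hc8.trans (hDl x hx)
  set r₁ := Ra*eR (-δ) with hr₁
  have hr₁0 : 0 < r₁ := by positivity
  have hr₁a : r₁ < Ra := exp_lt_self_mul hRa0 hδ0
  have hr₁r : r₁ ≤ r := by linarith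
  have hsepx : ∀ x ∈ ball (0:ℂ) r₁, (V^8)⁻¹≤‖w - Ξ x‖ := by
    intro x hx
    have hx' := hx
    rw [mem_ball_zero_iff] at hx
    have h1 := hgap δ hδ0 (by linarith) h4V
    have h2 : Ra≤‖x - xa‖ + ‖x‖ := by
      have := norm_sub_le (x) (x - xa)
      rw [sub_sub_cancel] at this; linarith
    have h3 : (V^6)⁻¹ < ‖x - xa‖ := by
      have : Ra*(1 - eR (-δ)) = Ra - r₁ := by rw [hr₁]; ring
      linarith
    have := hsep x (ball_subset_ball hr₁r hx') h3
    rw [norm_sub_rev]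
    have h5 : 0 < 3/4/V*(V^6)⁻¹ := by positivity
    linarith
  set g : ℂ → ℂ := fun z => (τ:ℂ)*(1/(w - z) - 1/w) with hg
  have h1w : ‖1/w‖≤2/3 := by
    rw [norm_div, norm_one, div_le_iff₀ (by linarith)]; linarith
  have hτn : ‖(τ:ℂ)‖ = τ := by rw [Complex.norm_real, Real.norm_eq_abs, abs_of_pos hτ]
  have hwΞ0 : ∀ x ∈ ball (0:ℂ) r₁, w - Ξ x ≠ 0 := by
    intro x hx h
    have := hsepx x hx
    rw [h, norm_zero] at this
    have : 0 < (V^8)⁻¹ := by positivity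
    linarith
  have hgΞ : DifferentiableOn ℂ (fun x => g (x*eC (χ x))) (ball 0 r₁) := by
    have h1 : DifferentiableOn ℂ (fun x => 1/(w - Ξ x)) (ball 0 r₁) :=
      (differentiableOn_const 1).div ((differentiableOn_const w).sub (hdΞ.mono (ball_subset_ball hr₁r))) hwΞ0
    exact (h1.sub_const _).const_mul _
  have hV8 : 1 ≤ V^8 := one_le_pow₀ (by linarith)
  have hgb : ∀ x ∈ ball (0:ℂ) r₁, ‖g (x*eC (χ x))‖≤2*τ*V^8 := by
    intro x hx
    change ‖(τ:ℂ)*(1/(w - Ξ x) - 1/w)‖≤_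
    rw [norm_mul, hτn]
    have h1 : ‖1/(w - Ξ x)‖ ≤ V^8 := by
      rw [norm_div, norm_one, one_div]
      exact inv_le_of_inv_le₀ (by positivity) (hsepx x hx)
    have h2 := norm_sub_le (1/(w - Ξ x)) (1/w)
    calc τ*‖1/(w - Ξ x) - 1/w‖ ≤ τ*(2*V^8) := by gcongr; linarith
      _ = _ := by ring
  have hyx : ∀ x ∈ ball (0:ℂ) (Ra*eR (5*δ)), ‖lam*x*eC (ω x)‖ < Ra*eR (5*δ + 1/V) := by
    intro x hx
    have h1 := norm_mul_exp_le (x := lam*x) ((hωε x hx).trans hε)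
    rw [mem_ball_zero_iff] at hx
    rw [norm_mul lam, hl, one_mul] at h1
    refine h1.trans_lt ?_
    rw [Real.exp_add, ← mul_assoc]
    gcongr
  have hyx1 : ∀ x ∈ ball (0:ℂ) r₁, ‖lam*x*eC (ω x)‖*eR (1/V) ≤ r*eR (-(1/V)) := by
    intro x hx
    have hx5 : x ∈ ball (0:ℂ) (Ra*eR (5*δ)) := by
      refine ball_subset_ball ?_ hx
      rw [hr₁]; gcongr; linarith
    calc _ ≤ Ra*eR (5*δ + 1/V)*eR (1/V) := by gcongr; exact (hyx x hx5).le
      _ = Ra*eR (5*δ + 1/V + 1/V) := by rw [mul_assoc, ← Real.exp_add]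
      _≤_ := hE2 _ _ (by linarith)
  have hbV : 2*(2*τ*V^8)/(1/V) = 4*τ*V^9 := by field_simp; ring
  have hctV : 8*(8*V^2)/(1/V)^2*(4*τ*V^9)/(1/V) = 256*τ*V^14 := by field_simp; ring
  obtain ⟨ω₁, S₁, hω₁0, hω₁⟩ := pert S (by positivity : 0 < 1/V) (g := g) (γ := 2*τ*V^8) (s := 1/V) hr₁0 hr₁r
    (exp_lt_self_mul hr0 (by positivity : 0 < 1/V)).le (by positivity) hexp hyx1 hgΞ hgb (by positivity) (by simp [hg]) hω0
    (by
      rw [hbV, div_div, lt_div_iff₀ (by positivity)]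
      have h1 : V^9*V ≤ V^14 := by
        rw [← pow_succ]; exact pow_le_pow_right₀ (by linarith) (by norm_num)
      have : 4*τ*V^9*(V*4) = 16*τ*(V^9*V) := by ring
      rw [this]
      have h2 : 16*τ*(V^9*V)≤16*τ*V^14 := by gcongr
      have h3 : 0 < τ*V^14 := by positivity
      linarith)
    (by rw [hbV, hctV]; linarith) (by positivity)
  rw [hbV, hctV] at hω₁
  refine ⟨g, ω₁, ?_, by simp [hg], ?_, S₁, hω₁0, ?_, ?_⟩
  · have : DifferentiableOn ℂ (fun z => 1/(w - z)) (ball (0:ℂ) 1.05) := by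
      refine (differentiableOn_const 1).div (by fun_prop) ?_
      intro z hz h
      rw [mem_ball_zero_iff] at hz
      rw [sub_eq_zero] at h; rw [← h] at hz; norm_num at hz; linarith
    exact (this.sub_const _).const_mul _
  · intro z hz
    rw [mem_ball_zero_iff] at hz
    rw [hg]
    simp only [norm_mul, hτn]
    have h1 : 0.45≤‖w - z‖ := by
      have := norm_sub_norm_le w z
      norm_num at hz ⊢; linarith
    have h2 : ‖1/(w - z)‖≤1/0.45 := by
      rw [norm_div, norm_one]; gcongr
    have h3 := norm_sub_le (1/(w - z)) (1/w)
    norm_num at h2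
    rw [mul_comm 3 τ]
    gcongr
    norm_num at *
    linarith
  · intro x hx
    have h1 := (hω₁ x hx).1
    have h2 := hωε x (by
      refine ball_subset_ball ?_ hx
      rw [hr₁]; gcongr; linarith)
    have h3 := norm_add_le (ω x) (ω₁ x - ω x)
    rw [add_sub_cancel] at h3
    linarith
  intro n
  set y : ℂ → ℂ := fun x => lam*x*eC (ω x) with hy
  set R := Ra*eR (5*δ) with hR
  set R1 := Ra*eR (4*δ) with hR1
  have hRr : R ≤ r := hE _ (by linarith)
  have hR0 : 0 < R := by positivity
  have hyR2 : ∀ x ∈ ball (0:ℂ) R, y x ∈ ball (0:ℂ) (r*eR (-(2/V))) := by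
    intro x hx
    rw [mem_ball_zero_iff]
    refine (hyx x hx).trans_le (hE2 _ _ ?_)
    have : 2/V = 2*(1/V) := by ring
    linarith
  have hyr : ∀ x ∈ ball (0:ℂ) R, y x ∈ ball (0:ℂ) r := fun x hx =>
    ball_subset_ball (exp_lt_self_mul hr0 (by positivity)).le (hyR2 x hx)
  set St : ℂ → ℂ := fun x => 1 + y x*deriv χ (y x) with hSt
  have hyd : DifferentiableOn ℂ y (ball 0 R) := by
    have := S.dω.mono (ball_subset_ball hRr); rw [hy]; fun_prop
  have hStd : DifferentiableOn ℂ St (ball 0 R) := by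
    have h2 := (S.dχ.deriv isOpen_ball).comp hyd hyr
    exact (differentiableOn_const 1).add (hyd.mul h2)
  have hStl : ∀ x ∈ ball (0:ℂ) R, 1/V≤‖St x‖ := fun x hx => S.κ_le _ (hyr x hx)
  have hStu : ∀ x ∈ ball (0:ℂ) R, ‖St x‖≤9*V^3 := fun x hx => hSup _ (hyR2 x hx)
  have hSt0 : ∀ x ∈ ball (0:ℂ) R, St x ≠ 0 := by
    intro x hx h
    have := hStl x hx
    rw [h, norm_zero] at this
    have : 0 < 1/V := by positivity
    linarith
  have hDd : DifferentiableOn ℂ (dslope Ξ xa) (ball 0 R) :=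
    ((Complex.differentiableOn_dslope (isOpen_ball.mem_nhds hxm)).2 hdΞ).mono (ball_subset_ball hRr)
  have hD0 : ∀ x ∈ ball (0:ℂ) R, dslope Ξ xa x ≠ 0 := by
    intro x hx h
    have := hDl' x (ball_subset_ball hRr hx)
    rw [h, norm_zero] at this
    have : 0 < (V^8)⁻¹ := by positivity
    linarith
  set m : ℂ → ℂ := fun x => 1/(dslope Ξ xa x*St x) with hm
  have hmd : DifferentiableOn ℂ m (ball 0 R) :=
    (differentiableOn_const 1).div (hDd.mul hStd) (fun x hx => mul_ne_zero (hD0 x hx) (hSt0 x hx))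
  have hmM : ∀ x ∈ ball (0:ℂ) R, ‖m x‖ ≤ V^9 := by
    intro x hx
    simp only [hm]
    rw [norm_div, norm_one, norm_mul, div_le_iff₀ (mul_pos (norm_pos_iff.2 (hD0 x hx)) (norm_pos_iff.2 (hSt0 x hx)))]
    calc (1:ℝ) = V^9*((V^8)⁻¹*(1/V)) := by field_simp
      _≤_ := by
        gcongr
        · exact hDl' x (ball_subset_ball hRr hx)
        · exact hStl x hx
  set h : ℂ → ℂ := fun x => - (1/w)*(1/St x) with hh
  have hR1R : R1 < R := by rw [hR, hR1]; gcongr; linarith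
  have hRaR1 : Ra < R1 := by
    rw [hR1]; nlinarith [Real.add_one_le_exp (4*δ)]
  have hR1sub := ball_subset_ball (x := (0:ℂ)) hR1R.le
  have hhd : DifferentiableOn ℂ h (ball 0 R) :=
    ((differentiableOn_const 1).div hStd hSt0).const_mul _
  have hhH : ∀ x ∈ ball (0:ℂ) R, ‖h x‖ ≤ V := by
    intro x hx
    simp only [hh]
    rw [norm_mul, norm_neg]
    have h1 : ‖1/St x‖ ≤ V := by
      rw [norm_div, norm_one]
      exact (one_div_le (norm_pos_iff.2 (hSt0 x hx)) hV0).2 (hStl x hx)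
    nlinarith [norm_nonneg (1/w), norm_nonneg (1/St x)]
  have hpc := pole_coeff hxa0 hRaR1 hR1R hmd hmM (hhd.mono hR1sub) (fun x hx => hhH x (hR1sub hx)) n
  have hxaR : xa ∈ ball (0:ℂ) R := by rw [mem_ball_zero_iff]; linarith
  -- lower bound for m xa
  have hmxa : 2*(V^8)⁻¹≤‖m xa‖ := by
    simp only [hm, dslope_same]
    rw [hΞder xa hxm, norm_div, norm_one, norm_mul, norm_mul]
    have h1 : ‖eC (χ xa)‖≤2*V := by
      refine (hexpχ xa hxm).trans ?_
      rw [div_le_iff₀ hr0]; rw [div_le_iff₀ hV0] at hrV; nlinarith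
    have h2 : ‖1 + xa*deriv χ xa‖≤9*V^3 := hSup xa (by
      rw [mem_ball_zero_iff]
      have := hE2 0 (2/V) (by have : 2/V = 2*(1/V) := by ring
                              linarith)
      rw [Real.exp_zero, mul_one] at this
      refine lt_of_le_of_ne this ?_
      intro heq
      have h7 := hE2 δ (2/V) (by have : 2/V = 2*(1/V) := by ring
                                 linarith)
      rw [← heq] at h7
      nlinarith [Real.add_one_le_exp δ])
    have h3 := hStu xa hxaR
    have hpos : 0 < ‖eC (χ xa)‖*‖1 + xa*deriv χ xa‖*‖St xa‖ := by
      refine mul_pos (mul_pos (norm_pos_iff.2 (Complex.exp_ne_zero _)) ?_) (norm_pos_iff.2 (hSt0 xa hxaR))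
      exact lt_of_lt_of_le (by positivity) (S.κ_le xa hxm)
    rw [le_div_iff₀ hpos]
    calc 2*(V^8)⁻¹*(‖eC (χ xa)‖*‖1 + xa*deriv χ xa‖*‖St xa‖)
       ≤2*(V^8)⁻¹*(2*V*(9*V^3)*(9*V^3)) := by gcongr
      _ = 324/V := by field_simp; norm_num
      _≤1 := by rw [div_le_one hV0]; linarith
  have hRgap : (V^2)⁻¹ ≤ R - R1 := by
    have h1 := hgap δ hδ0 (by linarith) h4V
    have h2 : R - R1 = R*(1 - eR (-δ)) := by
      have h7 : eR (4*δ) = eR (5*δ)*eR (-δ) := by rw [← Real.exp_add]; congr 1; ring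
      rw [hR, hR1, h7]; ring
    rw [h2]
    refine h1.trans ?_
    have : 0≤1 - eR (-δ) := by
      have : eR (-δ)≤1 := Real.exp_le_one_iff.2 (by linarith)
      linarith
    gcongr
    linarith
  set q : ℂ → ℂ := fun x => m x*(1/(xa - x)) + h x with hq
  have hr1R : r₁ < R := by linarith
  have hqeq : ∀ x ∈ ball (0:ℂ) r₁, (τ:ℂ)*q x = g (x*eC (χ x))/(1 + y x*deriv χ (y x)) := by
    intro x hx
    have hxR := ball_subset_ball hr1R.le hx
    change _ = (τ:ℂ)*(1/(w - Ξ x) - 1/w)/St x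
    have hne : x ≠ xa := by
      rintro rfl
      rw [mem_ball_zero_iff] at hx; linarith
    have h1 : w - Ξ x = (xa - x)*dslope Ξ xa x := by
      rw [dslope_of_ne _ hne, slope_def_field]
      have : x - xa ≠ 0 := sub_ne_zero.2 hne
      have e : xa - x = -(x - xa) := by ring
      rw [e]; field_simp; ring
    simp only [hq, hm, hh]
    have h2 := hD0 x hxR
    have h3 := hSt0 x hxR
    have h4 : xa - x ≠ 0 := sub_ne_zero.2 (Ne.symm hne)
    rw [h1]
    field_simp
    ring
  have hqd : DifferentiableOn ℂ q (ball 0 r₁) := by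
    have h1 : DifferentiableOn ℂ (fun x => 1/(xa - x)) (ball 0 r₁) := by
      refine (differentiableOn_const 1).div (by fun_prop) ?_
      intro x hx h
      rw [sub_eq_zero] at h
      rw [mem_ball_zero_iff, ← h] at hx; linarith
    exact ((hmd.mono (ball_subset_ball hr1R.le)).mul h1).add (hhd.mono (ball_subset_ball hr1R.le))
  set e : ℂ → ℂ := fun x => ω₁ x - ω x - (τ:ℂ)*q x with he
  have hωr1 := S.dω.mono (ball_subset_ball hr₁r)
  have hed : DifferentiableOn ℂ e (ball 0 r₁) := (S₁.dω.sub hωr1).sub (hqd.const_mul _)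
  have heb : ∀ x ∈ ball (0:ℂ) r₁, ‖e x‖ ≤ τ^2*V^24 := by
    intro x hx
    have h1 := (hω₁ x hx).2
    simp only [he]
    rw [hqeq x hx]
    refine h1.trans ?_
    calc 256*τ*V^14*(4*τ*V^9) = τ^2*(1024*V^23) := by ring
      _ ≤ τ^2*(V*V^23) := by gcongr; linarith
      _ = _ := by ring
  have hdec : tc n ω₁ = (τ:ℂ)*tc n q + tc n ω + tc n e := by
    rw [← tc_smul hr₁0 hqd, ← tc_add hr₁0 (hqd.const_mul _) hωr1,
      ← tc_add (f := fun x => (τ:ℂ)*q x + ω x) hr₁0 ((hqd.const_mul _).add hωr1) hed]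
    apply tc_congr hr₁0
    intro x hx
    simp only [he]; ring
  have hte := norm_tc_le hr₁0 hed heb n
  have htω := norm_tc_le hRa0 (S.dω.mono (ball_subset_ball hxr.le)) (fun x hx => hωε x (ball_subset_ball (by linarith) hx)) n
  have hfin : τ*‖tc n q‖ - ‖tc n ω‖ - ‖tc n e‖≤‖tc n ω₁‖ := by
    have h1 : (τ:ℂ)*tc n q = tc n ω₁ - tc n ω - tc n e := by rw [hdec]; ring
    have h2 : ‖(τ:ℂ)*tc n q‖ = τ*‖tc n q‖ := by rw [norm_mul, hτn]
    rw [← h2, h1]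
    have := norm_sub_le (tc n ω₁ - tc n ω) (tc n e)
    have := norm_sub_le (tc n ω₁) (tc n ω)
    linarith
  refine le_trans ?_ hfin
  have hqn : (V^8)⁻¹/Ra^n - 2*V^11/R1^n≤‖tc n q‖ := by
    refine le_trans ?_ hpc
    have h1 : (V^8)⁻¹/Ra^n≤‖m xa‖/Ra^(n+1) := by
      rw [pow_succ, div_le_div_iff₀ (by positivity) (by positivity)]
      have : (V^8)⁻¹*Ra≤‖m xa‖ := by
        have : Ra≤2 := by linarith
        have : (V^8)⁻¹*Ra≤(V^8)⁻¹*2 := by gcongr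
        linarith
      calc (V^8)⁻¹*(Ra^n*Ra) = (V^8)⁻¹*Ra*Ra^n := by ring
        _≤_ := by gcongr
    have h2 : (V^9/(R - R1) + V)/R1^n≤2*V^11/R1^n := by
      have h3 : V^9/(R - R1) ≤ V^9/(V^2)⁻¹ := by gcongr
      have h4 : V^9/(V^2)⁻¹ = V^11 := by field_simp
      have h5 : V ≤ V^11 := le_self_pow₀ (by linarith) (by norm_num)
      gcongr
      linarith
    linarith
  have h6 : τ*((V^8)⁻¹/Ra^n - 2*V^11/R1^n) ≤ τ*‖tc n q‖ := by gcongr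
  linarith

lemma disp_lip {ω : ℂ → ℂ} {ρ μ t b : ℝ} (ht : 0 < t) (hμ0 : 0 < μ) (hω : DifferentiableOn ℂ ω (ball 0 ρ))
    (hμ : ∀ x ∈ ball (0:ℂ) ρ, ‖ω x‖ ≤ μ) {x v : ℂ} (hx : ‖x‖*eR b < ρ*eR (-t)) (hρ : 0 < ρ)
    (hv : ‖v‖ ≤ b) : ‖ω (x*eC v) - ω x‖ ≤ μ/t*‖v‖ := by
  have hsub := ball_subset_ball (x := (0:ℂ)) (exp_lt_self_mul hρ ht).le
  set c : ℂ := ((t/(2*μ) : ℝ) : ℂ) with hc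
  have hcn : ‖c‖ = t/(2*μ) := by
    rw [hc, Complex.norm_real, Real.norm_eq_abs, abs_of_pos (by positivity)]
  have hd := norm_mul_deriv_le ht hμ0.le hω hμ
  have hb0 : 0 ≤ b := (norm_nonneg v).trans hv
  have := phi_exp_lip (φ := fun x => c*ω x) hx ((hω.mono hsub).const_mul c) (fun z hz => by
    have h1 : deriv (fun x => c*ω x) z = c*deriv ω z :=
      deriv_const_mul c ((hω.mono hsub).differentiableAt (isOpen_ball.mem_nhds hz))
    rw [h1, mul_left_comm, norm_mul, hcn]
    calc _ ≤ t/(2*μ)*(μ/t) := by gcongr; exact hd z hz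
      _ = 1/2 := by field_simp) hv (v' := 0) (by simpa using hb0)
  rw [Complex.exp_zero, mul_one, sub_zero, ← mul_sub, norm_mul, hcn] at this
  calc _ = 2*μ/t*(t/(2*μ)*‖ω (x*eC v) - ω x‖) := by field_simp
    _≤2*μ/t*(1/2*‖v‖) := by gcongr
    _ = _ := by ring

lemma disp_isBigO {f v : ℂ → ℂ} {ρ : ℝ} {m k : ℕ} (hρ : 0 < ρ) (hf : DifferentiableOn ℂ f (ball 0 ρ))
    (hO : f =O[𝓝 0] (fun x : ℂ => x^m)) (hv : v =O[𝓝 0] (fun x : ℂ => x^k)) (hk : 0 < k) :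
    (fun x => f (x*eC (v x)) - f x) =O[𝓝 0] (fun x : ℂ => x^(m + k)) := by
  obtain ⟨C, hC, hCO⟩ := hO.exists_pos
  rw [IsBigOWith_def] at hCO
  obtain ⟨ρ0, hρ0, hb⟩ := Metric.eventually_nhds_iff_ball.1 hCO
  have hv0 : Tendsto v (𝓝 0) (𝓝 0) := by
    refine hv.trans_tendsto ?_
    have : ContinuousAt (fun x : ℂ => x^k) 0 := by fun_prop
    simpa [ContinuousAt, hk.ne'] using this
  have hv1 : ∀ᶠ x in 𝓝 (0:ℂ), ‖v x‖≤1 := by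
    filter_upwards [hv0.eventually (ball_mem_nhds (0:ℂ) one_pos)] with x hx
    have : ‖v x‖ < 1 := by simpa using hx
    exact this.le
  have hsm : ∀ᶠ x in 𝓝 (0:ℂ), ‖x‖*eR 3 ≤ min ρ0 ρ := by
    have hc : ContinuousAt (fun x : ℂ => ‖x‖*eR 3) 0 := by fun_prop
    have := hc.eventually (gt_mem_nhds (show ‖(0:ℂ)‖*eR 3 < min ρ0 ρ by simpa using ⟨hρ0, hρ⟩))
    filter_upwards [this] with x hx using hx.le
  have hmain : (fun x => f (x*eC (v x)) - f x) =O[𝓝 0] (fun x : ℂ => x^m*v x) := by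
    refine IsBigO.of_bound (C*eR 3^m) ?_
    filter_upwards [hv1, hsm] with x h1 h2
    rcases eq_or_ne x 0 with rfl | hx0
    · simp
      positivity
    have hx : 0 < ‖x‖ := norm_pos_iff.2 hx0
    have hsub1 := ball_subset_ball (x := (0:ℂ)) (h2.trans (min_le_left _ _))
    have hsub2 := ball_subset_ball (x := (0:ℂ)) (h2.trans (min_le_right _ _))
    have := disp_lip (b := 1) (t := 1) (μ := C*(‖x‖*eR 3)^m) one_pos (by positivity) (hf.mono hsub2)
      (fun z hz => by
        refine (hb z (hsub1 hz)).trans ?_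
        rw [norm_pow]
        rw [mem_ball_zero_iff] at hz
        gcongr) (x := x) (v := v x) (by
          rw [mul_assoc, ← Real.exp_add]
          gcongr; norm_num) (by positivity) h1
    refine this.trans (le_of_eq ?_)
    rw [norm_mul, norm_pow, mul_pow]; ring
  refine hmain.trans ?_
  simpa [pow_add] using (isBigO_refl (fun x : ℂ => x^m) (𝓝 0)).mul hv

lemma tc_eq_zero_of_isBigO {f : ℂ → ℂ} {ρ : ℝ} {M k : ℕ} (hρ : 0 < ρ) (hf : DifferentiableOn ℂ f (ball 0 ρ))
    (hO : f =O[𝓝 0] (fun x : ℂ => x^M)) (hk : k < M) : tc k f = 0 := by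
  have h0 : HasJet M f 0 := by
    unfold HasJet; simpa using hO
  rw [tc_eq_of_hasJet hρ hf h0 hk]; simp

lemma isBigO_pow_mono {a b : ℕ} (h : a ≤ b) : (fun x : ℂ => x^b) =O[𝓝 0] (fun x : ℂ => x^a) := by
  obtain ⟨c, rfl⟩ := Nat.exists_eq_add_of_le h
  have hc : ContinuousAt (fun x : ℂ => x^c) 0 := by fun_prop
  simpa [pow_add] using (isBigO_refl (fun x : ℂ => x^a) (𝓝 0)).mul (hc.isBigO_one ℂ)

lemma isBigO_self_of_zero {φ : ℂ → ℂ} {ρ : ℝ} (hρ : 0 < ρ) (hφ : DifferentiableOn ℂ φ (ball 0 ρ)) (h0 : φ 0 = 0) :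
    φ =O[𝓝 0] (fun x : ℂ => x^1) := by
  have := (hφ.differentiableAt (ball_mem_nhds 0 hρ)).isBigO_sub
  simpa [h0] using this

/-- coefficient `n` after normalizing to order `n` -/
lemma stepA_coeff {lam : ℂ} {ω ω' φ : ℂ → ℂ} {ρ μ a t : ℝ} {n : ℕ} (hl : ‖lam‖ = 1) (hn : 0 < n) (hρ : 0 < ρ) (ht : 0 < t)
    (hμ0 : 0 < μ) (hω : DifferentiableOn ℂ ω (ball 0 ρ)) (hμ : ∀ x ∈ ball (0:ℂ) ρ, ‖ω x‖ ≤ μ)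
    (hφ : DifferentiableOn ℂ φ (ball 0 ρ)) (h0 : φ 0 = 0) (hφa : ∀ x ∈ ball (0:ℂ) ρ, ‖φ x‖ ≤ a) (hat : a ≤ t)
    (hω' : DifferentiableOn ℂ ω' (ball 0 (ρ*eR (-t))))
    (heq : ∀ x ∈ ball (0:ℂ) (ρ*eR (-t)), ω' x + φ (lam*x*eC (ω' x)) = φ x + ω (x*eC (φ x)))
    (hO : ω' =O[𝓝 0] (fun x : ℂ => x^n)) :
    ‖tc n ω' - tc n ω‖ ≤ a*‖lam^n - 1‖/ρ^n + μ/t*a/(ρ*eR (-(2*t)))^n := by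
  set ρ' := ρ*eR (-(2*t)) with hρ'
  have hρ'0 : 0 < ρ' := by positivity
  have hρ1 : ρ' ≤ ρ*eR (-t) := by rw [hρ']; gcongr; linarith
  have hρ2 : ρ' ≤ ρ := by linarith [exp_lt_self_mul hρ ht]
  have hs1 := ball_subset_ball (x := (0:ℂ)) hρ1
  have hs2 := ball_subset_ball (x := (0:ℂ)) hρ2
  have hlm : ∀ x ∈ ball (0:ℂ) ρ, lam*x ∈ ball (0:ℂ) ρ := by
    intro x hx; simpa [hl] using hx
  set d : ℂ → ℂ := fun x => ω (x*eC (φ x)) - ω x with hd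
  have hlt : ∀ x ∈ ball (0:ℂ) ρ', ‖x‖*eR a < ρ*eR (-t) := by
    intro x hx
    rw [mem_ball_zero_iff] at hx
    calc ‖x‖*eR a < ρ'*eR t := by
          have : eR a ≤ eR t := Real.exp_le_exp.2 hat
          have := Real.exp_pos a
          nlinarith [norm_nonneg x]
      _ = _ := by rw [hρ', mul_assoc, ← Real.exp_add]; congr 2; ring
  have hdb : ∀ x ∈ ball (0:ℂ) ρ', ‖d x‖ ≤ μ/t*a := by
    intro x hx
    have h1 := hφa x (hs2 hx)
    refine (disp_lip ht hμ0 hω hμ (hlt x hx) hρ h1).trans ?_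
    gcongr
  have hdd : DifferentiableOn ℂ d (ball 0 ρ') := by
    refine (hω.comp (differentiableOn_id.mul (hφ.mono hs2).cexp) ?_).sub (hω.mono hs2)
    intro x hx
    rw [mem_ball_zero_iff]
    have h1 := hφa x (hs2 hx)
    exact ((norm_mul_exp_le h1).trans_lt (hlt x hx)).trans (exp_lt_self_mul hρ ht)
  set e : ℂ → ℂ := fun x => ω' x - ω x - d x - (φ x - φ (lam*x)) with he
  have hφl : DifferentiableOn ℂ (fun x => φ (lam*x)) (ball 0 ρ) := hφ.comp (by fun_prop) hlm
  have hed : DifferentiableOn ℂ e (ball 0 ρ') :=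
    (((hω'.mono hs1).sub (hω.mono hs2)).sub hdd).sub ((hφ.mono hs2).sub (hφl.mono hs2))
  have heO : e =O[𝓝 0] (fun x : ℂ => x^(n+1)) := by
    have h1 := disp_isBigO (f := fun x => φ (lam*x)) (v := ω') (m := 1) (k := n) hρ hφl
      (isBigO_self_of_zero hρ hφl (by simpa using h0)) hO hn
    rw [add_comm 1 n] at h1
    refine IsBigO.congr' h1.neg_left ?_ EventuallyEq.rfl
    filter_upwards [ball_mem_nhds (0:ℂ) hρ'0] with x hx
    have h2 := heq x (hs1 hx)
    simp only [he, hd]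
    rw [← mul_assoc]
    linear_combination -h2
  have hze := tc_eq_zero_of_isBigO hρ'0 hed heO (Nat.lt_succ_self n)
  have hφll : tc n (fun x => φ (lam*x)) = lam^n*tc n φ := by
    rw [tc_eq_of_hasJet hρ hφl ((hasJet_tc hρ hφ (n+1)).rescale lam) (Nat.lt_succ_self n)]
    simp [coeff_rescale]
  have hdec : tc n ω' = tc n ω + tc n d + tc n φ + (-1)*tc n (fun x => φ (lam*x)) + tc n e := by
    rw [← tc_smul hρ'0 (hφl.mono hs2), ← tc_add hρ'0 (hω.mono hs2) hdd,
      ← tc_add (f := fun x => ω x + d x) hρ'0 ((hω.mono hs2).add hdd) (hφ.mono hs2),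
      ← tc_add (f := fun x => ω x + d x + φ x) hρ'0 (((hω.mono hs2).add hdd).add (hφ.mono hs2)) ((hφl.mono hs2).const_mul _),
      ← tc_add (f := fun x => ω x + d x + φ x + (-1)*φ (lam*x)) hρ'0 ((((hω.mono hs2).add hdd).add (hφ.mono hs2)).add ((hφl.mono hs2).const_mul _)) hed]
    apply tc_congr hρ'0
    intro x hx
    simp only [he]; ring
  rw [hdec, hze, hφll]
  have h3 := norm_tc_le hρ hφ hφa n
  have h4 := norm_tc_le hρ'0 hdd hdb n
  calc _ = ‖-(tc n φ*(lam^n - 1)) + tc n d‖ := by congr 1; ring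
    _≤‖tc n φ‖*‖lam^n - 1‖ + ‖tc n d‖ := by
      refine (norm_add_le _ _).trans ?_
      rw [norm_neg, norm_mul]
    _ ≤ a/ρ^n*‖lam^n - 1‖ + μ/t*a/ρ'^n := by gcongr
    _ = _ := by ring

lemma conj_step {lam : ℂ} (hl : ‖lam‖ = 1) {u χ ω φ : ℂ → ℂ} {r κ ρ μ a t : ℝ}
    (S : Sys lam u r κ χ ω) (hκ : 0 ≤ κ) (hρ : 0 < ρ) (hρr : ρ ≤ r) (ht : 0 < t)
    (hμ : ∀ x ∈ ball (0:ℂ) ρ, ‖ω x‖ ≤ μ) (ha : 0 ≤ a)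
    (hφ : DifferentiableOn ℂ φ (ball 0 ρ)) (hφ0 : φ 0 = 0) (hφa : ∀ x ∈ ball (0:ℂ) ρ, ‖φ x‖≤2*a)
    (hat : 16*a + 4*μ ≤ t) (ht1 : t≤1/2) :
    ∃ ω' : ℂ → ℂ, Sys lam u (ρ*eR (-(2*t))) (κ*(1 - 2*a/t))
        (fun x => φ x + χ (x*eC (φ x))) ω' ∧
      DifferentiableOn ℂ ω' (ball 0 (ρ*eR (-t))) ∧
      (∀ x ∈ ball (0:ℂ) (ρ*eR (-t)), ‖ω' x‖≤8*a + 2*μ ∧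
        ω' x + φ (lam*x*eC (ω' x)) = φ x + ω (x*eC (φ x)) ∧
        ‖ω' x‖≤2*‖φ x + ω (x*eC (φ x)) - φ (lam*x)‖) ∧
      (∀ y, ‖y‖*eR (4*a) < ρ*eR (-t) → ∃ x, ‖x‖≤‖y‖*eR (4*a) ∧
        x*eC (φ x) = y) := by
  have hμ0 : 0 ≤ μ := (norm_nonneg _).trans (hμ 0 (by simpa using hρ))
  have hin : ρ*eR (-t) < ρ := exp_lt_self_mul hρ ht
  have hin2 : ρ*eR (-(t/2)) < ρ := exp_lt_self_mul hρ (by linarith)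
  have hsub : ball (0:ℂ) (ρ*eR (-t)) ⊆ ball 0 ρ := ball_subset_ball hin.le
  have hlx : ∀ x ∈ ball (0:ℂ) ρ, lam*x ∈ ball (0:ℂ) ρ := by
    intro x hx; simpa [hl] using hx
  have hTin : ∀ x ∈ ball (0:ℂ) (ρ*eR (-t)), x*eC (φ x) ∈ ball (0:ℂ) ρ := by
    intro x hx
    have h1 := norm_mul_exp_le (x := x) (hφa x (hsub hx))
    rw [mem_ball_zero_iff] at hx ⊢
    calc _≤_ := h1
      _ < ρ*eR (-t)*eR (2*a) := by gcongr
      _ = ρ*eR (-t + 2*a) := by rw [Real.exp_add]; ring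
      _ ≤ ρ*1 := by
        gcongr
        rw [Real.exp_le_one_iff]; linarith
      _ = ρ := mul_one _
  have hres : ∀ x ∈ ball (0:ℂ) (ρ*eR (-t)),
      ‖φ x + ω (x*eC (φ x)) - φ (lam*x)‖≤4*a + μ := by
    intro x hx
    have h1 := hφa x (hsub hx)
    have h2 := hφa _ (hlx x (hsub hx))
    have h3 := hμ _ (hTin x hx)
    calc _≤‖φ x‖ + ‖ω (x*eC (φ x))‖ + ‖φ (lam*x)‖ :=
          (norm_sub_le _ _).trans (by gcongr; exact norm_add_le _ _)
      _≤_ := by linarith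
  have hderiv : ∀ x ∈ ball (0:ℂ) (ρ*eR (-(t/2))), ‖x*deriv φ x‖≤1/2 := by
    intro x hx
    refine (norm_mul_deriv_le (by linarith) (by linarith) hφ hφa x hx).trans ?_
    rw [div_le_div_iff₀ (by linarith) (by norm_num)]; linarith
  obtain ⟨ω', hω'd, hω'⟩ := conj_lemma hl (φ := φ) (ω := ω) (r := ρ*eR (-t)) (a := 2*a)
    (b := 8*a + 2*μ) (R1 := ρ*eR (-(t/2))) (R2 := ρ) (by linarith)
    (by rw [mul_assoc, ← Real.exp_add]; gcongr; linarith)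
    (by
      rw [mul_assoc, ← Real.exp_add]
      have : eR (-t + 2*a)≤1 := by rw [Real.exp_le_one_iff]; linarith
      nlinarith)
    (by gcongr; linarith) (hφ.mono (ball_subset_ball hin2.le)) (S.dω.mono (ball_subset_ball hρr)) (fun x hx => hφa x (hsub hx)) hderiv
    (fun x hx => (hres x hx).trans (by linarith))
  have hs1 : ρ*eR (-t) < ρ := exp_lt_self_mul hρ ht
  have hs2 : ρ*eR (-(2*t)) ≤ ρ*eR (-t) := by gcongr; linarith
  have hφ2 : DifferentiableOn ℂ φ (ball 0 (ρ*eR (-t))) := hφ.mono (ball_subset_ball hs1.le)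
  have hφa2 : ∀ x ∈ ball (0:ℂ) (ρ*eR (-t)), ‖φ x‖≤2*a :=
    fun x hx => hφa x (ball_subset_ball hs1.le hx)
  have hd : ∀ x ∈ ball (0:ℂ) (ρ*eR (-t)), ‖x*deriv φ x‖≤2*a/t :=
    norm_mul_deriv_le ht (by linarith) hφ hφa
  have hd2 : ∀ x ∈ ball (0:ℂ) (ρ*eR (-t)), ‖x*deriv φ x‖≤1/2 := by
    intro x hx
    refine (hd x hx).trans ?_
    rw [div_le_iff₀ ht]; linarith
  refine ⟨ω', ?_, hω'd, hω', ?_⟩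
  · refine S.trans hκ (hφ2.mono (ball_subset_ball hs2)) (hω'd.mono (ball_subset_ball hs2)) hφ0 ?_ ?_ ?_ ?_
    · intro x hx
      exact ball_subset_ball hρr (hTin x (ball_subset_ball hs2 hx))
    · refine inj_lemma (a := 2*a) (ρ := ρ*eR (-t)) ?_ hs2 hφ2 hφa2 hd2
      rw [mul_assoc, ← Real.exp_add]; gcongr; linarith
    · intro x hx
      have h1 := hd x (ball_subset_ball hs2 hx)
      have h2 := norm_sub_le (1 + x*deriv φ x) (x*deriv φ x)
      rw [add_sub_cancel_right, norm_one] at h2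
      linarith
    · intro x hx _
      exact (hω' x (ball_subset_ball hs2 hx)).2.1
  · intro y hy
    have := inv_lemma (a := 2*a) (by linarith) hφ2 hφa2 hd2 (y := y) (by rwa [show 2*(2*a) = 4*a by ring])
    rwa [show 2*(2*a) = 4*a by ring] at this

lemma stepL {lam : ℂ} (hl : ‖lam‖ = 1) {u χ ω : ℂ → ℂ} {r κ ρ μ a t : ℝ} {n n' : ℕ} (hL : Level lam n n') (h4 : 4*n ≤ n')
    (S : Sys lam u r κ χ ω) (hκ : 0 ≤ κ) (hρ : 0 < ρ) (hρr : ρ ≤ r) (ht : 0 < t)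
    (hμ : ∀ x ∈ ball (0:ℂ) ρ, ‖ω x‖ ≤ μ) (hO : ω =O[𝓝 0] (fun x : ℂ => x^n))
    (ha : (n:ℝ)^2*μ≤2*a)
    (hat : 16*a + 4*μ ≤ t) (ht1 : t≤1/2) :
    ∃ φ ω' : ℂ → ℂ, Sys lam u (ρ*eR (-(2*t))) (κ*(1 - 2*a/t))
        (fun x => φ x + χ (x*eC (φ x))) ω' ∧
      DifferentiableOn ℂ φ (ball 0 ρ) ∧ φ 0 = 0 ∧ (∀ x ∈ ball (0:ℂ) ρ, ‖φ x‖≤2*a) ∧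
      DifferentiableOn ℂ ω' (ball 0 (ρ*eR (-t))) ∧
      (∀ x ∈ ball (0:ℂ) (ρ*eR (-t)), ‖ω' x‖≤8*a + 2*μ) ∧
      (fun x => ω' x - tc n ω*x^n) =O[𝓝 0] (fun x : ℂ => x^(2*n)) := by
  have hμ0 : 0 ≤ μ := (norm_nonneg _).trans (hμ 0 (by simpa using hρ))
  have ha0 : 0 ≤ a := by nlinarith [show 0≤(n:ℝ)^2*μ by positivity]
  have hn := hL.pos
  have hωρ := S.dω.mono (ball_subset_ball hρr)
  set φ : ℂ → ℂ := fun x => ∑ k ∈ Finset.Ico (n+1) (2*n), tc k ω/(lam^k - 1)*x^k with hφ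
  have hns : ∀ k ∈ Finset.Ico (n+1) (2*n), 1≤(n:ℝ)*‖lam^k - 1‖ := by
    intro k hk
    rw [Finset.mem_Ico] at hk
    refine hL.small k ?_ (by omega)
    rintro ⟨i, rfl⟩
    have h1 : 1 < i := by
      by_contra hc
      have : i≤1 := by omega
      nlinarith [hk.1]
    nlinarith [hk.2]
  have hφd : Differentiable ℂ φ := by fun_prop
  have hφ0 : φ 0 = 0 := by
    refine Finset.sum_eq_zero fun k hk => ?_
    rw [Finset.mem_Ico] at hk
    rw [zero_pow (by omega), mul_zero]
  have hφa : ∀ x ∈ ball (0:ℂ) ρ, ‖φ x‖≤2*a := by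
    intro x hx
    rw [mem_ball_zero_iff] at hx
    have h1 : ∀ k ∈ Finset.Ico (n+1) (2*n), ‖tc k ω/(lam^k - 1)*x^k‖ ≤ n*μ := by
      intro k hk
      have h2 := norm_tc_le hρ hωρ hμ k
      have h3 := hns k hk
      have h4 : 0 < ‖lam^k - 1‖ := by
        by_contra hc
        have : ‖lam^k - 1‖ = 0 := le_antisymm (not_lt.1 hc) (norm_nonneg _)
        rw [this] at h3; linarith
      have h6 : ‖tc k ω‖*‖x‖^k ≤ μ := by
        calc _ ≤ μ/ρ^k*ρ^k := by gcongr
          _ = μ := by field_simp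
      rw [norm_mul, norm_div, norm_pow, div_mul_eq_mul_div, div_le_iff₀ h4]
      nlinarith
    refine (norm_sum_le_of_le _ h1).trans ?_
    rw [Finset.sum_const, nsmul_eq_mul, Nat.card_Ico]
    refine le_trans ?_ ha
    have : ((2*n - (n+1) : ℕ) : ℝ) ≤ n := by exact_mod_cast (by omega)
    calc _≤(n:ℝ)*(n*μ) := by gcongr
      _ = _ := by ring
  obtain ⟨ω', S', hω'd, hω', -⟩ := conj_step hl S hκ hρ hρr ht hμ ha0 hφd.differentiableOn hφ0 hφa hat ht1
  refine ⟨φ, ω', S', hφd.differentiableOn, hφ0, hφa, hω'd, fun x hx => (hω' x hx).1, ?_⟩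
  have hφO : φ =O[𝓝 0] (fun x : ℂ => x^(n+1)) := by
    refine IsBigO.fun_sum fun k hk => ?_
    rw [Finset.mem_Ico] at hk
    exact (isBigO_pow_mono hk.1).const_mul_left _
  have hnh : ball (0:ℂ) (ρ*eR (-t)) ∈ 𝓝 (0:ℂ) := ball_mem_nhds _ (by positivity)
  have hd1 := disp_isBigO hρ hωρ hO hφO (by omega)
  have hφlO : (fun x => φ (lam*x)) =O[𝓝 0] (fun x : ℂ => x^(n+1)) := by
    have h1 : Tendsto (fun x : ℂ => lam*x) (𝓝 0) (𝓝 0) := by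
      have : ContinuousAt (fun x : ℂ => lam*x) 0 := by fun_prop
      simpa using this.tendsto
    refine (hφO.comp_tendsto h1).trans (IsBigO.of_bound 1 (Eventually.of_forall fun x => ?_))
    simp [hl]
  have hω'O : ω' =O[𝓝 0] (fun x : ℂ => x^n) := by
    have h1 : (fun x => φ x + ω (x*eC (φ x)) - φ (lam*x)) =O[𝓝 0] (fun x : ℂ => x^n) := by
      have e : ∀ x, φ x + ω (x*eC (φ x)) - φ (lam*x) =
          φ x + ((ω (x*eC (φ x)) - ω x) + ω x) - φ (lam*x) := by intro x; ring
      simp only [e]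
      exact ((hφO.trans (isBigO_pow_mono (by omega))).add ((hd1.trans (isBigO_pow_mono (by omega))).add hO)).sub
        (hφlO.trans (isBigO_pow_mono (by omega)))
    refine IsBigO.trans (IsBigO.of_bound 2 ?_) h1
    filter_upwards [hnh] with x hx using (hω' x hx).2.2
  have hd2 := disp_isBigO (f := fun x => φ (lam*x)) hρ (by fun_prop) hφlO hω'O hn
  have hj := hasJet_tc hρ hωρ (2*n)
  unfold HasJet at hj
  have hj2 : (fun x => φ x - φ (lam*x) + ω x - tc n ω*x^n) =O[𝓝 0] (fun x : ℂ => x^(2*n)) := by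
    refine hj.congr_left fun x => ?_
    rw [eval_trunc, Finset.range_eq_Ico, ← Finset.sum_Ico_consecutive _ (Nat.zero_le n) (by omega : n≤2*n),
      Finset.sum_eq_sum_Ico_succ_bot (by omega : n < 2*n)]
    have h0 : ∑ i ∈ Finset.Ico 0 n, coeff i (PowerSeries.mk fun n => tc n ω)*x^i = 0 := by
      refine Finset.sum_eq_zero fun k hk => ?_
      rw [Finset.mem_Ico] at hk
      rw [coeff_mk, tc_eq_zero_of_isBigO hρ hωρ hO hk.2, zero_mul]
    have h1 : φ x - φ (lam*x) = - ∑ k ∈ Finset.Ico (n+1) (2*n), coeff k (PowerSeries.mk fun n => tc n ω)*x^k := by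
      rw [hφ, ← Finset.sum_sub_distrib, ← Finset.sum_neg_distrib]
      refine Finset.sum_congr rfl fun k hk => ?_
      have h3 := hns k hk
      have h4 : lam^k - 1 ≠ 0 := by
        intro hc; rw [hc] at h3; simp at h3; linarith
      rw [coeff_mk, mul_pow]
      field_simp
      ring
    rw [h0, h1, coeff_mk]; ring
  have hfin := (hj2.add (hd1.trans (isBigO_pow_mono (by omega : 2*n ≤ n + (n+1))))).sub
    (hd2.trans (isBigO_pow_mono (by omega : 2*n≤(n+1) + n)))
  refine hfin.congr' ?_ (EventuallyEq.refl _ _)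
  filter_upwards [hnh] with x hx
  have := (hω' x hx).2.1
  rw [← mul_assoc]
  linear_combination -this

lemma Sys.mono_κ {lam : ℂ} {u : ℂ → ℂ} {r κ κ' : ℝ} {χ ω : ℂ → ℂ} (S : Sys lam u r κ χ ω) (h : κ' ≤ κ) :
    Sys lam u r κ' χ ω :=
  ⟨S.dχ, S.dω, S.χ0, S.inj, S.bd, fun x hx => h.trans (S.κ_le x hx), S.eq⟩

lemma stepAL {lam : ℂ} (hl : ‖lam‖ = 1) (hlam : ∀ k, 0 < k → lam^k ≠ 1) {u χ ω : ℂ → ℂ} {r κ μ : ℝ} {n n' : ℕ}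
    (hL : Level lam n n') (h4 : 4*n ≤ n') (hV : 1000≤(n:ℝ))
    (S : Sys lam u r κ χ ω) (hκ : 0 ≤ κ) (hr : 0 < r) (hμ0 : 0 < μ)
    (hμ : ∀ x ∈ ball (0:ℂ) r, ‖ω x‖ ≤ μ) (hω0 : ω 0 = 0) (hμV : (n:ℝ)^8*μ≤1) :
    ∃ (Θ ω₃ : ℂ → ℂ) (A:ℂ), Sys lam u (r*eR (-(4/n))) (κ/2) (fun x => Θ x + χ (x*eC (Θ x))) ω₃ ∧
      (∀ x ∈ ball (0:ℂ) (r*eR (-(4/n))), ‖Θ x‖≤(n:ℝ)^5*μ) ∧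
      (∀ x ∈ ball (0:ℂ) (r*eR (-(4/n))), ‖ω₃ x‖≤(n:ℝ)^5*μ) ∧
      (fun x => ω₃ x - A*x^n) =O[𝓝 0] (fun x : ℂ => x^(2*n)) ∧
      ‖A - tc n ω‖≤(84*(n:ℝ)^2*μ/n' + 108*(n:ℝ)^3*μ^2)/r^n := by
  have hn := hL.pos
  set V : ℝ := (n:ℝ) with hVd
  have hV0 : 0 < V := by linarith
  have hpow : ∀ k, k≤8 → V^k*μ≤1 := by
    intro k hk
    refine le_trans ?_ hμV
    have : V^k ≤ V^8 := pow_le_pow_right₀ (by linarith) hk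
    gcongr
  have hp : ∀ k, k + 1≤8 → V^k*μ≤1/V := by
    intro k hk
    rw [le_div_iff₀ hV0]
    have := hpow (k+1) hk
    calc V^k*μ*V = V^(k+1)*μ := by ring
      _≤1 := this
  have hpk : ∀ k, V^k*μ*1000 ≤ V^(k+1)*μ := by
    intro k
    have : 0 ≤ V^k*μ := by positivity
    rw [pow_succ]; nlinarith
  have q0 := hpk 0
  have q1 := hpk 1
  have q2 := hpk 2
  have q3 := hpk 3
  have q4 := hpk 4
  have q5 := hpk 5
  have q6 := hpk 6
  norm_num only [pow_zero, one_mul] at q0 q1 q2 q3 q4 q5 q6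
  have hp7 := hp 7 (by norm_num)
  have h1V : 1/V≤1/1000 := by gcongr
  have ht0 : 0 < 1/V := by positivity
  have e1 : 0 < V^2*μ := by positivity
  set a := 6*V^2*μ with ha
  have ha0 : 0 ≤ a := by positivity
  obtain ⟨E, hE, hEa⟩ := lin_simple (D := V) (a := a) (M := n) hlam hr S.dω hω0 hμ
    (by linarith) hV0.le
    (fun k hk hk' => hL.small k (fun hd => by have := Nat.le_of_dvd (by omega) hd; omega) (by omega))
    (by rw [ha]; exact le_of_eq (by ring)) (by
      rw [ha]; calc 6*V^2*μ*V = 6*(V^3*μ) := by ring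
        _≤1 := by linarith)
  obtain ⟨φ, ω₂, S₂, hφ, hφ0, hφa, hω₂, hb, hO, -⟩ := lin_step hl (t := 1/V) S hκ hr le_rfl hn
    ht0 hμ (expS_jet hr S.dω n) hE ha0 hEa (by rw [ha]; linarith) (by linarith)
  have hA := stepA_coeff hl hn hr ht0 hμ0 S.dω hμ hφ hφ0 hφa (by linarith) hω₂ (fun x hx => (hb x hx).2) hO
  set r₂ := r*eR (-(2*(1/V))) with hr₂
  have hr₂0 : 0 < r₂ := by positivity
  have hr₂r : r₂ ≤ r*eR (-(1/V)) := by rw [hr₂]; gcongr; linarith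
  have hr₂r' : r₂ < r := exp_lt_self_mul hr (by linarith)
  have hb2 : ∀ x ∈ ball (0:ℂ) r₂, ‖ω₂ x‖≤50*V^2*μ := by
    intro x hx
    refine (hb x (ball_subset_ball hr₂r hx)).1.trans ?_
    rw [ha]; linarith
  have hκ1 : 1/2≤(1 - 2*a/(1/V))*(1 - 2*(25*V^4*μ)/(1/V)) := by
    have h1 : 2*a/(1/V) = 12*(V^3*μ) := by rw [ha]; field_simp; ring
    have h2 : 2*(25*V^4*μ)/(1/V) = 50*(V^5*μ) := by field_simp; ring
    rw [h1, h2]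
    have h3 : 50*(V^5*μ)≤1/10 := by linarith
    have h4 : 12*(V^3*μ)≤1/10 := by linarith
    nlinarith
  have hfac : 0≤1 - 2*a/(1/V) := by
    have h1 : 2*a/(1/V) = 12*(V^3*μ) := by rw [ha]; field_simp; ring
    rw [h1]; linarith
  obtain ⟨ψ, ω₃, S₃, hψ, hψ0, hψa, hω₃, hb3, hO3⟩ := stepL (a := 25*V^4*μ) (t := 1/V) hl hL h4 S₂ (mul_nonneg hκ hfac) hr₂0 le_rfl
    ht0 hb2 hO (le_of_eq (by ring)) (by linarith) (by linarith)
  have hr3 : r₂*eR (-(2*(1/V))) = r*eR (-(4/V)) := by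
    rw [hr₂, mul_assoc, ← Real.exp_add]; ring_nf
  rw [hr3] at S₃
  have hr3' : r*eR (-(4/V)) ≤ r₂*eR (-(1/V)) := by
    rw [← hr3]; gcongr; linarith
  have hr3'' : r*eR (-(4/V)) ≤ r₂ := hr3'.trans (exp_lt_self_mul hr₂0 ht0).le
  refine ⟨fun x => ψ x + φ (x*eC (ψ x)), ω₃, tc n ω₂, ?_, ?_, ?_, hO3, ?_⟩
  · have := S₃.mono_κ (κ' := κ/2) (by rw [mul_assoc]; nlinarith)
    convert this using 2 with x
    rw [Complex.exp_add]; ring_nf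
  · intro x hx
    have h1 := hψa x (ball_subset_ball hr3'' hx)
    have h2 : x*eC (ψ x) ∈ ball (0:ℂ) r := by
      have h3 := norm_mul_exp_le (x := x) h1
      rw [mem_ball_zero_iff] at hx ⊢
      refine h3.trans_lt ?_
      calc _ < r*eR (-(4/V))*eR (2*(25*V^4*μ)) := by gcongr
        _ = r*eR (-(4/V) + 2*(25*V^4*μ)) := by rw [mul_assoc, ← Real.exp_add]
        _ ≤ r*1 := by
          refine mul_le_mul_of_nonneg_left ?_ hr.le
          rw [Real.exp_le_one_iff]
          have : 4/V = 4*(1/V) := by ring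
          linarith
        _ = r := mul_one r
    have h3 := hφa _ h2
    have h5 := norm_add_le (ψ x) (φ (x*eC (ψ x)))
    rw [ha] at h3
    linarith
  · intro x hx
    have h1 := hb3 x (ball_subset_ball hr3' hx)
    linarith
  · refine hA.trans ?_
    rw [add_div]
    have hrn : 0 < r^n := by positivity
    have hn'0 : (0:ℝ) < n' := by exact_mod_cast hL.pos.trans hL.lt
    refine add_le_add ?_ ?_
    · gcongr
      calc 2*a*‖lam^n - 1‖≤2*a*(7/n') := by gcongr; exact hL.up
        _ = _ := by rw [ha]; ring
    · have : (r*eR (-(2*(1/V))))^n = r^n*eR (-2) := by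
        rw [mul_pow, ← Real.exp_nat_mul]; congr 2
        rw [← hVd]; field_simp
      rw [this, div_le_div_iff₀ (by positivity) hrn]
      have h9 : 1/9 ≤ eR (-2) := by
        rw [Real.exp_neg, one_div]
        refine inv_anti₀ (Real.exp_pos _) ?_
        have := Real.exp_one_lt_d9
        have h8 : eR 2 = eR 1*eR 1 := by rw [← Real.exp_add]; norm_num
        rw [h8]; nlinarith [Real.exp_pos 1]
      have h10 : μ/(1/V)*(2*a) = 12*V^3*μ^2 := by rw [ha]; field_simp; ring
      rw [h10]
      have h11 : 0 ≤ V^3*μ^2*r^n := by positivity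
      calc 12*V^3*μ^2*r^n = 108*(1/9)*(V^3*μ^2*r^n) := by ring
        _≤108*eR (-2)*(V^3*μ^2*r^n) := by gcongr
        _ = _ := by ring

/-- exponent of the Möbius type change of variables -/
noncomputable def mob (n : ℕ) (B:ℂ) (x:ℂ) : ℂ := -(1/(n:ℂ))*Complex.log (1 - B*x^n)

lemma mob_slit {n : ℕ} {B x : ℂ} (h : ‖B*x^n‖ < 1) : 0 < (1 - B*x^n).re := by
  have := (Complex.abs_re_le_norm _).trans_lt h
  rw [abs_lt] at this
  simp only [Complex.sub_re, Complex.one_re]; linarith [this.2]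

lemma mob_exp {n : ℕ} (hn : 0 < n) {B x : ℂ} (h : ‖B*x^n‖ < 1) :
    eC (-(n:ℂ)*mob n B x) = 1 - B*x^n := by
  have hn' : (n:ℂ) ≠ 0 := by exact_mod_cast hn.ne'
  have h0 : 1 - B*x^n ≠ 0 := by
    intro hc
    have := mob_slit h
    rw [hc] at this; simp at this
  rw [mob, show -(n:ℂ)*(-(1/(n:ℂ))*Complex.log (1 - B*x^n)) = Complex.log (1 - B*x^n) by field_simp,
    Complex.exp_log h0]

lemma mob_pow {n : ℕ} (hn : 0 < n) {B x : ℂ} (h : ‖B*x^n‖ < 1) :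
    (x*eC (mob n B x))^n = x^n/(1 - B*x^n) := by
  rw [← mob_exp hn h, mul_pow, ← Complex.exp_nat_mul, neg_mul, Complex.exp_neg, div_inv_eq_mul]

lemma mob_im {n : ℕ} (hn : 0 < n) {B x : ℂ} (h : ‖B*x^n‖ < 1) : n*|(mob n B x).im| < Real.pi/2 := by
  have h1 := Complex.abs_arg_lt_pi_div_two_iff.2 (Or.inl (mob_slit h))
  have hn' : (0:ℝ) < n := by exact_mod_cast hn
  have : (mob n B x).im = -(1/(n:ℝ))*(1 - B*x^n).arg := by
    rw [mob, ← Complex.log_im, show -(1/(n:ℂ)) = ((-(1/(n:ℝ)) : ℝ) : ℂ) by push_cast; ring, Complex.im_ofReal_mul]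
  rw [this, abs_mul, abs_neg, abs_of_pos (by positivity)]
  calc (n:ℝ)*(1/n*|(1 - B*x^n).arg|) = |(1 - B*x^n).arg| := by field_simp
    _ < _ := h1

lemma mob_deriv {n : ℕ} (hn : 0 < n) {B x : ℂ} (h : ‖B*x^n‖ < 1) :
    DifferentiableAt ℂ (mob n B) x ∧ 1 + x*deriv (mob n B) x = 1/(1 - B*x^n) := by
  have hn' : (n:ℂ) ≠ 0 := by exact_mod_cast hn.ne'
  have hs : 1 - B*x^n ∈ Complex.slitPlane := Or.inl (mob_slit h)
  have h0 := Complex.slitPlane_ne_zero hs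
  have h1 : HasDerivAt (fun x => 1 - B*x^n) (-(B*(n*x^(n-1)))) x := by
    simpa using ((hasDerivAt_pow n x).const_mul B).const_sub 1
  have h2 : HasDerivAt (mob n B) (-(1/(n:ℂ))*(-(B*(n*x^(n-1)))/(1 - B*x^n))) x :=
    (h1.clog hs).const_mul _
  refine ⟨h2.differentiableAt, ?_⟩
  rw [h2.deriv]
  have h3 : x*x^(n-1) = x^n := by
    rw [← pow_succ']; congr 1; omega
  have h4 : x*(-(1/(n:ℂ))*(-(B*(n*x^(n-1)))/(1 - B*x^n))) = B*(x*x^(n-1))/(1 - B*x^n) := by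
    field_simp
  rw [h4, h3]; field_simp; ring

lemma exp_eq_small {n : ℕ} (hn : 0 < n) {p q : ℂ} (h : eC (-(n:ℂ)*p) = eC (-(n:ℂ)*q))
    (him : n*|(p - q).im| < 2*Real.pi) : p = q := by
  have hn0 : (n:ℂ) ≠ 0 := by exact_mod_cast hn.ne'
  rw [Complex.exp_eq_exp_iff_exists_int] at h
  obtain ⟨k, hk⟩ := h
  have h1 : (n:ℂ)*(p - q) = -(k*(2*Real.pi*Complex.I)) := by linear_combination -hk
  have h2 : (n:ℝ)*(p - q).im = -(k*(2*Real.pi)) := by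
    have := congrArg Complex.im h1
    simpa using this
  have h3 : |(k:ℝ)| * (2*Real.pi) < 2*Real.pi := by
    have h4 : |(n:ℝ)*(p - q).im| = |(k:ℝ)| * (2*Real.pi) := by
      rw [h2, abs_neg, abs_mul, abs_of_pos Real.two_pi_pos]
    rw [← h4, abs_mul, abs_of_nonneg (by positivity)]; exact him
  have h5 : |(k:ℝ)| < 1 := by
    have := Real.two_pi_pos
    nlinarith
  have h6 : k = 0 := by
    have : |k| < 1 := by exact_mod_cast h5
    exact Int.abs_lt_one_iff.1 this
  rw [h6] at h1
  simp [hn0] at h1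
  exact sub_eq_zero.1 h1

set_option maxHeartbeats 1600000 in
lemma mobius {lam : ℂ} (hl : ‖lam‖ = 1) {u χ ω : ℂ → ℂ} {r κ m ϑ e s : ℝ} {n : ℕ} {A B : ℂ} (hn : 0 < n)
    (S : Sys lam u r κ χ ω) (hκ : 0 ≤ κ) (hr : 0 < r)
    (hm : ∀ x ∈ ball (0:ℂ) r, ‖ω x‖ ≤ m) (hO : (fun x => ω x - A*x^n) =O[𝓝 0] (fun x : ℂ => x^(2*n)))
    (hnm : n*m≤1/8) (hB : B*(lam^n - 1) = n*A) (hϑ : ϑ*(‖B‖*r^n) = 1) (he : 0 < e)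
    (hϑe : ϑ ≤ e) (hϑ0 : 0 < ϑ) (hϑ1 : ϑ≤1) (hs : 0 < s) (hs' : ‖B‖*s^n≤1 - e) :
    ∃ ω' : ℂ → ℂ, Sys lam u s (κ*(1/2)) (fun x => mob n B x + χ (x*eC (mob n B x))) ω' ∧
      ω' 0 = 0 ∧ ∀ x ∈ ball (0:ℂ) s, ‖ω' x‖≤5*m*ϑ^2/‖1 - B*x^n‖ := by
  have hnR : (0:ℝ) < n := by exact_mod_cast hn
  have hm0 : 0 ≤ m := (norm_nonneg _).trans (hm 0 (by simpa using hr))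
  have hnC : (n:ℂ) ≠ 0 := by exact_mod_cast hn.ne'
  have hBn : 0 < ‖B‖ := by
    rcases (norm_nonneg B).eq_or_lt with h | h
    · rw [← h] at hϑ; simp at hϑ
    · exact h
  -- basic estimates on the ball
  have hy : ∀ x ∈ ball (0:ℂ) s, ‖B*x^n‖ < 1 - e := by
    intro x hx
    rw [mem_ball_zero_iff] at hx
    rw [norm_mul, norm_pow]
    refine lt_of_lt_of_le ?_ hs'
    gcongr
  have hy1 : ∀ x ∈ ball (0:ℂ) s, ‖B*x^n‖ < 1 := fun x hx => (hy x hx).trans (by linarith)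
  have hlow : ∀ x ∈ ball (0:ℂ) s, e < ‖1 - B*x^n‖ := by
    intro x hx
    have h1 := hy x hx
    have h2 := norm_sub_norm_le (1:ℂ) (B*x^n)
    rw [norm_one] at h2; linarith
  set T : ℂ → ℂ := fun x => x*eC (mob n B x) with hT
  have hTn : ∀ x ∈ ball (0:ℂ) s, (‖T x‖/r)^n ≤ ϑ/‖1 - B*x^n‖ := by
    intro x hx
    rw [div_pow, ← norm_pow, hT]
    simp only
    rw [mob_pow hn (hy1 x hx), norm_div]
    have h1 := hy1 x hx
    rw [norm_mul] at h1
    have h2 : 0 < ‖1 - B*x^n‖ := he.trans (hlow x hx)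
    rw [div_div, div_le_div_iff₀ (by positivity) h2]
    have h3 : ‖x^n‖ ≤ ϑ*r^n := by
      have h5 : ‖B‖*‖x^n‖≤‖B‖*(ϑ*r^n) := by
        calc _≤1 := h1.le
          _ = ‖B‖*(ϑ*r^n) := by rw [← hϑ]; ring
      exact le_of_mul_le_mul_left h5 hBn
    nlinarith
  have hTin : ∀ x ∈ ball (0:ℂ) s, T x ∈ ball (0:ℂ) r := by
    intro x hx
    have h1 := hTn x hx
    have h2 : ϑ/‖1 - B*x^n‖ < 1 := by
      rw [div_lt_one (he.trans (hlow x hx))]; linarith [hlow x hx]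
    rw [mem_ball_zero_iff]
    by_contra hc
    have h3 : 1≤‖T x‖/r := by rw [one_le_div hr]; linarith
    have := one_le_pow₀ (n := n) h3
    linarith
  -- remainder
  set R : ℂ → ℂ := fun X => eC (-(n:ℂ)*ω X) - 1 + n*A*X^n with hR
  have hnω : ∀ X ∈ ball (0:ℂ) r, ‖-(n:ℂ)*ω X‖ ≤ n*m := by
    intro X hX
    rw [norm_mul, norm_neg, Complex.norm_natCast]
    gcongr
    exact hm X hX
  have hA : ‖A‖*r^n ≤ m := by
    have h1 : tc n ω = A := by
      have hj : HasJet (2*n) ω (PowerSeries.C A*PowerSeries.X^n) := by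
        unfold HasJet
        refine hO.congr_left fun x => ?_
        rw [eval_trunc]
        congr 1
        simp only [PowerSeries.coeff_C_mul, PowerSeries.coeff_X_pow]
        rw [Finset.sum_eq_single n]
        · simp
        · intro b _ hb; simp [hb]
        · intro h; exact absurd (Finset.mem_range.2 (by omega)) h
      rw [tc_eq_of_hasJet hr S.dω hj (by omega : n < 2*n)]
      simp [PowerSeries.coeff_X_pow]
    have h2 := norm_tc_le hr S.dω hm n
    rw [h1, le_div_iff₀ (by positivity)] at h2
    exact h2
  have hω0 : ω 0 = 0 := by
    have := isBigO_zero_val (by omega) hO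
    simpa [hn.ne'] using this
  have hRb : ∀ X ∈ ball (0:ℂ) r, ‖R X‖≤3*(n*m) := by
    intro X hX
    have h1 := norm_exp_sub_one_le_two ((hnω X hX).trans (by linarith))
    have h2 : ‖(n:ℂ)*A*X^n‖ ≤ n*m := by
      rw [mem_ball_zero_iff] at hX
      rw [norm_mul, norm_mul, Complex.norm_natCast, norm_pow, mul_assoc]
      gcongr
      exact le_trans (by gcongr) hA
    have h3 := norm_add_le (eC (-(n:ℂ)*ω X) - 1) ((n:ℂ)*A*X^n)
    have h4 := hnω X hX
    calc ‖R X‖≤_ := h3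
      _≤_ := by linarith
  have hRd : DifferentiableOn ℂ R (ball 0 r) := by
    have := S.dω
    fun_prop
  have hωn : ω =O[𝓝 0] (fun x : ℂ => x^n) := by
    have h1 : (fun x : ℂ => A*x^n) =O[𝓝 0] (fun x : ℂ => x^n) := (isBigO_refl _ _).const_mul_left _
    have := (hO.trans (isBigO_pow_mono (by omega : n≤2*n))).add h1
    exact this.congr_left fun x => by ring
  have hRO : R =O[𝓝 0] (fun x : ℂ => x^(2*n)) := by
    have hcω : ContinuousAt ω 0 := S.dω.continuousOn.continuousAt (ball_mem_nhds _ hr)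
    have tω : Tendsto (fun x => -(n:ℂ)*ω x) (𝓝 0) (𝓝 0) := by
      have : ContinuousAt (fun x => -(n:ℂ)*ω x) 0 := by fun_prop
      simpa [hω0] using this.tendsto
    have hg : (fun z : ℂ => eC z - 1 - z) =O[𝓝 0] (fun z : ℂ => z^2) := by
      refine IsBigO.of_bound 1 ?_
      filter_upwards [ball_mem_nhds (0:ℂ) one_pos] with z hz
      rw [mem_ball_zero_iff] at hz
      rw [one_mul, norm_pow]
      exact Complex.norm_exp_sub_one_sub_id_le hz.le
    have h1 := hg.comp_tendsto tω
    have h2 : (fun x => (-(n:ℂ)*ω x)^2) =O[𝓝 0] (fun x : ℂ => x^(2*n)) := by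
      have := (hωn.const_mul_left (-(n:ℂ))).pow 2
      refine this.congr_right fun x => by rw [← pow_mul, mul_comm]
    have h3 := (h1.trans h2).add (hO.const_mul_left (-(n:ℂ)))
    refine h3.congr_left fun x => ?_
    simp only [Function.comp, hR]; ring
  have hRv := vanish (by omega) hRd hRb hRO
  set z : ℂ → ℂ := fun x => (1 - B*x^n)*R (T x) with hz
  have hzb : ∀ x ∈ ball (0:ℂ) s, ‖z x‖≤3*(n*m)*ϑ^2/‖1 - B*x^n‖ := by
    intro x hx
    have h1 := hRv _ (hTin x hx)
    have h2 := hTn x hx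
    have h3 : 0 < ‖1 - B*x^n‖ := he.trans (hlow x hx)
    rw [hz]; simp only
    rw [norm_mul, le_div_iff₀ h3]
    calc ‖1 - B*x^n‖*‖R (T x)‖*‖1 - B*x^n‖
       ≤‖1 - B*x^n‖*(3*(n*m)*(ϑ/‖1 - B*x^n‖)^2)*‖1 - B*x^n‖ := by
          gcongr
          refine h1.trans ?_
          rw [mul_comm 2 n, pow_mul]
          gcongr
      _ = _ := by field_simp
  have hzs : ∀ x ∈ ball (0:ℂ) s, ‖z x‖≤3/8 := by
    intro x hx
    refine (hzb x hx).trans ?_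
    have h3 := hlow x hx
    rw [div_le_iff₀ (he.trans h3)]
    calc 3*(n*m)*ϑ^2 = 3*(n*m)*ϑ*ϑ := by ring
      _≤3*(1/8)*1*‖1 - B*x^n‖ := by gcongr; linarith
      _ = _ := by ring
  have hslit : ∀ x ∈ ball (0:ℂ) s, 1 + z x ∈ Complex.slitPlane := by
    intro x hx
    left
    have h2 := (Complex.abs_re_le_norm _).trans (hzs x hx)
    rw [abs_le] at h2
    simp only [Complex.add_re, Complex.one_re]; linarith
  set ω' : ℂ → ℂ := fun x => -(1/(n:ℂ))*Complex.log (1 + z x) with hω'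
  have hTd : DifferentiableOn ℂ T (ball 0 s) := by
    intro x hx
    have := (mob_deriv hn (hy1 x hx)).1
    have h2 : DifferentiableAt ℂ T x := by rw [hT]; fun_prop
    exact h2.differentiableWithinAt
  have hzd : DifferentiableOn ℂ z (ball 0 s) := by
    refine DifferentiableOn.mul (by fun_prop) (hRd.comp hTd hTin)
  have hω'd : DifferentiableOn ℂ ω' (ball 0 s) :=
    ((hzd.const_add 1).clog hslit).const_mul _
  have hω'b : ∀ x ∈ ball (0:ℂ) s, n*‖ω' x‖≤3/2*‖z x‖ := by
    intro x hx
    have h1 := Complex.norm_log_one_add_half_le_self (z := z x) ((hzs x hx).trans (by norm_num))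
    rw [hω']; simp only
    rw [norm_mul, norm_neg, norm_div, norm_one, Complex.norm_natCast]
    calc (n:ℝ)*(1/n*‖Complex.log (1 + z x)‖) = ‖Complex.log (1 + z x)‖ := by field_simp
      _≤_ := h1
  have hω'e : ∀ x ∈ ball (0:ℂ) s, eC (-(n:ℂ)*ω' x) = 1 + z x := by
    intro x hx
    rw [hω']; simp only
    rw [show -(n:ℂ)*(-(1/(n:ℂ))*Complex.log (1 + z x)) = Complex.log (1 + z x) by field_simp,
      Complex.exp_log (Complex.slitPlane_ne_zero (hslit x hx))]
  refine ⟨ω', ?_, ?_, ?_⟩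
  · refine S.trans hκ ?_ hω'd ?_ hTin ?_ ?_ ?_
    · intro x hx
      exact (mob_deriv hn (hy1 x hx)).1.differentiableWithinAt
    · simp [mob, hn.ne']
    · intro x hx x' hx' hxx
      have hxx : x*eC (mob n B x) = x'*eC (mob n B x') := hxx
      have h1 := congrArg (·^n) hxx
      rw [mob_pow hn (hy1 x hx), mob_pow hn (hy1 x' hx')] at h1
      have n1 : 1 - B*x^n ≠ 0 := by
        have := he.trans (hlow x hx)
        exact norm_pos_iff.1 this
      have n2 : 1 - B*x'^n ≠ 0 := by
        have := he.trans (hlow x' hx')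
        exact norm_pos_iff.1 this
      rw [div_eq_div_iff n1 n2] at h1
      have h2 : x^n = x'^n := by linear_combination h1
      have h3 : mob n B x = mob n B x' := by rw [mob, mob, h2]
      rw [h3] at hxx
      exact mul_right_cancel₀ (Complex.exp_ne_zero _) hxx
    · intro x hx
      rw [(mob_deriv hn (hy1 x hx)).2, norm_div, norm_one]
      have h3 : 0 < ‖1 - B*x^n‖ := he.trans (hlow x hx)
      rw [div_le_div_iff₀ (by norm_num) h3]
      have h1 := norm_sub_le (1:ℂ) (B*x^n)
      have h2 := hy1 x hx
      rw [norm_one] at h1; linarith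
    · intro x hx hx'
      refine exp_eq_small hn ?_ ?_
      · rw [mul_add, mul_add, Complex.exp_add, Complex.exp_add, mob_exp hn (hy1 x hx), mob_exp hn (hy1 _ hx'), hω'e x hx]
        have h1 : (lam*x*eC (ω' x))^n*(1 + z x) = lam^n*x^n := by
          rw [← hω'e x hx, mul_pow, mul_pow, ← Complex.exp_nat_mul, mul_assoc, ← Complex.exp_add]
          simp
        have h2 : eC (-(n:ℂ)*ω (x*eC (mob n B x))) = 1 - n*A*(T x)^n + R (T x) := by
          rw [hR]; simp only [hT]; ring
        have h3 : (1 - B*x^n)*(T x)^n = x^n := by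
          have n1 : 1 - B*x^n ≠ 0 := by
            have := he.trans (hlow x hx)
            exact norm_pos_iff.1 this
          simp only [hT]
          rw [mob_pow hn (hy1 x hx)]; field_simp
        rw [h2]
        have h4 : z x = (1 - B*x^n)*R (T x) := rfl
        have h5 : (1 + z x)*(1 - B*(lam*x*eC (ω' x))^n) = 1 + z x - B*(lam^n*x^n) := by
          rw [← h1]; ring
        rw [h5, h4]
        linear_combination (n*A)*h3 - x^n*hB
      · have i1 := mob_im hn (hy1 x hx)
        have i2 := mob_im hn (hy1 _ hx')
        have i3 := (Complex.abs_im_le_norm (ω' x))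
        have i4 := (Complex.abs_im_le_norm (ω (T x))).trans (hm _ (hTin x hx))
        have i5 := hω'b x hx
        have i6 := hzs x hx
        have i7 : (n:ℝ)*|(ω' x).im|≤9/16 := by
          calc (n:ℝ)*|(ω' x).im| ≤ n*‖ω' x‖ := by gcongr
            _≤_ := by linarith
        have i8 : (n:ℝ)*|(ω (T x)).im|≤1/8 := by
          calc (n:ℝ)*|(ω (T x)).im| ≤ n*m := by gcongr
            _≤_ := hnm
        have hpi := Real.pi_gt_three
        set p1 := (ω' x).im
        set p2 := (mob n B (lam*x*eC (ω' x))).im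
        set p3 := (mob n B x).im
        set p4 := (ω (T x)).im
        have e1 : (ω' x + mob n B (lam*x*eC (ω' x)) - (mob n B x + ω (x*eC (mob n B x)))).im
            = p1 + p2 - p3 - p4 := by
          simp only [Complex.sub_im, Complex.add_im]
          simp only [p1, p2, p3, p4, hT]; ring
        rw [e1]
        have e2 : |p1 + p2 - p3 - p4| ≤ |p1| + |p2| + |p3| + |p4| := by
          refine (abs_sub _ _).trans ?_
          gcongr
          refine (abs_sub _ _).trans ?_
          gcongr
          exact abs_add_le _ _
        calc (n:ℝ)*|p1 + p2 - p3 - p4| ≤ n*(|p1| + |p2| + |p3| + |p4|) := by gcongr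
          _ = n*|p1| + n*|p2| + n*|p3| + n*|p4| := by ring
          _ < _ := by linarith
  · have h1 : z 0 = 0 := by
      simp [hz, hR, hT, hω0, hn.ne']
    simp [hω', h1]
  · intro x hx
    have h1 := hω'b x hx
    have h2 := hzb x hx
    have h3 : 0 < ‖1 - B*x^n‖ := he.trans (hlow x hx)
    rw [le_div_iff₀ h3] at h2 ⊢
    have h4 : n*(‖ω' x‖*‖1 - B*x^n‖) ≤ n*(5*m*ϑ^2) := by
      calc n*(‖ω' x‖*‖1 - B*x^n‖) = (n*‖ω' x‖)*‖1 - B*x^n‖ := by ring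
        _≤(3/2*‖z x‖)*‖1 - B*x^n‖ := by gcongr
        _ = 3/2*(‖z x‖*‖1 - B*x^n‖) := by ring
        _≤3/2*(3*(n*m)*ϑ^2) := by gcongr
        _≤_ := by nlinarith [show 0 ≤ n*m*ϑ^2 by positivity]
    exact le_of_mul_le_mul_left h4 hnR

lemma hasJet_of_fps {f : ℂ → ℂ} {p : FormalMultilinearSeries ℂ ℂ ℂ} (hp : HasFPowerSeriesAt f p 0) (M : ℕ) :
    HasJet M f (PowerSeries.mk fun n => p.coeff n) := by
  have := hp.isBigO_sub_partialSum_pow M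
  simp only [zero_add] at this
  unfold HasJet
  have h2 : (fun x : ℂ => ‖x‖^M) =O[𝓝 0] fun x : ℂ => x^M := by
    refine IsBigO.of_bound 1 ?_
    filter_upwards with x; simp
  refine (this.trans h2).congr_left ?_
  intro x
  congr 1
  rw [FormalMultilinearSeries.partialSum, eval_trunc]
  refine Finset.sum_congr rfl fun k hk => ?_
  rw [FormalMultilinearSeries.apply_eq_pow_smul_coeff]
  simp [mul_comm]

lemma tc_L1 {f H : ℂ → ℂ} {R : ℝ} (hR : 0 < R) (hf : DifferentiableOn ℂ f (ball 0 R))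
    (hH : DifferentiableOn ℂ H (ball 0 R)) (hB : ∀ x ∈ ball (0:ℂ) R, ‖f x‖≤(H x).re) (n : ℕ) :
    ‖tc n f‖*R^n≤(H 0).re := by
  have h : ∀ s, 0 < s → s < R → ‖tc n f‖*s^n≤(H 0).re := by
    intro s hs hsR
    have hsub : closedBall (0:ℂ) s ⊆ ball 0 R := closedBall_subset_ball hsR
    have h1 : DiffContOnCl ℂ f (ball 0 s) := (hf.mono hsub).diffContOnCl_ball (subset_refl _)
    have h2 : DiffContOnCl ℂ H (ball 0 s) := (hH.mono hsub).diffContOnCl_ball (subset_refl _)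
    have hp := DiffContOnCl.hasFPowerSeriesOnBall (R := ⟨s, hs.le⟩) (c := 0) (f := f) h1 hs
    have hc : tc n f = (cauchyPowerSeries f 0 s).coeff n := by
      have := tc_eq_of_hasJet hR hf (hasJet_of_fps hp.hasFPowerSeriesAt (n+1)) (Nat.lt_succ_self n)
      rw [coeff_mk] at this; exact this
    have hle : ‖tc n f‖≤‖cauchyPowerSeries f 0 s n‖ := by
      rw [hc, FormalMultilinearSeries.coeff]
      refine (ContinuousMultilinearMap.le_opNorm _ _).trans ?_
      simp
    have hn := norm_cauchyPowerSeries_le f 0 s n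
    have hmv := DiffContOnCl.circleAverage (f := H) (c := 0) (R := s) (by rwa [abs_of_pos hs])
    have hcm : ∀ θ, circleMap 0 s θ ∈ ball (0:ℂ) R := fun θ => hsub (circleMap_mem_closedBall 0 hs.le θ)
    have hcf : Continuous fun θ => f (circleMap 0 s θ) :=
      hf.continuousOn.comp_continuous (continuous_circleMap 0 s) hcm
    have hcH : Continuous fun θ => H (circleMap 0 s θ) :=
      hH.continuousOn.comp_continuous (continuous_circleMap 0 s) hcm
    have hintg : (∫ θ in 0..2*Real.pi, ‖f (circleMap 0 s θ)‖) ≤ ∫ θ in 0..2*Real.pi, (H (circleMap 0 s θ)).re := by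
      refine intervalIntegral.integral_mono_on (by positivity) (hcf.norm.intervalIntegrable _ _)
        ((Complex.continuous_re.comp hcH).intervalIntegrable _ _) fun θ _ => hB _ (hcm θ)
    have hre : (∫ θ in 0..2*Real.pi, (H (circleMap 0 s θ)).re) = (∫ θ in 0..2*Real.pi, H (circleMap 0 s θ)).re := by
      have := Complex.reCLM.intervalIntegral_comp_comm (hcH.intervalIntegrable (μ := MeasureTheory.volume) 0 (2*Real.pi))
      simpa using this
    have hre2 : (2*Real.pi)⁻¹*(∫ θ in 0..2*Real.pi, H (circleMap 0 s θ)).re = (H 0).re := by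
      rw [← hmv, Real.circleAverage_def, Complex.smul_re, smul_eq_mul]
    rw [abs_of_pos hs] at hn
    calc ‖tc n f‖*s^n≤(((2*Real.pi)⁻¹*∫ θ in 0..2*Real.pi, ‖f (circleMap 0 s θ)‖)*s⁻¹^n)*s^n := by
          gcongr; exact hle.trans hn
      _ = (2*Real.pi)⁻¹*∫ θ in 0..2*Real.pi, ‖f (circleMap 0 s θ)‖ := by
          rw [mul_assoc, ← mul_pow, inv_mul_cancel₀ hs.ne', one_pow, mul_one]
      _≤(2*Real.pi)⁻¹*∫ θ in 0..2*Real.pi, (H (circleMap 0 s θ)).re := by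
          exact mul_le_mul_of_nonneg_left hintg (by positivity)
      _ = _ := by rw [hre, hre2]
  have hc : ContinuousWithinAt (fun s : ℝ => ‖tc n f‖*s^n) (Iio R) R := by fun_prop
  refine le_of_tendsto hc.tendsto ?_
  filter_upwards [Ioo_mem_nhdsLT hR] with s hs using h s hs.1 hs.2

/-- pointwise majorant of `1/|1-y|` by the real part of a holomorphic function -/
lemma pole_major {y : ℂ} {e Λ : ℝ} (he : 0 < e) (hy : ‖y‖≤1 - e) (hΛ : 1 ≤ Λ) (hΛe : eR (-Λ) ≤ e) :
    1/‖1 - y‖≤3*Λ*(eC (-((1 - 1/Λ : ℝ) : ℂ)*Complex.log (1 - y))).re := by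
  set z := 1 - y with hz
  have hzre : e ≤ z.re := by
    have := (Complex.abs_re_le_norm y)
    have h2 := le_abs_self y.re
    simp [hz]; linarith
  have hze : e≤‖z‖ := hzre.trans (Complex.re_le_norm z)
  have hz0 : 0 < ‖z‖ := by linarith
  have harg : |z.arg| ≤ Real.pi/2 := Complex.abs_arg_le_pi_div_two_iff.2 (by linarith)
  set ε := 1/Λ with hε
  have hΛ0 : 0 < Λ := by linarith
  have hε0 : 0 < ε := by positivity
  have hε1 : ε≤1 := by rw [hε, div_le_one hΛ0]; exact hΛ
  rw [Complex.exp_re]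
  have h1 : (-((1 - ε : ℝ) : ℂ)*Complex.log z).re = -(1 - ε)*Real.log ‖z‖ := by
    rw [← Complex.ofReal_neg, Complex.re_ofReal_mul, Complex.log_re]
  have h2 : (-((1 - ε : ℝ) : ℂ)*Complex.log z).im = -(1 - ε)*z.arg := by
    rw [← Complex.ofReal_neg, Complex.im_ofReal_mul, Complex.log_im]
  rw [h1, h2]
  have hcos : ε ≤ Real.cos (-(1 - ε)*z.arg) := by
    rw [← Real.cos_abs, abs_mul, abs_neg, abs_of_nonneg (by linarith : 0≤1 - ε)]
    have h3 : (1 - ε)*|z.arg|≤(1 - ε)*(Real.pi/2) := mul_le_mul_of_nonneg_left harg (by linarith)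
    have h4 : Real.cos ((1 - ε)*(Real.pi/2)) ≤ Real.cos ((1 - ε)*|z.arg|) := by
      apply Real.cos_le_cos_of_nonneg_of_le_pi _ _ h3
      · exact mul_nonneg (by linarith) (abs_nonneg _)
      · nlinarith [Real.pi_pos]
    refine le_trans ?_ h4
    rw [show (1 - ε)*(Real.pi/2) = Real.pi/2 - ε*(Real.pi/2) by ring, Real.cos_pi_div_two_sub]
    have := Real.mul_le_sin (x := ε*(Real.pi/2)) (by positivity) (by nlinarith [Real.pi_pos])
    calc ε = 2/Real.pi*(ε*(Real.pi/2)) := by field_simp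
      _≤_ := this
  have hexp : 1/(3*‖z‖) ≤ eR (-(1 - ε)*Real.log ‖z‖) := by
    have h5 : -Λ ≤ Real.log ‖z‖ := by
      rw [Real.le_log_iff_exp_le hz0]; linarith
    have h6 : -1 ≤ ε*Real.log ‖z‖ := by
      have := mul_le_mul_of_nonneg_left h5 hε0.le
      rw [hε] at this ⊢
      rw [show 1/Λ*-Λ = -1 by field_simp] at this
      exact this
    rw [show -(1 - ε)*Real.log ‖z‖ = ε*Real.log ‖z‖ + -Real.log ‖z‖ by ring, Real.exp_add, Real.exp_neg (Real.log _),
      Real.exp_log hz0, one_div, mul_inv]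
    gcongr
    refine le_trans ?_ (Real.exp_le_exp.2 h6)
    rw [Real.exp_neg]
    apply inv_anti₀ (Real.exp_pos _)
    have := Real.exp_one_lt_d9; linarith
  calc 1/‖z‖ = 3*Λ*(1/(3*‖z‖)*ε) := by rw [hε]; field_simp
    _≤_ := by gcongr

lemma expS_coeff_L1 {ω : ℂ → ℂ} {s K e Λ : ℝ} {B : ℂ} {n : ℕ} (hn : n ≠ 0) (hs : 0 < s) (hω : DifferentiableOn ℂ ω (ball 0 s))
    (hK0 : 0 ≤ K) (hK : ∀ x ∈ ball (0:ℂ) s, ‖ω x‖ ≤ K/‖1 - B*x^n‖) (he : 0 < e) (hB : ‖B‖*s^n≤1 - e)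
    (hΛ : 1 ≤ Λ) (hΛe : eR (-Λ) ≤ e) (hKe : K ≤ e) {j : ℕ} (hj : 1 ≤ j) :
    ‖coeff j (expS ω)‖*s^j≤6*K*Λ := by
  have hy : ∀ x ∈ ball (0:ℂ) s, ‖B*x^n‖≤1 - e := by
    intro x hx
    rw [mem_ball_zero_iff] at hx
    rw [norm_mul, norm_pow]
    refine le_trans ?_ hB
    gcongr
  have hre : ∀ x ∈ ball (0:ℂ) s, e≤(1 - B*x^n).re := by
    intro x hx
    have := (Complex.re_le_norm (B*x^n)).trans (hy x hx)
    rw [Complex.sub_re, Complex.one_re]; linarith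
  have h0 : DifferentiableOn ℂ (fun x => eC (ω x)) (ball 0 s) := by fun_prop
  have key := tc_L1 (f := fun x => eC (ω x) - 1)
    (H := fun x => ((6*K*Λ : ℝ) : ℂ)*eC (-((1 - 1/Λ : ℝ) : ℂ)*Complex.log (1 - B*x^n))) hs (by fun_prop) ?_ ?_ j
  · rw [tc_sub_const hs h0 1 hj] at key
    simp only [ne_eq, hn, not_false_eq_true, zero_pow, mul_zero, sub_zero, Complex.log_one, Complex.exp_zero, mul_one,
      Complex.ofReal_re] at key
    simpa [expS] using key
  · apply DifferentiableOn.const_mul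
    apply DifferentiableOn.cexp
    apply DifferentiableOn.const_mul
    apply DifferentiableOn.clog (by fun_prop)
    intro x hx
    exact Or.inl (he.trans_le (hre x hx))
  · intro x hx
    have h1 := hK x hx
    have hnorm : e≤‖1 - B*x^n‖ := (hre x hx).trans (Complex.re_le_norm _)
    have h2 : K/‖1 - B*x^n‖≤1 := by
      rw [div_le_one (by linarith)]; linarith
    refine (norm_exp_sub_one_le_two (h1.trans h2)).trans ?_
    have h3 := pole_major he (hy x hx) hΛ hΛe
    rw [Complex.re_ofReal_mul]
    calc 2*‖ω x‖≤2*(K*(1/‖1 - B*x^n‖)) := by rw [mul_one_div]; gcongr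
      _≤2*(K*(3*Λ*(eC (-((1 - 1/Λ : ℝ) : ℂ)*Complex.log (1 - B*x^n))).re)) := by gcongr
      _ = _ := by ring

lemma sum_inv_le {M n' : ℕ} (h : M ≤ n' + 1) (hn' : 1 ≤ n') : ∑ j ∈ Finset.Ico 1 M, (1/(j:ℝ))≤1 + Real.log n' := by
  calc ∑ j ∈ Finset.Ico 1 M, (1/(j:ℝ)) ≤ ∑ j ∈ Finset.Ico 1 (n' + 1), (1/(j:ℝ)) :=
        Finset.sum_le_sum_of_subset_of_nonneg (Finset.Ico_subset_Ico_right h) (fun i _ _ => by positivity)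
    _ = ((harmonic n' : ℚ) : ℝ) := by
        rw [harmonic_eq_sum_Icc]; push_cast
        refine Finset.sum_congr ?_ (fun i _ => by rw [one_div])
        rfl
    _≤_ := harmonic_le_one_add_log n'

set_option maxHeartbeats 1000000 in
lemma post {lam : ℂ} (hl : ‖lam‖ = 1) (hlam : ∀ k, 0 < k → lam^k ≠ 1) {u χ ω : ℂ → ℂ} {s κ K e a t Λ : ℝ} {n n' : ℕ} {B : ℂ}
    (S : Sys lam u s κ χ ω) (hκ : 0 ≤ κ) (hs : 0 < s) (hL : Level lam n n') (hω0 : ω 0 = 0) (hK0 : 0 ≤ K)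
    (hK : ∀ x ∈ ball (0:ℂ) s, ‖ω x‖ ≤ K/‖1 - B*x^n‖) (he : 0 < e) (hB : ‖B‖*s^n≤1 - e)
    (hΛ : 1 ≤ Λ) (hΛe : eR (-Λ) ≤ e) (hKe : K ≤ e)
    (ha : 12*n*n'*K*Λ*(1 + Real.log n') ≤ a) (ht : 0 < t) (hat : 16*a + 4*(K/e) ≤ t) (ht1 : t≤1/2) :
    ∃ φ ω' : ℂ → ℂ, Sys lam u (s/(1 + a)*eR (-(2*t))) (κ*(1 - 2*a/t))
        (fun x => φ x + χ (x*eC (φ x))) ω' ∧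
      (∀ x ∈ ball (0:ℂ) (s/(1 + a)*eR (-(2*t))), ‖ω' x‖≤(‖x‖/(s/(1 + a)*eR (-(2*t))))^((n' + 1)/2)) ∧
      (∀ y, ‖y‖*eR (4*a) < s/(1 + a)*eR (-t) → ∃ x, ‖x‖≤‖y‖*eR (4*a) ∧
        x*eC (φ x) = y) := by
  have hn0 : (0:ℝ) < n := by exact_mod_cast hL.pos
  have hn'1 : (1:ℝ) ≤ n' := by exact_mod_cast (by have := hL.pos; have := hL.lt; omega : 1 ≤ n')
  have hlog : 0 ≤ Real.log n' := Real.log_nonneg hn'1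
  have ha0 : 0 ≤ a := le_trans (by positivity) ha
  have hKe0 : 0 ≤ K/e := by positivity
  set M := (n' + 1)/2 with hM
  have hM0 : 0 < M := by have := hL.lt; have := hL.pos; omega
  set ρ := s/(1 + a) with hρd
  have hρ0 : 0 < ρ := by positivity
  have hρs : ρ ≤ s := div_le_self hs.le (by linarith)
  have hw0 := expS_zero hω0
  have hE := linSer_lin lam (expS ω) hlam hw0 M
  have hEa : ∑ k ∈ Finset.Ico 1 M, ‖coeff k (linSer lam (expS ω))‖*ρ^k ≤ a := by
    refine majorant hw0 hE hρ0.le ha0 (fun j => n*n'*(1/j)) (fun _ => by positivity) ?_ ?_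
    · intro j k hj hjk hk
      have hj0 : (0:ℝ) < j := by exact_mod_cast hj
      have hjk' : (j:ℝ) ≤ k := by exact_mod_cast hjk
      rw [mul_one_div, div_mul_eq_mul_div, le_div_iff₀ hj0, one_mul]
      by_cases hd : n ∣ k
      · obtain ⟨i, rfl⟩ := hd
        have hi : 1 ≤ i := by
          rcases Nat.eq_zero_or_pos i with rfl | h1
          · simp at hjk; omega
          · exact h1
        have := hL.res i hi (by rw [mul_comm i n]; omega)
        rw [mul_comm i n] at this
        refine hjk'.trans ?_
        push_cast
        calc (n:ℝ)*i ≤ n*(n'*‖lam^(n*i) - 1‖) := by gcongr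
          _ = _ := by ring
      · have := hL.small k hd (by omega)
        have hjn : (j:ℝ) ≤ n' := by exact_mod_cast (by omega : j ≤ n')
        calc (j:ℝ) ≤ n'*1 := by linarith
          _ ≤ n'*(n*‖lam^k - 1‖) := by gcongr
          _ = _ := by ring
    · refine le_trans ?_ ha
      calc _ ≤ ∑ j ∈ Finset.Ico 1 M, (n*n'*(6*K*Λ)*2)*(1/(j:ℝ)) := by
            refine Finset.sum_le_sum fun j hj => ?_
            rw [Finset.mem_Ico] at hj
            have h1 := expS_coeff_L1 hL.pos.ne' hs S.dω hK0 hK he hB hΛ hΛe hKe hj.1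
            have h2 : ρ^j*(1 + a)^(j + 1) = s^j*(1 + a) := by
              rw [pow_succ, ← mul_assoc, ← mul_pow, hρd, div_mul_cancel₀ _ (by positivity)]
            calc n*n'*(1/(j:ℝ))*‖coeff j (expS ω)‖*ρ^j*(1 + a)^(j + 1)
                = n*n'*(1/(j:ℝ))*‖coeff j (expS ω)‖*(ρ^j*(1 + a)^(j + 1)) := by ring
              _ = n*n'*(1/(j:ℝ))*(‖coeff j (expS ω)‖*s^j)*(1 + a) := by rw [h2]; ring
              _ ≤ n*n'*(1/(j:ℝ))*(6*K*Λ)*2 := by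
                  gcongr
                  linarith
              _ = _ := by ring
        _ = (n*n'*(6*K*Λ)*2)*∑ j ∈ Finset.Ico 1 M, (1/(j:ℝ)) := by rw [Finset.mul_sum]
        _≤(n*n'*(6*K*Λ)*2)*(1 + Real.log n') := by
            refine mul_le_mul_of_nonneg_left (sum_inv_le (by omega) (by exact_mod_cast hn'1)) (by positivity)
        _ = _ := by ring
  have hμ : ∀ x ∈ ball (0:ℂ) ρ, ‖ω x‖ ≤ K/e := by
    intro x hx
    refine (hK x (ball_subset_ball hρs hx)).trans ?_
    gcongr
    have hy : ‖B*x^n‖≤1 - e := by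
      have := ball_subset_ball hρs hx
      rw [mem_ball_zero_iff] at this
      rw [norm_mul, norm_pow]
      refine le_trans ?_ hB
      gcongr
    have := norm_sub_norm_le (1:ℂ) (B*x^n)
    rw [norm_one] at this
    linarith
  obtain ⟨φ, ω', S', hφ, hφ0, hφa, hω', hb, hO, hinv⟩ := lin_step hl (t := t) S hκ hρ0 hρs hM0 ht
    hμ (expS_jet hρ0 (S.dω.mono (ball_subset_ball hρs)) M) hE ha0 hEa hat ht1
  refine ⟨φ, ω', S', ?_, hinv⟩
  intro x hx
  have hr'ρ : ρ*eR (-(2*t)) ≤ ρ*eR (-t) := by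
    gcongr; linarith
  have := vanish (B := 1) hM0 S'.dω (fun x hx => (hb x (ball_subset_ball hr'ρ hx)).1.trans (by linarith)) hO x hx
  simpa using this

lemma pow_small {q : ℝ} (hq0 : 0 < q) (hq : q≤1/10000) {i j : ℕ} (h : i + 1 ≤ j) : 10000*q^j ≤ q^i := by
  have h1 : q^j ≤ q^(i + 1) := pow_le_pow_of_le_one hq0.le (by linarith) h
  have h2 : 10000*q≤1 := by linarith
  calc 10000*q^j≤10000*q^(i+1) := by linarith
    _ = q^i*(10000*q) := by ring
    _ ≤ q^i*1 := by gcongr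
    _ = _ := mul_one _

lemma omega_decay {ω : ℂ → ℂ} {r R L ν σ δ : ℝ} {N : ℕ} (hr : 0 < r)
    (hω : ∀ x ∈ ball (0:ℂ) r, ‖ω x‖≤(‖x‖/r)^N) (hν : 0 < ν) (hL : 200 ≤ L) (hLν : eR L = ν)
    (hN : ν≤2*N) (hσ : 2.5*L^2/ν ≤ σ) (hδ : δ = 6*L/ν) (hR : R ≤ r*eR (-σ)) (hR0 : 0 ≤ R) :
    ∀ x ∈ ball (0:ℂ) (R*eR (5*δ)), ‖ω x‖ ≤ ν⁻¹^200 := by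
  have hσδ : 400*L/ν ≤ σ - 5*δ := by
    have h1 : 400*L/ν + 5*δ = (430*L)/ν := by rw [hδ]; ring
    have h2 : (430*L)/ν≤2.5*L^2/ν := div_le_div_of_nonneg_right (by nlinarith) hν.le
    linarith
  have hpos : 0≤400*L/ν := by positivity
  have hRe : R*eR (5*δ) ≤ r*eR (-(σ - 5*δ)) := by
    calc R*eR (5*δ) ≤ r*eR (-σ)*eR (5*δ) := by gcongr
      _ = r*(eR (-σ)*eR (5*δ)) := by ring
      _ = _ := by rw [← Real.exp_add]; ring_nf
  intro x hx
  rw [mem_ball_zero_iff] at hx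
  have hx2 := hx.le.trans hRe
  have hxr : x ∈ ball (0:ℂ) r := by
    rw [mem_ball_zero_iff]
    refine hx.trans_le (hRe.trans ?_)
    have : eR (-(σ - 5*δ))≤1 := Real.exp_le_one_iff.2 (by linarith)
    nlinarith
  refine (hω x hxr).trans ?_
  calc (‖x‖/r)^N ≤ eR (-(σ - 5*δ))^N := by
        gcongr; rw [div_le_iff₀ hr]; linarith
    _ = eR (-(N*(σ - 5*δ))) := by rw [← Real.exp_nat_mul]; congr 1; ring
    _ ≤ eR (-(200*L)) := by
        rw [Real.exp_le_exp, neg_le_neg_iff]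
        calc 200*L = (ν/2)*(400*L/ν) := by field_simp; ring
          _ ≤ N*(σ - 5*δ) := by
            apply mul_le_mul _ hσδ hpos (by positivity); linarith
    _ = ν⁻¹^200 := by
        rw [Real.exp_neg, ← hLν, show (200:ℝ) = ((200:ℕ):ℝ) by norm_num, Real.exp_nat_mul, inv_pow]

set_option maxHeartbeats 1000000 in
lemma gain1 {lam : ℂ} (hl : ‖lam‖ = 1) (hlam : ∀ k, 0 < k → lam^k ≠ 1) {n n' : ℕ} {r σ L : ℝ} {u χ ω : ℂ → ℂ} {N : ℕ} {xa : ℂ}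
    (hL : Level lam n n') (hLd : eR L = n) (hL4 : 10000 ≤ L) (hnn : (n:ℝ)^116 ≤ n')
    (S : Sys lam u r (1/n) χ ω) (r0 : 0 < r) (r2 : r≤2) (hrn : 1/(n:ℝ) ≤ r)
    (hω : ∀ x ∈ ball (0:ℂ) r, ‖ω x‖≤(‖x‖/r)^N) (hN : n≤2*N)
    (hσ : 2.5*L^2/n ≤ σ) (hσ1 : 48*L/n≤1/2)
    (hxa : ‖xa‖ ≤ r*eR (-σ)) (arm : 3/2≤‖xa*eC (χ xa)‖) :
    ∃ (g Θ ω₃ : ℂ → ℂ) (A:ℂ), DifferentiableOn ℂ g (ball 0 1.05) ∧ g 0 = 0 ∧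
      (∀ z ∈ ball (0:ℂ) 1.05, ‖g z‖≤3*(n:ℝ)⁻¹^50) ∧
      Sys lam (fun z => u z + g z) (‖xa‖*eR (-((6*L + 4)/n))) (1/n/2) (fun x => Θ x + χ (x*eC (Θ x))) ω₃ ∧
      (∀ x ∈ ball (0:ℂ) (‖xa‖*eR (-((6*L + 4)/n))), ‖Θ x‖≤(n:ℝ)⁻¹^35) ∧
      (∀ x ∈ ball (0:ℂ) (‖xa‖*eR (-((6*L + 4)/n))), ‖ω₃ x‖≤(n:ℝ)⁻¹^35) ∧
      (fun x => ω₃ x - A*x^n) =O[𝓝 0] (fun x : ℂ => x^(2*n)) ∧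
      (n:ℝ)⁻¹^58/4≤‖A‖*‖xa‖^n := by
  set ν : ℝ := (n:ℝ) with hν
  have hν4 : 10000 ≤ ν := by
    rw [← hLd]; have := Real.add_one_le_exp L; linarith
  have hν0 : 0 < ν := by linarith
  set q := ν⁻¹ with hq
  have hq0 : 0 < q := by positivity
  have hq1 : q≤1/10000 := by rw [hq, inv_eq_one_div]; gcongr
  have hqν : q*ν = 1 := inv_mul_cancel₀ hν0.ne'
  have hN0 : 0 < N := by have := hL.pos; omega
  have hω0 : ω 0 = 0 := by
    have := hω 0 (by simpa using r0)
    simpa [hN0.ne'] using this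
  set δ := 6*L/ν with hδ
  have hdec := omega_decay (R := ‖xa‖) r0 hω hν0 (by linarith) hLd (by rw [hν]; exact_mod_cast hN) hσ hδ hxa (norm_nonneg _)
  set τ := q^50 with hτ
  set ε := q^200 with hε
  have hτ0 : 0 < τ := by positivity
  have hxa0 : 0 < ‖xa‖ := by
    rw [norm_pos_iff]; rintro rfl; simp at arm; norm_num at arm
  have hδσ : 8*δ ≤ σ := by
    refine le_trans ?_ hσ
    rw [hδ, mul_div_assoc']
    exact div_le_div_of_nonneg_right (by nlinarith) hν0.le
  obtain ⟨g, ω₁, hg, hg0, hgb, S₁, hω10, hω1b, hco⟩ := pole_pert hl S hν4 r0 hrn r2 hω0 (δ := δ) (ε := ε) (τ := τ) (xa := xa)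
    (by rw [hδ]; gcongr; linarith) (by
      rw [hδ]
      have : 6*L/ν≤48*L/ν := by gcongr; linarith
      linarith) (by
      calc ‖xa‖*eR (8*δ) ≤ r*eR (-σ)*eR (8*δ) := by gcongr
        _ = r*eR (-σ + 8*δ) := by rw [mul_assoc, ← Real.exp_add]
        _ ≤ r*eR 0 := mul_le_mul_of_nonneg_left (Real.exp_le_exp.2 (by linarith)) r0.le
        _ = r := by simp) (by positivity) (by
      rw [one_div, hε, ← hq]
      calc q^200 ≤ q^1 := pow_le_pow_of_le_one hq0.le (by linarith) (by norm_num)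
        _ = q := pow_one q) hdec arm hτ0 (by
      have := pow_small hq0 hq1 (i := 0) (j := 36) (by norm_num)
      calc 1024*τ*ν^14 = 1024*q^36*(q*ν)^14 := by rw [hτ]; ring
        _ = 1024*q^36 := by rw [hqν]; ring
        _≤1 := by nlinarith [pow_pos hq0 36])
  set μ := ε + 4*τ*ν^9 with hμ
  have hμq : μ = q^200 + 4*q^41 := by
    calc μ = q^200 + 4*q^41*(q*ν)^9 := by rw [hμ, hε, hτ]; ring
      _ = _ := by rw [hqν]; ring
  have hμ5 : μ≤5*q^41 := by
    have := pow_small hq0 hq1 (i := 41) (j := 200) (by norm_num)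
    rw [hμq]; nlinarith [pow_pos hq0 200]
  have hμ0 : 0 < μ := by rw [hμq]; positivity
  have hm : ν^5*μ ≤ q^35 := by
    have := pow_small hq0 hq1 (i := 35) (j := 36) (by norm_num)
    calc ν^5*μ ≤ ν^5*(5*q^41) := by gcongr
      _ = 5*q^36*(q*ν)^5 := by ring
      _ = 5*q^36 := by rw [hqν]; ring
      _≤_ := by nlinarith [pow_pos hq0 36]
  have h4 : 4*n ≤ n' := by
    have h1 : 4*ν ≤ n' := by
      refine le_trans ?_ hnn
      calc 4*ν ≤ ν*ν := by nlinarith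
        _ = ν^2 := by ring
        _ ≤ ν^116 := pow_le_pow_right₀ (by linarith) (by norm_num)
    rw [hν] at h1; exact_mod_cast h1
  have hr1 : 0 < ‖xa‖*eR (-δ) := by positivity
  obtain ⟨Θ, ω₃, A, S₃, hΘ, hω₃, hO, hA⟩ := stepAL hl hlam hL h4 (by linarith) S₁ (by positivity) hr1 hμ0 hω1b hω10 (by
      have := pow_small hq0 hq1 (i := 0) (j := 33) (by norm_num)
      calc ν^8*μ ≤ ν^8*(5*q^41) := by gcongr
      _ = 5*q^33*(q*ν)^8 := by ring
      _ = 5*q^33 := by rw [hqν]; ring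
      _≤_ := by nlinarith [pow_pos hq0 33])
  have hrad : ‖xa‖*eR (-δ)*eR (-(4/ν)) = ‖xa‖*eR (-((6*L + 4)/ν)) := by
    rw [mul_assoc, ← Real.exp_add, hδ]; ring_nf
  rw [hrad] at S₃ hΘ hω₃
  refine ⟨g, Θ, ω₃, A, hg, hg0, hgb, S₃, fun x hx => (hΘ x hx).trans hm, fun x hx => (hω₃ x hx).trans hm, hO, ?_⟩
  have hxn : 0 < ‖xa‖^n := by positivity
  have hco := hco n
  have he1 : ∀ c : ℝ, eR (c*δ)^n = eR (6*L)^c := by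
    intro c
    rw [← Real.exp_nat_mul, ← Real.exp_mul, hδ]
    congr 1
    rw [← hν]; field_simp
  have he6 : eR (6*L) = ν^6 := by
    rw [show (6:ℝ) = ((6:ℕ):ℝ) by norm_num, Real.exp_nat_mul, hLd]
  have he4 : eR (4*δ)^n = ν^24 := by
    rw [he1, he6, show (4:ℝ) = ((4:ℕ):ℝ) by norm_num, Real.rpow_natCast]; ring
  have hem : eR (-δ)^n = q^6 := by
    have := he1 (-1)
    rw [neg_one_mul, he6, Real.rpow_neg_one] at this
    rw [this, hq, inv_pow]
  rw [mul_pow, mul_pow, he4, hem] at hco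
  rw [mul_pow, hem] at hA
  -- multiply by |xa|^n
  have hco2 : q^58 - 2*q^63 - q^200 - q^70≤‖tc n ω₁‖*‖xa‖^n := by
    have := mul_le_mul_of_nonneg_right hco hxn.le
    refine le_trans (le_of_eq ?_) this
    have hνq : ν = q⁻¹ := by rw [hq, inv_inv]
    rw [hνq, hτ, hε]
    field_simp
  have hA2 : ‖A - tc n ω₁‖*‖xa‖^n≤(84*ν^2*μ/n' + 108*ν^3*μ^2)*ν^6 := by
    have := mul_le_mul_of_nonneg_right hA hxn.le
    refine le_trans this (le_of_eq ?_)
    have hνq : ν^6 = (q^6)⁻¹ := by rw [hq, inv_pow, inv_inv]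
    rw [← hν, hνq]
    generalize (84*ν^2*μ/(n':ℝ) + 108*ν^3*μ^2) = Z
    field_simp
  have hn'q : (n':ℝ)⁻¹ ≤ q^116 := by
    rw [hq, inv_pow]
    exact inv_anti₀ (by positivity) hnn
  have hA3 : (84*ν^2*μ/n' + 108*ν^3*μ^2)*ν^6≤420*q^149 + 2700*q^73 := by
    calc (84*ν^2*μ/n' + 108*ν^3*μ^2)*ν^6 ≤
        (84*ν^2*(5*q^41)*q^116 + 108*ν^3*(5*q^41)^2)*ν^6 := by
          rw [div_eq_mul_inv]; gcongr
      _ = 420*q^149*(q*ν)^8 + 2700*q^73*(q*ν)^9 := by ring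
      _ = _ := by rw [hqν]; ring
  have htri : ‖tc n ω₁‖ - ‖A - tc n ω₁‖≤‖A‖ := by
    have := norm_sub_norm_le (tc n ω₁) (tc n ω₁ - A)
    rw [sub_sub_cancel, norm_sub_rev (tc n ω₁) A] at this
    exact this
  have htri2 := mul_le_mul_of_nonneg_right htri hxn.le
  rw [sub_mul] at htri2
  have p1 := pow_small hq0 hq1 (i := 58) (j := 63) (by norm_num)
  have p2 := pow_small hq0 hq1 (i := 58) (j := 200) (by norm_num)
  have p3 := pow_small hq0 hq1 (i := 58) (j := 70) (by norm_num)
  have p4 := pow_small hq0 hq1 (i := 58) (j := 149) (by norm_num)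
  have p5 := pow_small hq0 hq1 (i := 58) (j := 73) (by norm_num)
  have p0 := pow_pos hq0 58
  linarith

/-- `ν^i≤10^4^{-(j-i)} ν^j` in multiplied form -/
lemma pow_big {ν : ℝ} (h : 10000 ≤ ν) {i j : ℕ} (hij : i + 1 ≤ j) : 10000*ν^i ≤ ν^j := by
  calc 10000*ν^i ≤ ν*ν^i := by gcongr
    _ = ν^(i + 1) := by ring
    _ ≤ ν^j := pow_le_pow_right₀ (by linarith) hij

lemma theta_exists {lam : ℂ} {n n' : ℕ} {r₃ R L : ℝ} {ω₃ : ℂ → ℂ} {A : ℂ} (hlam : ∀ k, 0 < k → lam^k ≠ 1)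
    (hL : Level lam n n') (hLd : eR L = n) (hν4 : 10000≤(n:ℝ)) (hn4 : 4*n ≤ n')
    (hR : 0 < R) (hr₃ : r₃ = R*eR (-((6*L + 4)/n)))
    (hω₃d : DifferentiableOn ℂ ω₃ (ball 0 r₃))
    (hω₃ : ∀ x ∈ ball (0:ℂ) r₃, ‖ω₃ x‖≤(n:ℝ)⁻¹^35)
    (hO : (fun x => ω₃ x - A*x^n) =O[𝓝 0] (fun x : ℂ => x^(2*n)))
    (hA : (n:ℝ)⁻¹^58/4≤‖A‖*R^n) :
    ∃ (B:ℂ) (ϑ:ℝ), B*(lam^n - 1) = n*A ∧ ϑ*(‖B‖*r₃^n) = 1 ∧ 0 < ϑ ∧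
      (n:ℝ)^34 ≤ ϑ*n' ∧ ϑ*n'≤(n:ℝ)^65 := by
  have hn := hL.pos
  set ν : ℝ := (n:ℝ) with hν
  have hν0 : 0 < ν := by linarith
  set q := ν⁻¹ with hq
  have hq0 : 0 < q := by positivity
  have hqν : q*ν = 1 := inv_mul_cancel₀ hν0.ne'
  have hq1 : q≤1/10000 := by rw [hq, inv_eq_one_div]; gcongr
  have hr0 : 0 < r₃ := by rw [hr₃]; positivity
  have hr₃n : r₃^n = R^n*(q^6*eR (-4)) := by
    rw [hr₃, mul_pow, ← Real.exp_nat_mul]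
    congr 1
    rw [show (n:ℝ)*-((6*L + 4)/ν) = -(6*L) + -4 by rw [← hν]; field_simp; ring, Real.exp_add, Real.exp_neg (6*L),
      show (6:ℝ) = ((6:ℕ):ℝ) by norm_num, Real.exp_nat_mul, hLd, hq, inv_pow]
  have hAtc : A = tc n ω₃ := by
    have h1 : HasJet (2*n) ω₃ (PowerSeries.C A*PowerSeries.X^n) := by
      unfold HasJet
      refine hO.congr_left ?_
      intro x
      rw [eval_trunc]
      congr 1
      rw [Finset.sum_eq_single n]
      · simp [PowerSeries.coeff_C_mul, PowerSeries.coeff_X_pow]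
      · intro b _ hb
        simp [PowerSeries.coeff_C_mul, PowerSeries.coeff_X_pow, hb]
      · intro h; exact absurd (Finset.mem_range.2 (by omega)) h
    rw [tc_eq_of_hasJet hr0 hω₃d h1 (k := n) (by omega)]
    simp [PowerSeries.coeff_C_mul, PowerSeries.coeff_X_pow]
  set α := ‖A‖*r₃^n with hα
  have hαup : α ≤ q^35 := by
    have := norm_tc_le hr0 hω₃d hω₃ n
    rw [← hAtc, le_div_iff₀ (by positivity)] at this
    exact this
  have he4 : 1/100 ≤ eR (-4) := by
    have h1 := Real.exp_one_lt_d9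
    rw [Real.exp_neg, one_div]
    apply inv_anti₀ (Real.exp_pos _)
    rw [show (4:ℝ) = ((4:ℕ):ℝ)*1 by norm_num, Real.exp_nat_mul]
    calc eR 1^4≤3^4 := by gcongr; linarith
      _≤100 := by norm_num
  have hαlo : q^65 ≤ α := by
    have p := pow_small hq0 hq1 (i := 64) (j := 65) (by norm_num)
    calc q^65 ≤ q^64/4*(1/100) := by nlinarith [pow_pos hq0 65]
      _ = (q^58/4)*(q^6*(1/100)) := by ring
      _≤(‖A‖*R^n)*(q^6*eR (-4)) := by gcongr
      _ = α := by rw [hα, hr₃n]; ring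
  have hα0 : 0 < α := lt_of_lt_of_le (by positivity) hαlo
  set d := ‖lam^n - 1‖ with hd
  have hlam1 : lam^n - 1 ≠ 0 := sub_ne_zero.2 (hlam n hn)
  have hd0 : 0 < d := norm_pos_iff.2 hlam1
  have hn'0 : (0:ℝ) < n' := by exact_mod_cast (by omega : 0 < n')
  have hdlo : 1 ≤ n'*d := by
    have := hL.res 1 le_rfl (by omega)
    simpa using this
  have hdup : d*n'≤7 := by
    have := hL.up
    rwa [le_div_iff₀ hn'0] at this
  refine ⟨n*A/(lam^n - 1), d/(ν*α), div_mul_cancel₀ _ hlam1, ?_, by positivity, ?_, ?_⟩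
  · rw [norm_div, norm_mul, Complex.norm_natCast, ← hd, ← hν]
    have hA0 : ‖A‖ ≠ 0 := by intro h; rw [hα, h, zero_mul] at hα0; exact lt_irrefl _ hα0
    have hrn : r₃^n ≠ 0 := by positivity
    rw [hα]; field_simp
  · rw [div_mul_eq_mul_div, le_div_iff₀ (by positivity)]
    calc ν^34*(ν*α) ≤ ν^34*(ν*q^35) := by gcongr
      _ = (q*ν)^35 := by ring
      _ = 1 := by rw [hqν]; norm_num
      _ ≤ d*n' := by linarith
  · rw [div_mul_eq_mul_div, div_le_iff₀ (by positivity)]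
    calc d*n' ≤ ν*1 := by linarith
      _ = ν*(q*ν)^65 := by rw [hqν]; norm_num
      _ = ν^65*(ν*q^65) := by ring
      _ ≤ ν^65*(ν*α) := by gcongr

/-- choice of the new arm tip -/
lemma tip {n : ℕ} (hn : 0 < n) {B xa : ℂ} {e b L : ℝ} (hB : B ≠ 0) (hxa : xa ≠ 0) (he : 0 < e)
    (hb : 1/(e*(‖B‖*‖xa‖^n)) = eR (-b)) (hb0 : 0 ≤ b) (hbL : b + 4 ≤ L) :
    ∃ w x : ℂ, ‖w‖ ≤ L/n ∧ w.re = -(b/n) ∧ ‖B‖*‖x‖^n = 1/(1 + e) ∧ x*eC (mob n B x) = xa*eC w := by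
  have hnC : (n:ℂ) ≠ 0 := by exact_mod_cast hn.ne'
  have hnR : (0:ℝ) < n := by exact_mod_cast hn
  set Q : ℂ := (1/(e:ℂ))/(B*xa^n) with hQ
  have heC : (e:ℂ) ≠ 0 := by exact_mod_cast he.ne'
  have hQ0 : Q ≠ 0 := by rw [hQ]; exact div_ne_zero (one_div_ne_zero heC) (mul_ne_zero hB (pow_ne_zero _ hxa))
  have hQn : ‖Q‖ = eR (-b) := by
    rw [← hb, hQ, norm_div, norm_div, norm_mul, norm_pow, norm_one, Complex.norm_real, Real.norm_of_nonneg he.le, div_div]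
  set w := Complex.log Q/n with hw
  have hwre : w.re = -(b/n) := by
    rw [hw, Complex.div_natCast_re, Complex.log_re, hQn, Real.log_exp]; ring
  have hwn : eC w^n = Q := by
    rw [← Complex.exp_nat_mul, hw, mul_div_cancel₀ _ hnC, Complex.exp_log hQ0]
  set X := xa*eC w with hX
  have hBX : B*X^n = 1/(e:ℂ) := by
    rw [hX, mul_pow, hwn, hQ]
    have := pow_ne_zero n hxa
    field_simp
  set c : ℝ := Real.log (e/(1 + e))/n with hc
  have hcn : eC (c:ℂ)^n = ((e/(1 + e) : ℝ) : ℂ) := by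
    rw [← Complex.exp_nat_mul, ← Complex.ofReal_natCast, ← Complex.ofReal_mul, ← Complex.ofReal_exp, hc,
      mul_div_cancel₀ _ hnR.ne', Real.exp_log (by positivity)]
  have hBx : B*(X*eC c)^n = ((1/(1 + e) : ℝ) : ℂ) := by
    rw [mul_pow, hcn, ← mul_assoc, hBX]
    have : (1 + (e:ℂ)) ≠ 0 := by exact_mod_cast (by positivity : (1 + e) ≠ 0)
    push_cast; field_simp
  refine ⟨w, X*eC c, ?_, hwre, ?_, ?_⟩
  · rw [hw, norm_div, Complex.norm_natCast]
    gcongr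
    refine (Complex.norm_le_abs_re_add_abs_im _).trans ?_
    rw [Complex.log_re, Complex.log_im, hQn, Real.log_exp, abs_neg, abs_of_nonneg hb0]
    have := Complex.abs_arg_le_pi Q
    have := Real.pi_le_four
    linarith
  · rw [← norm_pow, ← norm_mul, hBx, Complex.norm_real, Real.norm_of_nonneg (by positivity)]
  · have : mob n B (X*eC c) = -(c:ℂ) := by
      rw [mob, hBx, show (1:ℂ) - ((1/(1 + e) : ℝ) : ℂ) = ((e/(1 + e) : ℝ) : ℂ) by
        have : (1 + (e:ℂ)) ≠ 0 := by exact_mod_cast (by positivity : (1 + e) ≠ 0)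
        push_cast; field_simp; ring, ← Complex.ofReal_log (by positivity), hc]
      push_cast; ring
    rw [this, mul_assoc, ← Complex.exp_add, add_neg_cancel, Complex.exp_zero, mul_one]

lemma exp_le_one_add_two {y : ℝ} (hy : 0 ≤ y) (hy1 : y≤1/2) : eR y≤1 + 2*y := by
  have h1 := Real.add_one_le_exp (-y)
  have h2 : eR y*eR (-y) = 1 := by rw [← Real.exp_add]; simp
  have h3 := Real.exp_pos y
  have h4 : eR y*(1 - y)≤1 := by nlinarith
  nlinarith

/-- depth of the new arm tip -/
lemma depth {n : ℕ} (hn : 0 < n) {b x s e1 eb a t σ' : ℝ} (hb : 0 < b) (hx : 0 ≤ x) (hs : 0 < s) (h1 : b*x^n = 1/(1 + eb))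
    (h2 : b*s^n = 1 - e1) (ha : 0 ≤ a) (ht : 0 ≤ t) (hσ' : 0 ≤ σ') (he1 : 0 ≤ e1) (heb : 4*e1 ≤ eb) (heb1 : eb≤1)
    (hy : n*(5*a + 2*t + σ') ≤ eb/4) :
    x*eR (4*a) ≤ s/(1 + a)*eR (-(2*t))*eR (-σ') := by
  have hex : x*eR (4*a)*((1 + a)*eR (2*t + σ')) ≤ s := by
    have hle : x*eR (5*a + 2*t + σ') ≤ s := by
      refine le_of_pow_le_pow_left₀ hn.ne' hs.le ?_
      refine le_of_mul_le_mul_left ?_ hb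
      rw [mul_pow, ← mul_assoc, h1, h2, ← Real.exp_nat_mul, div_mul_eq_mul_div, one_mul, div_le_iff₀ (by linarith)]
      refine (exp_le_one_add_two (by positivity) (by linarith)).trans ?_
      nlinarith
    refine le_trans ?_ hle
    calc x*eR (4*a)*((1 + a)*eR (2*t + σ')) ≤
        x*eR (4*a)*(eR a*eR (2*t + σ')) := by
          have := Real.add_one_le_exp a
          gcongr; linarith
      _ = x*(eR (4*a)*eR a*eR (2*t + σ')) := by ring
      _ = _ := by rw [← Real.exp_add, ← Real.exp_add]; ring_nf
  rw [div_mul_eq_mul_div, div_mul_eq_mul_div, le_div_iff₀ (by linarith), mul_assoc s, ← Real.exp_add,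
    show -(2*t) + -σ' = -(2*t + σ') by ring, Real.exp_neg, ← div_eq_mul_inv, le_div_iff₀ (Real.exp_pos _)]
  linarith

set_option maxHeartbeats 1600000 in
lemma gain2 {lam : ℂ} (hl : ‖lam‖ = 1) (hlam : ∀ k, 0 < k → lam^k ≠ 1) {n n' : ℕ} {r₃ σ' L ϑ : ℝ} {u χ₃ ω₃ : ℂ → ℂ} {xa A B : ℂ}
    (hL : Level lam n n') (hLd : eR L = n) (hL4 : 10000 ≤ L) (hnn : (n:ℝ)^116 ≤ n') (hlog : Real.log n'≤(n:ℝ)^2)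
    (hxa : xa ≠ 0) (hr₃ : r₃ = ‖xa‖*eR (-((6*L + 4)/n)))
    (S : Sys lam u r₃ (1/n/2) χ₃ ω₃)
    (hω₃ : ∀ x ∈ ball (0:ℂ) r₃, ‖ω₃ x‖≤(n:ℝ)⁻¹^35)
    (hO : (fun x => ω₃ x - A*x^n) =O[𝓝 0] (fun x : ℂ => x^(2*n)))
    (hB : B*(lam^n - 1) = n*A) (hϑ : ϑ*(‖B‖*r₃^n) = 1) (hϑ0 : 0 < ϑ)
    (hϑ1 : (n:ℝ)^34 ≤ ϑ*n') (hϑ2 : ϑ*n'≤(n:ℝ)^65) (hσ' : 0 ≤ σ') (hσ'2 : σ'*n'≤5*Real.log n'^2) :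
    ∃ (χ' ω' : ℂ → ℂ) (r' : ℝ) (xb w : ℂ), 0 < r' ∧ r' ≤ r₃ ∧ Sys lam u r' (1/n') χ' ω' ∧
      (∀ x ∈ ball (0:ℂ) r', ‖ω' x‖≤(‖x‖/r')^((n' + 1)/2)) ∧ ‖xb‖ ≤ r'*eR (-σ') ∧
      ‖w‖≤55*L/n ∧ xa*eC w ∈ ball (0:ℂ) r₃ ∧
      xb*eC (χ' xb) = xa*eC w*eC (χ₃ (xa*eC w)) ∧
      r'^n*n'≤(n:ℝ)^65*r₃^n := by
  have hn := hL.pos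
  set ν : ℝ := (n:ℝ) with hν
  have hν4 : 10000 ≤ ν := by
    rw [← hLd]; have := Real.add_one_le_exp L; linarith
  have hν0 : 0 < ν := by linarith
  have hν1 : 1 ≤ ν := by linarith
  set q := ν⁻¹ with hq
  have hq0 : 0 < q := by positivity
  have hqν : q*ν = 1 := inv_mul_cancel₀ hν0.ne'
  have hq1 : q≤1/10000 := by rw [hq, inv_eq_one_div]; gcongr
  set N' : ℝ := (n' : ℝ) with hN'
  have hN'0 : 0 < N' := lt_of_lt_of_le (by positivity) hnn
  have hR0 : 0 < ‖xa‖ := norm_pos_iff.2 hxa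
  have hr0 : 0 < r₃ := by rw [hr₃]; positivity
  have hB0 : 0 < ‖B‖ := by
    rcases (norm_nonneg B).eq_or_lt with h | h
    · rw [← h] at hϑ; simp at hϑ
    · exact h
  have hsmall : ∀ k, k≤50 → 10000*(ϑ*ν^k)≤1 := by
    intro k hk
    have h1 : ϑ*ν^116 ≤ ν^65 := (by gcongr : ϑ*ν^116 ≤ ϑ*N').trans hϑ2
    have h2 : ϑ*ν^51≤1 := by
      refine le_of_mul_le_mul_right ?_ (pow_pos hν0 65)
      calc ϑ*ν^51*ν^65 = ϑ*ν^116 := by ring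
        _≤1*ν^65 := by linarith
    calc 10000*(ϑ*ν^k) = ϑ*(10000*ν^k) := by ring
      _ ≤ ϑ*ν^51 := by gcongr; exact pow_big hν4 (by omega)
      _≤1 := h2
  have hcomp : ∀ i j, i + 1 ≤ j → 10000*(ϑ*ν^i) ≤ ϑ*ν^j := by
    intro i j hij
    calc 10000*(ϑ*ν^i) = ϑ*(10000*ν^i) := by ring
      _≤_ := by gcongr; exact pow_big hν4 hij
  set e1 := ϑ*ν^2 with he1
  set eb := ϑ*ν^48 with heb
  set a := ϑ*ν^37 with ha
  set t := ϑ*ν^40 with ht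
  have he10 : 0 < e1 := by positivity
  have heb0 : 0 < eb := by positivity
  have ha0 : 0 < a := by positivity
  have ht0 : 0 < t := by positivity
  have he1s := hsmall 2 (by norm_num)
  have hebs := hsmall 48 (by norm_num)
  have hts := hsmall 40 (by norm_num)
  have hϑs := hsmall 0 (by norm_num)
  rw [← he1] at he1s
  rw [← heb] at hebs
  rw [← ht] at hts
  rw [pow_zero, mul_one] at hϑs
  have hϑe1 : ϑ ≤ e1 := by
    rw [he1]; exact le_mul_of_one_le_right hϑ0.le (one_le_pow₀ hν1)
  set s := r₃*(ϑ*(1 - e1))^((1:ℝ)/n) with hs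
  have hbase : 0 < ϑ*(1 - e1) := mul_pos hϑ0 (by linarith)
  have hs0 : 0 < s := by positivity
  have hsn : s^n = r₃^n*(ϑ*(1 - e1)) := by
    rw [hs, mul_pow, one_div, Real.rpow_inv_natCast_pow hbase.le hn.ne']
  have hBs : ‖B‖*s^n = 1 - e1 := by
    rw [hsn]
    calc ‖B‖*(r₃^n*(ϑ*(1 - e1))) = (ϑ*(‖B‖*r₃^n))*(1 - e1) := by ring
      _ = _ := by rw [hϑ, one_mul]
  have hsr : s ≤ r₃ := by
    refine mul_le_of_le_one_right hr0.le (Real.rpow_le_one hbase.le ?_ (by positivity))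
    nlinarith
  have hq35 : ν*q^35≤1/8 := by
    have := pow_small hq0 hq1 (i := 0) (j := 34) (by norm_num)
    calc ν*q^35 = q^34*(q*ν) := by ring
      _ = q^34 := by rw [hqν, mul_one]
      _≤1/8 := by rw [pow_zero] at this; linarith
  obtain ⟨ω₄, S₄, hω40, hω4⟩ := mobius hl hn S (by positivity) hr0 hω₃ hO hq35 hB hϑ he10 hϑe1 hϑ0 (by linarith) hs0 hBs.le
  set K := 5*q^35*ϑ^2 with hK
  have hK0 : 0 ≤ K := by positivity
  have hq35' : 5*q^35≤1 := by
    have := pow_small hq0 hq1 (i := 0) (j := 35) (by norm_num)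
    rw [pow_zero] at this; linarith [pow_pos hq0 35]
  have hKϑ : K ≤ ϑ*e1 := by
    calc K = 5*q^35*(ϑ*ϑ) := by rw [hK]; ring
      _≤1*(ϑ*e1) := by gcongr
      _ = _ := one_mul _
  have hKe1 : K/e1 ≤ ϑ := by rw [div_le_iff₀ he10]; exact hKϑ
  have hΛ1 : 1 ≤ Real.log N' := by
    rw [Real.le_log_iff_exp_le hN'0]
    refine le_trans ?_ hnn
    calc eR 1≤10000 := by have := Real.exp_one_lt_d9; linarith
      _ ≤ ν^1 := by simpa using hν4
      _ ≤ ν^116 := pow_le_pow_right₀ hν1 (by norm_num)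
  obtain ⟨φ, ω', S', hω', hinv⟩ := post hl hlam S₄ (by positivity) hs0 hL hω40 hK0 hω4 he10 hBs.le (a := a) (t := t) (Λ := Real.log N')
    hΛ1 (by
      rw [Real.exp_neg, Real.exp_log hN'0, ← one_div, div_le_iff₀ hN'0]
      calc (1:ℝ) ≤ ν^34*ν^2 := by
            rw [← pow_add]; exact one_le_pow₀ hν1
        _≤(ϑ*N')*ν^2 := by gcongr
        _ = e1*N' := by rw [he1]; ring) (by nlinarith) (by
      have h1 : 1 + Real.log N'≤2*ν^2 := by linarith [one_le_pow₀ hν1 (n := 2)]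
      have h2 : 120*ν^35 ≤ ν^37 := by
        have := pow_big hν4 (i := 35) (j := 37) (by norm_num)
        linarith [pow_pos hν0 35]
      calc 12*ν*N'*K*Real.log N'*(1 + Real.log N')≤12*ν*N'*K*ν^2*(2*ν^2) := by
            gcongr
        _ = 120*q^35*ν^5*ϑ*(ϑ*N') := by rw [hK]; ring
        _≤120*q^35*ν^5*ϑ*ν^65 := by gcongr
        _ = (q*ν)^35*(120*ν^35)*ϑ := by ring
        _ = (120*ν^35)*ϑ := by rw [hqν]; ring
        _ ≤ ν^37*ϑ := by gcongr
        _ = a := by rw [ha]; ring) ht0 (by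
      have h1 := hcomp 37 40 (by norm_num)
      have h2 := hcomp 0 40 (by norm_num)
      rw [pow_zero, mul_one] at h2
      rw [← ha, ← ht] at h1
      rw [← ht] at h2
      linarith) (by linarith)
  clear_value K
  -- the tip
  have hr₃n : r₃^n = ‖xa‖^n*eR (-(6*L + 4)) := by
    rw [hr₃, mul_pow, ← Real.exp_nat_mul]
    congr 2
    rw [← hν]; field_simp
  have hν48 : eR (48*L) = ν^48 := by
    rw [show (48:ℝ) = ((48:ℕ):ℝ) by norm_num, Real.exp_nat_mul, hLd]
  obtain ⟨w, x, hw, hwre, hBx, hxw⟩ := tip (L := 55*L) hn (norm_pos_iff.1 hB0) hxa heb0 (b := 54*L + 4) (by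
      have h1 : ‖B‖*‖xa‖^n = eR (6*L + 4)/ϑ := by
        rw [hr₃n] at hϑ
        rw [eq_div_iff hϑ0.ne']
        calc ‖B‖*‖xa‖^n*ϑ = (ϑ*(‖B‖*(‖xa‖^n*eR (-(6*L + 4)))))*eR (6*L + 4) := by
              rw [Real.exp_neg]; field_simp
          _ = _ := by rw [hϑ, one_mul]
      rw [h1, heb, ← hν48, show ϑ*eR (48*L)*(eR (6*L + 4)/ϑ) = eR (48*L)*eR (6*L + 4) by
        field_simp, ← Real.exp_add, one_div, ← Real.exp_neg]
      congr 1; ring) (by linarith) (by linarith)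
  have hXm : xa*eC w ∈ ball (0:ℂ) r₃ := by
    rw [mem_ball_zero_iff, norm_mul, Complex.norm_exp, hwre, hr₃]
    refine mul_lt_mul_of_pos_left (Real.exp_lt_exp.2 ?_) hR0
    rw [neg_lt_neg_iff]
    gcongr; linarith
  have hσν : ν*σ' ≤ ϑ*ν^1 := by
    have h1 : σ'*N' ≤ ϑ*N' := by
      refine hσ'2.trans (le_trans ?_ hϑ1)
      calc 5*Real.log N'^2≤5*(ν^2)^2 := by gcongr
        _ = 5*ν^4 := by ring
        _ ≤ ν^34 := by
          have := pow_big hν4 (i := 4) (j := 34) (by norm_num)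
          linarith [pow_pos hν0 4]
    have h2 := le_of_mul_le_mul_right h1 hN'0
    rw [pow_one]; nlinarith
  have hdepth := depth hn (a := a) (t := t) hB0 (norm_nonneg x) hs0 hBx hBs ha0.le ht0.le hσ' he10.le (by
      have := hcomp 2 48 (by norm_num)
      rw [← heb, ← he1] at this
      linarith) (by linarith) (by
      have h1 := hcomp 38 48 (by norm_num)
      have h2 := hcomp 41 48 (by norm_num)
      have h3 := hcomp 1 48 (by norm_num)
      have e1 : (n:ℝ)*(5*a + 2*t + σ') = 5*(ϑ*ν^38) + 2*(ϑ*ν^41) + ν*σ' := by rw [ha, ht, ← hν]; ring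
      rw [← heb] at h1 h2 h3
      have p1 : 0 < ϑ*ν^38 := by positivity
      have p2 : 0 < ϑ*ν^41 := by positivity
      have p3 : 0 < ϑ*ν^1 := by positivity
      rw [e1]; linarith)
  obtain ⟨xb, hxb, hxbe⟩ := hinv x (by
    refine hdepth.trans_lt ?_
    have : eR (-(2*t))*eR (-σ') < eR (-t) := by
      rw [← Real.exp_add]; exact Real.exp_lt_exp.2 (by linarith)
    rw [mul_assoc]
    exact mul_lt_mul_of_pos_left this (by positivity))
  set r' := s/(1 + a)*eR (-(2*t)) with hr'
  have hr'0 : 0 < r' := by positivity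
  have hr's : r' ≤ s := by
    calc r' ≤ s*1 := by
          apply mul_le_mul (div_le_self hs0.le (by linarith)) (Real.exp_le_one_iff.2 (by linarith)) (Real.exp_pos _).le hs0.le
      _ = s := mul_one s
  refine ⟨_, ω', r', xb, w, hr'0, hr's.trans hsr, S'.mono_κ ?_, hω', hxb.trans hdepth, hw, hXm, ?_, ?_⟩
  · have h1 : 2*a/t≤1/2 := by
      rw [div_le_iff₀ ht0]
      have := hcomp 37 40 (by norm_num)
      rw [← ha, ← ht] at this
      linarith
    have h2 : 1/N'≤1/ν/2*(1/2)*(1/2) := by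
      rw [show 1/ν/2*(1/2)*(1/2) = 1/(8*ν) by field_simp; norm_num]
      apply one_div_le_one_div_of_le (by positivity)
      refine le_trans ?_ hnn
      have := pow_big hν4 (i := 1) (j := 116) (by norm_num)
      rw [pow_one] at this; linarith
    refine h2.trans ?_
    gcongr
    linarith
  · have hmul : ∀ z p r : ℂ, z*eC (p + r) = z*eC p*eC r := by
      intro z p r; rw [Complex.exp_add]; ring
    rw [hmul, hxbe, hmul, hxw]
  · calc r'^n*N' ≤ s^n*N' := by gcongr
      _ = r₃^n*((ϑ*N')*(1 - e1)) := by rw [hsn]; ring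
      _ ≤ r₃^n*(ν^65*1) := by
          gcongr
          · linarith
          · linarith
      _ = _ := by ring

/-- crude Schwarz lemma -/
lemma schwarz_lip {f : ℂ → ℂ} {a y : ℂ} {ρ θ : ℝ} (hρ : 0 < ρ) (hf : DifferentiableOn ℂ f (ball a ρ))
    (hb : ∀ x ∈ ball a ρ, ‖f x‖ < 2) (hy : ‖y - a‖ ≤ θ*ρ) (hθ : θ < 1) : ‖f a‖ - 4*θ≤‖f y‖ := by
  have hya : y ∈ ball a ρ := by
    rw [mem_ball, dist_eq_norm]; nlinarith
  have hm : MapsTo f (ball a ρ) (ball (f a) 4) := by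
    intro x hx
    rw [mem_ball, dist_eq_norm]
    have := norm_sub_le (f x) (f a)
    have h1 := hb x hx
    have h2 := hb a (mem_ball_self hρ)
    linarith
  have := Complex.dist_le_div_mul_dist_of_mapsTo_ball hf (hm.mono_right ball_subset_closedBall) hya
  rw [dist_eq_norm, dist_eq_norm] at this
  have h3 : 4/ρ*‖y - a‖≤4*θ := by
    calc 4/ρ*‖y - a‖≤4/ρ*(θ*ρ) := by gcongr
      _ = 4*θ := by field_simp
  have h4 := norm_sub_norm_le (f a) (f y)
  rw [norm_sub_rev] at h4
  linarith

set_option maxHeartbeats 1000000 in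
lemma gain_step {lam : ℂ} (hl : ‖lam‖ = 1) (hlam : ∀ k, 0 < k → lam^k ≠ 1) {ηP : ℝ} {n n' : ℕ} {σ σ' G : ℝ}
    (hL : Level lam n n') (hn : 10000 ≤ Real.log n) (hnn : (n:ℝ)^116 ≤ n') (hlog : Real.log n'≤(n:ℝ)^2)
    (hσ : 2.5*Real.log n^2/n ≤ σ) (hσ' : 0 ≤ σ') (hσ'2 : σ'*n'≤5*Real.log n'^2)
    (T : St lam ηP n σ G) (hr : 1/(n:ℝ) ≤ T.r) (hη : 1/(n:ℝ) ≤ ηP) :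
    Nonempty (St lam ηP n' σ' (G + (Real.log n' - 116*Real.log n)/n)) := by
  obtain ⟨u, χ, ω, r, N, xa, S, r0, r2, hu, hu0, hub, hω, hN, hxa, arm, gain⟩ := T
  dsimp only at hr
  set L := Real.log n with hLdef
  have hn0 : (0:ℝ) < n := by exact_mod_cast hL.pos
  have hLd : eR L = n := Real.exp_log hn0
  set ν : ℝ := (n:ℝ) with hν
  have hL0 : 0 < L := by linarith
  have hquad : L^2/2 ≤ ν := by
    rw [← hLd]; have := Real.quadratic_le_exp_of_nonneg hL0.le; linarith
  have hν4 : 10000 ≤ ν := by nlinarith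
  have hLν : L/ν≤1/5000 := by
    rw [div_le_iff₀ hn0]; nlinarith
  have hLν0 : 0 < L/ν := by positivity
  have harm0 : 0 < 600/L := by positivity
  obtain ⟨g, Θ, ω₃, A, hg, hg0, hgb, S₃, hΘ, hω₃, hO, hA⟩ := gain1 hl hlam hL hLd hn hnn S r0 r2 hr hω hN hσ (by
    rw [mul_div_assoc]; linarith) hxa (by linarith)
  have hxa0 : xa ≠ 0 := by
    rintro rfl; simp at arm; linarith
  have hR0 : 0 < ‖xa‖ := norm_pos_iff.2 hxa0
  have h4 : 4*n ≤ n' := by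
    have h1 : 4*ν ≤ n' := by
      refine le_trans ?_ hnn
      have := pow_big hν4 (i := 1) (j := 116) (by norm_num)
      rw [pow_one] at this; linarith
    rw [hν] at h1; exact_mod_cast h1
  have h4ν : 4*ν ≤ n' := by rw [hν]; exact_mod_cast h4
  have hn'0 : (0:ℝ) < n' := by linarith
  obtain ⟨B, ϑ, hB, hϑ, hϑ0, hϑ1, hϑ2⟩ := theta_exists hlam hL hLd hν4 h4 hR0 rfl S₃.dω hω₃ hO hA
  obtain ⟨χ', ω', r', xb, w, hr'0, hr'3, S', hω', hxb, hw, hXm, heq, hgain⟩ :=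
    gain2 hl hlam hL hLd hn hnn hlog hxa0 rfl S₃ hω₃ hO hB hϑ hϑ0 hϑ1 hϑ2 hσ' hσ'2
  have hσ0 : 0 < σ := lt_of_lt_of_le (by positivity) hσ
  set r₃ := ‖xa‖*eR (-((6*L + 4)/ν)) with hr₃
  have hr₃0 : 0 < r₃ := by positivity
  have hxar : ‖xa‖ ≤ r := hxa.trans (exp_lt_self_mul r0 hσ0).le
  have hr₃r : r₃ ≤ r := (exp_lt_self_mul hR0 (by positivity)).le.trans hxar
  have hlogn' : 116*L ≤ Real.log n' := by
    rw [Real.le_log_iff_exp_le hn'0, show (116:ℝ) = ((116:ℕ):ℝ) by norm_num, Real.exp_nat_mul, hLd]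
    exact hnn
  have hlogpos : 0 < Real.log n' := by linarith
  refine ⟨⟨_, χ', ω', r', (n' + 1)/2, xb, S', hr'0, hr'3.trans (hr₃r.trans r2), hu.add hg, ?_, ?_, hω', by omega, hxb, ?_, ?_⟩⟩
  · simp [hu0, hg0]
  · intro z hz
    have h1 := hub z hz
    have h2 := hgb z hz
    have h3 : 3*ν⁻¹^50 ≤ ηP*(1/(2*ν)) := by
      have hq0 : 0 < ν⁻¹ := by positivity
      have hq1 : ν⁻¹≤1/10000 := by rw [inv_eq_one_div]; gcongr
      have := pow_small hq0 hq1 (i := 2) (j := 50) (by norm_num)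
      have h5 : 1/ν*(1/(2*ν)) ≤ ηP*(1/(2*ν)) := by gcongr
      have h6 : 1/ν*(1/(2*ν)) = ν⁻¹^2/2 := by field_simp
      rw [h6] at h5
      linarith [pow_pos hq0 50, pow_pos hq0 2]
    have hη0 : 0 ≤ ηP := le_trans (by positivity) hη
    have h4 : 1/(n':ℝ)≤1/(2*ν) := by
      apply one_div_le_one_div_of_le (by positivity); linarith
    have h7 : ηP*(1/(n':ℝ)) ≤ ηP*(1/(2*ν)) := by gcongr
    have h8 : ηP*(1/ν) = ηP*(1/(2*ν)) + ηP*(1/(2*ν)) := by field_simp; ring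
    calc ‖u z + g z‖≤‖u z‖ + ‖g z‖ := norm_add_le _ _
      _ ≤ ηP*(1 - 1/ν) + 3*ν⁻¹^50 := by gcongr
      _≤_ := by rw [mul_sub, mul_sub]; linarith
  · rw [heq]
    set X := xa*eC w with hX
    have hmul : ∀ z p r : ℂ, z*eC (p + r) = z*eC p*eC r := by
      intro z p r; rw [Complex.exp_add]; ring
    rw [hmul]
    set Y := X*eC (Θ X) with hY
    have hΘX := hΘ X hXm
    have hq35 : ν⁻¹^35 ≤ L/ν := by
      calc ν⁻¹^35 ≤ ν⁻¹^1 := pow_le_pow_of_le_one (by positivity) (by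
              rw [inv_eq_one_div, div_le_one hn0]; linarith) (by norm_num)
        _ = 1/ν := by rw [pow_one, one_div]
        _ ≤ L/ν := by gcongr; linarith
    have hwΘ : ‖w + Θ X‖≤56*(L/ν) := by
      have h1 := norm_add_le w (Θ X)
      rw [mul_div_assoc] at hw
      linarith
    have hYxa : ‖Y - xa‖≤‖xa‖*(112*(L/ν)) := by
      have h1 : Y - xa = xa*(eC (w + Θ X) - 1) := by rw [hY, hX, Complex.exp_add]; ring
      rw [h1, norm_mul]
      gcongr
      refine (norm_exp_sub_one_le_two (by linarith)).trans ?_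
      linarith
    set ρ := ‖xa‖*(L^2/ν) with hρ
    have hsub : ball xa ρ ⊆ ball (0:ℂ) r := by
      intro x hx
      rw [mem_ball, dist_eq_norm] at hx
      rw [mem_ball_zero_iff]
      have h1 := norm_add_le (x - xa) xa
      rw [sub_add_cancel] at h1
      have h2 : ‖xa‖*(L^2/ν + 1) ≤ r := by
        calc ‖xa‖*(L^2/ν + 1) ≤ r*eR (-σ)*eR (L^2/ν) := by
              gcongr; exact Real.add_one_le_exp _
          _ = r*eR (-σ + L^2/ν) := by rw [mul_assoc, ← Real.exp_add]
          _ ≤ r*eR 0 := by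
              refine mul_le_mul_of_nonneg_left (Real.exp_le_exp.2 ?_) r0.le
              have : 2.5*L^2/ν = 2.5*(L^2/ν) := by ring
              have h3 : 0 ≤ L^2/ν := by positivity
              linarith
          _ = r := by simp
      nlinarith
    have hsch := schwarz_lip (f := fun x => x*eC (χ x)) (a := xa) (y := Y) (ρ := ρ) (θ := 112/L) (by positivity) (by
        have := S.dχ.mono hsub
        fun_prop) (fun x hx => S.bd x (hsub hx)) (hYxa.trans (le_of_eq (by rw [hρ]; field_simp))) (by
        rw [div_lt_one hL0]; linarith)
    refine le_trans ?_ hsch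
    have h1 : 600/Real.log n'≤600/(116*L) := by gcongr
    have h2 : 600/(116*L) = (600/116)*(1/L) := by field_simp
    have h3 : 600/L = 600*(1/L) := by field_simp
    have h4 : 112/L = 112*(1/L) := by field_simp
    have h5 : 0 < 1/L := by positivity
    rw [h3] at arm
    rw [h2] at h1
    rw [h4]
    linarith
  · have h1 : r'^n*n' ≤ ν^65*r^n := hgain.trans (by gcongr)
    have h2 : (n:ℝ)*Real.log r' + Real.log n'≤65*L + n*Real.log r := by
      have := Real.log_le_log (by positivity) h1
      rw [Real.log_mul (by positivity) (by positivity), Real.log_mul (by positivity) (by positivity), Real.log_pow,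
        Real.log_pow, Real.log_pow] at this
      push_cast at this
      exact this
    rw [Real.log_div (by norm_num) r0.ne'] at gain
    rw [Real.log_div (by norm_num) hr'0.ne']
    have h3 : (Real.log n' - 116*L)/ν ≤ Real.log r - Real.log r' := by
      rw [div_le_iff₀ hn0, hν]
      linarith
    linarith

lemma denom_bound {lam : ℂ} (hlam : ∀ k, 0 < k → lam^k ≠ 1) {K C η : ℝ} (hP : BoundP lam K C η) (hη : 0 < η)
    {n n' : ℕ} (hL : Level lam n n') : η*n'≤7*(K*C^n) := by
  have hn := hL.pos
  have hn' : (0:ℝ) < n' := by exact_mod_cast hL.pos.trans hL.lt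
  set w : PowerSeries ℂ := 1 + PowerSeries.C (η:ℂ)*X^n with hw
  have hcw : ∀ k, coeff k w = (if k = 0 then 1 else 0) + (if k = n then (η:ℂ) else 0) := by
    intro k
    rw [hw, map_add, coeff_one, coeff_C_mul, coeff_X_pow]
    simp
  have hw0 : coeff 0 w = 1 := by rw [hcw]; simp [hn.ne]
  have hj : HasJet (n+1) (fun z => eC (∑ i ∈ Finset.Icc 1 n, (if i = n then (η:ℂ) else 0)*z^i)) w := by
    have h1 : ∀ z : ℂ, ∑ i ∈ Finset.Icc 1 n, (if i = n then (η:ℂ) else 0)*z^i = η*z^n := by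
      intro z
      rw [Finset.sum_eq_single n]
      · simp
      · intro b _ hb; simp [hb]
      · intro h; exact absurd (Finset.mem_Icc.2 ⟨hn, le_rfl⟩) h
    simp only [h1]
    have h2 : HasJet (n+1) (fun z : ℂ => 1 + η*z^n) w := by
      have := (HasJet.const (n+1) 1).add (((HasJet.id (n+1)).pow n).smul (η:ℂ))
      simpa [hw] using this
    refine h2.congr ?_
    have ht : Tendsto (fun z : ℂ => (η:ℂ)*z^n) (𝓝 0) (𝓝 0) := by
      have : Continuous (fun z : ℂ => (η:ℂ)*z^n) := by fun_prop
      simpa [hn.ne'] using this.tendsto 0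
    refine IsBigO.of_bound (η^2) ?_
    filter_upwards [ht.eventually (ball_mem_nhds (0:ℂ) one_pos), ball_mem_nhds (0:ℂ) one_pos] with z hz hz1
    rw [dist_zero_right] at hz
    rw [mem_ball_zero_iff] at hz1
    have h3 := Complex.norm_exp_sub_one_sub_id_le hz.le
    rw [show 1 + (η:ℂ)*z^n - eC (η*z^n) = -(eC (η*z^n) - 1 - η*z^n) by ring, norm_neg]
    refine h3.trans ?_
    rw [norm_mul, norm_pow, norm_pow, mul_pow, ← pow_mul]
    have h4 : ‖z‖^(n*2)≤‖z‖^(n + 1) := pow_le_pow_of_le_one (norm_nonneg _) hz1.le (by omega)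
    have h5 : ‖(η:ℂ)‖ = η := by simp [abs_of_pos hη]
    rw [h5]
    exact mul_le_mul_of_nonneg_left h4 (by positivity)
  have hb := hP (fun i => if i = n then (η:ℂ) else 0) n (fun i => by
    split_ifs
    · simp [abs_of_pos hη]
    · simp [hη.le]) w (linSer lam w) hj (linSer_lin lam w hlam hw0 _) n le_rfl
  rw [linSer_rec lam w hn, Finset.sum_eq_single (n-1)] at hb
  · rw [show n - 1 + 1 = n by omega, hcw, if_neg hn.ne', if_pos rfl, zero_add, Nat.sub_self, coeff_zero_eq_constantCoeff] at hb
    have h0 : constantCoeff (linSer lam w) = 1 := by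
      rw [← coeff_zero_eq_constantCoeff]; exact (linSer_lin lam w hlam hw0 1).1
    rw [map_pow, h0, one_pow, mul_one, norm_div] at hb
    have hp : 0 < ‖lam^n - 1‖ := norm_pos_iff.2 (sub_ne_zero.2 (hlam n hn))
    rw [div_le_iff₀ hp] at hb
    have h5 : ‖(η:ℂ)‖ = η := by simp [abs_of_pos hη]
    rw [h5] at hb
    have hKC : 0 ≤ K*C^n := by
      by_contra h
      push Not at h
      nlinarith
    have h6 : η ≤ K*C^n*(7/n') := hb.trans (mul_le_mul_of_nonneg_left hL.up hKC)
    calc η*n' ≤ K*C^n*(7/n')*n' := by gcongr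
      _ = _ := by field_simp
  · intro b hb1 hbn
    rw [hcw, if_neg (by omega), if_neg (by simp at hb1; omega)]; simp
  · intro h; simp at h; omega

/-- g -/
noncomputable def gq (x:ℝ) : ℝ := Real.log x^2/x

lemma gq_nonneg {x : ℝ} (hx : 0 ≤ x) : 0 ≤ gq x := by unfold gq; positivity

lemma gq_anti {x y : ℝ} (hx : eR 2 ≤ x) (hxy : x ≤ y) : gq y ≤ gq x := by
  have h0 : 0 < x := (Real.exp_pos 2).trans_le hx
  have hy0 : 0 < y := h0.trans_le hxy
  have h := Real.log_div_sqrt_antitoneOn (a := x) (b := y) hx (hx.trans hxy) hxy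
  have hly : 0 ≤ Real.log y/√y := by
    apply div_nonneg (Real.log_nonneg _) (Real.sqrt_nonneg _)
    have := Real.add_one_le_exp 2
    linarith
  have h2 := pow_le_pow_left₀ hly h 2
  simpa [div_pow, Real.sq_sqrt h0.le, Real.sq_sqrt hy0.le, gq] using h2

lemma gq_two {x y : ℝ} (hx : 10000 ≤ Real.log x) (hx0 : 0 < x) (hxy : 2*x ≤ y) : gq y≤0.6*gq x := by
  have hxe : eR 2 ≤ x := by
    rw [← Real.le_log_iff_exp_le hx0]; linarith
  refine (gq_anti (x := 2*x) (by linarith) hxy).trans ?_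
  unfold gq
  rw [Real.log_mul two_ne_zero hx0.ne']
  have := Real.log_two_lt_d9
  have h0 : 0 < Real.log 2 := Real.log_pos one_lt_two
  rw [show 0.6*(Real.log x^2/x) = (1.2*Real.log x^2)/(2*x) by field_simp; norm_num]
  apply div_le_div_of_nonneg_right _ (by positivity)
  nlinarith

lemma St.r_lower {lam : ℂ} {K C η : ℝ} (hP : BoundP lam K C η) (hK : 0 < K) (hC : 0 < C) (hη : 0 < η) {n : ℕ} {σ G : ℝ}
    (T : St lam η n σ G) (hn : 10000 ≤ Real.log n) (hσ : 2.5*Real.log n^2/n ≤ σ) :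
    min (1/(2*C)) (1/(4*K)) ≤ T.r := by
  have hn0 : (0:ℝ) < n := by
    rcases Nat.eq_zero_or_pos n with rfl | h
    · simp at hn; linarith
    · exact_mod_cast h
  have hσ0 : 0 < σ := lt_of_lt_of_le (by positivity) hσ
  have hN : (n:ℝ)≤2*T.N := by exact_mod_cast T.hN
  have hN0 : (0:ℝ) < T.N := by linarith
  have := final hP hK hC (by exact_mod_cast hN0) T.r0 T.hu T.hu0 (fun z hz => (T.hub z hz).trans (by
    have : 0≤1/(n:ℝ) := by positivity
    nlinarith)) T.S T.hω hσ0 (by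
      have h1 : 2.5*Real.log n^2/n*(n/2) ≤ σ*T.N := by
        apply mul_le_mul hσ (by linarith) (by positivity) hσ0.le
      have h2 : 2.5*Real.log n^2/n*(n/2) = 1.25*Real.log n^2 := by field_simp; norm_num
      nlinarith) T.hxa (by
      have h3 := T.arm
      have : 0≤600/Real.log n := by positivity
      linarith)
  rcases this with h | h
  · refine (min_le_left _ _).trans ?_
    rw [div_le_iff₀ (by positivity)]; linarith
  · refine (min_le_right _ _).trans ?_
    rw [div_le_iff₀ (by positivity)]; linarith

lemma St.init (lam:ℂ) {η : ℝ} (hη : 0 ≤ η) {n : ℕ} {σ : ℝ} (hn : 10000 ≤ Real.log n) (hσ : σ≤1/100) :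
    Nonempty (St lam η n σ 0) := by
  have hn0 : (0:ℝ) < n := by
    rcases Nat.eq_zero_or_pos n with rfl | h
    · simp at hn; linarith
    · exact_mod_cast h
  have hn1 : 1/(n:ℝ)≤1 := by
    rw [div_le_one hn0]
    have : 1 ≤ n := by exact_mod_cast hn0
    exact_mod_cast this
  refine ⟨⟨fun _ => 0, fun _ => 0, fun _ => 0, 2, n, ((2*eR (-σ) : ℝ) : ℂ), ?_, by norm_num, le_rfl, ?_, rfl, ?_, ?_, by omega, ?_, ?_, ?_⟩⟩
  · refine ⟨by fun_prop, by fun_prop, rfl, ?_, ?_, ?_, ?_⟩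
    · intro x _ y _ h; simpa using h
    · intro x hx; simpa using hx
    · intro x _; simpa using hn1
    · intro x _ _; simp
  · fun_prop
  · intro z _; simp only [norm_zero]; apply mul_nonneg hη; linarith
  · intro x _; simp only [norm_zero]; positivity
  · rw [Complex.norm_real, Real.norm_eq_abs, abs_of_pos (by positivity)]
  · rw [Complex.exp_zero, mul_one, Complex.norm_real, Real.norm_eq_abs, abs_of_pos (by positivity)]
    have h1 : 600/Real.log n≤600/10000 := by gcongr
    have h2 := Real.add_one_le_exp (-σ)
    linarith
  · simp

set_option maxHeartbeats 1000000 in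
theorem partB {lam : ℂ} (hl : ‖lam‖ = 1) (hlam : ∀ k, 0 < k → lam^k ≠ 1) {K C η : ℝ} (hP : BoundP lam K C η)
    (hK : 0 < K) (hC : 0 < C) (hη : 0 < η) (q : ℕ → ℕ) (m₀ : ℕ) (hL : ∀ m, m₀ ≤ m → Level lam (q m) (q (m+1)))
    (hq2 : ∀ m, m₀ ≤ m → 2*q m ≤ q (m+2)) :
    Summable (fun m => Real.log (q (m+1))/q m) := by
  -- q → ∞
  have hqge : ∀ m, m₀ + m ≤ m₀ + q (m₀ + m) := by
    intro m
    induction m with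
    | zero => simp
    | succ m ih =>
      have := (hL (m₀ + m) (by omega)).lt
      rw [← add_assoc]; omega
  have hqt : Tendsto (fun m => (q m : ℝ)) atTop atTop := by
    rw [← tendsto_add_atTop_iff_nat m₀]
    refine tendsto_atTop_mono (fun m => ?_) tendsto_natCast_atTop_atTop
    have := hqge m
    rw [add_comm m m₀]
    have : m ≤ q (m₀ + m) := by omega
    exact_mod_cast this
  set c := min (1/(2*C)) (1/(4*K)) with hc
  have hc0 : 0 < c := by rw [hc]; positivity
  -- eventually good
  have hgood : ∀ᶠ x : ℝ in atTop, 10000 ≤ Real.log x ∧ 1/c ≤ x ∧ 1/η ≤ x ∧ Real.log (7*K/η) + x*Real.log C ≤ x^2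
      ∧ 5*gq x≤1/100 := by
    refine (Real.tendsto_log_atTop.eventually_ge_atTop _).and ((eventually_ge_atTop _).and ((eventually_ge_atTop _).and (Eventually.and ?_ ?_)))
    · filter_upwards [eventually_ge_atTop (max 1 (|Real.log (7*K/η)| + |Real.log C|))] with x hx
      have h1 : 1 ≤ x := (le_max_left _ _).trans hx
      have h2 : |Real.log (7*K/η)| + |Real.log C| ≤ x := (le_max_right _ _).trans hx
      have h3 := le_abs_self (Real.log (7*K/η))
      have h4 := le_abs_self (Real.log C)
      have h5 := abs_nonneg (Real.log (7*K/η))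
      nlinarith
    · have h1 : Tendsto gq atTop (𝓝 0) := by
        have := Real.isLittleO_pow_log_id_atTop (n := 2)
        exact this.tendsto_div_nhds_zero
      have h2 := h1.const_mul 5
      rw [mul_zero] at h2
      exact h2.eventually_le_const (by norm_num)
  obtain ⟨m₁, hm₁⟩ := eventually_atTop.1 ((hqt.eventually hgood).and (eventually_ge_atTop m₀))
  -- shift
  set Q : ℕ → ℕ := fun m => q (m + m₁) with hQ
  have hQL : ∀ m, Level lam (Q m) (Q (m+1)) := by
    intro m
    have := hL (m + m₁) (by have := (hm₁ m₁ le_rfl).2; omega)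
    rw [hQ]; simp only; rw [show m + 1 + m₁ = m + m₁ + 1 by ring]; exact this
  have hQ2 : ∀ m, (2:ℝ)*Q m ≤ Q (m+2) := by
    intro m
    have := hq2 (m + m₁) (by have := (hm₁ m₁ le_rfl).2; omega)
    rw [hQ]; simp only; rw [show m + 2 + m₁ = m + m₁ + 2 by ring]; exact_mod_cast this
  have hQg := fun m => (hm₁ (m + m₁) (by omega)).1
  have hQlog : ∀ m, 10000 ≤ Real.log (Q m) := fun m => (hQg m).1
  have hQ0 : ∀ m, (0:ℝ) < Q m := fun m => by exact_mod_cast (hQL m).pos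
  have hQlt : ∀ m, (Q m : ℝ) ≤ Q (m+1) := fun m => by exact_mod_cast (hQL m).lt.le
  have hQe : ∀ m, eR 2 ≤ Q m := fun m => by
    rw [← Real.le_log_iff_exp_le (hQ0 m)]; linarith [hQlog m]
  have hQlog2 : ∀ m, Real.log (Q (m+1))≤(Q m : ℝ)^2 := by
    intro m
    have h1 := denom_bound hlam hP hη (hQL m)
    have h2 : (Q (m+1) : ℝ)≤7*K/η*C^(Q m) := by
      rw [div_mul_eq_mul_div, le_div_iff₀ hη]; linarith
    have h3 := Real.log_le_log (hQ0 (m+1)) h2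
    rw [Real.log_mul (by positivity) (by positivity), Real.log_pow] at h3
    exact h3.trans (hQg m).2.2.2.1
  set σ : ℕ → ℝ := fun m => 2.5*(gq (Q m) + gq (Q (m+1))) with hσ
  have hg0 : ∀ m, 0 ≤ gq (Q m) := fun m => gq_nonneg (hQ0 m).le
  have hga : ∀ m, gq (Q (m+1)) ≤ gq (Q m) := fun m => gq_anti (hQe m) (hQlt m)
  have hg2 : ∀ m, gq (Q (m+2))≤0.6*gq (Q m) := fun m => gq_two (hQlog m) (hQ0 m) (hQ2 m)
  have hgpos : ∀ m, 0 < gq (Q m) := fun m => by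
    unfold gq; have := hQlog m; have := hQ0 m; positivity
  have hσ1 : ∀ m, 2.5*Real.log (Q m)^2/(Q m) ≤ σ m := fun m => by
    have : 2.5*Real.log (Q m)^2/(Q m) = 2.5*gq (Q m) := by unfold gq; ring
    rw [this, hσ]; simp only
    linarith [hg0 (m+1)]
  have hσ2 : ∀ m, σ m*Q m≤5*Real.log (Q m)^2 := fun m => by
    have h1 : σ m≤5*gq (Q m) := by rw [hσ]; simp only; linarith [hga m]
    calc σ m*Q m≤5*gq (Q m)*Q m := by have := hQ0 m; gcongr
      _ = _ := by unfold gq; have := hQ0 m; field_simp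
  have hσpos : ∀ m, 0 < σ m := fun m => by
    rw [hσ]; simp only; linarith [hgpos m, hgpos (m+1)]
  have hσ3 : ∀ m, σ (m+1) + Real.log (Q m)^2/(Q m) ≤ σ m := fun m => by
    have h1 : Real.log (Q m)^2/(Q m) = gq (Q m) := rfl
    rw [h1, hσ]; simp only; rw [show m + 1 + 1 = m + 2 by ring]
    linarith [hg2 m]
  set gn : ℕ → ℝ := fun m => max 0 ((Real.log (Q (m+1)) - 116*Real.log (Q m))/Q m) with hgn
  have hSt : ∀ m, Nonempty (St lam η (Q m) (σ m) (∑ i ∈ Finset.range m, gn i)) := by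
    intro m
    induction m with
    | zero =>
      rw [Finset.sum_range_zero]
      refine St.init lam hη.le (hQlog 0) ?_
      have h1 : σ 0≤5*gq (Q 0) := by rw [hσ]; simp only; linarith [hga 0]
      have h2 := (hQg 0).2.2.2.2
      exact h1.trans h2
    | succ m ih =>
      obtain ⟨T⟩ := ih
      rw [Finset.sum_range_succ]
      have hνp : (0:ℝ) < (Q m : ℝ)^116 := by have := hQ0 m; positivity
      rcases le_total ((Q (m+1) : ℕ) : ℝ) ((Q m : ℝ)^116) with h | h
      · have h1 : gn m = 0 := by
          rw [hgn]; simp only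
          apply max_eq_left
          have := Real.log_le_log (hQ0 (m+1)) h
          rw [Real.log_pow] at this
          push_cast at this
          exact div_nonpos_of_nonpos_of_nonneg (by linarith) (hQ0 m).le
        rw [h1, add_zero]
        exact ng_step hl hlam hη.le (hQL m) (by linarith [hQlog m]) h (hσpos (m+1)) (hσ3 m) T
      · have h1 : gn m = (Real.log (Q (m+1)) - 116*Real.log (Q m))/Q m := by
          rw [hgn]; simp only
          apply max_eq_right
          have := Real.log_le_log hνp h
          rw [Real.log_pow] at this
          push_cast at this
          exact div_nonneg (by linarith) (hQ0 m).le
        rw [h1]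
        refine gain_step hl hlam (hQL m) (hQlog m) h (hQlog2 m) (hσ1 m) (hσpos (m+1)).le (hσ2 (m+1)) T ?_ ?_
        · refine le_trans ?_ (T.r_lower hP hK hC hη (hQlog m) (hσ1 m))
          rw [div_le_iff₀ (hQ0 m), ← div_le_iff₀' hc0]
          exact (hQg m).2.1
        · rw [div_le_iff₀ (hQ0 m), ← div_le_iff₀' hη]
          exact (hQg m).2.2.1
  have hgn0 : ∀ m, 0 ≤ gn m := fun m => le_max_left _ _
  have hgs : Summable gn := by
    refine summable_of_sum_range_le hgn0 (c := Real.log (2/c)) fun m => ?_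
    obtain ⟨T⟩ := hSt m
    refine T.gain.trans (Real.log_le_log (div_pos two_pos T.r0) ?_)
    exact div_le_div_of_nonneg_left two_pos.le hc0 (T.r_lower hP hK hC hη (hQlog m) (hσ1 m))
  have hgqs : Summable (fun m => gq (Q m)) := by
    refine summable_of_sum_range_le (c := σ 0) hg0 fun m => ?_
    have : ∑ i ∈ Finset.range m, gq (Q i) ≤ σ 0 - σ m := by
      induction m with
      | zero => simp
      | succ m ih =>
        rw [Finset.sum_range_succ]
        have := hσ3 m
        have h1 : Real.log (Q m)^2/(Q m) = gq (Q m) := rfl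
        linarith
    linarith [hσpos m]
  rw [← summable_nat_add_iff m₁]
  refine Summable.of_nonneg_of_le (fun m => ?_) (fun m => ?_) (hgs.add (hgqs.mul_left 116))
  · have h1 := hQlog (m+1)
    have h2 := hQ0 m
    have e : q (m + m₁ + 1) = Q (m+1) := by rw [hQ]; simp only; congr 1; ring
    have e2 : q (m + m₁) = Q m := rfl
    rw [e, e2]
    positivity
  · have e : q (m + m₁ + 1) = Q (m+1) := by rw [hQ]; simp only; congr 1; ring
    have e2 : q (m + m₁) = Q m := rfl
    rw [e, e2]
    have h1 : (Real.log (Q (m+1)) - 116*Real.log (Q m))/Q m ≤ gn m := le_max_right _ _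
    have h2 : Real.log (Q m)/Q m ≤ gq (Q m) := by
      unfold gq
      apply div_le_div_of_nonneg_right _ (hQ0 m).le
      nlinarith [hQlog m]
    have h3 : Real.log (Q (m+1))/Q m = (Real.log (Q (m+1)) - 116*Real.log (Q m))/Q m + 116*(Real.log (Q m)/Q m) := by ring
    rw [h3]
    linarith

lemma exp_int_bounds {y : ℝ} (m : ℤ) :
    ‖eC (2*Real.pi*Complex.I*y) - 1‖≤2*Real.pi*|y - m| ∧
    (|y - m|≤1/2 → 4*|y - m|≤‖eC (2*Real.pi*Complex.I*y) - 1‖) := by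
  have h1 : eC (2*Real.pi*Complex.I*y) = eC (Complex.I*((2*Real.pi*(y - m) : ℝ) : ℂ)) := by
    rw [Complex.exp_eq_exp_iff_exists_int]
    exact ⟨m, by push_cast; ring⟩
  rw [h1]
  have hπ := Real.pi_pos
  refine ⟨Real.norm_exp_I_mul_ofReal_sub_one_le.trans (le_of_eq ?_), fun h => ?_⟩
  · rw [Real.norm_eq_abs, abs_mul, abs_of_pos (by positivity)]
  · rw [Complex.norm_exp_I_mul_ofReal_sub_one, norm_mul]
    have h2 : |2*Real.pi*(y - m)/2| = Real.pi*|y - m| := by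
      rw [show 2*Real.pi*(y - m)/2 = Real.pi*(y - m) by ring, abs_mul, abs_of_pos hπ]
    have h3 := Real.mul_abs_le_abs_sin (x := 2*Real.pi*(y - m)/2) (by rw [h2]; nlinarith)
    rw [h2] at h3
    have h4 : 2/Real.pi*(Real.pi*|y - m|) = 2*|y - m| := by field_simp
    rw [h4] at h3
    rw [Real.norm_eq_abs, Real.norm_eq_abs, abs_two]
    linarith

lemma level_of {α : ℝ} {p : ℤ} {n n' : ℕ} (hn : 0 < n) (hlt : n < n') (hcop : IsCoprime p (n:ℤ))
    (hu : |α - p/n|≤1/(n*n')) (hlo : 1/(2*(n*n')) ≤ |α - p/n|) :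
    Level (eC (2*Real.pi*Complex.I*α)) n n' := by
  have hn0 : (0:ℝ) < n := by exact_mod_cast hn
  have hn'0 : (0:ℝ) < n' := by exact_mod_cast hn.trans hlt
  have hpow : ∀ k : ℕ, eC (2*Real.pi*Complex.I*α)^k = eC (2*Real.pi*Complex.I*((k*α : ℝ) : ℂ)) := by
    intro k
    rw [← Complex.exp_nat_mul]; congr 1; push_cast; ring
  set s := α - p/n with hs
  have hα : α = p/n + s := by rw [hs]; ring
  refine ⟨hn, hlt, ?_, ?_, ?_⟩
  · intro k hk hk2
    rw [hpow]
    set m := round ((k:ℝ)*α) with hm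
    have h1 : |(k:ℝ)*α - m|≤1/2 := abs_sub_round _
    have h2 := (exp_int_bounds (y := k*α) m).2 h1
    have hne : (k:ℤ)*p - m*n ≠ 0 := by
      intro h
      have : (n:ℤ) ∣ k*p := ⟨m, by linarith⟩
      have := hcop.symm.dvd_of_dvd_mul_right this
      exact hk (by exact_mod_cast this)
    have h3 : (1:ℝ) ≤ |(k:ℝ)*p - m*n| := by
      have := Int.one_le_abs hne
      exact_mod_cast this
    have h4 : (k:ℝ)*α - m = ((k:ℝ)*p - m*n)/n + k*s := by rw [hα]; field_simp; ring
    have h5 : 1/(n:ℝ) ≤ |((k:ℝ)*p - m*n)/n| := by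
      rw [abs_div, abs_of_pos hn0]; gcongr
    have h6 : |(k:ℝ)*s|≤1/n/2 := by
      rw [abs_mul, Nat.abs_cast]
      have hk2' : (2:ℝ)*k ≤ n' := by exact_mod_cast hk2
      calc (k:ℝ)*|s| ≤ k*(1/(n*n')) := by gcongr
        _ = (2*k)/n'*(1/n/2) := by field_simp
        _≤1*(1/n/2) := by gcongr; rwa [div_le_one hn'0]
        _ = _ := one_mul _
    have h7 : 1/(n:ℝ)/2 ≤ |(k:ℝ)*α - m| := by
      rw [h4]
      have := abs_sub_abs_le_abs_sub (((k:ℝ)*p - m*n)/n) (-(k*s))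
      rw [abs_neg, sub_neg_eq_add] at this
      linarith
    calc (1:ℝ) ≤ n*(4*(1/n/2)) := by field_simp; norm_num
      _ ≤ n*(4*|(k:ℝ)*α - m|) := by gcongr
      _≤_ := by gcongr
  · intro i hi hi2
    rw [hpow]
    have h4 : ((i*n : ℕ) : ℝ)*α - ((i*p : ℤ) : ℝ) = i*n*s := by rw [hα]; push_cast; field_simp; ring
    have hi0 : (0:ℝ) < i := by exact_mod_cast hi
    have hb := exp_int_bounds (y := (i*n : ℕ)*α) (i*p)
    rw [h4, abs_mul, abs_of_pos (by positivity)] at hb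
    have hi2' : (2:ℝ)*(i*n) ≤ n' := by exact_mod_cast hi2
    have hn1 : (1:ℝ) ≤ n := by exact_mod_cast hn
    have h5 : (i:ℝ)*n*|s|≤1/2 := by
      calc (i:ℝ)*n*|s| ≤ i*n*(1/(n*n')) := by gcongr
        _ = (2*(i*n))/n'*(1/n/2) := by field_simp
        _≤1*(1/1/2) := by gcongr; rwa [div_le_one hn'0]
        _ = _ := by norm_num
    have h6 := hb.2 h5
    calc (i:ℝ) ≤ n'*(4*(i*n*(1/(2*(n*n'))))) := by field_simp; norm_num
      _ ≤ n'*(4*(i*n*|s|)) := by gcongr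
      _≤_ := by gcongr
  · rw [hpow]
    have h4 : (n:ℝ)*α - (p:ℝ) = n*s := by rw [hα]; field_simp; ring
    have hb := exp_int_bounds (y := n*α) p
    rw [h4, abs_mul, abs_of_pos hn0] at hb
    refine hb.1.trans ?_
    have := Real.pi_lt_d2
    calc 2*Real.pi*(n*|s|)≤2*3.5*(n*(1/(n*n'))) := by gcongr; linarith
      _ = _ := by field_simp; norm_num

lemma cf_data {α : ℝ} (hα : Irrational α) : ∃ (p : ℕ → ℤ) (q : ℕ → ℕ),
    (∀ m, contFracDen α m = q m) ∧ (∀ m, 1 ≤ m → Level (eC (2*Real.pi*Complex.I*α)) (q m) (q (m+1))) ∧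
    (∀ m, 1 ≤ m → 2*q m ≤ q (m+2)) := by
  set g := GenContFract.of α with hg
  have hnt : ∀ n, ¬ g.TerminatedAt n := by
    intro n h
    obtain ⟨x, hx⟩ := (GenContFract.terminates_iff_rat α).1 ⟨n, h⟩
    exact hα ⟨x, hx.symm⟩
  have hs : ∀ n, ∃ (gp : GenContFract.Pair ℝ) (z : ℤ), g.s.get? n = some gp ∧ gp.a = 1 ∧ gp.b = z ∧ 1 ≤ z := by
    intro n
    have h1 := hnt n
    rw [GenContFract.terminatedAt_iff_s_none] at h1
    obtain ⟨gp, hgp⟩ := Option.ne_none_iff_exists'.1 h1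
    obtain ⟨ha, z, hz⟩ := GenContFract.of_partNum_eq_one_and_exists_int_partDen_eq hgp
    have h2 : (1:ℝ) ≤ gp.b := GenContFract.of_one_le_get?_partDen (GenContFract.partDen_eq_s_b hgp)
    refine ⟨gp, z, hgp, ha, hz, ?_⟩
    rw [hz] at h2; exact_mod_cast h2
  choose gp z hz1 hz2 hz3 hz4 using hs
  have hden : ∀ m, g.dens (m+2) = z (m+1)*g.dens (m+1) + g.dens m := by
    intro m
    rw [GenContFract.dens_recurrence (hz1 (m+1)) rfl rfl, hz2, hz3, one_mul]
  have hnum : ∀ m, g.nums (m+2) = z (m+1)*g.nums (m+1) + g.nums m := by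
    intro m
    rw [GenContFract.nums_recurrence (hz1 (m+1)) rfl rfl, hz2, hz3, one_mul]
  have hd0 : g.dens 0 = 1 := GenContFract.zeroth_den_eq_one
  have hd1 : g.dens 1 = z 0 := by rw [GenContFract.first_den_eq (hz1 0), hz3]
  have hn0 : g.nums 0 = ⌊α⌋ := by rw [GenContFract.zeroth_num_eq_h, hg, GenContFract.of_h_eq_floor]
  have hn1 : g.nums 1 = z 0*⌊α⌋ + 1 := by
    rw [GenContFract.first_num_eq (hz1 0), hz3, hz2, hg, GenContFract.of_h_eq_floor]
  have hq : ∀ m, (∃ q : ℕ, 0 < q ∧ g.dens m = q) ∧ (∃ q : ℕ, 0 < q ∧ g.dens (m+1) = q) := by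
    intro m
    induction m with
    | zero =>
      refine ⟨⟨1, one_pos, by simp [hd0]⟩, ⟨(z 0).toNat, by have := hz4 0; omega, ?_⟩⟩
      rw [zero_add, hd1]
      have : ((z 0).toNat : ℤ) = z 0 := Int.toNat_of_nonneg (by have := hz4 0; omega)
      exact_mod_cast congrArg (Int.cast : ℤ → ℝ) this.symm
    | succ m ih =>
      refine ⟨ih.2, ?_⟩
      obtain ⟨⟨a, ha0, ha⟩, ⟨b, hb0, hb⟩⟩ := ih
      refine ⟨(z (m+1)).toNat*b + a, by omega, ?_⟩
      have : ((z (m+1)).toNat : ℤ) = z (m+1) := Int.toNat_of_nonneg (by have := hz4 (m+1); omega)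
      have h2 : (((z (m+1)).toNat : ℕ) : ℝ) = z (m+1) := by exact_mod_cast congrArg (Int.cast : ℤ → ℝ) this
      rw [hden, ha, hb]; push_cast; rw [h2]
  have hp : ∀ m, (∃ q : ℤ, g.nums m = q) ∧ (∃ q : ℤ, g.nums (m+1) = q) := by
    intro m
    induction m with
    | zero => exact ⟨⟨_, hn0⟩, ⟨z 0*⌊α⌋ + 1, by rw [zero_add, hn1]; push_cast; ring⟩⟩
    | succ m ih =>
      refine ⟨ih.2, ?_⟩
      obtain ⟨⟨a, ha⟩, ⟨b, hb⟩⟩ := ih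
      exact ⟨z (m+1)*b + a, by rw [hnum, ha, hb]; push_cast; ring⟩
  choose q hq0 hqd using fun m => (hq m).1
  choose p hpn using fun m => (hp m).1
  have hqr : ∀ m, (q (m+2) : ℤ) = z (m+1)*q (m+1) + q m := by
    intro m
    have := hden m
    rw [hqd, hqd, hqd] at this
    exact_mod_cast this
  have hmono : ∀ m, q (m+1) < q (m+2) := by
    intro m
    have h1 := hqr m
    have h2 := hz4 (m+1)
    have h3 := hq0 m
    have h4 := hq0 (m+1)
    have : (q (m+1) : ℤ) < q (m+2) := by nlinarith
    exact_mod_cast this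
  have hle : ∀ m, q m ≤ q (m+1) := by
    intro m
    rcases m with _ | m
    · have : g.dens 0 ≤ g.dens 1 := GenContFract.of_den_mono
      rw [hqd, hqd] at this; exact_mod_cast this
    · exact (hmono m).le
  have hdbl : ∀ m, 2*q m ≤ q (m+2) := by
    intro m
    have h1 := hqr m
    have h2 := hz4 (m+1)
    have h3 := hle m
    have h4 := hq0 (m+1)
    have : 2*(q m : ℤ) ≤ q (m+2) := by
      rw [h1]
      have h3' : (q m : ℤ) ≤ q (m+1) := by exact_mod_cast h3
      nlinarith
    exact_mod_cast this
  have hdet : ∀ m, p m*q (m+1) - q m*p (m+1) = (-1)^(m+1) := by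
    intro m
    have := SimpContFract.determinant (s := SimpContFract.of α) (n := m) (hnt m)
    have h2 : (SimpContFract.of α : GenContFract ℝ) = g := rfl
    rw [h2, hqd, hqd, hpn, hpn] at this
    exact_mod_cast this
  have hap : ∀ m, |α - p m/q m|≤1/(q m*q (m+1)) := by
    intro m
    have := GenContFract.abs_sub_convs_le (hnt m)
    rw [GenContFract.conv_eq_num_div_den, ← hg, hqd, hqd, hpn] at this
    exact this
  refine ⟨p, q, hqd, fun m hm => ?_, fun m _ => hdbl m⟩
  have a0 : (0:ℝ) < q m := by exact_mod_cast hq0 m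
  have a1 : (0:ℝ) < q (m+1) := by exact_mod_cast hq0 (m+1)
  have a2 : (0:ℝ) < q (m+2) := by exact_mod_cast hq0 (m+2)
  refine level_of (p := p m) (hq0 m) ?_ ?_ (hap m) ?_
  · obtain ⟨k, rfl⟩ : ∃ k, m = k + 1 := ⟨m - 1, by omega⟩
    exact hmono k
  · have h := hdet m
    rcases neg_one_pow_eq_or ℤ (m+1) with h1 | h1
    · rw [h1] at h
      exact ⟨q (m+1), -p (m+1), by linarith⟩
    · rw [h1] at h
      exact ⟨-q (m+1), p (m+1), by linarith⟩
  · have h1 : |(p m : ℝ)/q m - p (m+1)/q (m+1)| = 1/(q m*q (m+1)) := by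
      have : (p m : ℝ)/q m - p (m+1)/q (m+1) = ((-1)^(m+1) : ℤ)/(q m*q (m+1)) := by
        rw [← hdet m]; push_cast; field_simp
      rw [this, abs_div]
      congr 1
      · push_cast; simp
      · rw [abs_of_pos (by positivity)]
    have h2 := hap (m+1)
    have h3 := abs_sub_le ((p m : ℝ)/q m) α (p (m+1)/q (m+1))
    rw [h1, abs_sub_comm ((p m : ℝ)/q m)] at h3
    have h4 : 1/((q (m+1) : ℝ)*q (m+2))≤1/(2*(q m*q (m+1))) := by
      apply one_div_le_one_div_of_le (by positivity)
      have : (2:ℝ)*q m ≤ q (m+2) := by exact_mod_cast hdbl m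
      nlinarith
    have h5 : 1/((q m : ℝ)*q (m+1)) = 1/(2*(q m*q (m+1))) + 1/(2*(q m*q (m+1))) := by field_simp; norm_num
    rw [show m + 1 + 1 = m + 2 by ring] at h2
    linarith

lemma lam_pow_ne {α : ℝ} (hα : Irrational α) (k : ℕ) (hk : 0 < k) : eC (2*Real.pi*Complex.I*α)^k ≠ 1 := by
  intro h
  rw [← Complex.exp_nat_mul, Complex.exp_eq_one_iff] at h
  obtain ⟨m, hm⟩ := h
  have h1 : (2*Real.pi*Complex.I : ℂ) ≠ 0 := by simp [Real.pi_ne_zero]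
  have h2 : (k:ℂ)*α = m := by
    apply mul_right_cancel₀ h1
    rw [← hm]; ring
  have h3 : (k:ℝ)*α = m := by exact_mod_cast h2
  have hk0 : (k:ℝ) ≠ 0 := by exact_mod_cast hk.ne'
  refine hα ⟨(m:ℚ)/k, ?_⟩
  push_cast
  field_simp
  linarith

theorem brjuno_of_boundP {α : ℝ} (hα : Irrational α) {K C η : ℝ}
    (hP : BoundP (eC (2*Real.pi*Complex.I*α)) K C η) (hK : 0 < K) (hC : 0 < C) (hη : 0 < η) :
    BrjunoCondition α := by
  obtain ⟨p, q, hq, hL, hq2⟩ := cf_data hα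
  have hl : ‖eC (2*Real.pi*Complex.I*α)‖ = 1 := by
    rw [Complex.norm_exp]; simp
  have := partB hl (lam_pow_ne hα) hP hK hC hη q 1 hL hq2
  unfold BrjunoCondition
  simp only [hq]
  exact this

/-- quantitative implicit function lemma -/
lemma imp {U : Set ℂ} (hU : IsOpen U) (k : ℂ → ℂ → ℂ) (A : ℂ → ℂ) {s B b κ : ℝ} (hs : 0 < s) (hb : 0 ≤ b) (hκ : 0 < κ)
    (hk : ∀ x ∈ U, DifferentiableOn ℂ (k x) (ball 0 s)) (hB : ∀ x ∈ U, ∀ w ∈ ball (0:ℂ) s, ‖k x w‖ ≤ B)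
    (hk1 : ∀ w : ℂ → ℂ, DifferentiableOn ℂ w U → (∀ x ∈ U, ‖w x‖ ≤ b) → DifferentiableOn ℂ (fun x => k x (w x)) U)
    (hA : DifferentiableOn ℂ A U) (hAd : ∀ x ∈ U, deriv (k x) 0 = A x) (hAκ : ∀ x ∈ U, κ≤‖A x‖)
    (hbs : b < s/4) (hBb : 8*B/s^2*b ≤ κ/2) (h0 : ∀ x ∈ U, ‖k x 0‖ ≤ κ*(b/2)) :
    ∃ w : ℂ → ℂ, DifferentiableOn ℂ w U ∧ ∀ x ∈ U, ‖w x‖ ≤ b ∧ k x (w x) = 0 ∧ κ*‖w x‖≤2*‖k x 0‖ ∧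
      ∀ v, ‖v‖ ≤ b → k x v = 0 → v = w x := by
  have hA0 : ∀ x ∈ U, A x ≠ 0 := fun x hx h => by
    have := hAκ x hx; rw [h, norm_zero] at this; linarith
  have hlip : ∀ x ∈ U, ∀ w w' : ℂ, ‖w‖ ≤ b → ‖w'‖ ≤ b →
      ‖(w - k x w/A x) - (w' - k x w'/A x)‖≤1/2*‖w - w'‖ := by
    intro x hx w w' hw hw'
    have h1 := quad_lip hs (hk x hx) (hB x hx) hbs hw hw'
    rw [hAd x hx] at h1
    have h2 : (w - k x w/A x) - (w' - k x w'/A x) = -((k x w - k x w' - A x*(w - w'))/A x) := by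
      have := hA0 x hx; field_simp; ring
    rw [h2, norm_neg, norm_div, div_le_iff₀ (hκ.trans_le (hAκ x hx))]
    calc _≤8*B/s^2*b*‖w - w'‖ := h1
      _ ≤ κ/2*‖w - w'‖ := by gcongr
      _ = 1/2*‖w - w'‖*κ := by ring
      _≤_ := by have := hAκ x hx; gcongr
  obtain ⟨w, hw, hw2⟩ := holfix hU (fun x w => w - k x w/A x) hb
    (fun w hw hwb => hw.sub ((hk1 w hw hwb).div hA hA0)) (fun x hx => by
      rw [zero_sub, norm_neg, norm_div, div_le_iff₀ (hκ.trans_le (hAκ x hx))]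
      refine (h0 x hx).trans ?_
      rw [mul_comm]
      have := hAκ x hx
      gcongr) hlip
  refine ⟨w, hw, fun x hx => ?_⟩
  obtain ⟨h1, h2, h3⟩ := hw2 x hx
  have hk0 : k x (w x) = 0 := by
    have : k x (w x)/A x = 0 := by linear_combination -h2
    rcases div_eq_zero_iff.1 this with h | h
    · exact h
    · exact absurd h (hA0 x hx)
  refine ⟨h1, hk0, ?_, ?_⟩
  · rw [zero_sub, norm_neg, norm_div] at h3
    have hp := hκ.trans_le (hAκ x hx)
    calc κ*‖w x‖≤‖A x‖*(2*(‖k x 0‖/‖A x‖)) := by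
          apply mul_le_mul (hAκ x hx) h3 (norm_nonneg _) hp.le
      _ = _ := by field_simp
  · intro v hv hv0
    have := hlip x hx v (w x) hv h1
    rw [hv0, hk0, zero_div, sub_zero, sub_zero] at this
    have h4 := norm_nonneg (v - w x)
    have : ‖v - w x‖ = 0 := by linarith
    exact sub_eq_zero.1 (norm_eq_zero.1 this)

/-- Schwarz lemma in convenient form -/
lemma schwarz0 {f : ℂ → ℂ} {r B : ℝ} (hf : DifferentiableOn ℂ f (ball 0 r)) (hf0 : f 0 = 0)
    (hB : ∀ x ∈ ball (0:ℂ) r, ‖f x‖ ≤ B) : ∀ x ∈ ball (0:ℂ) r, ‖f x‖ ≤ B/r*‖x‖ := by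
  intro x hx
  have h0 : 0 < r := pos_of_mem_ball hx
  have hm : MapsTo f (ball 0 r) (closedBall (f 0) B) := by
    intro y hy; rw [hf0, mem_closedBall_zero_iff]; exact hB y hy
  have := Complex.dist_le_div_mul_dist_of_mapsTo_ball hf hm hx
  simpa [hf0, dist_zero_right] using this

/-- Koenigs linearization -/
lemma koenigs {lam : ℂ} {ω : ℂ → ℂ} {ρ q c a : ℝ} (hρ : 0 < ρ) (hq0 : 0 ≤ q) (hq1 : q < 1) (ha0 : 0 < a)
    (hl1 : ‖lam‖≤1)
    (hω : DifferentiableOn ℂ ω (ball 0 ρ)) (hc : ∀ x ∈ ball (0:ℂ) ρ, ‖ω x‖ ≤ c*‖x‖)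
    (hq : ∀ x ∈ ball (0:ℂ) ρ, ‖lam*eC (ω x)‖ ≤ q) (ha : c*ρ/(1 - q) ≤ a) :
    ∃ ψ : ℂ → ℂ, DifferentiableOn ℂ ψ (ball 0 (ρ*eR (-(6*a)))) ∧ ψ 0 = 0 ∧
      ∀ y ∈ ball (0:ℂ) (ρ*eR (-(6*a))), y*eC (ψ y) ∈ ball (0:ℂ) ρ ∧
        ‖ψ y‖≤2*a ∧ ψ (lam*y) = ψ y + ω (y*eC (ψ y)) := by
  have h1q : 0 < 1 - q := by linarith
  have hc0 : 0 ≤ c := by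
    have h1 : ((ρ/2 : ℝ) : ℂ) ∈ ball (0:ℂ) ρ := by
      rw [mem_ball_zero_iff, Complex.norm_real, Real.norm_eq_abs, abs_of_pos (by positivity)]; linarith
    have := (norm_nonneg _).trans (hc _ h1)
    rw [Complex.norm_real, Real.norm_eq_abs, abs_of_pos (by positivity)] at this
    by_contra h; push Not at h
    nlinarith
  set f : ℂ → ℂ := fun z => lam*z*eC (ω z) with hf
  have hfq : ∀ z ∈ ball (0:ℂ) ρ, ‖f z‖ ≤ q*‖z‖ := by
    intro z hz
    rw [hf]; simp only
    rw [show lam*z*eC (ω z) = lam*eC (ω z)*z by ring, norm_mul]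
    have := hq z hz
    gcongr
  have hfm : MapsTo f (ball 0 ρ) (ball 0 ρ) := by
    intro z hz
    have := hfq z hz
    rw [mem_ball_zero_iff] at hz ⊢
    have := norm_nonneg z
    nlinarith
  have hfd : DifferentiableOn ℂ f (ball 0 ρ) := by
    rw [hf]; fun_prop
  have hit : ∀ j : ℕ, MapsTo f^[j] (ball 0 ρ) (ball 0 ρ) := fun j => hfm.iterate j
  have hitd : ∀ j : ℕ, DifferentiableOn ℂ f^[j] (ball 0 ρ) := fun j => by
    induction j with
    | zero => simpa using differentiableOn_id
    | succ j ih =>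
      rw [Function.iterate_succ']
      exact hfd.comp ih (hit j)
  have hitn : ∀ j : ℕ, ∀ z ∈ ball (0:ℂ) ρ, ‖f^[j] z‖ ≤ q^j*‖z‖ := by
    intro j z hz
    induction j with
    | zero => simp
    | succ j ih =>
      rw [Function.iterate_succ', Function.comp_apply]
      refine (hfq _ (hit j hz)).trans ?_
      rw [pow_succ]
      nlinarith
  have hterm : ∀ j : ℕ, ∀ z ∈ ball (0:ℂ) ρ, ‖ω (f^[j] z)‖ ≤ c*ρ*q^j := by
    intro j z hz
    refine (hc _ (hit j hz)).trans ?_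
    have h1 := hitn j z hz
    rw [mem_ball_zero_iff] at hz
    calc c*‖f^[j] z‖ ≤ c*(q^j*ρ) := by
          gcongr
          exact h1.trans (by gcongr)
      _ = _ := by ring
  have hsum : Summable fun j : ℕ => c*ρ*q^j := (summable_geometric_of_lt_one hq0 hq1).mul_left _
  set Φ : ℂ → ℂ := fun z => ∑' j, ω (f^[j] z) with hΦ
  have hΦd : DifferentiableOn ℂ Φ (ball 0 ρ) :=
    Complex.differentiableOn_tsum_of_summable_norm hsum (fun j => hω.comp (hitd j) (hit j)) isOpen_ball hterm
  have hts : (∑' j : ℕ, c*ρ*q^j) = c*ρ/(1 - q) := by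
    rw [tsum_mul_left, tsum_geometric_of_lt_one hq0 hq1]; rfl
  have hΦa : ∀ z ∈ ball (0:ℂ) ρ, ‖Φ z‖ ≤ a := by
    intro z hz
    refine le_trans ?_ ha
    rw [← hts]
    exact tsum_of_norm_bounded hsum.hasSum (fun j => hterm j z hz)
  have hω0 : ω 0 = 0 := by
    have := hc 0 (mem_ball_self hρ)
    rw [norm_zero, mul_zero] at this
    exact norm_le_zero_iff.1 this
  have hf0 : ∀ j : ℕ, f^[j] 0 = 0 := by
    intro j
    have := hitn j 0 (mem_ball_self hρ)
    rw [norm_zero, mul_zero] at this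
    exact norm_le_zero_iff.1 this
  have hΦ0 : Φ 0 = 0 := by rw [hΦ]; simp [hf0, hω0]
  have hΦf : ∀ z ∈ ball (0:ℂ) ρ, Φ z = ω z + Φ (f z) := by
    intro z hz
    have hs : Summable fun j : ℕ => ω (f^[j] z) := Summable.of_norm_bounded hsum (fun j => hterm j z hz)
    rw [hΦ]; simp only
    rw [hs.tsum_eq_zero_add]
    simp only [Function.iterate_zero, id, Function.iterate_succ, Function.comp_apply]
  -- derivative bound
  set R := ρ*eR (-(2*a)) with hR
  have hRρ : R ≤ ρ := (exp_lt_self_mul hρ (by positivity)).le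
  have hΦ' : ∀ x ∈ ball (0:ℂ) R, ‖x*deriv Φ x‖≤1/2 := by
    intro x hx
    have := norm_mul_deriv_le (t := 2*a) (by positivity) ha0.le hΦd hΦa x hx
    refine this.trans (le_of_eq ?_)
    field_simp
  set r := ρ*eR (-(6*a)) with hr
  have hr0 : 0 < r := by positivity
  have hreq : r*eR (3*a) < R := by
    rw [hr, hR, mul_assoc, ← Real.exp_add]
    exact mul_lt_mul_of_pos_left (Real.exp_lt_exp.2 (by linarith)) hρ
  have hxe : ∀ x ∈ ball (0:ℂ) r, ‖x‖*eR (3*a) < R := by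
    intro x hx
    rw [mem_ball_zero_iff] at hx
    refine lt_of_le_of_lt ?_ hreq
    gcongr
  have hΦdR := hΦd.mono (ball_subset_ball hRρ)
  have hmem : ∀ x ∈ ball (0:ℂ) r, ∀ w : ℂ, ‖w‖≤3*a → x*eC w ∈ ball (0:ℂ) R := by
    intro x hx w hw
    rw [mem_ball_zero_iff]
    exact (norm_mul_exp_le hw).trans_lt (hxe x hx)
  have hlip : ∀ x ∈ ball (0:ℂ) r, ∀ w w' : ℂ, ‖w‖≤3*a → ‖w'‖≤3*a →
      ‖(-Φ (x*eC w)) - (-Φ (x*eC w'))‖≤(1/2)*‖w - w'‖ := by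
    intro x hx w w' hw hw'
    have := phi_exp_lip (hxe x hx) hΦdR hΦ' hw hw'
    rwa [show (-Φ (x*eC w)) - (-Φ (x*eC w')) = -(Φ (x*eC w) - Φ (x*eC w')) by ring, norm_neg]
  obtain ⟨ψ, hψ, hψ2⟩ := holfix (isOpen_ball (x := (0:ℂ)) (ε := r)) (fun x w => -Φ (x*eC w)) (b := 2*a) (by positivity)
    (fun w hw hwb => by
      refine (hΦdR.comp (f := fun x => x*eC (w x)) (by fun_prop) ?_).neg
      intro x hx
      exact hmem x hx _ ((hwb x hx).trans (by linarith)))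
    (fun x hx => by
      rw [norm_neg]
      refine (hΦa _ (ball_subset_ball hRρ (hmem x hx 0 (by simp; positivity)))).trans (by linarith))
    (fun x hx w w' hw hw' => hlip x hx w w' (by linarith) (by linarith))
  refine ⟨ψ, hψ, ?_, ?_⟩
  · have := (hψ2 0 (mem_ball_self hr0)).2.2
    rw [zero_mul, hΦ0, neg_zero, norm_zero, mul_zero] at this
    exact norm_le_zero_iff.1 this
  · intro y hy
    obtain ⟨h1, h2, -⟩ := hψ2 y hy
    set x := y*eC (ψ y) with hx
    have hxR : x ∈ ball (0:ℂ) R := hmem y hy _ (h1.trans (by linarith))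
    have hxρ := ball_subset_ball hRρ hxR
    refine ⟨hxρ, h1, ?_⟩
    have hly : lam*y ∈ ball (0:ℂ) r := by
      rw [mem_ball_zero_iff] at hy ⊢
      rw [norm_mul]
      have := norm_nonneg y
      nlinarith
    obtain ⟨h3, h4, -⟩ := hψ2 _ hly
    have hωa : ‖ω x‖ ≤ a := by
      have h5 := hterm 0 x hxρ
      simp only [Function.iterate_zero, id, pow_zero, mul_one] at h5
      refine h5.trans (le_trans ?_ ha)
      rw [le_div_iff₀ h1q]
      have : 0 ≤ c*ρ := by positivity
      nlinarith
    have hv : ‖ψ y + ω x‖≤3*a := (norm_add_le _ _).trans (by linarith)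
    have hv2 : -Φ (lam*y*eC (ψ y + ω x)) = ψ y + ω x := by
      have h6 : lam*y*eC (ψ y + ω x) = f x := by
        rw [hf]; simp only; rw [Complex.exp_add, hx]; ring
      rw [h6]
      have h7 := hΦf x hxρ
      linear_combination h2 + h7
    have h8 := hlip _ hly (ψ (lam*y)) (ψ y + ω x) (h3.trans (by linarith)) hv
    rw [h4, hv2] at h8
    have h9 := norm_nonneg (ψ (lam*y) - (ψ y + ω x))
    have : ‖ψ (lam*y) - (ψ y + ω x)‖ = 0 := by linarith
    exact sub_eq_zero.1 (norm_eq_zero.1 this)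

section
/-- hypotheses on the perturbation family `u t z` -/
structure UH (X:ℝ) (u : ℂ → ℂ → ℂ) : Prop where
  hX : 4 ≤ X
  hd : DifferentiableOn ℂ (fun p : ℂ × ℂ => u p.1 p.2) {p | X/2 < ‖p.2 + X‖}
  h0 : ∀ t, u t 0 = 0
  h1 : ∀ t, u t (-1) = 0
  hb : ∀ t z : ℂ, ‖t‖≤1 → X/2 < ‖z + X‖ → ‖u t z‖≤1
  hc : ∀ t z : ℂ, ‖t‖≤1 → X/2 < ‖z + X‖ → ‖z*deriv (u t) z‖≤1/2*‖1 + z‖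

lemma isOpen_W (X:ℝ) : IsOpen {z : ℂ | X/2 < ‖z + X‖} :=
  isOpen_lt continuous_const (by fun_prop)

lemma isOpen_W2 (X:ℝ) : IsOpen {p : ℂ × ℂ | X/2 < ‖p.2 + X‖} :=
  isOpen_lt continuous_const (by fun_prop)

lemma UH.diffz {X : ℝ} {u : ℂ → ℂ → ℂ} (h : UH X u) (t:ℂ) :
    DifferentiableOn ℂ (u t) {z : ℂ | X/2 < ‖z + X‖} :=
  h.hd.comp (f := fun z : ℂ => ((t, z) : ℂ × ℂ)) (by fun_prop) (fun z hz => hz)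

lemma UH.difft {X : ℝ} {u : ℂ → ℂ → ℂ} (h : UH X u) {z : ℂ} (hz : X/2 < ‖z + X‖) :
    Differentiable ℂ (fun t => u t z) := by
  rw [← differentiableOn_univ]
  exact h.hd.comp (f := fun t : ℂ => ((t, z) : ℂ × ℂ)) (by fun_prop) (fun t _ => hz)

/-- linearizing chart of `λ z e^{z + u t z}` on the disk of radius `r` -/
structure IsCh (X:ℝ) (u : ℂ → ℂ → ℂ) (lam t : ℂ) (r:ℝ) (χ : ℂ → ℂ) : Prop where
  hd : DifferentiableOn ℂ χ (ball 0 r)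
  h0 : χ 0 = 0
  hW : ∀ x ∈ ball (0:ℂ) r, X/2 < ‖x*eC (χ x) + X‖
  he : ∀ x ∈ ball (0:ℂ) r, χ (lam*x) = χ x + x*eC (χ x) + u t (x*eC (χ x))

lemma mul_mem_ball {lam x : ℂ} {r : ℝ} (hl : ‖lam‖≤1) (hx : x ∈ ball (0:ℂ) r) : lam*x ∈ ball (0:ℂ) r := by
  rw [mem_ball_zero_iff] at hx ⊢
  rw [norm_mul]
  have := norm_nonneg x
  nlinarith

lemma pow_mul_mem_ball {lam x : ℂ} {r : ℝ} (hl : ‖lam‖≤1) (hx : x ∈ ball (0:ℂ) r) (n : ℕ) :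
    lam^n*x ∈ ball (0:ℂ) r :=
  mul_mem_ball (by rw [norm_pow]; exact pow_le_one₀ (norm_nonneg _) hl) hx

lemma tendsto_pow_mul {lam : ℂ} (hl : ‖lam‖ < 1) (x:ℂ) : Tendsto (fun n : ℕ => lam^n*x) atTop (𝓝 0) := by
  have := (tendsto_pow_atTop_nhds_zero_of_norm_lt_one hl).mul_const x
  rwa [zero_mul] at this

section
variable {X : ℝ} {u : ℂ → ℂ → ℂ} {lam t : ℂ} {r : ℝ} {χ : ℂ → ℂ}

lemma IsCh.gd (h : IsCh X u lam t r χ) : DifferentiableOn ℂ (fun x => x*eC (χ x)) (ball 0 r) :=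
  differentiableOn_id.mul h.hd.cexp

lemma IsCh.mono (h : IsCh X u lam t r χ) {r' : ℝ} (hr : r' ≤ r) : IsCh X u lam t r' χ :=
  ⟨h.hd.mono (ball_subset_ball hr), h.h0, fun x hx => h.hW x (ball_subset_ball hr hx), fun x hx => h.he x (ball_subset_ball hr hx)⟩

/-- `g(λx) = F(g(x))` -/
lemma IsCh.gF (h : IsCh X u lam t r χ) {x : ℂ} (hx : x ∈ ball (0:ℂ) r) :
    lam*x*eC (χ (lam*x)) = lam*(x*eC (χ x)) *
      eC (x*eC (χ x) + u t (x*eC (χ x))) := by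
  rw [h.he x hx, add_assoc, Complex.exp_add (χ x)]; ring

lemma IsCh.Lrec (hu : UH X u) (hl : ‖lam‖≤1) (h : IsCh X u lam t r χ) {x : ℂ} (hx : x ∈ ball (0:ℂ) r) :
    1 + lam*x*deriv χ (lam*x) = (1 + x*deriv χ x) *
      (1 + x*eC (χ x) + x*eC (χ x)*deriv (u t) (x*eC (χ x))) := by
  have hχ : HasDerivAt χ (deriv χ x) x := (h.hd.differentiableAt (isOpen_ball.mem_nhds hx)).hasDerivAt
  have hχl : HasDerivAt χ (deriv χ (lam*x)) (lam*x) :=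
    (h.hd.differentiableAt (isOpen_ball.mem_nhds (mul_mem_ball hl hx))).hasDerivAt
  have hu' : HasDerivAt (u t) (deriv (u t) (x*eC (χ x))) (x*eC (χ x)) :=
    ((hu.diffz t).differentiableAt ((isOpen_W X).mem_nhds (h.hW x hx))).hasDerivAt
  have hg : HasDerivAt (fun x => x*eC (χ x)) (1*eC (χ x) + x*(eC (χ x)*deriv χ x)) x :=
    (hasDerivAt_id x).mul hχ.cexp
  have h1 : HasDerivAt (fun x => χ (lam*x)) (deriv χ (lam*x)*(lam*1)) x :=
    hχl.comp x ((hasDerivAt_id x).const_mul lam)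
  have h2 := (hχ.add hg).add (hu'.comp x hg)
  have h3 : (fun x => χ (lam*x)) =ᶠ[𝓝 x] ((χ + fun x => x*eC (χ x)) + (u t ∘ fun x => x*eC (χ x))) := by
    filter_upwards [isOpen_ball.mem_nhds hx] with y hy
    simpa using h.he y hy
  have h4 := h1.unique (h2.congr_of_eventuallyEq h3)
  linear_combination x*h4

lemma IsCh.deriv_cont (h : IsCh X u lam t r χ) : ContinuousOn (fun x => 1 + x*deriv χ x) (ball 0 r) :=
  continuousOn_const.add (continuousOn_id.mul ((h.hd.deriv isOpen_ball).continuousOn))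

lemma IsCh.L_ne (hu : UH X u) (hl : ‖lam‖ < 1) (h : IsCh X u lam t r χ) {x : ℂ} (hx : x ∈ ball (0:ℂ) r) :
    1 + x*deriv χ x ≠ 0 := by
  intro h0
  have h1 : ∀ n : ℕ, 1 + lam^n*x*deriv χ (lam^n*x) = 0 := by
    intro n
    induction n with
    | zero => simpa using h0
    | succ n ih =>
      have := h.Lrec hu hl.le (pow_mul_mem_ball hl.le hx n)
      rw [ih, zero_mul] at this
      rw [← this, pow_succ']; ring_nf
  have hr : (0:ℝ) < r := pos_of_mem_ball hx
  have h2 := ((h.deriv_cont.continuousAt (ball_mem_nhds 0 hr)).tendsto.comp (tendsto_pow_mul hl x))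
  have h3 : ((fun x => 1 + x*deriv χ x) ∘ fun n : ℕ => lam^n*x) = fun _ => 0 := funext h1
  rw [h3] at h2
  have := tendsto_nhds_unique h2 tendsto_const_nhds
  simp at this

lemma IsCh.g_ne (hu : UH X u) (ht : ‖t‖≤1) (hl : ‖lam‖ < 1) (h : IsCh X u lam t r χ) {x : ℂ} (hx : x ∈ ball (0:ℂ) r) :
    x*eC (χ x) ≠ -1 := by
  intro h0
  have h1 := hu.hc t _ ht (h.hW x hx)
  rw [h0] at h1
  have h2 : (-1 : ℂ)*deriv (u t) (-1) = 0 := by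
    rw [← norm_le_zero_iff]; refine h1.trans (by simp)
  have := h.Lrec hu hl.le hx
  rw [h0, h2] at this
  exact h.L_ne hu hl (mul_mem_ball hl.le hx) (by rw [this]; ring)

lemma IsCh.inj (hl0 : lam ≠ 0) (hl : ‖lam‖ < 1) (h : IsCh X u lam t r χ) :
    InjOn (fun x => x*eC (χ x)) (ball 0 r) := by
  intro x hx y hy hxy
  have hr : (0:ℝ) < r := pos_of_mem_ball hx
  simp only at hxy
  have h1 : ∀ n : ℕ, lam^n*x*eC (χ (lam^n*x)) = lam^n*y*eC (χ (lam^n*y)) := by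
    intro n
    induction n with
    | zero => simpa using hxy
    | succ n ih =>
      have e1 := h.gF (pow_mul_mem_ball hl.le hx n)
      have e2 := h.gF (pow_mul_mem_ball hl.le hy n)
      rw [ih] at e1
      rw [pow_succ', mul_assoc lam (lam^n) x, mul_assoc lam (lam^n) y, e1, e2]
  have hg0 : deriv (fun x => x*eC (χ x)) 0 = 1 := by
    have hχ : HasDerivAt χ (deriv χ 0) 0 := (h.hd.differentiableAt (ball_mem_nhds 0 hr)).hasDerivAt
    have := ((hasDerivAt_id (0:ℂ)).mul hχ.cexp).deriv
    simp only [id, h.h0, Complex.exp_zero] at this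
    exact (by simpa using this : deriv (id*fun x => eC (χ x)) 0 = 1)
  have hs : HasStrictDerivAt (fun x => x*eC (χ x)) (deriv (fun x => x*eC (χ x)) 0) 0 :=
    (h.gd.analyticAt (ball_mem_nhds 0 hr)).hasStrictDerivAt
  have hin := hs.eventually_left_inverse (by rw [hg0]; exact one_ne_zero)
  have ex := (tendsto_pow_mul hl x).eventually hin
  have ey := (tendsto_pow_mul hl y).eventually hin
  obtain ⟨n, h2, h3⟩ := (ex.and ey).exists
  have h4 : lam^n*x = lam^n*y := by
    rw [← h2, ← h3, h1 n]
  exact mul_left_cancel₀ (pow_ne_zero n hl0) h4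

end
end

section
lemma exists_log {f : ℂ → ℂ} {r : ℝ} (hr : 0 < r) (hf : DifferentiableOn ℂ f (ball 0 r))
    (hne : ∀ x ∈ ball (0:ℂ) r, f x ≠ 0) (h0 : f 0 = 1) :
    ∃ ℓ : ℂ → ℂ, DifferentiableOn ℂ ℓ (ball 0 r) ∧ ℓ 0 = 0 ∧ ∀ x ∈ ball (0:ℂ) r, f x = eC (ℓ x) := by
  have h1 : DifferentiableOn ℂ (fun x => deriv f x/f x) (ball 0 r) := (hf.deriv isOpen_ball).div hf hne
  obtain ⟨ℓ, hℓ0, hℓ⟩ := h1.isExactOn_ball.with_val_at 0 0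
  refine ⟨ℓ, fun x hx => (hℓ x hx).differentiableAt.differentiableWithinAt, hℓ0, fun x hx => ?_⟩
  have hd : ∀ y ∈ ball (0:ℂ) r, HasDerivAt (fun y => f y*eC (-ℓ y)) 0 y := by
    intro y hy
    have hfy : HasDerivAt f (deriv f y) y := (hf.differentiableAt (isOpen_ball.mem_nhds hy)).hasDerivAt
    have := hfy.mul (hℓ y hy).neg.cexp
    refine this.congr_deriv ?_
    have := hne y hy
    simp only [Pi.neg_apply]
    field_simp
    ring
  have h2 := isOpen_ball.is_const_of_deriv_eq_zero (convex_ball (0:ℂ) r).isPreconnected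
    (fun y hy => (hd y hy).differentiableAt.differentiableWithinAt) (fun y hy => (hd y hy).deriv) hx (mem_ball_self hr)
  simp only [h0, hℓ0, neg_zero, Complex.exp_zero, mul_one] at h2
  rw [Complex.exp_neg] at h2
  exact (mul_inv_eq_one₀ (Complex.exp_ne_zero _)).1 h2

section
variable {X : ℝ} {u : ℂ → ℂ → ℂ} {lam t : ℂ} {r : ℝ} {χ : ℂ → ℂ}

lemma IsCh.grow (hX : 0 < X) (h : IsCh X u lam t r χ) {x : ℂ} (hx : x ∈ ball (0:ℂ) r) :
    ‖x*eC (χ x) + X‖ ≤ X*eR (2*‖x‖/(r - ‖x‖)) := by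
  have hr : (0:ℝ) < r := pos_of_mem_ball hx
  have hXc : (X:ℂ) ≠ 0 := by exact_mod_cast hX.ne'
  have hne : ∀ x ∈ ball (0:ℂ) r, x*eC (χ x) + X ≠ 0 := by
    intro y hy h0
    have := h.hW y hy
    rw [h0, norm_zero] at this; linarith
  obtain ⟨ℓ, hℓd, hℓ0, hℓ⟩ := exists_log (f := fun x => X/(x*eC (χ x) + X)) hr
    ((differentiableOn_const _).div (h.gd.add_const _) hne) (fun x hx => div_ne_zero hXc (hne x hx))
    (by simp [hXc])
  have hn : ∀ y ∈ ball (0:ℂ) r, X = eR (ℓ y).re*‖y*eC (χ y) + X‖ := by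
    intro y hy
    have h1 := congrArg norm (hℓ y hy)
    rw [norm_div, Complex.norm_exp, Complex.norm_real, Real.norm_eq_abs, abs_of_pos hX,
      div_eq_iff (norm_ne_zero_iff.2 (hne y hy))] at h1
    exact h1
  have hre : MapsTo ℓ (ball 0 r) {z | z.re≤1} := by
    intro y hy
    have h1 := hn y hy
    have h2 := h.hW y hy
    have h3 : eR (ℓ y).re ≤ eR 1 := by
      have := Real.add_one_le_exp 1
      have h4 := Real.exp_pos (ℓ y).re
      by_contra h5; push Not at h5
      nlinarith
    exact Real.exp_le_exp.1 h3
  have hb := Complex.borelCaratheodory_zero one_pos hℓd hre hr hx hℓ0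
  rw [mul_one] at hb
  have h5 := hn x hx
  have h6 : -(ℓ x).re≤2*‖x‖/(r - ‖x‖) := by
    have := (abs_le.1 (Complex.abs_re_le_norm (ℓ x))).1
    linarith
  calc ‖x*eC (χ x) + X‖ = X*eR (-(ℓ x).re) := by
        rw [Real.exp_neg]; nth_rw 2 [h5]
        have := Real.exp_pos (ℓ x).re
        field_simp
    _≤_ := by gcongr

/-- crude bound on the half disk -/
lemma IsCh.half (hX : 0 < X) (h : IsCh X u lam t r χ) {x : ℂ} (hx : x ∈ ball (0:ℂ) (r/2)) :
    ‖x*eC (χ x)‖≤9*X := by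
  have hr : (0:ℝ) < r := by have := pos_of_mem_ball hx; linarith
  have h1 := h.grow hX (ball_subset_ball (by linarith) hx)
  rw [mem_ball_zero_iff] at hx
  have h2 : 2*‖x‖/(r - ‖x‖)≤2 := by
    rw [div_le_iff₀ (by linarith)]; linarith
  have h3 : eR 2≤8 := by
    have h4 : eR 2 = eR 1*eR 1 := by rw [← Real.exp_add]; norm_num
    have h5 := Real.exp_one_lt_d9
    have := Real.exp_pos 1
    rw [h4]; nlinarith
  have h6 : X*eR (2*‖x‖/(r - ‖x‖)) ≤ X*8 := by
    have := (Real.exp_le_exp.2 h2).trans h3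
    gcongr
  calc ‖x*eC (χ x)‖ = ‖(x*eC (χ x) + X) - X‖ := by ring_nf
    _≤‖x*eC (χ x) + X‖ + ‖(X:ℂ)‖ := norm_sub_le _ _
    _ ≤ X*8 + X := by
      rw [Complex.norm_real, Real.norm_eq_abs, abs_of_pos hX]; linarith
    _ = _ := by ring

lemma IsCh.hg0 (h : IsCh X u lam t r χ) (hr : 0 < r) : HasDerivAt (fun x => x*eC (χ x)) 1 0 := by
  have hχ : HasDerivAt χ (deriv χ 0) 0 := (h.hd.differentiableAt (ball_mem_nhds 0 hr)).hasDerivAt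
  have := ((hasDerivAt_id (0:ℂ)).mul hχ.cexp)
  refine this.congr_deriv ?_
  simp [h.h0]

lemma IsCh.r_le (hX : 0 < X) (h : IsCh X u lam t r χ) (hr : 0 < r) : r≤18*X := by
  have h1 := norm_deriv_le (half_pos hr) (h.gd.mono (ball_subset_ball (by linarith)))
    (fun x hx => h.half hX hx)
  rw [(h.hg0 hr).deriv, norm_one, le_div_iff₀ (half_pos hr)] at h1
  linarith

lemma IsCh.small (hX : 0 < X) (h : IsCh X u lam t r χ) {x : ℂ} (hx : x ∈ ball (0:ℂ) (r/2)) :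
    ‖x*eC (χ x)‖≤18*X/r*‖x‖ := by
  have := schwarz0 (h.gd.mono (ball_subset_ball (by have := pos_of_mem_ball hx; linarith))) (by simp) (fun x hx => h.half hX hx) x hx
  rw [show 9*X/(r/2) = 18*X/r by ring] at this
  exact this

lemma IsCh.near (hX : 0 < X) (h : IsCh X u lam t r χ) {x : ℂ} (hx : x ∈ ball (0:ℂ) (r/2)) :
    ‖x*eC (χ x) - x‖≤18*X*(2*‖x‖/r)^2 := by
  have hr : (0:ℝ) < r := by have := pos_of_mem_ball hx; linarith
  have hd : DifferentiableOn ℂ (fun x => x*eC (χ x) - x) (ball 0 (r/2)) :=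
    (h.gd.mono (ball_subset_ball (by linarith))).sub differentiableOn_id
  have hO : (fun x => x*eC (χ x) - x) =O[𝓝 0] (fun x : ℂ => x^2) := by
    have h1 : (fun x => eC (χ x) - 1) =O[𝓝 0] (fun x : ℂ => x) := by
      have h2 : HasDerivAt (fun x => eC (χ x)) _ 0 := ((h.hd.differentiableAt (ball_mem_nhds 0 hr)).hasDerivAt).cexp
      have := h2.differentiableAt.isBigO_sub
      simpa [h.h0] using this
    have := (isBigO_refl (fun x : ℂ => x) (𝓝 0)).mul h1
    refine (this.congr ?_ ?_)
    · intro x; ring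
    · intro x; ring
  have hB : ∀ x ∈ ball (0:ℂ) (r/2), ‖x*eC (χ x) - x‖≤18*X := by
    intro x hx
    have h1 := h.half hX hx
    have h2 := h.r_le hX hr
    rw [mem_ball_zero_iff] at hx
    refine (norm_sub_le _ _).trans (by linarith)
  have := vanish (N := 2) (by norm_num) hd hB hO x hx
  rw [show ‖x‖/(r/2) = 2*‖x‖/r by field_simp] at this
  exact this

/-- the chart stays away from the boundary of the domain -/
lemma IsCh.away (hu : UH X u) (ht : ‖t‖≤1) (hl : ‖lam‖ < 1) (hl2 : 1/2≤‖lam‖) (h : IsCh X u lam t r χ) {ε : ℝ}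
    (hε : 0 < ε) (hε1 : ε≤1) (hr : ε ≤ r) (hXε : 2000*X^2*eR (1 - X/4) < ε^2) {x : ℂ} (hx : x ∈ ball (0:ℂ) r) :
    3*X/4≤‖x*eC (χ x) + X‖ := by
  have hX4 := hu.hX
  have hX : 0 < X := by linarith
  have hr0 : 0 < r := by linarith
  have hl0 : lam ≠ 0 := by intro h0; rw [h0, norm_zero] at hl2; linarith
  by_contra hc
  push Not at hc
  set z := x*eC (χ x) with hz
  have hXn : ‖(X:ℂ)‖ = X := by rw [Complex.norm_real, Real.norm_eq_abs, abs_of_pos hX]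
  have hzre : z.re ≤ -(X/4) := by
    have h1 := (abs_le.1 (Complex.abs_re_le_norm (z + X))).2
    rw [Complex.add_re, Complex.ofReal_re] at h1
    linarith
  have hzl : X/4 < ‖z‖ := by
    have h1 : ‖(X:ℂ)‖≤‖z + X‖ + ‖z‖ := by
      calc ‖(X:ℂ)‖ = ‖(z + X) - z‖ := by ring_nf
        _≤_ := norm_sub_le _ _
    linarith
  have hzu : ‖z‖≤7*X/4 := by
    calc ‖z‖ = ‖(z + X) - X‖ := by ring_nf
      _≤‖z + X‖ + ‖(X:ℂ)‖ := norm_sub_le _ _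
      _≤_ := by linarith
  -- size of the image
  have hF : ‖lam*x*eC (χ (lam*x))‖≤7*X/4*eR (1 - X/4) := by
    rw [h.gF hx, ← hz, norm_mul, norm_mul, Complex.norm_exp]
    have h1 : (z + u t z).re≤1 - X/4 := by
      rw [Complex.add_re]
      have := (Complex.re_le_norm (u t z)).trans (hu.hb t z ht (h.hW x hx))
      linarith
    have h2 : ‖lam‖*‖z‖≤7*X/4 := by
      have := norm_nonneg z
      nlinarith
    have := Real.exp_le_exp.2 h1
    gcongr
  set R := ε^2/(144*X) with hR
  have hR0 : 0 < R := by positivity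
  have hRε : R*36 ≤ ε := by
    rw [hR, div_mul_eq_mul_div, div_le_iff₀ (by positivity)]
    nlinarith
  have hRr : closedBall (0:ℂ) R ⊆ ball 0 (r/2) := closedBall_subset_ball (by linarith)
  have hcov := DiffContOnCl.ball_subset_image_closedBall (f := fun x => x*eC (χ x)) (z₀ := 0) (r := R) (ε := R/2)
    ((h.gd.mono (hRr.trans (ball_subset_ball (by linarith)))).diffContOnCl_ball Subset.rfl) hR0 (by
      intro y hy
      rw [mem_sphere_zero_iff_norm] at hy
      have h1 := h.near hX (hRr (by rw [mem_closedBall_zero_iff, hy]))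
      have h2 : 18*X*(2*‖y‖/r)^2 ≤ R/2 := by
        rw [hy]
        have h3 : (2*R/r)^2≤(2*R/ε)^2 := by gcongr
        have h4 : 18*X*(2*R/ε)^2 = R/2 := by
          rw [hR]; field_simp; ring
        calc _≤18*X*(2*R/ε)^2 := by gcongr
          _≤_ := h4.le
      simp only [zero_mul, sub_zero]
      have h6 : ‖y‖≤‖y*eC (χ y)‖ + ‖y*eC (χ y) - y‖ := by
        calc ‖y‖ = ‖y*eC (χ y) - (y*eC (χ y) - y)‖ := by ring_nf
          _≤_ := norm_sub_le _ _
      linarith) (by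
      have := ((h.hg0 hr0).eventually_ne (c := (fun x => x*eC (χ x)) 0) one_ne_zero).frequently
      exact this.filter_mono nhdsWithin_le_nhds)
  have hmem : lam*x*eC (χ (lam*x)) ∈ ball ((fun x => x*eC (χ x)) (0:ℂ)) (R/2/2) := by
    simp only [zero_mul]
    rw [mem_ball_zero_iff]
    refine hF.trans_lt ?_
    rw [hR, div_div, div_div, lt_div_iff₀ (by positivity)]
    have := Real.exp_pos (1 - X/4)
    nlinarith [mul_pos (pow_pos hX 2) this]
  obtain ⟨y, hy, hyx⟩ := hcov hmem
  have hyr : y ∈ ball (0:ℂ) r := ball_subset_ball (by linarith) (hRr hy)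
  have hyx2 : y = lam*x := h.inj hl0 hl hyr (mul_mem_ball hl.le hx) hyx
  rw [hyx2, mem_closedBall_zero_iff, norm_mul] at hy
  have hxR : ‖x‖≤2*R := by
    have := norm_nonneg x
    nlinarith
  have hs := h.small hX (x := x) (by rw [mem_ball_zero_iff]; linarith)
  rw [← hz] at hs
  have : 18*X/r*‖x‖ ≤ X/4 := by
    calc 18*X/r*‖x‖≤18*X/ε*(2*R) := by gcongr
      _ = ε/4 := by rw [hR]; field_simp; ring
      _ ≤ X/4 := by linarith
  linarith

end

/-- uniform bound for the charts -/
lemma chart_bound {X ρ r₀ : ℝ} (hX : 0 < X) (hρ : 0 < ρ) (hr₀ : ρ < r₀) : ∃ N : ℝ, 0 < N ∧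
    ∀ (u : ℂ → ℂ → ℂ) (lam t : ℂ) (r:ℝ) (χ : ℂ → ℂ), r₀ ≤ r → IsCh X u lam t r χ → ∀ x ∈ ball (0:ℂ) ρ, ‖χ x‖ ≤ N := by
  set ρ' := (ρ + r₀)/2 with hρ'
  have hρ'0 : 0 < ρ' := by rw [hρ']; linarith
  have hlt1 : ρ < ρ' := by rw [hρ']; linarith
  have hlt2 : ρ' < r₀ := by rw [hρ']; linarith
  set B := X*eR (2*ρ'/(r₀ - ρ')) + X with hB
  set M := B/ρ' with hM
  have hM0 : 0 < M := by positivity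
  have hd1 : 0 < ρ' - ρ := by linarith
  refine ⟨2*M*ρ/(ρ' - ρ), by positivity, ?_⟩
  intro u lam t r χ hr h x hx
  have hgr : ∀ y ∈ closedBall (0:ℂ) ρ', ‖eC (χ y)‖ ≤ M := by
    have hsub : closedBall (0:ℂ) ρ' ⊆ ball 0 r := closedBall_subset_ball (by linarith)
    intro y hy
    refine Complex.norm_le_of_forall_mem_frontier_norm_le (U := ball (0:ℂ) ρ') isBounded_ball
      (((h.hd.cexp).mono hsub).diffContOnCl_ball Subset.rfl) ?_ (by rwa [closure_ball _ hρ'0.ne'])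
    intro w hw
    rw [frontier_ball _ hρ'0.ne', mem_sphere_zero_iff_norm] at hw
    have hw2 : w ∈ ball (0:ℂ) r := hsub (by rw [mem_closedBall_zero_iff, hw])
    have h1 := h.grow hX hw2
    rw [hw] at h1
    have h2 : 2*ρ'/(r - ρ')≤2*ρ'/(r₀ - ρ') := by
      apply div_le_div_of_nonneg_left (by positivity) (by linarith) (by linarith)
    rw [hM, le_div_iff₀ hρ'0]
    calc ‖eC (χ w)‖*ρ' = ‖w*eC (χ w)‖ := by rw [norm_mul, hw]; ring
      _ = ‖(w*eC (χ w) + X) - X‖ := by ring_nf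
      _≤‖w*eC (χ w) + X‖ + ‖(X:ℂ)‖ := norm_sub_le _ _
      _ ≤ B := by
        rw [Complex.norm_real, Real.norm_eq_abs, abs_of_pos hX, hB]
        have := Real.exp_le_exp.2 h2
        nlinarith
  have hre : MapsTo χ (ball 0 ρ') {z | z.re ≤ M} := by
    intro y hy
    have h1 := hgr y (ball_subset_closedBall hy)
    rw [Complex.norm_exp] at h1
    have := Real.add_one_le_exp (χ y).re
    show (χ y).re ≤ M
    linarith
  have h3 := Complex.borelCaratheodory_zero hM0 (h.hd.mono (ball_subset_ball (by linarith))) hre hρ'0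
    (ball_subset_ball hlt1.le hx) h.h0
  rw [mem_ball_zero_iff] at hx
  refine h3.trans ?_
  have := norm_nonneg x
  apply div_le_div₀ (by positivity) (by gcongr) hd1 (by linarith)
end

lemma hasSum_tc {f : ℂ → ℂ} {R : ℝ} (hf : DifferentiableOn ℂ f (ball 0 R)) {x : ℂ} (hx : x ∈ ball (0:ℂ) R) :
    HasSum (fun j : ℕ => tc j f*x^j) (f x) := by
  have := Complex.hasSum_taylorSeries_on_ball hf hx
  refine this.congr_fun ?_
  intro j
  simp only [tc, sub_zero, smul_eq_mul]
  field_simp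

set_option maxHeartbeats 1600000 in
/-- normal-family limit of charts: abstract version -/
lemma limit_fun {r : ℝ} {χ : ℕ → ℂ → ℂ} {R : ℕ → ℝ} {ε N₀ : ℝ} (hε : 0 < ε) (hN0 : ∀ k, ∀ x ∈ ball (0:ℂ) ε, ‖χ k x‖ ≤ N₀)
    (hεR : ∀ k, ε ≤ R k)
    (hd : ∀ k, DifferentiableOn ℂ (χ k) (ball 0 (R k))) (hb : ∀ ρ, 0 < ρ → ρ < r → ∃ N, 0 < N ∧ ∀ᶠ k in atTop,
      ρ < R k ∧ ∀ x ∈ ball (0:ℂ) ρ, ‖χ k x‖ ≤ N) :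
    ∃ (φ : ℕ → ℕ) (f : ℂ → ℂ), StrictMono φ ∧ DifferentiableOn ℂ f (ball 0 r) ∧
      ∀ x ∈ ball (0:ℂ) r, Tendsto (fun k => χ (φ k) x) atTop (𝓝 (f x)) := by
  have hcomp : IsCompact (Set.univ.pi fun j : ℕ => closedBall (0:ℂ) (N₀/ε^j)) :=
    isCompact_univ_pi fun j => isCompact_closedBall _ _
  obtain ⟨c, -, φ, hφ, hc⟩ := hcomp.tendsto_subseq (x := fun k j => tc j (χ k)) (by
    intro k j _
    rw [mem_closedBall_zero_iff]
    exact norm_tc_le hε ((hd k).mono (ball_subset_ball (hεR k))) (hN0 k) j)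
  rw [tendsto_pi_nhds] at hc
  have hcj : ∀ j, Tendsto (fun k => tc j (χ (φ k))) atTop (𝓝 (c j)) := hc
  have hbd : ∀ ρ, 0 < ρ → ρ < r → ∃ N, 0 < N ∧ (∀ᶠ k in atTop, ∀ j, ‖tc j (χ (φ k))‖ ≤ N/ρ^j) ∧ ∀ j, ‖c j‖ ≤ N/ρ^j := by
    intro ρ hρ hρr
    obtain ⟨N, hN, hNk⟩ := hb ρ hρ hρr
    have h1 : ∀ᶠ k in atTop, ∀ j, ‖tc j (χ (φ k))‖ ≤ N/ρ^j := by
      filter_upwards [hφ.tendsto_atTop.eventually hNk] with k hk j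
      exact norm_tc_le hρ ((hd _).mono (ball_subset_ball hk.1.le)) hk.2 j
    refine ⟨N, hN, h1, fun j => ?_⟩
    exact le_of_tendsto (hcj j).norm (h1.mono fun k hk => hk j)
  refine ⟨φ, fun x => ∑' j, c j*x^j, hφ, ?_, ?_⟩
  · intro x hx
    rw [mem_ball_zero_iff] at hx
    set ρ := (‖x‖ + r)/2 with hρ
    set ρ1 := (ρ + r)/2 with hρ1
    have hx0 := norm_nonneg x
    have hρ0 : 0 < ρ := by rw [hρ]; linarith
    have h1 : ‖x‖ < ρ := by rw [hρ]; linarith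
    have h2 : ρ < ρ1 := by rw [hρ1, hρ]; linarith
    have h3 : ρ1 < r := by rw [hρ1, hρ]; linarith
    have hρ10 : 0 < ρ1 := hρ0.trans h2
    obtain ⟨N, hN, -, hcN⟩ := hbd ρ1 (by linarith) h3
    have hsum : Summable fun j : ℕ => N*(ρ/ρ1)^j := (summable_geometric_of_lt_one (by positivity)
      ((div_lt_one (by linarith)).2 h2)).mul_left _
    have := Complex.differentiableOn_tsum_of_summable_norm (F := fun j x => c j*x^j) hsum (U := ball (0:ℂ) ρ)
      (fun j => by fun_prop) isOpen_ball (by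
        intro j y hy
        rw [mem_ball_zero_iff] at hy
        rw [norm_mul, norm_pow, div_pow]
        calc ‖c j‖*‖y‖^j ≤ N/ρ1^j*ρ^j := by
              have := hcN j
              gcongr
          _ = _ := by ring)
    exact (this.differentiableAt (isOpen_ball.mem_nhds (mem_ball_zero_iff.2 h1))).differentiableWithinAt
  · intro x hx
    rw [mem_ball_zero_iff] at hx
    set ρ := (‖x‖ + r)/2 with hρ
    have hx0 := norm_nonneg x
    have hρ0 : 0 < ρ := by rw [hρ]; linarith
    have h1 : ‖x‖ < ρ := by rw [hρ]; linarith
    have h3 : ρ < r := by rw [hρ]; linarith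
    obtain ⟨N, hN, hkN, -⟩ := hbd ρ hρ0 h3
    obtain ⟨_, _, hN2⟩ := hb ρ hρ0 h3
    have hsum : Summable fun j : ℕ => N*(‖x‖/ρ)^j := (summable_geometric_of_lt_one (by positivity)
      ((div_lt_one (by linarith)).2 h1)).mul_left _
    have h4 := tendsto_tsum_of_dominated_convergence (f := fun k j => tc j (χ (φ k))*x^j) (g := fun j => c j*x^j)
      (𝓕 := atTop) hsum (fun j => (hcj j).mul_const _) (by
        filter_upwards [hkN] with k hk j
        rw [norm_mul, norm_pow, div_pow]
        calc ‖tc j (χ (φ k))‖*‖x‖^j ≤ N/ρ^j*‖x‖^j := by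
              have := hk j
              gcongr
          _ = _ := by ring)
    refine h4.congr' ?_
    filter_upwards [hφ.tendsto_atTop.eventually hN2] with k hk
    exact (hasSum_tc (hd (φ k)) (mem_ball_zero_iff.2 (h1.trans hk.1))).tsum_eq

/-- closedness of the set of charts -/
lemma chart_closed {X ε : ℝ} {u : ℂ → ℂ → ℂ} (hu : UH X u) {lam : ℂ} (hl : ‖lam‖ < 1) (hl2 : 1/2≤‖lam‖)
    (hε : 0 < ε) (hε1 : ε≤1) (hXε : 2000*X^2*eR (1 - X/4) < ε^2)
    {t : ℂ} {r : ℝ} {tk : ℕ → ℂ} {rk : ℕ → ℝ} {χ : ℕ → ℂ → ℂ} (ht1 : ∀ k, ‖tk k‖≤1) (hrk : ∀ k, ε ≤ rk k)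
    (htk : Tendsto tk atTop (𝓝 t)) (hr : Tendsto rk atTop (𝓝 r)) (h : ∀ k, IsCh X u lam (tk k) (rk k) (χ k)) :
    ∃ f, IsCh X u lam t r f := by
  have hX : 0 < X := by have := hu.hX; linarith
  obtain ⟨N₀, hN00, hN0⟩ := chart_bound hX (half_pos hε) (half_lt_self hε)
  have hεr : ε ≤ r := ge_of_tendsto' hr hrk
  obtain ⟨φ, f, hφ, hfd, hf⟩ := limit_fun (r := r) (χ := χ) (R := rk) (half_pos hε) (N₀ := N₀)
    (fun k => hN0 u lam (tk k) (rk k) (χ k) (hrk k) (h k)) (fun k => by linarith [hrk k]) (fun k => (h k).hd) (by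
      intro ρ hρ hρr
      obtain ⟨N, hN, hN2⟩ := chart_bound hX hρ (show ρ < (ρ + r)/2 by linarith)
      refine ⟨N, hN, ?_⟩
      filter_upwards [hr.eventually (lt_mem_nhds (show (ρ + r)/2 < r by linarith))] with k hk
      exact ⟨by linarith, hN2 u lam (tk k) (rk k) (χ k) hk.le (h k)⟩)
  have hev : ∀ x ∈ ball (0:ℂ) r, ∀ᶠ k in atTop, x ∈ ball (0:ℂ) (rk (φ k)) := by
    intro x hx
    rw [mem_ball_zero_iff] at hx
    filter_upwards [(hr.comp hφ.tendsto_atTop).eventually (lt_mem_nhds hx)] with k hk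
    rw [mem_ball_zero_iff]; exact hk
  have hg : ∀ x ∈ ball (0:ℂ) r, Tendsto (fun k => x*eC (χ (φ k) x)) atTop (𝓝 (x*eC (f x))) :=
    fun x hx => ((hf x hx).cexp).const_mul x
  have hW : ∀ x ∈ ball (0:ℂ) r, X/2 < ‖x*eC (f x) + X‖ := by
    intro x hx
    have h1 : Tendsto (fun k => ‖x*eC (χ (φ k) x) + X‖) atTop (𝓝 ‖x*eC (f x) + X‖) :=
      ((hg x hx).add_const _).norm
    have h2 : 3*X/4≤‖x*eC (f x) + X‖ := by
      refine ge_of_tendsto h1 ?_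
      filter_upwards [hev x hx] with k hk
      exact (h (φ k)).away hu (ht1 _) hl hl2 hε hε1 (hrk _) hXε hk
    linarith
  refine ⟨f, hfd, ?_, hW, ?_⟩
  · have h0 : (0:ℂ) ∈ ball (0:ℂ) r := mem_ball_self (by linarith)
    refine tendsto_nhds_unique (hf 0 h0) ?_
    simp only [(h _).h0]
    exact tendsto_const_nhds
  · intro x hx
    have h1 := hf _ (mul_mem_ball hl.le hx)
    have hc : ContinuousAt (fun p : ℂ × ℂ => u p.1 p.2) (t, x*eC (f x)) :=
      hu.hd.continuousOn.continuousAt ((isOpen_W2 X).mem_nhds (hW x hx))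
    have h2 : Tendsto (fun k => u (tk (φ k)) (x*eC (χ (φ k) x))) atTop (𝓝 (u t (x*eC (f x)))) :=
      hc.tendsto.comp ((htk.comp hφ.tendsto_atTop).prodMk_nhds (hg x hx))
    have h3 := ((hf x hx).add (hg x hx)).add h2
    refine tendsto_nhds_unique h1 (h3.congr' ?_)
    filter_upwards [hev x hx] with k hk
    exact ((h (φ k)).he x hk).symm

set_option maxHeartbeats 1600000 in
/-- perturbation of a chart -/
lemma chart_pert {lam : ℂ} {χ Γ : ℂ → ℂ} {r ρ s B κ b m q a : ℝ} (hρ : 0 < ρ) (hs : 0 < s) (hb : 0 ≤ b) (hκ : 0 < κ)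
    (hl : ‖lam‖≤1) (hρr : ρ*eR s ≤ r) (hχ : DifferentiableOn ℂ χ (ball 0 r)) (h0 : χ 0 = 0)
    (hΓ : DifferentiableOn ℂ Γ (ball 0 ρ)) (hB : ∀ x ∈ ball (0:ℂ) r, ‖χ x‖ ≤ B) (hBΓ : ∀ x ∈ ball (0:ℂ) ρ, ‖Γ x‖ ≤ B)
    (hκL : ∀ x ∈ ball (0:ℂ) ρ, κ≤‖1 + lam*x*deriv χ (lam*x)‖)
    (hm0 : 0 ≤ m) (hm : ∀ x ∈ ball (0:ℂ) ρ, ‖χ (lam*x) - Γ x‖ ≤ m*‖x‖) (hm2 : m*ρ ≤ κ*(b/2)) (hbs : b < s/4)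
    (hBb : 8*(s + 2*B)/s^2*b ≤ κ/2) (hq0 : 0 ≤ q) (hq1 : q < 1) (ha0 : 0 < a)
    (hq : ‖lam‖*eR (2*m/κ*ρ) ≤ q) (ha : 2*m/κ*ρ/(1 - q) ≤ a) :
    ∃ χ' : ℂ → ℂ, DifferentiableOn ℂ χ' (ball 0 (ρ*eR (-(6*a)))) ∧ χ' 0 = 0 ∧
      ∀ y ∈ ball (0:ℂ) (ρ*eR (-(6*a))), ∃ x ∈ ball (0:ℂ) ρ, y*eC (χ' y) = x*eC (χ x) ∧
        χ' (lam*y) = χ' y + (Γ x - χ x) := by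
  have hmem : ∀ x ∈ ball (0:ℂ) ρ, ∀ w : ℂ, ‖w‖ ≤ s → lam*x*eC w ∈ ball (0:ℂ) r := by
    intro x hx w hw
    have h1 := mul_mem_ball hl hx
    rw [mem_ball_zero_iff] at h1 ⊢
    refine (norm_mul_exp_le hw).trans_lt (lt_of_lt_of_le ?_ hρr)
    exact mul_lt_mul_of_pos_right h1 (Real.exp_pos _)
  have hρr' : ρ ≤ r := by
    have : 1 ≤ eR s := Real.one_le_exp hs.le
    nlinarith
  have hΓ0 : ∀ x ∈ ball (0:ℂ) ρ, lam*x ∈ ball (0:ℂ) r := fun x hx => ball_subset_ball hρr' (mul_mem_ball hl hx)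
  obtain ⟨ω, hωd, hω⟩ := imp (isOpen_ball (x := (0:ℂ)) (ε := ρ)) (fun x w => w + χ (lam*x*eC w) - Γ x)
    (fun x => 1 + lam*x*deriv χ (lam*x)) (s := s) (B := s + 2*B) (b := b) (κ := κ) hs hb hκ
    (by
      intro x hx
      refine (differentiableOn_id.add (hχ.comp (f := fun w => lam*x*eC w) (by fun_prop) ?_)).sub_const _
      intro w hw
      exact hmem x hx w (mem_ball_zero_iff.1 hw).le)
    (by
      intro x hx w hw
      have hw' := (mem_ball_zero_iff.1 hw).le
      have h1 := hB _ (hmem x hx w hw')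
      have h2 := hBΓ x hx
      refine (norm_sub_le _ _).trans ((add_le_add_left (norm_add_le _ _) _).trans (by linarith)))
    (by
      intro w hw hwb
      refine (hw.add (hχ.comp (f := fun x => lam*x*eC (w x)) (by fun_prop) ?_)).sub hΓ
      intro x hx
      exact hmem x hx _ ((hwb x hx).trans (by linarith)))
    (by
      have h1 : DifferentiableOn ℂ (fun x => deriv χ (lam*x)) (ball 0 ρ) :=
        (hχ.deriv isOpen_ball).comp (f := fun x => lam*x) (by fun_prop) hΓ0
      fun_prop)
    (by
      intro x hx
      have h1 : HasDerivAt χ (deriv χ (lam*x)) (lam*x*eC 0) := by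
        rw [Complex.exp_zero, mul_one]
        exact (hχ.differentiableAt (isOpen_ball.mem_nhds (hΓ0 x hx))).hasDerivAt
      have h2 : HasDerivAt (fun w => lam*x*eC w) (lam*x*eC 0) 0 :=
        (Complex.hasDerivAt_exp 0).const_mul _
      have h3 := ((hasDerivAt_id (0:ℂ)).add (h1.comp 0 h2)).sub_const (Γ x)
      have h4 := h3.deriv
      simp only [Complex.exp_zero, mul_one] at h4
      refine Eq.trans ?_ (h4.trans (by ring))
      rfl)
    hκL hbs hBb (by
      intro x hx
      simp only [Complex.exp_zero, mul_one, zero_add]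
      refine (hm x hx).trans (le_trans ?_ hm2)
      have := (mem_ball_zero_iff.1 hx).le
      gcongr)
  have hωc : ∀ x ∈ ball (0:ℂ) ρ, ‖ω x‖≤2*m/κ*‖x‖ := by
    intro x hx
    have h1 := (hω x hx).2.2.1
    simp only [Complex.exp_zero, mul_one, zero_add] at h1
    have h2 := hm x hx
    rw [div_mul_eq_mul_div, le_div_iff₀ hκ]
    nlinarith
  obtain ⟨ψ, hψd, hψ0, hψ⟩ := koenigs (lam := lam) hρ hq0 hq1 ha0 hl hωd hωc (by
      intro x hx
      refine le_trans ?_ hq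
      refine norm_mul_exp_le ((hωc x hx).trans ?_)
      have := (mem_ball_zero_iff.1 hx).le
      gcongr) ha
  refine ⟨fun y => ψ y + χ (y*eC (ψ y)), ?_, ?_, ?_⟩
  · refine hψd.add (hχ.comp (f := fun y => y*eC (ψ y)) (by fun_prop) ?_)
    intro y hy
    exact ball_subset_ball hρr' (hψ y hy).1
  · simp [hψ0, h0]
  · intro y hy
    obtain ⟨h1, h2, h3⟩ := hψ y hy
    refine ⟨y*eC (ψ y), h1, ?_, ?_⟩
    · simp only []
      rw [Complex.exp_add]; ring
    · have h4 := (hω _ h1).2.1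
      simp only [] at h4 ⊢
      have h5 : lam*y*eC (ψ (lam*y)) = lam*(y*eC (ψ y))*eC (ω (y*eC (ψ y))) := by
        rw [h3, Complex.exp_add]; ring
      rw [h5, h3]
      linear_combination h4

lemma UH.tlip {X : ℝ} {u : ℂ → ℂ → ℂ} (hu : UH X u) {t₀ t z : ℂ} (ht : t ∈ ball t₀ (1 - ‖t₀‖))
    (hz : X/2 < ‖z + X‖) : ‖u t z - u t₀ z‖≤2/(1 - ‖t₀‖)*‖t - t₀‖ := by
  have hin : ∀ t ∈ ball t₀ (1 - ‖t₀‖), ‖t‖≤1 := by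
    intro t ht
    rw [mem_ball, dist_eq_norm] at ht
    have : ‖t‖≤‖t - t₀‖ + ‖t₀‖ := by
      calc ‖t‖ = ‖(t - t₀) + t₀‖ := by ring_nf
        _≤_ := norm_add_le _ _
    linarith
  have h0 : ‖t₀‖≤1 := hin t₀ (mem_ball_self (pos_of_mem_ball ht))
  have hm : MapsTo (fun t => u t z) (ball t₀ (1 - ‖t₀‖)) (closedBall (u t₀ z) 2) := by
    intro t' ht'
    rw [mem_closedBall, dist_eq_norm]
    refine (norm_sub_le _ _).trans ?_
    have := hu.hb t' z (hin t' ht') hz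
    have := hu.hb t₀ z h0 hz
    linarith
  have := Complex.dist_le_div_mul_dist_of_mapsTo_ball (hu.difft hz).differentiableOn hm ht
  rwa [dist_eq_norm, dist_eq_norm] at this

set_option maxHeartbeats 1600000 in
/-- openness -/
lemma chart_open {X : ℝ} {u : ℂ → ℂ → ℂ} (hu : UH X u) {lam : ℂ} (hl : ‖lam‖ < 1)
    {t₀ : ℂ} {r r₁ : ℝ} {χ : ℂ → ℂ} (ht₀ : ‖t₀‖ < 1) (hr₁ : 0 < r₁) (hr : r₁ < r) (h : IsCh X u lam t₀ r χ) :
    ∀ᶠ t in 𝓝 t₀, ∃ f, IsCh X u lam t r₁ f := by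
  set ρ := (r₁ + r)/2 with hρd
  set r' := (ρ + r)/2 with hr'd
  have e1 : r₁ < ρ := by rw [hρd]; linarith
  have e2 : ρ < r' := by rw [hr'd, hρd]; linarith
  have e3 : r' < r := by rw [hr'd, hρd]; linarith
  have hρ : 0 < ρ := by linarith
  have hr' : 0 < r' := by linarith
  obtain ⟨B₀, hB₀⟩ := (isCompact_closedBall (0:ℂ) r').exists_bound_of_continuousOn
    (h.hd.continuousOn.mono (closedBall_subset_ball e3))
  have hB0 : 0 ≤ B₀ := (norm_nonneg _).trans (hB₀ 0 (mem_closedBall_self hr'.le))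
  obtain ⟨κ, hκ, hκL⟩ : ∃ κ > 0, ∀ x ∈ ball (0:ℂ) ρ, κ≤‖1 + lam*x*deriv χ (lam*x)‖ := by
    obtain ⟨x₀, hx₀, hmin⟩ := (isCompact_closedBall (0:ℂ) ρ).exists_isMinOn ⟨0, mem_closedBall_self hρ.le⟩
      ((h.deriv_cont.mono (closedBall_subset_ball (e2.trans e3))).norm)
    refine ⟨_, norm_pos_iff.2 (h.L_ne hu hl (closedBall_subset_ball (e2.trans e3) hx₀)), fun x hx => ?_⟩
    exact hmin (ball_subset_closedBall (mul_mem_ball hl.le hx))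
  set B := B₀ + ρ*eR B₀ + 1 with hBd
  have hBpos : 0 < B := by positivity
  set s := Real.log (r'/ρ) with hsd
  have hs : 0 < s := Real.log_pos ((one_lt_div hρ).2 e2)
  have hse : ρ*eR s = r' := by
    rw [hsd, Real.exp_log (by positivity)]; field_simp
  obtain ⟨b, hb0, hbs, hBb⟩ : ∃ b > 0, b < s/4 ∧ 8*(s + 2*B)/s^2*b ≤ κ/2 := by
    refine ⟨min (s/8) (κ/2/(8*(s + 2*B)/s^2)), by positivity, (min_le_left _ _).trans_lt (by linarith), ?_⟩
    calc _≤8*(s + 2*B)/s^2*(κ/2/(8*(s + 2*B)/s^2)) := by gcongr; exact min_le_right _ _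
      _ = _ := by field_simp
  set q := (1 + ‖lam‖)/2 with hqd
  have hln := norm_nonneg lam
  have hq0 : 0 ≤ q := by positivity
  have hq1 : q < 1 := by rw [hqd]; linarith
  have hlq : ‖lam‖ < q := by rw [hqd]; linarith
  set a := Real.log (ρ/r₁)/6 with had
  have ha0 : 0 < a := by have := Real.log_pos ((one_lt_div hr₁).2 e1); positivity
  have hae : ρ*eR (-(6*a)) = r₁ := by
    rw [had, Real.exp_neg, show 6*(Real.log (ρ/r₁)/6) = Real.log (ρ/r₁) by ring, Real.exp_log (by positivity)]
    field_simp
  have hδ : ∀ᶠ δ in 𝓝 (0:ℝ), δ < κ*(b/2) ∧ ‖lam‖*eR (2*δ/κ) < q ∧ 2*δ/κ/(1 - q) < a := by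
    refine (eventually_lt_nhds (by positivity)).and (Eventually.and ?_ ?_)
    · have hc : ContinuousAt (fun δ : ℝ => ‖lam‖*eR (2*δ/κ)) 0 := by fun_prop
      refine hc.eventually (gt_mem_nhds ?_)
      simpa using hlq
    · have hc : ContinuousAt (fun δ : ℝ => 2*δ/κ/(1 - q)) 0 := by fun_prop
      refine hc.eventually (gt_mem_nhds ?_)
      simpa using ha0
  have htend : Tendsto (fun t : ℂ => 2/(1 - ‖t₀‖)*‖t - t₀‖) (𝓝 t₀) (𝓝 0) := by
    have hc : ContinuousAt (fun t : ℂ => 2/(1 - ‖t₀‖)*‖t - t₀‖) t₀ := by fun_prop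
    have := hc.tendsto
    simpa using this
  filter_upwards [htend.eventually hδ, ball_mem_nhds t₀ (show 0 < 1 - ‖t₀‖ by linarith)] with t ⟨hd1, hd2, hd3⟩ htb
  set δ := 2/(1 - ‖t₀‖)*‖t - t₀‖ with hδd
  have hδ0 : 0 ≤ δ := by
    have : 0 < 1 - ‖t₀‖ := by linarith
    positivity
  have ht1 : ‖t‖≤1 := by
    rw [mem_ball, dist_eq_norm] at htb
    have : ‖t‖≤‖t - t₀‖ + ‖t₀‖ := by
      calc ‖t‖ = ‖(t - t₀) + t₀‖ := by ring_nf
        _≤_ := norm_add_le _ _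
    linarith
  have hsub : ball (0:ℂ) ρ ⊆ ball 0 r := ball_subset_ball (e2.trans e3).le
  have hgd : DifferentiableOn ℂ (fun x => u t (x*eC (χ x))) (ball 0 r) :=
    (hu.diffz t).comp h.gd h.hW
  have hgd0 : DifferentiableOn ℂ (fun x => u t₀ (x*eC (χ x))) (ball 0 r) :=
    (hu.diffz t₀).comp h.gd h.hW
  have hdiff : ∀ x ∈ ball (0:ℂ) ρ, ‖u t₀ (x*eC (χ x)) - u t (x*eC (χ x))‖ ≤ δ/ρ*‖x‖ := by
    refine schwarz0 (f := fun x => u t₀ (x*eC (χ x)) - u t (x*eC (χ x)))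
      ((hgd0.sub hgd).mono hsub) (by simp [hu.h0]) ?_
    intro x hx
    rw [norm_sub_rev]
    exact hu.tlip htb (h.hW x (hsub hx))
  obtain ⟨f, hf1, hf2, hf3⟩ := chart_pert (lam := lam) (χ := χ) (Γ := fun x => χ x + x*eC (χ x) + u t (x*eC (χ x)))
    (r := r') (ρ := ρ) (s := s) (B := B) (κ := κ) (b := b) (m := δ/ρ) (q := q) (a := a) hρ hs hb0.le hκ hl.le hse.le
    (h.hd.mono (ball_subset_ball e3.le)) h.h0 (((h.hd.add h.gd).add hgd).mono hsub)
    (fun x hx => (hB₀ x (ball_subset_closedBall hx)).trans (by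
      rw [hBd]; have : 0 < ρ*eR B₀ := by positivity
      linarith))
    (fun x hx => by
      have h1 := hB₀ x (ball_subset_closedBall (ball_subset_ball e2.le hx))
      have h2 := hu.hb t _ ht1 (h.hW x (hsub hx))
      have h3 : ‖x*eC (χ x)‖ ≤ ρ*eR B₀ := (norm_mul_exp_le h1).trans (by
        have := (mem_ball_zero_iff.1 hx).le
        gcongr)
      refine (norm_add_le _ _).trans ((add_le_add_left (norm_add_le _ _) _).trans ?_)
      rw [hBd]; linarith)
    hκL (by positivity) (fun x hx => by
      refine le_trans (le_of_eq ?_) (hdiff x hx)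
      rw [h.he x (hsub hx)]; congr 1; ring)
    (by rw [div_mul_cancel₀ _ hρ.ne']; exact hd1.le) hbs hBb hq0 hq1 ha0
    (by rw [show 2*(δ/ρ)/κ*ρ = 2*δ/κ by field_simp]; exact hd2.le)
    (by rw [show 2*(δ/ρ)/κ*ρ = 2*δ/κ by field_simp]; exact hd3.le)
  rw [hae] at hf1 hf3
  refine ⟨f, hf1, hf2, ?_, ?_⟩
  · intro y hy
    obtain ⟨x, hx, h1, -⟩ := hf3 y hy
    rw [h1]; exact h.hW x (hsub hx)
  · intro y hy
    obtain ⟨x, hx, h1, h2⟩ := hf3 y hy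
    rw [h2, h1]; ring

section
lemma ev_small (c:ℝ) {d : ℝ} (hd : 0 < d) : ∀ᶠ δ in 𝓝[>] (0:ℝ), c*δ < d := by
  have hc : ContinuousAt (fun δ : ℝ => c*δ) 0 := by fun_prop
  exact (hc.eventually (gt_mem_nhds (by simpa using hd))).filter_mono nhdsWithin_le_nhds

section
variable {X : ℝ} {u : ℂ → ℂ → ℂ} {lam t : ℂ} {r : ℝ} {χ : ℂ → ℂ}

lemma UH.mult_lower (hu : UH X u) (ht : ‖t‖≤1) {z : ℂ} (hz : X/2 < ‖z + X‖) :
    1/2*‖1 + z‖≤‖1 + z + z*deriv (u t) z‖ := by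
  have h1 := hu.hc t z ht hz
  have : ‖1 + z‖≤‖1 + z + z*deriv (u t) z‖ + ‖z*deriv (u t) z‖ := by
    calc ‖1 + z‖ = ‖(1 + z + z*deriv (u t) z) - z*deriv (u t) z‖ := by ring_nf
      _≤_ := norm_sub_le _ _
  linarith

lemma IsCh.deriv_bound (hu : UH X u) (ht : ‖t‖≤1) (hl : ‖lam‖ < 1) (hl0 : 0 < ‖lam‖) (hr : 0 < r) (h : IsCh X u lam t r χ)
    {κ : ℝ} (hκ : 0 < κ) (hκg : ∀ x ∈ ball (0:ℂ) r, κ≤‖1 + x*eC (χ x)‖) :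
    ∃ Λ, 0 ≤ Λ ∧ ∀ x ∈ ball (0:ℂ) r, ‖deriv χ x‖ ≤ Λ := by
  have hlr : ‖lam‖*r < r := by nlinarith
  have hsub : closedBall (0:ℂ) (‖lam‖*r) ⊆ ball 0 r := closedBall_subset_ball hlr
  obtain ⟨D1, hD1⟩ := (isCompact_closedBall (0:ℂ) (‖lam‖*r)).exists_bound_of_continuousOn
    ((h.hd.deriv isOpen_ball).continuousOn.mono hsub)
  obtain ⟨D2, hD2⟩ := (isCompact_closedBall (0:ℂ) (‖lam‖*r)).exists_bound_of_continuousOn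
    (h.deriv_cont.mono hsub)
  have h0 : (0:ℂ) ∈ closedBall (0:ℂ) (‖lam‖*r) := mem_closedBall_self (by positivity)
  have hD20 : 0 ≤ D2 := (norm_nonneg _).trans (hD2 0 h0)
  refine ⟨max D1 ((1 + 2*D2/κ)/(‖lam‖*r)), le_max_of_le_right (by positivity), fun x hx => ?_⟩
  rcases le_or_gt ‖x‖ (‖lam‖*r) with hc | hc
  · exact (hD1 x (mem_closedBall_zero_iff.2 hc)).trans (le_max_left _ _)
  · refine le_trans ?_ (le_max_right _ _)
    have h1 := h.Lrec hu hl.le hx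
    have h2 := (hκg x hx).trans' le_rfl
    have h3 := hu.mult_lower ht (h.hW x hx)
    have h4 := hD2 (lam*x) (by
      rw [mem_closedBall_zero_iff, norm_mul]
      have := (mem_ball_zero_iff.1 hx).le
      gcongr)
    rw [h1, norm_mul] at h4
    have h5 : ‖1 + x*deriv χ x‖≤2*D2/κ := by
      rw [le_div_iff₀ hκ]
      have := norm_nonneg (1 + x*deriv χ x)
      nlinarith
    have h6 : ‖x*deriv χ x‖≤1 + 2*D2/κ := by
      calc ‖x*deriv χ x‖ = ‖(1 + x*deriv χ x) - 1‖ := by ring_nf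
        _≤‖1 + x*deriv χ x‖ + ‖(1:ℂ)‖ := norm_sub_le _ _
        _≤_ := by rw [norm_one]; linarith
    rw [norm_mul] at h6
    rw [le_div_iff₀ (by positivity), mul_comm]
    refine le_trans ?_ h6
    gcongr

lemma UH.zlip (hu : UH X u) (ht : ‖t‖≤1) {g z : ℂ} (hg : 3*X/4≤‖g + X‖) (hz : ‖z - g‖ ≤ X/8) :
    ‖u t z - u t g‖≤2*‖z - g‖ := by
  have hX := hu.hX
  have hsub : ball g (X/4) ⊆ {z : ℂ | X/2 < ‖z + X‖} := by
    intro y hy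
    rw [mem_ball, dist_eq_norm] at hy
    have : ‖g + X‖≤‖y + X‖ + ‖y - g‖ := by
      calc ‖g + X‖ = ‖(y + X) - (y - g)‖ := by ring_nf
        _≤_ := norm_sub_le _ _
    show X/2 < ‖y + X‖
    linarith
  have hm : MapsTo (u t) (ball g (X/4)) (closedBall (u t g) 2) := by
    intro y hy
    rw [mem_closedBall, dist_eq_norm]
    refine (norm_sub_le _ _).trans ?_
    have := hu.hb t y ht (hsub hy)
    have := hu.hb t g ht (hsub (mem_ball_self (by linarith)))
    linarith
  have hzb : z ∈ ball g (X/4) := by rw [mem_ball, dist_eq_norm]; linarith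
  have := Complex.dist_le_div_mul_dist_of_mapsTo_ball ((hu.diffz t).mono hsub) hm hzb
  rw [dist_eq_norm, dist_eq_norm] at this
  refine this.trans ?_
  gcongr
  rw [div_le_iff₀ (by linarith)]; linarith

set_option maxHeartbeats 3200000 in
lemma IsCh.extend (hu : UH X u) (ht : ‖t‖≤1) (hl : ‖lam‖ < 1) (hl0 : 0 < ‖lam‖) (hr : 0 < r) (h : IsCh X u lam t r χ)
    (haw : ∀ x ∈ ball (0:ℂ) r, 3*X/4≤‖x*eC (χ x) + X‖)
    {κ : ℝ} (hκ : 0 < κ) (hκg : ∀ x ∈ ball (0:ℂ) r, κ≤‖1 + x*eC (χ x)‖) :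
    ∃ r' > r, ∃ f, IsCh X u lam t r' f := by
  obtain ⟨Λ, hΛ, hΛd⟩ := h.deriv_bound hu ht hl hl0 hr hκ hκg
  have hX4 := hu.hX
  have hlip : ∀ x ∈ ball (0:ℂ) r, ∀ y ∈ ball (0:ℂ) r, ‖χ x - χ y‖ ≤ Λ*‖x - y‖ := fun x hx y hy =>
    lip_of_deriv isOpen_ball (convex_ball _ _) h.hd hΛd hx hy
  have hχB : ∀ x ∈ ball (0:ℂ) r, ‖χ x‖ ≤ Λ*r := by
    intro x hx
    have h1 := hlip x hx 0 (mem_ball_self hr)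
    rw [h.h0, sub_zero, sub_zero] at h1
    refine h1.trans ?_
    have := (mem_ball_zero_iff.1 hx).le
    gcongr
  set B₀ := Λ*r with hB₀
  have hB0 : 0 ≤ B₀ := by positivity
  set M := r*eR B₀ with hM
  have hM0 : 0 < M := by positivity
  have hgM : ∀ x ∈ ball (0:ℂ) r, ‖x*eC (χ x)‖ ≤ M := by
    intro x hx
    refine (norm_mul_exp_le (hχB x hx)).trans ?_
    have := (mem_ball_zero_iff.1 hx).le
    rw [hM]; gcongr
  set s := min 1 (X/(64*M)) with hs
  have hs0 : 0 < s := by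
    have : 0 < X := by linarith
    positivity
  have hs1 : s≤1 := min_le_left _ _
  have hsM : 4*M*s ≤ X/16 := by
    calc 4*M*s≤4*M*(X/(64*M)) := by gcongr; exact min_le_right _ _
      _ = _ := by field_simp; ring
  set B := 2*B₀ + s + (M + X/8) + 1 with hB
  have hBpos : 0 < B := by positivity
  obtain ⟨b, hb0, hbs, hBb⟩ : ∃ b > 0, b < s/4 ∧ 8*B/s^2*b ≤ κ/4/2 := by
    refine ⟨min (s/8) (κ/8/(8*B/s^2)), by positivity, (min_le_left _ _).trans_lt (by linarith), ?_⟩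
    calc _≤8*B/s^2*(κ/8/(8*B/s^2)) := by gcongr; exact min_le_right _ _
      _ = _ := by field_simp; norm_num
  have hev : ∀ᶠ δ in 𝓝[>] (0:ℝ), 1*δ < 1/2 ∧ 1*δ < 1 - ‖lam‖ ∧ (2*M)*δ < X/16 ∧ (2*M)*δ < κ/2 ∧
      (6*M + 2*B₀)*δ < κ/4*(b/2) ∧ B₀*δ < b ∧ 0 < δ := by
    refine (ev_small 1 (by norm_num)).and ((ev_small 1 (by linarith)).and ((ev_small _ (by linarith)).and ((ev_small _ (by linarith)).and
      ((ev_small _ (by positivity)).and ((ev_small _ hb0).and ?_)))))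
    exact eventually_mem_nhdsWithin
  obtain ⟨δ, d1, d2, d3, d4, d5, d6, hδ⟩ := hev.exists
  rw [one_mul] at d1 d2
  have h1δ : 0 < 1 - δ := by linarith
  set r' := r/(1 - δ) with hr'
  have hr'e : (1 - δ)*r' = r := by rw [hr']; field_simp
  have hr'r : r < r' := by
    rw [hr', lt_div_iff₀ h1δ]; nlinarith
  have hr'2 : r'≤2*r := by
    rw [hr', div_le_iff₀ h1δ]; nlinarith
  have hdc : ((1 - δ : ℝ) : ℂ) ≠ 0 := by exact_mod_cast h1δ.ne'
  set e : ℂ := ((1 - δ : ℝ) : ℂ) with he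
  have hen : ‖e‖ = 1 - δ := by rw [he, Complex.norm_real, Real.norm_eq_abs, abs_of_pos h1δ]
  have hy : ∀ x ∈ ball (0:ℂ) r', e*x ∈ ball (0:ℂ) r := by
    intro x hx
    rw [mem_ball_zero_iff] at hx ⊢
    rw [norm_mul, hen, ← hr'e]
    gcongr
  have hly : ∀ x ∈ ball (0:ℂ) r', lam*x ∈ ball (0:ℂ) r := by
    intro x hx
    rw [mem_ball_zero_iff] at hx ⊢
    rw [norm_mul, ← hr'e]
    have := norm_nonneg x
    have h1 : ‖lam‖*‖x‖≤(1 - δ)*‖x‖ := by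
      have : ‖lam‖≤1 - δ := by linarith
      gcongr
    have h2 : (1 - δ)*‖x‖ < (1 - δ)*r' := by gcongr
    linarith
  set Z : ℂ → ℂ := fun x => x*eC (χ (e*x)) with hZ
  have hχ0d : DifferentiableOn ℂ (fun x => χ (e*x)) (ball 0 r') :=
    h.hd.comp (f := fun x => e*x) (by fun_prop) hy
  have hχld : DifferentiableOn ℂ (fun x => χ (lam*x)) (ball 0 r') :=
    h.hd.comp (f := fun x => lam*x) (by fun_prop) hly
  have hZd : DifferentiableOn ℂ Z (ball 0 r') := differentiableOn_id.mul hχ0d.cexp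
  have hZg : ∀ x ∈ ball (0:ℂ) r', ‖Z x - e*x*eC (χ (e*x))‖≤2*M*δ ∧ ‖Z x‖≤2*M := by
    intro x hx
    have h1 := hgM _ (hy x hx)
    have h2 : e*x*eC (χ (e*x)) = e*Z x := by rw [hZ]; ring
    rw [h2, norm_mul, hen] at h1
    have h3 : ‖Z x‖≤2*M := by
      have := norm_nonneg (Z x)
      nlinarith
    refine ⟨?_, h3⟩
    rw [h2, show Z x - e*Z x = (δ:ℂ)*Z x by rw [he]; push_cast; ring, norm_mul, Complex.norm_real, Real.norm_eq_abs,
      abs_of_pos hδ]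
    nlinarith
  have hZe : ∀ x ∈ ball (0:ℂ) r', ∀ v : ℂ, ‖v‖ ≤ s → ‖Z x*eC v - e*x*eC (χ (e*x))‖ ≤ X/8 := by
    intro x hx v hv
    obtain ⟨h1, h2⟩ := hZg x hx
    have h3 := Complex.norm_exp_sub_one_le (hv.trans hs1)
    have h4 : ‖Z x*(eC v - 1)‖≤2*M*(2*s) := by
      rw [norm_mul]
      have : 2*‖v‖≤2*s := by linarith
      exact mul_le_mul h2 (h3.trans this) (norm_nonneg _) (by positivity)
    calc _ = ‖Z x*(eC v - 1) + (Z x - e*x*eC (χ (e*x)))‖ := by ring_nf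
      _≤_ := norm_add_le _ _
      _ ≤ X/8 := by linarith
  have hZW : ∀ x ∈ ball (0:ℂ) r', ∀ v : ℂ, ‖v‖ ≤ s → X/2 < ‖Z x*eC v + X‖ := by
    intro x hx v hv
    have h1 := hZe x hx v hv
    have h2 := haw _ (hy x hx)
    have : ‖e*x*eC (χ (e*x)) + X‖≤‖Z x*eC v + X‖ + ‖Z x*eC v - e*x*eC (χ (e*x))‖ := by
      calc _ = ‖(Z x*eC v + X) - (Z x*eC v - e*x*eC (χ (e*x)))‖ := by ring_nf
        _≤_ := norm_sub_le _ _
    linarith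
  have hZW0 : ∀ x ∈ ball (0:ℂ) r', X/2 < ‖Z x + X‖ := by
    intro x hx
    have := hZW x hx 0 (by rw [norm_zero]; exact hs0.le)
    rwa [Complex.exp_zero, mul_one] at this
  have hZe0 : ∀ x ∈ ball (0:ℂ) r', ‖Z x - e*x*eC (χ (e*x))‖ ≤ X/8 := by
    intro x hx
    have := hZe x hx 0 (by rw [norm_zero]; exact hs0.le)
    rwa [Complex.exp_zero, mul_one] at this
  obtain ⟨w, hwd, hw⟩ := imp (isOpen_ball (x := (0:ℂ)) (ε := r'))
    (fun x v => χ (e*x) + v + Z x*eC v + u t (Z x*eC v) - χ (lam*x))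
    (fun x => 1 + Z x + Z x*deriv (u t) (Z x)) (s := s) (B := B) (b := b) (κ := κ/4) hs0 hb0.le (by positivity)
    (by
      intro x hx
      have h1 : DifferentiableOn ℂ (fun v => u t (Z x*eC v)) (ball 0 s) :=
        (hu.diffz t).comp (f := fun v => Z x*eC v) (by fun_prop) (fun v hv => hZW x hx v (mem_ball_zero_iff.1 hv).le)
      exact ((((differentiableOn_const _).add differentiableOn_id).add (Complex.differentiable_exp.const_mul _).differentiableOn).add h1).sub (differentiableOn_const _))
    (by
      intro x hx v hv
      have hv' := (mem_ball_zero_iff.1 hv).le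
      have h1 := hχB _ (hy x hx)
      have h2 := hχB _ (hly x hx)
      have h3 := hu.hb t _ ht (hZW x hx v hv')
      have h4 := hZe x hx v hv'
      have h5 := hgM _ (hy x hx)
      have h6 : ‖Z x*eC v‖ ≤ M + X/8 := by
        calc _ = ‖e*x*eC (χ (e*x)) + (Z x*eC v - e*x*eC (χ (e*x)))‖ := by ring_nf
          _≤_ := norm_add_le _ _
          _≤_ := by linarith
      calc _≤‖χ (e*x)‖ + ‖v‖ + ‖Z x*eC v‖ + ‖u t (Z x*eC v)‖ + ‖χ (lam*x)‖ :=
            (norm_sub_le _ _).trans (by gcongr; exact norm_add₄_le)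
        _ ≤ B := by rw [hB]; linarith)
    (by
      intro w hw hwb
      have h1 : DifferentiableOn ℂ (fun x => u t (Z x*eC (w x))) (ball 0 r') :=
        (hu.diffz t).comp (f := fun x => Z x*eC (w x)) (hZd.mul hw.cexp)
          (fun x hx => hZW x hx _ ((hwb x hx).trans (by linarith)))
      exact (((hχ0d.add hw).add (hZd.mul hw.cexp)).add h1).sub hχld)
    (by
      have h1 : DifferentiableOn ℂ (fun x => deriv (u t) (Z x)) (ball 0 r') :=
        ((hu.diffz t).deriv (isOpen_W X)).comp hZd hZW0
      fun_prop)
    (by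
      intro x hx
      have h1 : HasDerivAt (u t) (deriv (u t) (Z x)) (Z x*eC 0) := by
        rw [Complex.exp_zero, mul_one]
        exact ((hu.diffz t).differentiableAt ((isOpen_W X).mem_nhds (hZW0 x hx))).hasDerivAt
      have h2 : HasDerivAt (fun v => Z x*eC v) (Z x*eC 0) 0 :=
        (Complex.hasDerivAt_exp 0).const_mul _
      have h3 := (((((hasDerivAt_id (0:ℂ)).const_add (χ (e*x))).add h2).add (h1.comp 0 h2)).sub_const (χ (lam*x))).deriv
      simp only [Complex.exp_zero, mul_one] at h3
      refine Eq.trans ?_ (h3.trans (by ring))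
      rfl)
    (by
      intro x hx
      have h1 := hu.mult_lower ht (hZW0 x hx)
      have h2 := hκg _ (hy x hx)
      have h3 := (hZg x hx).1
      have h4 : ‖1 + e*x*eC (χ (e*x))‖≤‖1 + Z x‖ + ‖Z x - e*x*eC (χ (e*x))‖ := by
        calc _ = ‖(1 + Z x) - (Z x - e*x*eC (χ (e*x)))‖ := by ring_nf
          _≤_ := norm_sub_le _ _
      linarith)
    hbs hBb (by
      intro x hx
      simp only [Complex.exp_zero, mul_one, add_zero]
      have h1 := h.he _ (hy x hx)
      have h2 := (hZg x hx).1
      have h3 := hu.zlip ht (haw _ (hy x hx)) (hZe0 x hx)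
      have h4 := hlip _ (hly x hx) _ (mul_mem_ball hl.le (hy x hx))
      have h5 : ‖lam*x - lam*(e*x)‖≤2*r*δ := by
        rw [show lam*x - lam*(e*x) = lam*((δ:ℂ)*x) by rw [he]; push_cast; ring, norm_mul, norm_mul,
          Complex.norm_real, Real.norm_eq_abs, abs_of_pos hδ]
        have h6 := (mem_ball_zero_iff.1 hx).le
        have h7 := norm_nonneg x
        calc ‖lam‖*(δ*‖x‖)≤1*(δ*(2*r)) := by
              have : ‖x‖≤2*r := by linarith
              gcongr
          _ = _ := by ring
      have h8 : Λ*‖lam*x - lam*(e*x)‖≤2*B₀*δ := by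
        calc _ ≤ Λ*(2*r*δ) := by gcongr
          _ = _ := by rw [hB₀]; ring
      calc ‖χ (e*x) + Z x + u t (Z x) - χ (lam*x)‖
          = ‖(Z x - e*x*eC (χ (e*x))) + (u t (Z x) - u t (e*x*eC (χ (e*x)))) -
            (χ (lam*x) - χ (lam*(e*x)))‖ := by rw [h1]; ring_nf
        _≤_ := norm_sub_le _ _
        _≤_ := add_le_add_left (norm_add_le _ _) _
        _≤_ := by linarith)
  have hfχ : ∀ x ∈ ball (0:ℂ) r, χ (e*x) + w x = χ x := by
    intro x hx
    have hx' := ball_subset_ball hr'r.le hx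
    have h1 := (hw x hx').2.2.2 (χ x - χ (e*x)) (by
      refine (hlip x hx _ (hy x hx')).trans (le_trans ?_ d6.le)
      rw [show x - e*x = (δ:ℂ)*x by rw [he]; push_cast; ring, norm_mul,
          Complex.norm_real, Real.norm_eq_abs, abs_of_pos hδ, hB₀]
      have h6 := (mem_ball_zero_iff.1 hx).le
      calc Λ*(δ*‖x‖) ≤ Λ*(δ*r) := by gcongr
        _ = _ := by ring) (by
      have h2 : Z x*eC (χ x - χ (e*x)) = x*eC (χ x) := by
        rw [hZ, mul_assoc, ← Complex.exp_add]; ring_nf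
      rw [h2, h.he x hx]; ring)
    rw [← h1]; ring
  refine ⟨r', hr'r, fun x => χ (e*x) + w x, hχ0d.add hwd, ?_, ?_, ?_⟩
  · rw [hfχ 0 (mem_ball_self hr), h.h0]
  · intro x hx
    have := hZW x hx (w x) ((hw x hx).1.trans (by linarith))
    rw [Complex.exp_add, ← mul_assoc]; exact this
  · intro x hx
    have h1 := (hw x hx).2.1
    rw [hfχ _ (hly x hx), Complex.exp_add, ← mul_assoc]
    linear_combination -h1

end
end

section
section
variable {X : ℝ} {u : ℂ → ℂ → ℂ} {lam t : ℂ} {r : ℝ} {χ : ℂ → ℂ}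

/-- a chart which cannot be extended has the critical point on its boundary -/
lemma IsCh.crit (hu : UH X u) (ht : ‖t‖≤1) (hl : ‖lam‖ < 1) (hl0 : 0 < ‖lam‖) (hr : 0 < r) (h : IsCh X u lam t r χ)
    (haw : ∀ x ∈ ball (0:ℂ) r, 3*X/4≤‖x*eC (χ x) + X‖)
    (hne : ¬ ∃ r' > r, ∃ f, IsCh X u lam t r' f) :
    ∃ y : ℂ, ‖y‖ = ‖lam‖*r ∧ y*eC (χ y) = -(lam*eC (-1)) := by
  have h1 : ∀ n : ℕ, ∃ x ∈ ball (0:ℂ) r, ‖1 + x*eC (χ x)‖ < 1/((n:ℝ) + 1) := by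
    intro n
    by_contra! hc
    exact hne (h.extend hu ht hl hl0 hr haw (κ := 1/((n:ℝ) + 1)) (by positivity) hc)
  choose x hx hxn using h1
  obtain ⟨y, hy, φ, hφ, hlim⟩ := (isCompact_closedBall (0:ℂ) r).tendsto_subseq (fun n => ball_subset_closedBall (hx n))
  have hg : Tendsto (fun n => x (φ n)*eC (χ (x (φ n)))) atTop (𝓝 (-1)) := by
    have : Tendsto (fun n => 1 + x n*eC (χ (x n))) atTop (𝓝 0) :=
      squeeze_zero_norm (fun n => (hxn n).le) tendsto_one_div_add_atTop_nhds_zero_nat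
    have h2 := (this.comp hφ.tendsto_atTop).const_add (-1)
    simpa using h2
  have hlW : ∀ {y : ℂ}, y ∈ ball (0:ℂ) r → ContinuousAt (fun x => x*eC (χ x)) y := fun hy =>
    (h.gd.differentiableAt (isOpen_ball.mem_nhds hy)).continuousAt
  have hyr : ‖y‖ = r := by
    refine le_antisymm (mem_closedBall_zero_iff.1 hy) ?_
    by_contra! hc
    have hy' := mem_ball_zero_iff.2 hc
    exact h.g_ne hu ht hl hy' (tendsto_nhds_unique ((hlW hy').tendsto.comp hlim) hg)
  have hly : lam*y ∈ ball (0:ℂ) r := by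
    rw [mem_ball_zero_iff, norm_mul, hyr]; nlinarith
  refine ⟨lam*y, by rw [norm_mul, hyr], tendsto_nhds_unique ((hlW hly).tendsto.comp (hlim.const_mul lam)) ?_⟩
  have hW1 : X/2 < ‖(-1:ℂ) + X‖ := by
    have h2 := norm_sub_norm_le (X:ℂ) 1
    rw [Complex.norm_real, Real.norm_eq_abs, norm_one] at h2
    rw [neg_add_eq_sub]
    have := le_abs_self X
    have := hu.hX
    linarith
  have hu1 := ((hu.diffz t).differentiableAt ((isOpen_W X).mem_nhds hW1)).continuousAt.tendsto.comp hg
  rw [hu.h1] at hu1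
  have h3 := (hg.const_mul lam).mul ((hg.add hu1).cexp)
  rw [add_zero, mul_neg_one, neg_mul] at h3
  exact h3.congr fun n => (h.gF (hx (φ n))).symm

/-- orbit of the critical value -/
noncomputable def orb (u : ℂ → ℂ → ℂ) (lam:ℂ) : ℕ → ℂ → ℂ
  | 0, _ => -(lam*eC (-1))
  | n + 1, t => lam*orb u lam n t*eC (orb u lam n t + u t (orb u lam n t))

lemma IsCh.orb_eq (hl : ‖lam‖≤1) (h : IsCh X u lam t r χ) {y : ℂ} (hy : y ∈ ball (0:ℂ) r)
    (hyc : y*eC (χ y) = -(lam*eC (-1))) (n : ℕ) :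
    orb u lam n t = lam^n*y*eC (χ (lam^n*y)) ∧
    χ (lam^n*y) = χ y + ∑ j ∈ Finset.range n, (orb u lam j t + u t (orb u lam j t)) := by
  induction n with
  | zero => simp [orb, hyc]
  | succ n ih =>
    have h1 := pow_mul_mem_ball hl hy n
    have e : lam^(n + 1)*y = lam*(lam^n*y) := by ring
    constructor
    · rw [orb, ih.1, e, h.gF h1]
    · rw [Finset.sum_range_succ, ← add_assoc, ← ih.2, e, h.he _ h1, ih.1, add_assoc]

lemma UH.near0 (hu : UH X u) (ht : ‖t‖≤1) {z : ℂ} (hz : ‖z‖ < 1) : X/2 < ‖z + X‖ ∧ ‖z + u t z‖≤2*‖z‖ := by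
  have hW : ∀ z : ℂ, ‖z‖ < 1 → X/2 < ‖z + X‖ := by
    intro z hz
    have h2 := norm_sub_norm_le (X:ℂ) (-z)
    rw [Complex.norm_real, Real.norm_eq_abs, norm_neg, sub_neg_eq_add, add_comm _ z] at h2
    have := le_abs_self X
    have := hu.hX
    linarith
  refine ⟨hW z hz, (norm_add_le _ _).trans ?_⟩
  have := schwarz0 (r := 1) (B := 1) ((hu.diffz t).mono fun z hz => hW z (mem_ball_zero_iff.1 hz)) (hu.h0 t)
    (fun z hz => hu.hb t z ht (hW z (mem_ball_zero_iff.1 hz))) z (mem_ball_zero_iff.2 hz)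
  linarith

lemma UH.orb_step (hu : UH X u) (hd : DifferentiableAt ℂ (orb u lam n) t) (hW : X/2 < ‖orb u lam n t + X‖) :
    DifferentiableAt ℂ (fun t => orb u lam n t + u t (orb u lam n t)) t ∧ DifferentiableAt ℂ (orb u lam (n + 1)) t := by
  have h1 : DifferentiableAt ℂ (fun t => u t (orb u lam n t)) t :=
    DifferentiableAt.comp t (g := fun p : ℂ × ℂ => u p.1 p.2) (f := fun t => (t, orb u lam n t))
      (hu.hd.differentiableAt ((isOpen_W2 X).mem_nhds hW)) (differentiableAt_id.prodMk hd)
  exact ⟨hd.add h1, (hd.const_mul lam).mul (hd.add h1).cexp⟩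

/-- the position of the critical point depends holomorphically on the parameter -/
lemma IsCh.critU (hu : UH X u) (ht : ‖t‖ < 1) (hl : ‖lam‖ < 1) (hl0 : 0 < ‖lam‖) (h : IsCh X u lam t r χ)
    {y : ℂ} (hy : y ∈ ball (0:ℂ) r) (hyc : y*eC (χ y) = -(lam*eC (-1))) :
    ∃ U : ℂ → ℂ, (∀ᶠ t' in 𝓝 t, DifferentiableAt ℂ U t') ∧ ∀ᶠ t' in 𝓝 t, ∀ r' χ' y', IsCh X u lam t' r' χ' →
      y' ∈ ball (0:ℂ) r' → y'*eC (χ' y') = -(lam*eC (-1)) → y' = U t' := by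
  obtain ⟨σ, hσ0, hσ1, hσq⟩ : ∃ σ : ℝ, 0 < σ ∧ σ < 1 ∧ ‖lam‖*eR (2*σ) < 1 := by
    have h1 : ContinuousAt (fun σ : ℝ => ‖lam‖*eR (2*σ)) 0 := by fun_prop
    have h2 : ∀ᶠ σ in 𝓝 (0:ℝ), ‖lam‖*eR (2*σ) < 1 :=
      h1.eventually_lt continuousAt_const (by simpa using hl)
    obtain ⟨σ, h3, h4, h5⟩ := ((h2.filter_mono nhdsWithin_le_nhds).and ((eventually_mem_nhdsWithin (s := Ioi (0:ℝ))).and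
      ((gt_mem_nhds (zero_lt_one' ℝ)).filter_mono nhdsWithin_le_nhds))).exists
    exact ⟨σ, h4, h5, h3⟩
  set q := ‖lam‖*eR (2*σ) with hq
  have hq0 : 0 ≤ q := by positivity
  have hn : ∀ n, orb u lam n t = lam^n*y*eC (χ (lam^n*y)) := fun n => (h.orb_eq hl.le hy hyc n).1
  have hev : ∀ n, ∀ᶠ t' in 𝓝 t, DifferentiableAt ℂ (orb u lam n) t' ∧ X/2 < ‖orb u lam n t' + X‖ := by
    intro n
    suffices h1 : ∀ᶠ t' in 𝓝 t, DifferentiableAt ℂ (orb u lam n) t' by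
      have h2 : X/2 < ‖orb u lam n t + X‖ := by rw [hn]; exact h.hW _ (pow_mul_mem_ball hl.le hy n)
      exact h1.and (h1.self_of_nhds.continuousAt.eventually ((isOpen_W X).mem_nhds h2))
    induction n with
    | zero => exact Eventually.of_forall fun t' => differentiableAt_const _
    | succ n ih =>
      have h2 : X/2 < ‖orb u lam n t + X‖ := by rw [hn]; exact h.hW _ (pow_mul_mem_ball hl.le hy n)
      filter_upwards [ih, ih.self_of_nhds.continuousAt.eventually ((isOpen_W X).mem_nhds h2)] with t' h3 h4
      exact (hu.orb_step h3 h4).2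
  obtain ⟨N, hN⟩ : ∃ N, ‖orb u lam N t‖ < σ := by
    have h0r : (0:ℂ) ∈ ball (0:ℂ) r := mem_ball_self ((norm_nonneg y).trans_lt (mem_ball_zero_iff.1 hy))
    have h1 : Tendsto (fun n => orb u lam n t) atTop (𝓝 0) := by
      have h2 := (h.gd.differentiableAt (isOpen_ball.mem_nhds h0r)).continuousAt.tendsto.comp (tendsto_pow_mul hl y)
      rw [zero_mul] at h2
      exact h2.congr fun n => (hn n).symm
    have h3 := (h1.eventually (ball_mem_nhds 0 hσ0)).exists
    exact h3.imp fun N h => mem_ball_zero_iff.1 h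
  have hall : ∀ᶠ t' in 𝓝 t, (∀ n ∈ Finset.range (N + 1), DifferentiableAt ℂ (orb u lam n) t' ∧ X/2 < ‖orb u lam n t' + X‖) ∧
      ‖orb u lam N t'‖ < σ ∧ ‖t'‖ < 1 := by
    refine ((Finset.eventually_all _).2 fun n _ => hev n).and (Eventually.and ?_ ?_)
    · exact (hev N).self_of_nhds.1.continuousAt.norm.eventually_lt continuousAt_const hN
    · exact continuous_norm.continuousAt.eventually_lt continuousAt_const ht
  obtain ⟨δ, hδ, hδt⟩ := Metric.eventually_nhds_iff_ball.1 hall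
  have htail : ∀ t' ∈ ball t δ, ∀ j, ‖orb u lam (N + j) t'‖ ≤ q^j*σ ∧ DifferentiableAt ℂ (orb u lam (N + j)) t' := by
    intro t' ht' j
    induction j with
    | zero => simpa using ⟨(hδt t' ht').2.1.le, ((hδt t' ht').1 N (by simp)).1⟩
    | succ j ih =>
      have h1 : ‖orb u lam (N + j) t'‖ ≤ σ := ih.1.trans (mul_le_of_le_one_left hσ0.le (pow_le_one₀ hq0 hσq.le))
      have h2 := hu.near0 (hδt t' ht').2.2.le (h1.trans_lt hσ1)
      refine ⟨?_, (hu.orb_step ih.2 h2.1).2⟩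
      rw [← add_assoc, orb, norm_mul, norm_mul]
      calc _≤‖lam‖*(q^j*σ)*eR (2*σ) := by
            gcongr
            · exact ih.1
            · exact (Complex.norm_exp_le_exp_norm _).trans (Real.exp_le_exp.2 (by linarith))
        _ = _ := by rw [pow_succ, hq]; ring
  have hG : ∀ t' ∈ ball t δ, ∀ j, ‖orb u lam (N + j) t' + u t' (orb u lam (N + j) t')‖ ≤ q^j*(2*σ) ∧
      DifferentiableAt ℂ (fun t' => orb u lam (N + j) t' + u t' (orb u lam (N + j) t')) t' := by
    intro t' ht' j
    have ih := htail t' ht' j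
    have h1 : ‖orb u lam (N + j) t'‖ ≤ σ := ih.1.trans (mul_le_of_le_one_left hσ0.le (pow_le_one₀ hq0 hσq.le))
    have h2 := hu.near0 (hδt t' ht').2.2.le (h1.trans_lt hσ1)
    exact ⟨by linarith, (hu.orb_step ih.2 h2.1).1⟩
  have hsum : Summable fun j : ℕ => q^j*(2*σ) := (summable_geometric_of_lt_one hq0 hσq).mul_right _
  refine ⟨fun t' => -(lam*eC (-1))*eC (∑ n ∈ Finset.range N, (orb u lam n t' + u t' (orb u lam n t')) +
    ∑' j, (orb u lam (N + j) t' + u t' (orb u lam (N + j) t'))), ?_, ?_⟩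
  · filter_upwards [ball_mem_nhds t hδ] with t' ht'
    have h1 := (Complex.differentiableOn_tsum_of_summable_norm (u := fun j : ℕ => q^j*(2*σ)) hsum
      (fun j t' ht' => (hG t' ht' j).2.differentiableWithinAt) isOpen_ball (fun j t' ht' => (hG t' ht' j).1)).differentiableAt
      (isOpen_ball.mem_nhds ht')
    have h2 : DifferentiableAt ℂ (fun t' => ∑ n ∈ Finset.range N, (orb u lam n t' + u t' (orb u lam n t'))) t' := by
      refine DifferentiableAt.fun_sum fun n hn => ?_
      have h3 := (hδt t' ht').1 n (by have := Finset.mem_range.1 hn; exact Finset.mem_range.2 (by omega))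
      exact (hu.orb_step h3.1 h3.2).1
    exact ((h2.add h1).cexp).const_mul _
  · filter_upwards [ball_mem_nhds t hδ] with t' ht' r' χ' y' h' hy' hyc'
    have h0r : (0:ℂ) ∈ ball (0:ℂ) r' := mem_ball_self ((norm_nonneg y').trans_lt (mem_ball_zero_iff.1 hy'))
    have h1 : Tendsto (fun j => χ' (lam^(j + N)*y')) atTop (𝓝 0) := by
      have h2 := (h'.hd.differentiableAt (isOpen_ball.mem_nhds h0r)).continuousAt.tendsto.comp (tendsto_pow_mul hl y')
      rw [h'.h0] at h2
      exact h2.comp (tendsto_add_atTop_nat N)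
    have h3 := ((Summable.of_norm_bounded hsum fun j => (hG t' ht' j).1).hasSum.tendsto_sum_nat.const_add
      (χ' y' + ∑ n ∈ Finset.range N, (orb u lam n t' + u t' (orb u lam n t'))))
    have h4 := tendsto_nhds_unique h1 (h3.congr fun j => by
      rw [(h'.orb_eq hl.le hy' hyc' (j + N)).2, add_comm j N, Finset.sum_range_add, add_assoc])
    rw [← hyc', mul_assoc, ← Complex.exp_add, ← add_assoc, ← h4, Complex.exp_zero, mul_one]

end
end

section
section
variable {X : ℝ} {u : ℂ → ℂ → ℂ} {lam : ℂ} {ε : ℝ} {χ : ℂ → ℂ}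

lemma charts_compact (hu : UH X u) (hl : ‖lam‖ < 1) (hl2 : 1/2≤‖lam‖)
    (hε : 0 < ε) (hε1 : ε≤1) (hXε : 2000*X^2*eR (1 - X/4) < ε^2) {τ : ℝ} (hτ : τ≤1) :
    IsCompact {p : ℂ × ℝ | ‖p.1‖ ≤ τ ∧ ε ≤ p.2 ∧ ∃ f, IsCh X u lam p.1 p.2 f} := by
  refine Metric.isCompact_of_isClosed_isBounded (IsSeqClosed.isClosed ?_) ?_
  · intro p q hp hq
    choose f hf using fun n => (hp n).2.2
    have h1 := (continuous_fst.tendsto q).comp hq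
    have h2 := (continuous_snd.tendsto q).comp hq
    exact ⟨le_of_tendsto h1.norm (Eventually.of_forall fun n => (hp n).1), ge_of_tendsto h2 (Eventually.of_forall fun n => (hp n).2.1),
      chart_closed hu hl hl2 hε hε1 hXε (fun n => (hp n).1.trans hτ) (fun n => (hp n).2.1) h1 h2 hf⟩
  · refine ((isBounded_closedBall (x := (0:ℂ)) (r := τ)).prod (Metric.isBounded_Icc ε (18*X))).subset ?_
    rintro ⟨t, r⟩ ⟨h1, h2, f, h3⟩
    exact ⟨mem_closedBall_zero_iff.2 h1, h2, h3.r_le (by linarith [hu.hX]) (hε.trans_le h2)⟩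

/-- maximum principle: charts of radius `ε₁` exist for some parameter on every circle -/
lemma charts_all (hu : UH X u) (hl : ‖lam‖ < 1) (hl2 : 1/2≤‖lam‖)
    (hε : 0 < ε) (hε1 : ε≤1) (hXε : 2000*X^2*eR (1 - X/4) < ε^2) {ε₁ : ℝ} (hεε : ε < ε₁)
    (h : IsCh X u lam 0 ε₁ χ) {τ : ℝ} (hτ0 : 0 ≤ τ) (hτ : τ < 1) : ∃ t : ℂ, ‖t‖ = τ ∧ ∃ f, IsCh X u lam t ε₁ f := by
  have hl0 : 0 < ‖lam‖ := by linarith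
  set 𝓒 := {p : ℂ × ℝ | ‖p.1‖ ≤ τ ∧ ε ≤ p.2 ∧ ∃ f, IsCh X u lam p.1 p.2 f} with h𝓒
  have hC : IsCompact 𝓒 := charts_compact hu hl hl2 hε hε1 hXε hτ.le
  obtain ⟨p₀, hp₀, hmax₀⟩ := hC.exists_isMaxOn ⟨(0, ε₁), by simpa using hτ0, hεε.le, χ, h⟩ continuous_snd.continuousOn
  obtain ⟨p, ⟨hp, hp2⟩, hmax⟩ := (hC.inter_right (isClosed_eq continuous_snd (continuous_const (y := p₀.2)))).exists_isMaxOn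
    ⟨p₀, hp₀, rfl⟩ (continuous_norm.comp continuous_fst).continuousOn
  have hp2' : p.2 = p₀.2 := hp2
  have hM : ∀ t r f, ‖t‖ ≤ τ → ε ≤ r → IsCh X u lam t r f → r ≤ p.2 := fun t r f h1 h2 h3 => by
    rw [hp2']; exact hmax₀ (show (t, r) ∈ 𝓒 from ⟨h1, h2, f, h3⟩)
  have hM2 : ∀ t f, ‖t‖ ≤ τ → IsCh X u lam t p.2 f → ‖t‖≤‖p.1‖ := fun t f h1 h3 =>
    hmax (show (t, p.2) ∈ 𝓒 ∩ _ from ⟨⟨h1, hp.2.1, f, h3⟩, hp2⟩)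
  have hr1 : ε₁ ≤ p.2 := hM 0 ε₁ χ (by simpa using hτ0) hεε.le h
  obtain ⟨hpt, hpr, f, hf⟩ := hp
  refine ⟨p.1, le_antisymm hpt ?_, f, hf.mono hr1⟩
  by_contra! hlt
  -- the maximal chart at a nearby parameter
  have hcr : ∀ t : ℂ, ‖t‖ ≤ τ → (∃ f, IsCh X u lam t ε f) → ∃ r ≤ p.2, ε ≤ r ∧ ∃ f, IsCh X u lam t r f ∧
      ∃ y : ℂ, ‖y‖ = ‖lam‖*r ∧ y*eC (f y) = -(lam*eC (-1)) := by
    intro t ht hex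
    obtain ⟨⟨t', r⟩, ⟨⟨h1, h2, f, h3⟩, h4⟩, h5⟩ := (hC.inter_right (isClosed_eq continuous_fst (continuous_const (y := t)))).exists_isMaxOn
      ⟨(t, ε), ⟨ht, le_rfl, hex⟩, rfl⟩ continuous_snd.continuousOn
    obtain rfl : t' = t := h4
    have h2' : ε ≤ r := h2
    have ht1 : ‖t'‖≤1 := ht.trans hτ.le
    refine ⟨r, hM t' r f ht h2 h3, h2, f, h3, IsCh.crit hu ht1 hl hl0 (hε.trans_le h2) h3
      (fun x hx => h3.away hu ht1 hl hl2 hε hε1 h2 hXε hx) ?_⟩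
    rintro ⟨r', hr', f', h6⟩
    have : r' ≤ r := h5 (show (t', r') ∈ 𝓒 ∩ _ from ⟨⟨ht, h2'.trans hr'.le, f', h6⟩, rfl⟩)
    linarith
  have hball : ∀ {y : ℂ} {r : ℝ}, ε ≤ r → ‖y‖ = ‖lam‖*r → y ∈ ball (0:ℂ) r := fun h1 h2 => by
    rw [mem_ball_zero_iff, h2]; nlinarith
  obtain ⟨y, hy, hyc⟩ : ∃ y : ℂ, ‖y‖ = ‖lam‖*p.2 ∧ y*eC (f y) = -(lam*eC (-1)) := by
    refine IsCh.crit hu (hpt.trans hτ.le) hl hl0 (hε.trans_le hpr) hf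
      (fun x hx => hf.away hu (hpt.trans hτ.le) hl hl2 hε hε1 hpr hXε hx) ?_
    rintro ⟨r', hr', f', h6⟩
    exact absurd (hM _ _ f' hpt (hpr.trans hr'.le) h6) (not_le.2 hr')
  obtain ⟨U, hUd, hU⟩ := hf.critU hu (hpt.trans_lt hτ) hl hl0 (hball hpr hy) hyc
  have hUp : ‖U p.1‖ = ‖lam‖*p.2 := by
    rw [← hU.self_of_nhds p.2 f y hf (hball hpr hy) hyc, hy]
  have hev : ∀ᶠ t in 𝓝 p.1, ∃ r ≤ p.2, ‖U t‖ = ‖lam‖*r ∧ ∃ f, IsCh X u lam t r f := by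
    filter_upwards [hU, chart_open hu hl (hpt.trans_lt hτ) hε (hεε.trans_le hr1) hf,
      continuous_norm.continuousAt.eventually_lt continuousAt_const hlt] with t h1 h2 h3
    obtain ⟨r, h4, h5, f', h6, y', h7, h8⟩ := hcr t h3.le h2
    exact ⟨r, h4, by rw [← h1 r f' y' h6 (hball h5 h7) h8, h7], f', h6⟩
  have hloc : IsLocalMax (norm ∘ U) p.1 := by
    filter_upwards [hev] with t ⟨r, h1, h2, _⟩
    simp only [Function.comp, hUp, h2]
    gcongr
  have hfin := (Complex.norm_eventually_eq_of_isLocalMax hUd hloc).and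
    (hev.and (continuous_norm.continuousAt.eventually_lt continuousAt_const hlt))
  obtain ⟨δ, hδ, hδt⟩ := Metric.eventually_nhds_iff_ball.1 hfin
  obtain ⟨t, ht, htn⟩ : ∃ t ∈ ball p.1 δ, ‖p.1‖ < ‖t‖ := by
    rcases eq_or_ne p.1 0 with h0 | h0
    · refine ⟨((δ/2 : ℝ) : ℂ), ?_, ?_⟩
      · rw [h0, mem_ball_zero_iff, Complex.norm_real, Real.norm_eq_abs, abs_of_pos (by linarith)]; linarith
      · rw [h0, norm_zero, Complex.norm_real, Real.norm_eq_abs, abs_of_pos (by linarith)]; linarith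
    · have hp0 := norm_pos_iff.2 h0
      have he : ‖p.1 + ((δ/(2*‖p.1‖) : ℝ) : ℂ)*p.1‖ = ‖p.1‖ + δ/2 := by
        rw [show p.1 + ((δ/(2*‖p.1‖) : ℝ) : ℂ)*p.1 = ((1 + δ/(2*‖p.1‖) : ℝ) : ℂ)*p.1 by push_cast; ring, norm_mul,
          Complex.norm_real, Real.norm_eq_abs, abs_of_pos (by positivity)]
        field_simp
      refine ⟨p.1 + ((δ/(2*‖p.1‖) : ℝ) : ℂ)*p.1, ?_, by rw [he]; linarith⟩
      rw [mem_ball, dist_eq_norm, add_sub_cancel_left, norm_mul, Complex.norm_real, Real.norm_eq_abs, abs_of_pos (by positivity)]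
      field_simp
      linarith
  obtain ⟨h1, ⟨r, h2, h3, f', h4⟩, h5⟩ := hδt t ht
  have : r = p.2 := by
    rw [h3, hUp] at h1
    exact mul_left_cancel₀ hl0.ne' h1
  subst this
  linarith [hM2 t f' h5.le h4]

end
end

/-- the concrete perturbation family -/
lemma UH_of {X : ℝ} (hX : 4 ≤ X) {V : ℂ → ℂ} (hV : Differentiable ℂ V) (hV0 : V 0 = 0)
    (hVb : ∀ y ∈ ball (0:ℂ) (1/2), ‖V y‖≤1) :
    UH X (fun t z => 1/24*V (t*(z/(z + X))/12)*((1 + z)/(z + X))^2) := by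
  have hn : ∀ z : ℂ, X/2 < ‖z + X‖ → z + X ≠ 0 := fun z hz => norm_pos_iff.1 (lt_trans (by linarith) hz)
  have key : ∀ (z:ℂ) (c:ℝ), X/2 < ‖z + X‖ → 0 ≤ c → c ≤ X → ‖1 - (c:ℂ)/(z + X)‖≤3 ∧ ‖(c:ℂ)/(z + X)^2‖≤1 := by
    intro z c hz h0 hc
    have h1 : ‖(c:ℂ)/(z + X)‖≤2 := by
      rw [norm_div, Complex.norm_real, Real.norm_eq_abs, abs_of_nonneg h0, div_le_iff₀ (by linarith)]; linarith
    constructor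
    · refine (norm_sub_le _ _).trans ?_
      rw [norm_one]; linarith
    · rw [norm_div, norm_pow, Complex.norm_real, Real.norm_eq_abs, abs_of_nonneg h0, div_le_iff₀ (by nlinarith)]; nlinarith
  have ha : ∀ z : ℂ, X/2 < ‖z + X‖ → z/(z + X) = 1 - (X:ℂ)/(z + X) := fun z hz => by
    have := hn z hz; field_simp; ring
  have hb : ∀ z : ℂ, X/2 < ‖z + X‖ → (1 + z)/(z + X) = 1 - ((X - 1 : ℝ):ℂ)/(z + X) := fun z hz => by
    have := hn z hz; push_cast; field_simp; ring
  have ha3 : ∀ z : ℂ, X/2 < ‖z + X‖ → ‖z/(z + X)‖≤3 := fun z hz => by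
    rw [ha z hz]; exact (key z X hz (by linarith) le_rfl).1
  have hb3 : ∀ z : ℂ, X/2 < ‖z + X‖ → ‖(1 + z)/(z + X)‖≤3 := fun z hz => by
    rw [hb z hz]; exact (key z (X - 1) hz (by linarith) (by linarith)).1
  have hy : ∀ t z : ℂ, ‖t‖≤1 → X/2 < ‖z + X‖ → ‖t*(z/(z + X))/12‖≤1/4 := by
    intro t z ht hz
    rw [norm_div, norm_mul, show ‖(12:ℂ)‖ = 12 by norm_num]
    have := mul_le_mul ht (ha3 z hz) (norm_nonneg _) zero_le_one
    linarith
  have hVm : ∀ t z : ℂ, ‖t‖≤1 → X/2 < ‖z + X‖ → ‖V (t*(z/(z + X))/12)‖≤1 := fun t z ht hz =>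
    hVb _ (mem_ball_zero_iff.2 ((hy t z ht hz).trans_lt (by norm_num)))
  refine ⟨hX, ?_, fun t => by simp [hV0], fun t => by simp, fun t z ht hz => ?_, fun t z ht hz => ?_⟩
  · intro p hp
    have h1 := hn p.2 hp
    have h2 : DifferentiableAt ℂ (fun p : ℂ × ℂ => p.1*(p.2/(p.2 + X))/12) p := by fun_prop (disch := exact h1)
    have h3 : DifferentiableAt ℂ (fun p : ℂ × ℂ => ((1 + p.2)/(p.2 + X))^2) p := by fun_prop (disch := exact h1)
    exact ((((hV _).comp p h2).const_mul (1/24)).mul h3).differentiableWithinAt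
  · rw [norm_mul, norm_mul, norm_pow, show ‖(1/24 : ℂ)‖ = 1/24 by norm_num]
    have h1 := hVm t z ht hz
    have h2 := pow_le_pow_left₀ (norm_nonneg _) (hb3 z hz) 2
    have := mul_le_mul h1 h2 (by positivity) zero_le_one
    linarith
  · have h1 := hn z hz
    have hda : HasDerivAt (fun z : ℂ => z/(z + X)) ((X:ℂ)/(z + X)^2) z :=
      ((hasDerivAt_id z).div ((hasDerivAt_id z).add_const _) h1).congr_deriv (by simp)
    have hdb : HasDerivAt (fun z : ℂ => (1 + z)/(z + X)) (((X - 1 : ℝ):ℂ)/(z + X)^2) z :=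
      (((hasDerivAt_id z).const_add 1).div ((hasDerivAt_id z).add_const _) h1).congr_deriv (by push_cast; simp; ring)
    have hdV := ((hV (t*(z/(z + X))/12)).hasDerivAt.comp z ((hda.const_mul t).div_const 12)).const_mul (1/24)
    have hdu := hdV.mul (hdb.pow 2)
    have h4 := ((key z X hz (by linarith) le_rfl).2)
    have h5 := ((key z (X - 1) hz (by linarith) (by linarith)).2)
    have h6 : ‖deriv V (t*(z/(z + X))/12)‖≤4 :=
      (norm_deriv_le (f := V) (B := 1) (R := 1/4) (by norm_num) hV.differentiableOn (fun w hw => hVb w (by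
        rw [mem_ball_zero_iff]; rw [mem_ball, dist_eq_norm] at hw
        have := norm_le_insert' w (t*(z/(z + X))/12)
        linarith [hy t z ht hz]))).trans (by norm_num)
    set a' := (X:ℂ)/(z + X)^2
    set b' := ((X - 1 : ℝ):ℂ)/(z + X)^2
    set D := deriv V (t*(z/(z + X))/12)
    set V₀ := V (t*(z/(z + X))/12) with hV₀
    have h7 : z*deriv (fun z => 1/24*V (t*(z/(z + X))/12)*((1 + z)/(z + X))^2) z =
        1/24*(z/(z + X))*(D*(t*a'/12)*((1 + z)/(z + X)) + 2*V₀*b')*(1 + z) := by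
      rw [show deriv (fun z => 1/24*V (t*(z/(z + X))/12)*((1 + z)/(z + X))^2) z = _ from hdu.deriv]
      simp only [Function.comp, Pi.pow_apply, ← hV₀, Nat.cast_ofNat, show 2 - 1 = 1 from rfl, pow_one]
      field_simp
    rw [h7, norm_mul]
    refine mul_le_mul_of_nonneg_right ?_ (norm_nonneg _)
    have h8 : ‖D*(t*a'/12)*((1 + z)/(z + X)) + 2*V₀*b'‖≤4*(1*1/12)*3 + 2*1*1 := by
      refine (norm_add_le _ _).trans (add_le_add ?_ ?_)
      · rw [norm_mul, norm_mul, norm_div, norm_mul, show ‖(12:ℂ)‖ = 12 by norm_num]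
        have := hb3 z hz
        gcongr
      · rw [norm_mul, norm_mul, show ‖(2:ℂ)‖ = 2 by norm_num]
        have := hVm t z ht hz
        gcongr
    rw [norm_mul, norm_mul, show ‖(1/24 : ℂ)‖ = 1/24 by norm_num]
    calc _≤1/24*3*(4*(1*1/12)*3 + 2*1*1 : ℝ) := by
          have := ha3 z hz
          gcongr
      _≤1/2 := by norm_num

/-- logarithmic form of the linearization -/
lemma start_log {lam : ℂ} (hl : ‖lam‖ = 1) (hlam : ∀ k, 0 < k → lam^k ≠ 1)
    (hlin : LinearizableAt (fun z => lam*z*eC z) 0 lam) :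
    ∃ r > 0, ∃ χ : ℂ → ℂ, DifferentiableOn ℂ χ (ball 0 r) ∧ χ 0 = 0 ∧ ∀ x ∈ ball (0:ℂ) r,
      ‖χ x‖≤1/4 ∧ ‖x*eC (χ x)‖ < 1 ∧ χ (lam*x) = χ x + x*eC (χ x) := by
  obtain ⟨r, hr, h, hd, hinj, h0, hc⟩ := hlin
  have han : AnalyticAt ℂ h 0 := hd.analyticAt (ball_mem_nhds 0 hr)
  have hnz : ¬ ∀ᶠ z in 𝓝 0, h z = 0 := by
    intro hz
    obtain ⟨δ, hδ, hz⟩ := Metric.eventually_nhds_iff_ball.1 (hz.and (ball_mem_nhds 0 hr))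
    have hm : ((δ/2 : ℝ) : ℂ) ∈ ball (0:ℂ) δ := by
      rw [mem_ball_zero_iff, Complex.norm_real, Real.norm_eq_abs, abs_of_pos (by linarith)]; linarith
    have h1 := hinj (hz _ hm).2 (mem_ball_self hr) ((hz _ hm).1.trans h0.symm)
    rw [Complex.ofReal_eq_zero] at h1
    linarith
  obtain ⟨n, g, hg, hg0, hgn⟩ := han.exists_eventuallyEq_pow_smul_nonzero_iff.2 hnz
  simp only [sub_zero, smul_eq_mul] at hgn
  have hlt : Tendsto (fun x : ℂ => lam*x) (𝓝 0) (𝓝 0) := by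
    have : Continuous fun x : ℂ => lam*x := by fun_prop
    simpa using this.tendsto 0
  have hn : n = 1 := by
    have h1 : ∀ᶠ x in 𝓝[≠] (0:ℂ), lam*g x*eC (h x) = lam^n*g (lam*x) := by
      filter_upwards [hgn.filter_mono nhdsWithin_le_nhds, (hlt.eventually hgn).filter_mono nhdsWithin_le_nhds,
        nhdsWithin_le_nhds (ball_mem_nhds 0 hr), self_mem_nhdsWithin] with x h2 h3 h4 h5
      have h6 := hc x h4
      simp only at h6
      rw [h3] at h6
      refine mul_left_cancel₀ (pow_ne_zero n h5) ?_
      calc _ = lam*(x^n*g x)*eC (h x) := by ring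
        _ = _ := by rw [← h2, h6]; ring
    have hgl := hg.continuousAt.tendsto
    have h2 : Tendsto (fun x => lam*g x*eC (h x)) (𝓝[≠] 0) (𝓝 (lam*g 0*eC (h 0))) :=
      ((hgl.const_mul lam).mul han.continuousAt.tendsto.cexp).mono_left nhdsWithin_le_nhds
    have h3 : Tendsto (fun x => lam^n*g (lam*x)) (𝓝[≠] 0) (𝓝 (lam^n*g 0)) :=
      ((hgl.comp hlt).const_mul _).mono_left nhdsWithin_le_nhds
    have h4 := tendsto_nhds_unique (h2.congr' h1) h3
    rw [h0, Complex.exp_zero, mul_one] at h4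
    have h5 := mul_right_cancel₀ hg0 h4
    rcases n with _ | _ | n
    · have := hgn.self_of_nhds
      rw [pow_zero, one_mul, h0] at this
      exact absurd this.symm hg0
    · rfl
    · exfalso
      refine hlam (n + 1) (by omega) ?_
      have hl0 : lam ≠ 0 := norm_ne_zero_iff.1 (by rw [hl]; norm_num)
      refine mul_right_cancel₀ hl0 ?_
      rw [one_mul, ← pow_succ]; exact h5.symm
  subst hn
  obtain ⟨δ, hδ, hA⟩ := Metric.eventually_nhds_iff_ball.1 (hg.eventually_analyticAt.and
    ((hg.continuousAt.eventually_ne hg0).and (hgn.and (ball_mem_nhds 0 hr))))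
  set c := g 0 with hcdef
  have hc0 : 0 < ‖c‖ := norm_pos_iff.2 hg0
  have hdiv : ∀ x ∈ ball (0:ℂ) (δ*‖c‖), x/c ∈ ball (0:ℂ) δ := by
    intro x hx
    rw [mem_ball_zero_iff] at hx ⊢
    rwa [norm_div, div_lt_iff₀ hc0]
  obtain ⟨χ, hχd, hχ0, hχ⟩ := exists_log (f := fun x => g (x/c)/c) (mul_pos hδ hc0)
    (fun x hx => ((DifferentiableAt.comp x (g := g) (f := fun x => x/c) (hA _ (hdiv x hx)).1.differentiableAt
      (by fun_prop)).div_const c).differentiableWithinAt)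
    (fun x hx => div_ne_zero (hA _ (hdiv x hx)).2.1 hg0) (by simp only [zero_div]; exact div_self hg0)
  have hgx : ∀ x ∈ ball (0:ℂ) (δ*‖c‖), x*eC (χ x) = h (x/c) := by
    intro x hx
    have := (hA _ (hdiv x hx)).2.2.1
    rw [← hχ x hx, this]; ring
  have hχc : ContinuousAt χ 0 := (hχd.differentiableAt (ball_mem_nhds 0 (mul_pos hδ hc0))).continuousAt
  have h3 : ∀ᶠ x in 𝓝 0, ‖χ x‖ < 1/8 := hχc.norm.eventually_lt continuousAt_const (by rw [hχ0]; norm_num)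
  have h4 : ∀ᶠ x in 𝓝 0, ‖x*eC (χ x)‖ < 1/4 :=
    (continuousAt_id.mul hχc.cexp).norm.eventually_lt continuousAt_const (by simp)
  obtain ⟨ρ, hρ, hρx⟩ := Metric.eventually_nhds_iff_ball.1 (h3.and (h4.and (ball_mem_nhds 0 (mul_pos hδ hc0))))
  refine ⟨ρ, hρ, χ, hχd.mono fun x hx => (hρx x hx).2.2, hχ0, fun x hx => ?_⟩
  obtain ⟨h5, h6, h7⟩ := hρx x hx
  have hlx := mul_mem_ball hl.le hx
  obtain ⟨h8, h9, h10⟩ := hρx _ hlx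
  refine ⟨by linarith, by linarith, ?_⟩
  rcases eq_or_ne x 0 with rfl | hx0
  · simp [hχ0]
  have hl0 : lam ≠ 0 := norm_ne_zero_iff.1 (by rw [hl]; norm_num)
  have h11 := hc _ (hA _ (hdiv x h7)).2.2.2
  simp only at h11
  rw [← mul_div_assoc, ← hgx x h7, ← hgx _ h10] at h11
  have h12 : eC (χ (lam*x) - χ x - x*eC (χ x)) = 1 := by
    rw [Complex.exp_sub, Complex.exp_sub, div_div, ← Complex.exp_add, div_eq_one_iff_eq (Complex.exp_ne_zero _), Complex.exp_add]
    refine mul_left_cancel₀ (mul_ne_zero hl0 hx0) ?_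
    rw [← h11]; ring
  have h13 := norm_le_two_mul_exp_sub_one (z := χ (lam*x) - χ x - x*eC (χ x))
    ((norm_sub_le _ _).trans (by linarith [norm_sub_le (χ (lam*x)) (χ x)]))
  rw [h12, sub_self, norm_zero, mul_zero] at h13
  linear_combination norm_le_zero_iff.1 h13

/-- uniform charts for the multipliers `e^{-s} λ` -/
lemma start_charts {lam : ℂ} (hl : ‖lam‖ = 1) (hlam : ∀ k, 0 < k → lam^k ≠ 1)
    (hlin : LinearizableAt (fun z => lam*z*eC z) 0 lam) :
    ∃ ε > 0, ε≤1 ∧ ∀ s : ℝ, 0 < s → s≤1/16 → ∀ X u, UH X u → (∀ z, u 0 z = 0) →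
      ∃ χ, IsCh X u ((eR (-s) : ℝ)*lam) 0 ε χ := by
  obtain ⟨r, hr, χ, hd, h0, h⟩ := start_log hl hlam hlin
  refine ⟨min 1 (r/4*eR (-(6*1))), by positivity, min_le_left _ _, fun s hs hs1 X u hu hu0 => ?_⟩
  set mu : ℂ := (eR (-s) : ℝ)*lam with hmu
  have hmun : ‖mu‖ = eR (-s) := by
    rw [hmu, norm_mul, hl, mul_one, Complex.norm_real, Real.norm_eq_abs, Real.abs_exp]
  have hs' : eR (-s)≤1 := Real.exp_le_one_iff.2 (by linarith)
  have hmu1 : ‖mu‖≤1 := hmun.trans_le hs'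
  have hsub : ball (0:ℂ) (r/4) ⊆ ball 0 r := ball_subset_ball (by linarith)
  have hder : ∀ x ∈ ball (0:ℂ) (r/4), ‖deriv χ x‖≤1/(3*r) := by
    intro x hx
    refine (norm_deriv_le' (hsub hx) hd fun z hz => (h z hz).1).trans ?_
    have := mem_ball_zero_iff.1 hx
    rw [sub_zero, div_le_div_iff₀ (by linarith) (by positivity)]
    linarith
  have hmm : ‖mu - lam‖ ≤ s := by
    rw [hmu, show (eR (-s) : ℝ)*lam - lam = ((eR (-s) - 1 : ℝ) : ℂ)*lam by push_cast; ring, norm_mul, hl, mul_one,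
      Complex.norm_real, Real.norm_eq_abs, abs_le]
    constructor <;> linarith [Real.add_one_le_exp (-s)]
  have hq : 2*s/5≤1 - eR (-(2*s/3)) := by
    have h1 : eR (-(2*s/3))*eR (2*s/3) = 1 := by rw [← Real.exp_add]; simp
    have h2 := Real.add_one_le_exp (2*s/3)
    have h3 := Real.exp_pos (-(2*s/3))
    nlinarith
  have e1 : 2*(s/(3*r))/(1/2)*(r/4) = s/3 := by field_simp; norm_num
  obtain ⟨χ', h1, h2, h3⟩ := chart_pert (lam := mu) (χ := χ) (Γ := fun x => χ (lam*x)) (r := r) (ρ := r/4) (s := 1) (B := 1/4)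
    (κ := 1/2) (b := s/3) (m := s/(3*r)) (q := eR (-(2*s/3))) (a := 1) (by positivity) one_pos (by positivity)
    (by norm_num) hmu1 (by nlinarith [Real.exp_one_lt_d9]) hd h0
    ((hd.mono hsub).comp (by fun_prop) fun x hx => mul_mem_ball hl.le hx) (fun x hx => (h x hx).1)
    (fun x hx => (h _ (mul_mem_ball hl.le (hsub hx))).1)
    (by
      intro x hx
      have h4 := hder _ (mul_mem_ball hmu1 hx)
      have h5 := (mem_ball_zero_iff.1 (mul_mem_ball hmu1 hx)).le
      have h6 : ‖mu*x*deriv χ (mu*x)‖ ≤ r/4*(1/(3*r)) := by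
        rw [norm_mul]; exact mul_le_mul h5 h4 (norm_nonneg _) (by positivity)
      rw [show r/4*(1/(3*r)) = 1/12 by field_simp; norm_num] at h6
      have h7 := norm_sub_norm_le (1:ℂ) (-(mu*x*deriv χ (mu*x)))
      rw [norm_neg, norm_one, sub_neg_eq_add] at h7
      linarith)
    (by positivity)
    (by
      intro x hx
      have h4 := lip_of_deriv isOpen_ball (convex_ball 0 _) (hd.mono hsub) hder (mul_mem_ball hmu1 hx) (mul_mem_ball hl.le hx)
      rw [← sub_mul, norm_mul] at h4
      calc _≤1/(3*r)*(‖mu - lam‖*‖x‖) := h4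
        _≤1/(3*r)*(s*‖x‖) := by gcongr
        _ = _ := by ring)
    (by rw [show s/(3*r)*(r/4) = s/12 by field_simp; norm_num]; linarith) (by linarith) (by linarith) (Real.exp_pos _).le
    (by linarith) one_pos (by rw [e1, hmun, ← Real.exp_add]; exact Real.exp_le_exp.2 (by linarith))
    (by rw [e1, div_le_one (by linarith)]; linarith)
  refine ⟨χ', IsCh.mono ⟨h1, h2, fun y hy => ?_, fun y hy => ?_⟩ (min_le_right _ _)⟩
  · obtain ⟨x, hx, h4, -⟩ := h3 y hy
    rw [h4]; exact (hu.near0 (t := 0) (by simp) (h x (hsub hx)).2.1).1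
  · obtain ⟨x, hx, h4, h5⟩ := h3 y hy
    rw [h5, h4, hu0, (h x (hsub hx)).2.2]; ring

section
/-- graded closure properties of a predicate relating a family of numbers and one number -/
structure Gr {T : Type} (Q : ℕ → (T → ℂ) → ℂ → Prop) : Prop where
  zero : ∀ k, Q k (fun _ => 0) 0
  one : Q 0 (fun _ => 1) 1
  add : ∀ {k f g b c}, Q k f b → Q k g c → Q k (fun t => f t + g t) (b + c)
  mul : ∀ {k l f g b c}, Q k f b → Q l g c → Q (k + l) (fun t => f t*g t) (b*c)

def GS {T : Type} (Q : ℕ → (T → ℂ) → ℂ → Prop) (n : ℕ) (P : T → PowerSeries ℂ) (B : PowerSeries ℂ) : Prop :=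
  ∀ k < n, Q k (fun t => coeff k (P t)) (coeff k B)

section
variable {T : Type} {Q : ℕ → (T → ℂ) → ℂ → Prop} {n : ℕ} {P R : T → PowerSeries ℂ} {B D : PowerSeries ℂ}

lemma Gr.sum (hQ : Gr Q) {ι : Type} (s : Finset ι) {k : ℕ} {f : ι → T → ℂ} {b : ι → ℂ} (h : ∀ i ∈ s, Q k (f i) (b i)) :
    Q k (fun t => ∑ i ∈ s, f i t) (∑ i ∈ s, b i) := by
  classical
  induction s using Finset.induction_on with
  | empty => simpa using hQ.zero k
  | insert a s ha ih =>
    simp only [Finset.sum_insert ha]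
    exact hQ.add (h a (Finset.mem_insert_self a s)) (ih fun i hi => h i (Finset.mem_insert_of_mem hi))

lemma Gr.mulS (hQ : Gr Q) (h : GS Q n P B) (h' : GS Q n R D) : GS Q n (fun t => P t*R t) (B*D) := by
  intro k hk
  simp only [coeff_mul]
  refine hQ.sum _ fun p hp => ?_
  have hp' := Finset.HasAntidiagonal.mem_antidiagonal.1 hp
  have := hQ.mul (h p.1 (by omega)) (h' p.2 (by omega))
  rwa [hp'] at this

lemma Gr.powS (hQ : Gr Q) (h : GS Q n P B) (j : ℕ) : GS Q n (fun t => P t^j) (B^j) := by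
  induction j with
  | zero =>
    intro k _
    simp only [pow_zero, coeff_one]
    rcases eq_or_ne k 0 with rfl | hk
    · simpa using hQ.one
    · simpa [hk] using hQ.zero k
  | succ j ih => simp only [pow_succ]; exact hQ.mulS ih h

lemma Gr.sumS (hQ : Gr Q) {ι : Type} (s : Finset ι) {F : ι → T → PowerSeries ℂ} {G : ι → PowerSeries ℂ}
    (h : ∀ i ∈ s, GS Q n (F i) (G i)) : GS Q n (fun t => ∑ i ∈ s, F i t) (∑ i ∈ s, G i) := by
  intro k hk
  simp only [map_sum]
  exact hQ.sum s fun i hi => h i hi k hk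

lemma linSer_zero (lam:ℂ) (w : PowerSeries ℂ) : coeff 0 (linSer lam w) = 1 := by
  rw [linSer, coeff_mk, linCoef]; simp

lemma Gr.lin (hQ : Gr Q) (h : GS Q n P B) {m : T → ℂ} {m₀ : ℂ}
    (hm : ∀ k f b, 0 < k → Q k f b → Q k (fun t => f t/(m t^k - 1)) (b/(m₀^k - 1))) :
    GS Q n (fun t => linSer (m t) (P t)) (linSer m₀ B) := by
  intro k
  induction k using Nat.strong_induction_on with
  | _ k ih =>
  intro hk
  rcases Nat.eq_zero_or_pos k with rfl | hk0
  · simpa only [linSer_zero] using hQ.one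
  · simp only [linSer_rec _ _ hk0]
    refine hm k _ _ hk0 (hQ.sum _ fun j hj => ?_)
    have hj' := Finset.mem_range.1 hj
    have h1 := hQ.powS (n := k) (fun i hi => ih i hi (by omega)) (j + 2) (k - (j + 1)) (by omega)
    have h2 := hQ.mul (h (j + 1) (by omega)) h1
    rwa [show j + 1 + (k - (j + 1)) = k by omega] at h2

end

/-- polynomial families with prescribed top coefficient -/
def QP (k : ℕ) (f : ℂ → ℂ) (b:ℂ) : Prop :=
  ∃ p : Polynomial ℂ, p.natDegree ≤ k ∧ p.coeff k = b ∧ ∀ t, f t = p.eval t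

lemma gr_QP : Gr QP where
  zero k := ⟨0, by simp, by simp, by simp⟩
  one := ⟨1, by simp, by simp, by simp⟩
  add := by
    rintro k f g b c ⟨p, hp, hpb, hpf⟩ ⟨q, hq, hqc, hqg⟩
    exact ⟨p + q, Polynomial.natDegree_add_le_of_degree_le hp hq, by rw [Polynomial.coeff_add, hpb, hqc], fun t => by
      simp only [Polynomial.eval_add, hpf, hqg]⟩
  mul := by
    rintro k l f g b c ⟨p, hp, hpb, hpf⟩ ⟨q, hq, hqc, hqg⟩
    exact ⟨p*q, Polynomial.natDegree_mul_le_of_le hp hq, by rw [Polynomial.coeff_mul_add_eq_of_natDegree_le hp hq, hpb, hqc],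
      fun t => by simp only [Polynomial.eval_mul, hpf, hqg]⟩

lemma gs_const (n : ℕ) (S : PowerSeries ℂ) : GS QP n (fun _ => S) (C (coeff 0 S)) := by
  intro k _
  refine ⟨Polynomial.C (coeff k S), by simp, ?_, by simp⟩
  rw [Polynomial.coeff_C, coeff_C]
  split_ifs with h
  · rw [h]
  · rfl

lemma gs_t (n : ℕ) (S : PowerSeries ℂ) (h0 : coeff 0 S = 0) : GS QP n (fun t => C t*S) (C (coeff 1 S)*X) := by
  intro k _
  rcases k with _ | k
  · exact ⟨0, by simp, by simp, fun t => by simp [h0]⟩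
  · refine ⟨Polynomial.C (coeff (k + 1) S)*Polynomial.X, ?_, ?_, fun t => by
      simp only [coeff_C_mul, Polynomial.eval_mul, Polynomial.eval_C, Polynomial.eval_X]; ring⟩
    · exact (Polynomial.natDegree_C_mul_le _ _).trans (Polynomial.natDegree_X_le.trans (by omega))
    · rw [coeff_C_mul, coeff_X, Polynomial.coeff_C_mul, Polynomial.coeff_X]
      rcases k with _ | k <;> simp

/-- jets of a family, polynomial in the parameter, with the top germ -/
def FJ (M : ℕ) (F : ℂ → ℂ → ℂ) (f : ℂ → ℂ) : Prop :=
  ∃ P B, (∀ t, HasJet M (F t) (P t)) ∧ GS QP M P B ∧ HasJet M f B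

section
variable {M : ℕ} {F G : ℂ → ℂ → ℂ} {f g : ℂ → ℂ}

lemma HasJet.coeff_zero {A : PowerSeries ℂ} (hM : 0 < M) (h : HasJet M f A) : coeff 0 A = f 0 := by
  have h1 : (fun x => f x - (trunc M A).eval x) =O[𝓝 0] (fun x : ℂ => x^M) := h
  have := isBigO_zero_val hM h1
  rw [eval_trunc, Finset.sum_eq_single 0 (fun k _ hk => by simp [hk]) (fun h => absurd (Finset.mem_range.2 hM) h)] at this
  simp only [pow_zero, mul_one] at this
  linear_combination -this

lemma FJ.add (h : FJ M F f) (h' : FJ M G g) : FJ M (fun t z => F t z + G t z) (fun z => f z + g z) := by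
  obtain ⟨P, B, h1, h2, h3⟩ := h
  obtain ⟨R, D, h4, h5, h6⟩ := h'
  refine ⟨fun t => P t + R t, B + D, fun t => (h1 t).add (h4 t), fun k hk => ?_, h3.add h6⟩
  simp only [map_add]
  exact gr_QP.add (h2 k hk) (h5 k hk)

lemma FJ.mul (h : FJ M F f) (h' : FJ M G g) : FJ M (fun t z => F t z*G t z) (fun z => f z*g z) := by
  obtain ⟨P, B, h1, h2, h3⟩ := h
  obtain ⟨R, D, h4, h5, h6⟩ := h'
  exact ⟨fun t => P t*R t, B*D, fun t => (h1 t).mul (h4 t), gr_QP.mulS h2 h5, h3.mul h6⟩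

lemma FJ.analytic (hM : 0 < M) (hf : AnalyticAt ℂ f 0) : FJ M (fun _ => f) (fun _ => f 0) := by
  obtain ⟨A, hA⟩ := AnalyticAt.hasJet hf
  exact ⟨fun _ => A, C (f 0), fun _ => hA M, by rw [← (hA M).coeff_zero hM]; exact gs_const M A, HasJet.const M _⟩

lemma FJ.comp {H : ℂ → ℂ} (hM : 0 < M) (hH : AnalyticAt ℂ H 0) (h : FJ M F f) (hF0 : ∀ t, F t 0 = 0) (hf0 : f 0 = 0) :
    FJ M (fun t z => H (F t z)) (fun z => H (f z)) := by
  obtain ⟨A, hA⟩ := AnalyticAt.hasJet hH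
  obtain ⟨P, B, h1, h2, h3⟩ := h
  refine ⟨_, _, fun t => (hA M).comp (h1 t) (((h1 t).coeff_zero hM).trans (hF0 t)) hM, ?_,
    (hA M).comp h3 ((h3.coeff_zero hM).trans hf0) hM⟩
  refine gr_QP.sumS _ fun j _ => gr_QP.mulS ?_ (gr_QP.powS h2 j)
  simpa using gs_const M (C (coeff j A))

lemma FJ.tmul (hM : 0 < M) {a : ℂ} (hf : AnalyticAt ℂ f 0) (hf0 : f 0 = 0) (hd : HasDerivAt f a 0) :
    FJ M (fun t z => t*f z) (fun z => a*z) := by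
  obtain ⟨A, hA⟩ := AnalyticAt.hasJet hf
  have hA0 := ((hA M).coeff_zero hM).trans hf0
  have hA1 : coeff 1 A = a := by
    refine HasDerivAt.unique ?_ hd
    have h1 : HasJet 2 f A := hA 2
    have h2 : (fun x => f x - (trunc 2 A).eval x) =O[𝓝 0] (fun x : ℂ => x^2) := h1
    have h3 : HasDerivAt (fun x => f x - (trunc 2 A).eval x) 0 0 := by
      rw [hasDerivAt_iff_isLittleO_nhds_zero]
      simp only [zero_add, smul_zero, sub_zero, isBigO_zero_val two_pos h2]
      exact h2.trans_isLittleO (by simpa using isLittleO_pow_id (𝕜 := ℂ) one_lt_two)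
    have h4 := h3.add ((trunc 2 A).hasDerivAt 0)
    refine (h4.congr_deriv ?_).congr_of_eventuallyEq (Eventually.of_forall fun x => by simp)
    rw [zero_add, ← Polynomial.coeff_zero_eq_eval_zero, Polynomial.coeff_derivative, coeff_trunc]
    simp
  refine ⟨fun t => C t*A, C a*X, fun t => (hA M).smul t, ?_, (HasJet.id M).smul a⟩
  rw [← hA1]; exact gs_t M A hA0

end
end

lemma prod_dist {k i : ℕ} (hi : i ≤ k) :
    ∏ j ∈ (Finset.range (k + 1)).erase i, |(i:ℝ) - j| = (i.factorial : ℝ)*(k - i).factorial := by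
  have h1 : ∏ j ∈ (Finset.range (k + 1)).erase i, |(i:ℝ) - j| = ∏ j ∈ Finset.range (k + 1), if j = i then 1 else |(i:ℝ) - j| := by
    rw [← Finset.mul_prod_erase _ _ (Finset.mem_range.2 (Nat.lt_succ_of_le hi)), if_pos rfl, one_mul]
    exact Finset.prod_congr rfl fun j hj => (if_neg (Finset.mem_erase.1 hj).1).symm
  rw [h1, show k + 1 = i + (k - i + 1) by omega, Finset.prod_range_add, Finset.prod_range_succ', add_zero, if_pos rfl, mul_one]
  congr 1
  · rw [← Finset.prod_range_reflect, ← Finset.prod_range_add_one_eq_factorial, Nat.cast_prod]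
    refine Finset.prod_congr rfl fun j hj => ?_
    have := Finset.mem_range.1 hj
    rw [if_neg (by omega), Nat.sub_sub, Nat.cast_sub (by omega), abs_of_nonneg (by push_cast; linarith [(Nat.cast_nonneg j : (0:ℝ) ≤ j)])]
    push_cast; ring
  · rw [← Finset.prod_range_add_one_eq_factorial, Nat.cast_prod]
    refine Finset.prod_congr rfl fun j _ => ?_
    rw [if_neg (by omega), abs_of_nonpos (by push_cast; linarith [(Nat.cast_nonneg j : (0:ℝ) ≤ j)])]
    push_cast; ring

lemma top_coeff_le {p : Polynomial ℂ} {k : ℕ} (hp : p.natDegree ≤ k) {B : ℝ}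
    (h : ∀ τ : ℝ, 0 ≤ τ → τ < 1 → ∃ t : ℂ, ‖t‖ = τ ∧ ‖p.eval t‖ ≤ B) :
    ‖p.coeff k‖ ≤ B*eR 1*(2*eR 1)^k := by
  have hB : 0 ≤ B := by obtain ⟨t, -, ht⟩ := h 0 le_rfl one_pos; exact (norm_nonneg _).trans ht
  have hk0 : (0:ℝ) < k + 1 := by positivity
  have hex : ∀ i : ℕ, ∃ t : ℂ, i < k + 1 → ‖t‖ = i/(k + 1) ∧ ‖p.eval t‖ ≤ B := by
    intro i
    by_cases hi : i < k + 1
    · obtain ⟨t, ht⟩ := h (i/(k + 1)) (by positivity) ((div_lt_one hk0).2 (by exact_mod_cast hi))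
      exact ⟨t, fun _ => ht⟩
    · exact ⟨0, fun h => absurd h hi⟩
  choose v hv using hex
  have hd : ∀ i < k + 1, ∀ j < k + 1, |(i:ℝ) - j|/(k + 1)≤‖v i - v j‖ := by
    intro i hi j hj
    have := abs_norm_sub_norm_le (v i) (v j)
    rwa [(hv i hi).1, (hv j hj).1, ← sub_div, abs_div, abs_of_pos hk0] at this
  have hinj : Set.InjOn v (Finset.range (k + 1)) := by
    intro i hi j hj hij
    have h1 := hd i (by simpa using hi) j (by simpa using hj)
    rw [hij, sub_self, norm_zero, div_le_iff₀ hk0, zero_mul] at h1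
    have := abs_nonpos_iff.1 h1
    exact_mod_cast sub_eq_zero.1 this
  have hdeg : p.degree < (Finset.range (k + 1)).card := by
    rw [Finset.card_range]
    exact lt_of_le_of_lt Polynomial.degree_le_natDegree (by exact_mod_cast Nat.lt_succ_of_le hp)
  have hc := Lagrange.coeff_eq_sum hinj hdeg
  rw [Finset.card_range, Nat.add_sub_cancel] at hc
  rw [hc]
  have hterm : ∀ i ∈ Finset.range (k + 1), ‖p.eval (v i)/∏ j ∈ (Finset.range (k + 1)).erase i, (v i - v j)‖ ≤
      B*(k + 1)^k/k.factorial*(k.choose i : ℝ) := by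
    intro i hi
    have hik : i ≤ k := by have := Finset.mem_range.1 hi; omega
    have h1 : (i.factorial : ℝ)*(k - i).factorial/(k + 1)^k ≤ ∏ j ∈ (Finset.range (k + 1)).erase i, ‖v i - v j‖ := by
      rw [← prod_dist hik, show ((k:ℝ) + 1)^k = ∏ j ∈ (Finset.range (k + 1)).erase i, ((k:ℝ) + 1) by
        rw [Finset.prod_const, Finset.card_erase_of_mem hi, Finset.card_range, Nat.add_sub_cancel], ← Finset.prod_div_distrib]
      exact Finset.prod_le_prod (fun j _ => by positivity) fun j hj =>
        hd i (Finset.mem_range.1 hi) j (Finset.mem_range.1 (Finset.mem_erase.1 hj).2)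
    rw [norm_div, norm_prod]
    refine (div_le_div₀ hB (hv i (Finset.mem_range.1 hi)).2 (by positivity) h1).trans (le_of_eq ?_)
    rw [Nat.cast_choose ℝ hik]
    field_simp
  refine (norm_sum_le_of_le _ hterm).trans ?_
  rw [← Finset.mul_sum, ← Nat.cast_sum, Nat.sum_range_choose]
  have h2 := Real.pow_div_factorial_le_exp ((k:ℝ) + 1) hk0.le k
  rw [Real.exp_add, show eR (k:ℝ) = eR 1^k by rw [← Real.exp_nat_mul, mul_one]] at h2
  push_cast
  calc B*(k + 1)^k/k.factorial*2^k = B*2^k*((k + 1)^k/k.factorial) := by ring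
    _ ≤ B*2^k*(eR 1^k*eR 1) := by gcongr
    _ = _ := by rw [mul_pow]; ring

lemma gr_tendsto {T : Type} (l : Filter T) : Gr (fun _ f b => Tendsto f l (𝓝 b)) where
  zero _ := tendsto_const_nhds
  one := tendsto_const_nhds
  add h h' := h.add h'
  mul h h' := h.mul h'

lemma Lin.rescale {lam κ : ℂ} {w E : PowerSeries ℂ} {M : ℕ} (h : Lin lam w E M) :
    Lin lam (PowerSeries.rescale κ w) (PowerSeries.rescale κ E) M := by
  refine ⟨by simpa using h.1, fun k hk => ?_⟩
  rw [coeff_rescale, mul_left_comm, h.2 k hk, Finset.mul_sum]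
  refine Finset.sum_congr rfl fun j hj => ?_
  rw [← map_pow, coeff_rescale, coeff_rescale]
  have : κ^k = κ^j*κ^(k - j) := by rw [← pow_add]; congr 1; have := Finset.mem_range.1 hj; omega
  rw [this]; ring

/-- coefficients of the linearization from a chart -/
lemma chart_coeff {X : ℝ} {u : ℂ → ℂ → ℂ} {mu t : ℂ} {ε : ℝ} {χ : ℂ → ℂ} (hu : UH X u) (hε : 0 < ε)
    (hmu : ∀ k, 0 < k → mu^k ≠ 1) (h : IsCh X u mu t ε χ) {M : ℕ} (hM : 0 < M) {w : PowerSeries ℂ}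
    (hw : HasJet M (fun z => eC (z + u t z)) w) {k : ℕ} (hk : k < M) :
    ‖coeff k (linSer mu w)‖≤18*X/ε/(ε/2)^k := by
  have hX : 0 < X := by linarith [hu.hX]
  have hd : DifferentiableOn ℂ (fun x => eC (χ x)) (ball 0 (ε/2)) :=
    (h.hd.mono (ball_subset_ball (by linarith))).cexp
  have hj := hasJet_tc (half_pos hε) hd M
  have hb := norm_tc_le (B := 18*X/ε) (half_pos hε) hd (fun x hx => by
    rcases eq_or_ne x 0 with rfl | hx0
    · rw [h.h0, Complex.exp_zero, norm_one, le_div_iff₀ hε, one_mul]; exact h.r_le hX hε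
    · have := h.small hX hx
      rw [norm_mul, mul_comm] at this
      exact le_of_mul_le_mul_right this (norm_pos_iff.2 hx0)) k
  have h0 := hj.coeff_zero hM
  rw [h.h0, Complex.exp_zero] at h0
  have hL := (lin_bridge (lam := mu) hM hw hj h0).2 (by
    refine (isBigO_zero (E' := ℂ) (fun x : ℂ => x^M) (𝓝 0)).congr' ?_ (EventuallyEq.refl _ _)
    filter_upwards [ball_mem_nhds (0:ℂ) hε] with x hx
    rw [h.he x hx]
    simp only [Complex.exp_add]
    ring)
  have hw0 : coeff 0 w = 1 := by rw [hw.coeff_zero hM, hu.h0, add_zero, Complex.exp_zero]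
  rw [Lin.unique hmu hw0 (fun _ _ => rfl) (linSer_lin mu w hmu hw0 M) hL k hk, coeff_mk]
  exact hb

lemma fj_main {X : ℝ} (hX : 4 ≤ X) {V : ℂ → ℂ} (hV : Differentiable ℂ V) (hV0 : V 0 = 0) {M : ℕ} (hM : 0 < M) :
    FJ M (fun t z => eC (z + 1/24*V (t*(z/(z + X))/12)*((1 + z)/(z + X))^2))
      (fun z => eC (0 + 1/24*V (1/(X:ℂ)*z/12)*((1 + 0)/(0 + (X:ℂ)))^2)) := by
  have hX0 : (0:ℂ) + X ≠ 0 := by rw [zero_add]; exact_mod_cast (by linarith : X ≠ 0)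
  have hX0' : (X:ℂ) ≠ 0 := by simpa using hX0
  have ha : AnalyticAt ℂ (fun z : ℂ => z + X) 0 := by fun_prop
  have ha1 : AnalyticAt ℂ (fun z : ℂ => z/(z + X)) 0 := analyticAt_id.div ha hX0
  have ha2 : AnalyticAt ℂ (fun z : ℂ => ((1 + z)/(z + X))^2) 0 :=
    ((analyticAt_const.add analyticAt_id).div ha hX0).pow 2
  have hd : HasDerivAt (fun z : ℂ => z/(z + X)) (1/X) 0 := by
    have := (hasDerivAt_id (0:ℂ)).div ((hasDerivAt_id (0:ℂ)).add_const (X:ℂ)) hX0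
    refine this.congr_deriv ?_
    simp only [id]
    field_simp
    ring
  have h1 := FJ.tmul hM ha1 (by simp) hd
  have hH : AnalyticAt ℂ (fun y => 1/24*V (y/12)) 0 :=
    Differentiable.analyticAt ((hV.comp (differentiable_id.div_const 12)).const_mul _) 0
  have h2 := FJ.comp hM hH h1 (by simp) (by simp)
  have h3 := (FJ.analytic hM (f := fun z : ℂ => z) analyticAt_id).add (h2.mul (FJ.analytic hM ha2))
  exact FJ.comp hM (H := eC) (Differentiable.analyticAt Complex.differentiable_exp 0) h3
    (by intro t; simp [hV0]) (by simp [hV0])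

lemma boundP_of_lin {lam : ℂ} (hl : ‖lam‖ = 1) (hlam : ∀ k, 0 < k → lam^k ≠ 1)
    (hlin : LinearizableAt (fun z => lam*z*eC z) 0 lam) :
    ∃ K C η : ℝ, 0 < K ∧ 0 < C ∧ 0 < η ∧ BoundP lam K C η := by
  obtain ⟨ε, hε, hε1, hst⟩ := start_charts hl hlam hlin
  obtain ⟨X, hX, hXε⟩ : ∃ X : ℝ, 4 ≤ X ∧ 2000*X^2*eR (1 - X/4) < (ε/2)^2 := by
    have h1 : Tendsto (fun X : ℝ => 2000*X^2*eR (1 - X/4)) atTop (𝓝 0) := by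
      have h2 := (Real.tendsto_pow_mul_exp_neg_atTop_nhds_zero 2).comp (tendsto_id.atTop_div_const (by norm_num : (0:ℝ) < 4))
      have h3 := h2.const_mul (2000*16*eR 1)
      rw [mul_zero] at h3
      refine h3.congr fun X => ?_
      simp only [Function.comp, id, sub_eq_add_neg, Real.exp_add]
      ring
    obtain ⟨X, h2, h3⟩ := ((h1.eventually_lt_const (by positivity : 0 < (ε/2)^2)).and (eventually_ge_atTop 4)).exists
    exact ⟨X, h3, h2⟩
  have hX0 : 0 < X := by linarith
  have hXc : (X:ℂ) ≠ 0 := by exact_mod_cast hX0.ne'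
  refine ⟨18*X/ε*eR 1, (2/ε)*(2*eR 1)*(12*X), 1/(24*X^2), by positivity, by positivity,
    by positivity, ?_⟩
  intro c d hc w E hw hE k hk
  set V : ℂ → ℂ := fun y => ∑ i ∈ Finset.Icc 1 d, (24*X^2*c i)*y^i with hVdef
  have hV : Differentiable ℂ V := by
    have : ∀ i ∈ Finset.Icc 1 d, Differentiable ℂ (fun y : ℂ => (24*X^2*c i)*y^i) := fun i _ => by fun_prop
    simpa [hVdef] using Differentiable.fun_sum this
  have hV0 : V 0 = 0 := Finset.sum_eq_zero fun i hi => by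
    have := (Finset.mem_Icc.1 hi).1
    rw [zero_pow (by omega), mul_zero]
  have hVb : ∀ y ∈ ball (0:ℂ) (1/2), ‖V y‖≤1 := by
    intro y hy
    rw [mem_ball_zero_iff] at hy
    have h1 : ∀ i ∈ Finset.Icc 1 d, ‖(24*X^2*c i)*y^i‖≤(1/2 : ℝ)^i := by
      intro i _
      rw [norm_mul, norm_mul, norm_pow]
      have h2 : ‖(24*X^2 : ℂ)‖ = 24*X^2 := by simp
      have h3 := hc i
      rw [le_div_iff₀ (by positivity)] at h3
      have h4 : ‖(24*X^2 : ℂ)‖*‖c i‖≤1 := by rw [h2]; linarith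
      calc _≤1*(1/2 : ℝ)^i := by gcongr
        _ = _ := one_mul _
    refine (norm_sum_le_of_le _ h1).trans ?_
    have h5 : ∀ d : ℕ, ∑ i ∈ Finset.Icc 1 d, (1/2 : ℝ)^i = 1 - (1/2)^d := by
      intro d
      induction d with
      | zero => simp
      | succ d ih => rw [Finset.sum_Icc_succ_top (by omega), ih]; ring
    rw [h5]
    linarith [pow_pos (one_half_pos : (0:ℝ) < 1/2) d]
  have hu := UH_of hX hV hV0 hVb
  obtain ⟨P, B, hP, hPB, hB⟩ := fj_main hX hV hV0 (Nat.succ_pos d)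
  have hkd : k < d + 1 := by omega
  -- bound for s > 0
  have hs : ∀ s : ℝ, 0 < s → s≤1/16 → ‖coeff k (linSer ((eR (-s) : ℝ)*lam) B)‖ ≤
      18*X/ε/(ε/2)^k*eR 1*(2*eR 1)^k := by
    intro s hs hs1
    obtain ⟨χ, hχ⟩ := hst s hs hs1 X _ hu (fun z => by simp [hV0])
    set mu : ℂ := (eR (-s) : ℝ)*lam with hmu
    have hn : ‖mu‖ = eR (-s) := by
      rw [hmu, norm_mul, hl, mul_one, Complex.norm_real, Real.norm_of_nonneg (Real.exp_pos _).le]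
    have hmu1 : ‖mu‖ < 1 := by rw [hn]; rw [← Real.exp_zero]; exact Real.exp_lt_exp.2 (by linarith)
    have hmu2 : 1/2≤‖mu‖ := by rw [hn]; linarith [Real.add_one_le_exp (-s)]
    have hmk : ∀ k, 0 < k → mu^k ≠ 1 := fun k hk h => by
      have := congrArg norm h
      rw [norm_pow, norm_one] at this
      exact (pow_lt_one₀ (norm_nonneg _) hmu1 hk.ne').ne this
    obtain ⟨p, hp1, hp2, hp3⟩ := gr_QP.lin (m := fun _ => mu) (m₀ := mu) hPB (by
      rintro k f b - ⟨p, h1, h2, h3⟩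
      refine ⟨p*Polynomial.C (1/(mu^k - 1)), (Polynomial.natDegree_mul_C_le _ _).trans h1, ?_, fun t => ?_⟩
      · rw [Polynomial.coeff_mul_C, h2, mul_one_div]
      · simp only [Polynomial.eval_mul, Polynomial.eval_C, h3, mul_one_div]) k hkd
    rw [← hp2]
    refine top_coeff_le hp1 fun τ h0 h1 => ?_
    obtain ⟨t, ht, g, hg⟩ := charts_all hu hmu1 hmu2 (half_pos hε) (by linarith) hXε (half_lt_self hε) hχ h0 h1
    refine ⟨t, ht, ?_⟩
    rw [← hp3]
    exact chart_coeff hu hε hmk hg (Nat.succ_pos d) (hP t) hkd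
  have hlim : Tendsto (fun s : ℝ => coeff k (linSer ((eR (-s) : ℝ)*lam) B)) (𝓝[>] 0) (𝓝 (coeff k (linSer lam B))) := by
    have hm : Tendsto (fun s : ℝ => ((eR (-s) : ℝ) : ℂ)*lam) (𝓝[>] 0) (𝓝 lam) := by
      have : Continuous (fun s : ℝ => ((eR (-s) : ℝ) : ℂ)*lam) := by fun_prop
      have := this.tendsto 0
      simp only [neg_zero, Real.exp_zero, Complex.ofReal_one, one_mul] at this
      exact this.mono_left nhdsWithin_le_nhds
    exact (gr_tendsto (𝓝[>] (0:ℝ))).lin (n := d + 1) (P := fun _ => B) (B := B) (fun _ _ => tendsto_const_nhds)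
      (fun k f b hk h => h.div ((hm.pow k).sub_const 1) (sub_ne_zero.2 (hlam k hk))) k hkd
  have hb := le_of_tendsto hlim.norm (by
    filter_upwards [Ioc_mem_nhdsGT (by norm_num : (0:ℝ) < 1/16)] with s h using hs s h.1 h.2)
  -- compare
  set κ : ℂ := 1/(12*X) with hκ
  have hB' : HasJet (d + 1) (fun z => eC (∑ i ∈ Finset.Icc 1 d, c i*(κ*z)^i)) B := by
    convert hB using 3 with z
    rw [hVdef, zero_add, Finset.mul_sum, Finset.sum_mul]
    refine Finset.sum_congr rfl fun i _ => ?_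
    rw [show (1:ℂ)/X*z/12 = κ*z by rw [hκ]; field_simp]
    rw [add_zero, zero_add]
    field_simp
  have hB0 : coeff 0 B = 1 := by
    rw [hB.coeff_zero (Nat.succ_pos d)]; simp [hV0]
  have hcmp := Lin.unique hlam hB0 (hB'.unique (hw.rescale κ)) (linSer_lin lam B hlam hB0 (d + 1)) hE.rescale k hkd
  rw [hcmp, coeff_rescale, norm_mul, norm_pow] at hb
  have hκn : ‖κ‖ = 1/(12*X) := by rw [hκ]; simp [abs_of_pos hX0]
  rw [hκn, div_pow, one_pow, one_div, inv_mul_le_iff₀ (by positivity)] at hb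
  refine hb.trans (le_of_eq ?_)
  simp only [mul_pow, div_pow]
  field_simp

end GB

/-- **Geyer's theorem**: if the origin is a Siegel fixed point of
`f(z) = λ ∫₀^z (1+t)e^t dt = λ z e^z`, then `α` satisfies the Brjuno condition. -/
theorem geyer_brjuno (α : ℝ) (hα : Irrational α) (lam : ℂ)
    (hlam : lam = Complex.exp (2 * Real.pi * Complex.I * α))
    (f : ℂ → ℂ) (hf : f = fun z => lam * z * Complex.exp z)
    (hlin : LinearizableAt f 0 lam) : BrjunoCondition α := by
  subst hf
  subst hlam
  have hl : ‖Complex.exp (2 * Real.pi * Complex.I * α)‖ = 1 := by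
    rw [show (2 * Real.pi * Complex.I * α : ℂ) = (2 * Real.pi * α : ℝ) * Complex.I by push_cast; ring]
    exact Complex.norm_exp_ofReal_mul_I _
  obtain ⟨K, C, η, hK, hC, hη, hP⟩ := GB.boundP_of_lin hl (GB.lam_pow_ne hα) hlin
  exact GB.brjuno_of_boundP hα hP hK hC hη
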